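/- (Corollary 2: Cauchy problem.) For every T > 0 there exist a positive number δ₀ and a natural number 𝔎 such that: for all ψ₀, ψ₁ ∈ C^∞([0,1]) with (ψ₀(x), x·ψ₀'(x), ψ₁(x), x·ψ₁'(x)) ∈ U⁴ for all x ∈ [0,1] and max_{k ≤ 𝔎} ( ‖D^k ψ₀‖_{L^∞}, ‖D^k ψ₁‖_{L^∞} ) ≤ δ₀, there exist y, v ∈ C^∞([0,T]×[0,1]) satisfying ∂_t y − J(x, y, x∂ₓy)·v = 0 and ∂_t v + H₁(x, y, x∂ₓy, v)·(𝓛y) + H₂(x, y, x∂ₓy, v, x∂ₓv) = 0 on [0,T]×[0,1], with the initial conditions y(0,·) = ψ₀ and v(0,·) = ψ₁. -/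

import Mathlib

open Set Real Filter

/-- The differential operator 𝓛:
`(𝓛y)(x) = −x(1−x)y''(x) − ((5/2)(1−x) − (N/2)x)y'(x) + ℓ₁(x)·x(1−x)·y'(x) + L₀(x)·y(x)`. -/
noncomputable def opL (N : ℝ) (ℓ₁ L₀ : ℝ → ℝ) (y : ℝ → ℝ) (x : ℝ) : ℝ :=
  -(x * (1 - x)) * deriv (deriv y) x
    - ((5 / 2) * (1 - x) - (N / 2) * x) * deriv y x
    + ℓ₁ x * (x * (1 - x)) * deriv y x
    + L₀ x * y x

/-- `𝓛y` expressed through the values `y`, `η = ∂ₓy`, `ζ = ∂ₓ²y`. -/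
noncomputable def Lfun (N : ℝ) (ℓ₁ L₀ : ℝ → ℝ) (x y η ζ : ℝ) : ℝ :=
  -(x * (1 - x)) * ζ - ((5 / 2) * (1 - x) - (N / 2) * x) * η
    + ℓ₁ x * (x * (1 - x)) * η + L₀ x * y

namespace JacobiWave

open MeasureTheory intervalIntegral

/-- The polynomial vanishing simply at both endpoints of `[0,1]`. -/
def qf (x : ℝ) : ℝ := x * (1 - x)

lemma qf_nonneg {x : ℝ} (hx : x ∈ Icc (0:ℝ) 1) : 0 ≤ qf x :=
  mul_nonneg hx.1 (by linarith [hx.2])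

lemma qf_le_one {x : ℝ} (hx : x ∈ Icc (0:ℝ) 1) : qf x ≤ 1 := by
  unfold qf; nlinarith [hx.1, hx.2]

lemma qf_pow_anti {x : ℝ} (hx : x ∈ Icc (0:ℝ) 1) {m n : ℕ} (h : m ≤ n) :
    qf x ^ n ≤ qf x ^ m :=
  pow_le_pow_of_le_one (qf_nonneg hx) (qf_le_one hx) h

lemma hasDerivAt_qf (x : ℝ) : HasDerivAt qf (1 - 2 * x) x := by
  have := (hasDerivAt_id' x).fun_mul ((hasDerivAt_id' x).const_sub 1)
  exact this.congr_deriv (by ring)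

@[fun_prop]
lemma continuous_qf : Continuous qf := by unfold qf; fun_prop

lemma contDiff_qf {n : WithTop ℕ∞} : ContDiff ℝ n qf := by unfold qf; fun_prop

lemma hasDerivAt_qf_pow (n : ℕ) (x : ℝ) :
    HasDerivAt (fun x => qf x ^ (n + 1)) ((n + 1) * qf x ^ n * (1 - 2 * x)) x := by
  simpa using (hasDerivAt_qf x).fun_pow (n + 1)

/-- Monotonicity of the integral over `[0,1]` for continuous functions. -/
lemma integral_mono_cont {f g : ℝ → ℝ} (hf : Continuous f) (hg : Continuous g)
    (h : ∀ x ∈ Icc (0:ℝ) 1, f x ≤ g x) : ∫ x in (0:ℝ)..1, f x ≤ ∫ x in (0:ℝ)..1, g x :=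
  integral_mono_on zero_le_one (hf.intervalIntegrable _ _) (hg.intervalIntegrable _ _) h

lemma integral_nonneg_cont {f : ℝ → ℝ} (h : ∀ x ∈ Icc (0:ℝ) 1, 0 ≤ f x) :
    0 ≤ ∫ x in (0:ℝ)..1, f x :=
  intervalIntegral.integral_nonneg zero_le_one h

lemma pointwise_le_integral {G G' : ℝ → ℝ} (hG : ∀ x, HasDerivAt G (G' x) x)
    (hG' : Continuous G') {x : ℝ} (hx : x ∈ Icc (0:ℝ) 1) :
    G x ≤ (∫ s in (0:ℝ)..1, G s) + ∫ s in (0:ℝ)..1, |G' s| := by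
  have hGc : Continuous G := continuous_iff_continuousAt.2 fun x => (hG x).continuousAt
  have key : ∀ s ∈ Icc (0:ℝ) 1, G x - (∫ s in (0:ℝ)..1, |G' s|) ≤ G s := by
    intro s hs
    have h1 : ∫ r in s..x, G' r = G x - G s :=
      integral_eq_sub_of_hasDerivAt (fun r _ => hG r) (hG'.intervalIntegrable _ _)
    have h2 : |∫ r in s..x, G' r| ≤ ∫ r in (0:ℝ)..1, |G' r| := by
      have h3 := intervalIntegral.norm_integral_le_abs_integral_norm (f := G') (a := s) (b := x)
        (μ := volume)
      have h4 : |∫ r in s..x, ‖G' r‖| ≤ |∫ r in (0:ℝ)..1, ‖G' r‖| := by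
        apply abs_integral_mono_interval (f := fun r => ‖G' r‖) (μ := volume)
        · apply uIoc_subset_uIoc_of_uIcc_subset_uIcc; apply uIcc_subset_uIcc <;> rw [uIcc_of_le zero_le_one] <;> assumption
        · exact Eventually.of_forall fun r => norm_nonneg _
        · exact (hG'.norm.intervalIntegrable _ _)
      simp only [Real.norm_eq_abs] at h3 h4
      rw [abs_of_nonneg (integral_nonneg_cont (f := fun r => |G' r|) fun _ _ => abs_nonneg _)] at h4
      exact h3.trans h4
    have := (abs_le.1 h2).2
    linarith [le_abs_self (∫ r in s..x, G' r)]
  have := integral_mono_cont (continuous_const) hGc key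
  simp only [intervalIntegral.integral_const] at this
  simp at this
  linarith

lemma integral_deriv_zero_ends {G G' : ℝ → ℝ} (hG : ∀ x, HasDerivAt G (G' x) x)
    (hG' : Continuous G') (h0 : G 0 = 0) (h1 : G 1 = 0) : ∫ s in (0:ℝ)..1, G' s = 0 := by
  rw [integral_eq_sub_of_hasDerivAt (fun r _ => hG r) (hG'.intervalIntegrable _ _), h0, h1, sub_zero]

/-- Hardy's inequality with the degenerate weights `qf ^ n`. -/
lemma hardy (n : ℕ) {f f' : ℝ → ℝ} (hf : ∀ x, HasDerivAt f (f' x) x) (hf' : Continuous f') :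
    ∫ x in (0:ℝ)..1, qf x ^ n * f x ^ 2 ≤
      72 * ∫ x in (0:ℝ)..1, qf x ^ (n + 2) * (f x ^ 2 + f' x ^ 2) := by
  have hfc : Continuous f := continuous_iff_continuousAt.2 fun x => (hf x).continuousAt
  set G : ℝ → ℝ := fun x => qf x ^ (n + 1) * ((1 - 2 * x) * f x ^ 2) with hGdef
  set G' : ℝ → ℝ := fun x => (n + 1) * qf x ^ n * (1 - 2 * x) * ((1 - 2 * x) * f x ^ 2)
    + qf x ^ (n + 1) * (-2 * f x ^ 2 + (1 - 2 * x) * (2 * f x * f' x)) with hG'def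
  have hG : ∀ x, HasDerivAt G (G' x) x := by
    intro x
    have h1 : HasDerivAt (fun x : ℝ => 1 - 2 * x) (-2) x := by
      simpa using ((hasDerivAt_id' x).const_mul 2).const_sub 1
    have h2 : HasDerivAt (fun x => f x ^ 2) (2 * f x * f' x) x := by
      simpa using (hf x).fun_pow 2
    have := (hasDerivAt_qf_pow n x).fun_mul (h1.fun_mul h2)
    exact this
  have hG'c : Continuous G' := by simp only [hG'def]; fun_prop
  have hz : ∫ s in (0:ℝ)..1, G' s = 0 :=
    integral_deriv_zero_ends hG hG'c (by simp [hGdef, qf]) (by simp [hGdef, qf])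
  have key : ∫ x in (0:ℝ)..1, (qf x ^ n * f x ^ 2) ≤
      ∫ x in (0:ℝ)..1, (2 * G' x / (n + 1) + 72 * (qf x ^ (n + 2) * (f x ^ 2 + f' x ^ 2)) ) := by
    refine integral_mono_cont (by fun_prop) (by fun_prop) fun x hx => ?_
    set q := qf x with hq
    have hq0 : 0 ≤ q := qf_nonneg hx
    have hq1 : q ≤ 1 := qf_le_one hx
    have h4 : (1 - 2 * x) ^ 2 = 1 - 4 * q := by rw [hq, qf]; ring
    set r := 1 - 2 * x
    set a := f x
    set b := f' x
    have hn : (0:ℝ) < n + 1 := by positivity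
    have e1 : 2 * G' x / (n + 1) = 2 * q ^ n * (1 - 4 * q) * a ^ 2
        + (4 / (n + 1)) * q ^ (n + 1) * (r * a * b - a ^ 2) := by
      rw [← h4]; simp only [hG'def]; field_simp; ring
    rw [e1]
    have hc0 : 0 ≤ 4 / ((n:ℝ) + 1) := by positivity
    have hc1 : 4 / ((n:ℝ) + 1) ≤ 4 := by
      rw [div_le_iff₀ hn]; nlinarith [(Nat.cast_nonneg n : (0:ℝ) ≤ n)]
    set c := 4 / ((n:ℝ) + 1)
    have hqn : 0 ≤ q ^ n := pow_nonneg hq0 n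
    have hr1 : r ^ 2 ≤ 1 := by rw [h4]; linarith
    have h5 : a ^ 2 ≤ 2 * (1 - 4 * q) * a ^ 2 + c * q * (r * a * b - a ^ 2)
        + 72 * (q ^ 2 * (a ^ 2 + b ^ 2)) := by
      have h6 : -(c * q * (r * a * b)) ≤ 4 * q * (|a| * |b|) := by
        have : -(r * a * b) ≤ |a| * |b| := by
          have hr : |r| ≤ 1 := abs_le_one_iff_mul_self_le_one.2 (by nlinarith)
          calc -(r * a * b) ≤ |r * a * b| := neg_le_abs _
            _ = |r| * (|a| * |b|) := by rw [abs_mul, abs_mul]; ring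
            _ ≤ 1 * (|a| * |b|) := by gcongr
            _ = _ := one_mul _
        have h7 : 0 ≤ |a| * |b| := by positivity
        have h8 : c * q ≤ 4 * q := by gcongr
        have h9 : 0 ≤ c * q := by positivity
        nlinarith
      have h7 : c * q * a ^ 2 ≤ 4 * q * a ^ 2 := by gcongr
      have h8 : a ^ 2 = |a| ^ 2 := (sq_abs a).symm
      have h9 : b ^ 2 = |b| ^ 2 := (sq_abs b).symm
      have h10 : 0 ≤ a ^ 2 * (1 - 12 * q + 36 * q ^ 2) := by
        have : 1 - 12 * q + 36 * q ^ 2 = (1 - 6 * q) ^ 2 := by ring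
        rw [this]; positivity
      nlinarith [sq_nonneg (|a| / 2 - 4 * q * |b|), sq_nonneg (q * a), sq_nonneg (q * b),
        sq_nonneg (|a| - 24 * q * |a|), sq_nonneg (|a| - 16 * q * |a|)]
    calc q ^ n * a ^ 2 ≤ q ^ n * (2 * (1 - 4 * q) * a ^ 2 + c * q * (r * a * b - a ^ 2)
        + 72 * (q ^ 2 * (a ^ 2 + b ^ 2))) := by gcongr
      _ = _ := by ring
  rw [intervalIntegral.integral_add ((by fun_prop : Continuous fun x => 2 * G' x / (n + 1)).intervalIntegrable _ _)
    ((by fun_prop : Continuous fun x => 72 * (qf x ^ (n + 2) * (f x ^ 2 + f' x ^ 2))).intervalIntegrable _ _),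
    intervalIntegral.integral_const_mul] at key
  have e : ∀ x, 2 * G' x / (n + 1) = (2 / (n + 1)) * G' x := fun x => by ring
  simp only [e, intervalIntegral.integral_const_mul, hz] at key
  linarith

end JacobiWave

namespace JacobiWave

open MeasureTheory intervalIntegral
open scoped ContDiff

lemma hasDerivAt_iteratedDeriv {f : ℝ → ℝ} (hf : ContDiff ℝ ∞ f) (k : ℕ) (x : ℝ) :
    HasDerivAt (iteratedDeriv k f) (iteratedDeriv (k + 1) f x) x := by
  rw [iteratedDeriv_succ]
  exact ((hf.differentiable_iteratedDeriv k (by exact_mod_cast WithTop.coe_lt_top _)) x).hasDerivAt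

lemma contDiff_iteratedDeriv {f : ℝ → ℝ} (hf : ContDiff ℝ ∞ f) (k : ℕ) :
    ContDiff ℝ ∞ (iteratedDeriv k f) := by
  induction k with
  | zero => simpa using hf
  | succ k ih => rw [iteratedDeriv_succ]; exact (contDiff_infty_iff_deriv.1 ih).2

lemma continuous_iteratedDeriv {f : ℝ → ℝ} (hf : ContDiff ℝ ∞ f) (k : ℕ) :
    Continuous (iteratedDeriv k f) := (contDiff_iteratedDeriv hf k).continuous

/-- Unweighted-by-`wt` quadratic form `∫ qⁿ (f⁽ᵐ⁾)²`. -/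
noncomputable def Kint (n m : ℕ) (f : ℝ → ℝ) : ℝ := ∫ x in (0:ℝ)..1, qf x ^ n * iteratedDeriv m f x ^ 2

lemma Kint_nonneg (n m : ℕ) (f : ℝ → ℝ) : 0 ≤ Kint n m f :=
  integral_nonneg_cont fun _ hx => mul_nonneg (pow_nonneg (qf_nonneg hx) _) (sq_nonneg _)

lemma Kint_hardy (n m : ℕ) {f : ℝ → ℝ} (hf : ContDiff ℝ ∞ f) :
    Kint n m f ≤ 72 * (Kint (n + 2) m f + Kint (n + 2) (m + 1) f) := by
  have h := hardy n (hasDerivAt_iteratedDeriv hf m) (continuous_iteratedDeriv hf (m + 1))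
  have c1 := continuous_iteratedDeriv hf m
  have c2 := continuous_iteratedDeriv hf (m + 1)
  have e := integral_add (μ := volume) (a := 0) (b := 1)
    (f := fun x => qf x ^ (n + 2) * iteratedDeriv m f x ^ 2)
    (g := fun x => qf x ^ (n + 2) * iteratedDeriv (m + 1) f x ^ 2)
    ((by fun_prop : Continuous _).intervalIntegrable _ _)
    ((by fun_prop : Continuous _).intervalIntegrable _ _)
  unfold Kint
  rw [← e]
  simpa only [mul_add] using h

lemma Kint_hardy_iter (r : ℕ) : ∃ C : ℝ, 0 ≤ C ∧ ∀ (n m : ℕ) (f : ℝ → ℝ), ContDiff ℝ ∞ f →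
    Kint n m f ≤ C * ∑ i ∈ Finset.range (r + 1), Kint (n + 2 * r) (m + i) f := by
  induction r with
  | zero => exact ⟨1, zero_le_one, fun n m f _ => by simp⟩
  | succ r ih =>
    obtain ⟨C, hC, h⟩ := ih
    refine ⟨C * ((r + 1) * 144), by positivity, fun n m f hf => (h n m f hf).trans ?_⟩
    rw [mul_assoc]
    refine mul_le_mul_of_nonneg_left ?_ hC
    set S := ∑ i ∈ Finset.range (r + 1 + 1), Kint (n + 2 * (r + 1)) (m + i) f with hS
    have hterm : ∀ i < r + 2, Kint (n + 2 * (r + 1)) (m + i) f ≤ S := fun i hi =>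
      Finset.single_le_sum (f := fun i => Kint (n + 2 * (r + 1)) (m + i) f)
        (fun i _ => Kint_nonneg _ _ _) (Finset.mem_range.2 hi)
    have : ∀ i ∈ Finset.range (r + 1), Kint (n + 2 * r) (m + i) f ≤ 144 * S := by
      intro i hi
      have hi' := Finset.mem_range.1 hi
      have h1 := Kint_hardy (n + 2 * r) (m + i) hf
      have h2 := hterm i (by omega)
      have h3 := hterm (i + 1) (by omega)
      have e1 : n + 2 * (r + 1) = n + 2 * r + 2 := by ring
      have e2 : m + (i + 1) = m + i + 1 := by ring
      rw [e1] at h2 h3; rw [e2] at h3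
      linarith
    refine (Finset.sum_le_sum this).trans (le_of_eq ?_)
    simp [mul_assoc]

lemma Kint_anti {n n' : ℕ} (h : n ≤ n') (m : ℕ) {f : ℝ → ℝ} (hf : ContDiff ℝ ∞ f) :
    Kint n' m f ≤ Kint n m f := by
  have c1 := continuous_iteratedDeriv hf m
  exact integral_mono_cont (by fun_prop) (by fun_prop) fun x hx =>
    mul_le_mul_of_nonneg_right (qf_pow_anti hx h) (sq_nonneg _)

lemma sup_le_Kint (n m : ℕ) {f : ℝ → ℝ} (hf : ContDiff ℝ ∞ f) {x : ℝ} (hx : x ∈ Icc (0:ℝ) 1) :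
    qf x ^ n * iteratedDeriv m f x ^ 2 ≤ (72 * n + 2) * (Kint n m f + Kint n (m + 1) f) := by
  have c1 := continuous_iteratedDeriv hf m
  have c2 := continuous_iteratedDeriv hf (m + 1)
  have hd : ∀ x, HasDerivAt (fun x => qf x ^ n * iteratedDeriv m f x ^ 2)
      (n * qf x ^ (n - 1) * (1 - 2 * x) * iteratedDeriv m f x ^ 2
        + qf x ^ n * (2 * iteratedDeriv m f x * iteratedDeriv (m + 1) f x)) x := by
    intro x
    have h2 : HasDerivAt (fun x => iteratedDeriv m f x ^ 2)
        (2 * iteratedDeriv m f x * iteratedDeriv (m + 1) f x) x := by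
      simpa using (hasDerivAt_iteratedDeriv hf m x).fun_pow 2
    exact ((hasDerivAt_qf x).fun_pow n).fun_mul h2
  have h1 := pointwise_le_integral hd (by fun_prop) hx
  have h2 : (∫ s in (0:ℝ)..1, |n * qf s ^ (n - 1) * (1 - 2 * s) * iteratedDeriv m f s ^ 2
        + qf s ^ n * (2 * iteratedDeriv m f s * iteratedDeriv (m + 1) f s)|) ≤
      ∫ s in (0:ℝ)..1, ((n:ℝ) * (qf s ^ (n - 1) * iteratedDeriv m f s ^ 2)
        + (qf s ^ n * iteratedDeriv m f s ^ 2 + qf s ^ n * iteratedDeriv (m + 1) f s ^ 2)) := by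
    refine integral_mono_cont (by fun_prop) (by fun_prop) fun s hs => ?_
    have hq := qf_nonneg hs
    have hq1 := pow_nonneg hq (n - 1)
    have hq2 := pow_nonneg hq n
    refine (abs_add_le _ _).trans (add_le_add ?_ ?_)
    · have : |1 - 2 * s| ≤ 1 := abs_le.2 ⟨by linarith [hs.2], by linarith [hs.1]⟩
      rw [abs_mul, abs_mul, abs_mul, abs_of_nonneg hq1, Nat.abs_cast, abs_of_nonneg (sq_nonneg (iteratedDeriv m f s))]
      calc (n:ℝ) * qf s ^ (n - 1) * |1 - 2 * s| * iteratedDeriv m f s ^ 2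
          ≤ (n:ℝ) * qf s ^ (n - 1) * 1 * iteratedDeriv m f s ^ 2 := by gcongr
        _ = _ := by ring
    · rw [abs_mul, abs_of_nonneg hq2, ← mul_add]
      refine mul_le_mul_of_nonneg_left (abs_le.2 ⟨?_, ?_⟩) hq2
      · nlinarith [sq_nonneg (iteratedDeriv m f s + iteratedDeriv (m + 1) f s)]
      · nlinarith [sq_nonneg (iteratedDeriv m f s - iteratedDeriv (m + 1) f s)]
  rw [integral_add ((by fun_prop : Continuous _).intervalIntegrable _ _)
    ((by fun_prop : Continuous _).intervalIntegrable _ _),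
    integral_add ((by fun_prop : Continuous _).intervalIntegrable _ _)
    ((by fun_prop : Continuous _).intervalIntegrable _ _), intervalIntegral.integral_const_mul] at h2
  have h3 : (n:ℝ) * Kint (n - 1) m f ≤ 72 * n * (Kint n m f + Kint n (m + 1) f) := by
    rcases Nat.eq_zero_or_pos n with rfl | hn
    · simp
    have a1 := Kint_hardy (n - 1) m hf
    have a2 := Kint_anti (show n ≤ n - 1 + 2 by omega) m hf
    have a3 := Kint_anti (show n ≤ n - 1 + 2 by omega) (m + 1) hf
    calc (n:ℝ) * Kint (n - 1) m f ≤ n * (72 * (Kint n m f + Kint n (m + 1) f)) := by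
          gcongr; linarith
      _ = _ := by ring
  have k1 := Kint_nonneg n (m + 1) f
  unfold Kint at *
  linarith

end JacobiWave

namespace JacobiWave

open MeasureTheory intervalIntegral
open scoped ContDiff

/-- The reduced Jacobi weight. -/
noncomputable def wm (N x : ℝ) : ℝ := x ^ (1/2 : ℝ) * (1 - x) ^ (N / 2 - 2)

/-- The Jacobi weight `x^{3/2} (1-x)^{N/2-1}` on `[0,1]`. -/
noncomputable def wt (N x : ℝ) : ℝ := qf x * wm N x

/-- The drift coefficient of the Jacobi operator. -/
noncomputable def bf (N x : ℝ) : ℝ := (5 / 2) * (1 - x) - (N / 2) * x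

@[fun_prop]
lemma continuous_bf {N : ℝ} : Continuous (bf N) := by unfold bf; fun_prop

lemma continuous_wm {N : ℝ} (hN : 4 < N) : Continuous (wm N) := by
  unfold wm
  exact (continuous_id.rpow_const fun _ => Or.inr (by norm_num)).mul
    ((continuous_const.sub continuous_id).rpow_const fun _ => Or.inr (by linarith))

lemma continuous_wt {N : ℝ} (hN : 4 < N) : Continuous (wt N) :=
  continuous_qf.mul (continuous_wm hN)

lemma wm_nonneg (N : ℝ) {x : ℝ} (hx : x ∈ Icc (0:ℝ) 1) : 0 ≤ wm N x :=
  mul_nonneg (rpow_nonneg hx.1 _) (rpow_nonneg (by linarith [hx.2]) _)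

lemma wt_nonneg (N : ℝ) {x : ℝ} (hx : x ∈ Icc (0:ℝ) 1) : 0 ≤ wt N x :=
  mul_nonneg (qf_nonneg hx) (wm_nonneg N hx)

lemma wm_le_one {N : ℝ} (hN : 4 < N) {x : ℝ} (hx : x ∈ Icc (0:ℝ) 1) : wm N x ≤ 1 :=
  mul_le_one₀ (rpow_le_one hx.1 hx.2 (by norm_num)) (rpow_nonneg (by linarith [hx.2]) _)
    (rpow_le_one (by linarith [hx.2]) (by linarith [hx.1]) (by linarith))

lemma wt_le_one {N : ℝ} (hN : 4 < N) {x : ℝ} (hx : x ∈ Icc (0:ℝ) 1) : wt N x ≤ 1 :=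
  mul_le_one₀ (qf_le_one hx) (wm_nonneg N hx) (wm_le_one hN hx)

/-- An integer power of `qf` bounding `wt` from below. -/
noncomputable def gam (N : ℝ) : ℕ := ⌈N⌉₊ + 1

lemma qf_pow_gam_le_wt {N : ℝ} (hN : 4 < N) {x : ℝ} (hx : x ∈ Icc (0:ℝ) 1) :
    qf x ^ gam N ≤ wt N x := by
  have aux : ∀ {z p : ℝ} {n : ℕ}, z ∈ Icc (0:ℝ) 1 → 0 < p → p ≤ n → z ^ n ≤ z ^ p := by
    intro z p n hz hp hn
    rcases hz.1.eq_or_lt with h | h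
    · have : n ≠ 0 := by rintro rfl; simp at hn; linarith
      rw [← h, zero_rpow hp.ne', zero_pow this]
    · rw [← rpow_natCast]; exact rpow_le_rpow_of_exponent_ge h hz.2 hn
  have hc := Nat.le_ceil N
  rw [gam, pow_succ, wt, mul_comm, wm]
  refine mul_le_mul_of_nonneg_left ?_ (qf_nonneg hx)
  rw [qf, mul_pow]
  have h1 : 0 ≤ 1 - x := by linarith [hx.2]
  exact mul_le_mul (aux hx (by norm_num) (by linarith)) (aux ⟨h1, by linarith [hx.1]⟩ (by linarith)
    (by linarith)) (pow_nonneg h1 _) (rpow_nonneg hx.1 _)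

lemma hasDerivAt_wt {N : ℝ} {x : ℝ} (hx : x ∈ Ioo (0:ℝ) 1) :
    HasDerivAt (wt N) (wm N x * (bf N x - (1 - 2 * x))) x := by
  have hx1 : 0 < 1 - x := by linarith [hx.2]
  have h1 : HasDerivAt (fun x : ℝ => x ^ (1/2:ℝ)) ((1/2) * x ^ ((1/2:ℝ) - 1)) x :=
    hasDerivAt_rpow_const (Or.inl hx.1.ne')
  have h2 : HasDerivAt (fun x : ℝ => (1 - x) ^ (N/2-2)) (-1 * (N/2-2) * (1 - x) ^ (N/2-2-1)) x :=
    ((hasDerivAt_id' x).const_sub 1).rpow_const (Or.inl hx1.ne')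
  refine ((hasDerivAt_qf x).fun_mul (h1.fun_mul h2)).congr_deriv ?_
  rw [rpow_sub_one hx.1.ne', rpow_sub_one hx1.ne', bf, wm, qf]
  have := hx.1.ne'
  field_simp
  ring

lemma weighted_div_identity {N : ℝ} (hN : 4 < N) (k : ℕ) {h h' : ℝ → ℝ}
    (hh : ∀ x, HasDerivAt h (h' x) x) (hh' : Continuous h') :
    ∫ x in (0:ℝ)..1, (wm N x * qf x ^ k * (bf N x + (k - 1) * (1 - 2 * x)) * h x
      + wt N x * qf x ^ k * h' x) = 0 := by
  have hc : Continuous h := continuous_iff_continuousAt.2 fun x => (hh x).continuousAt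
  have cm := continuous_wm hN
  have ct := continuous_wt hN
  rw [integral_eq_sub_of_hasDerivAt_of_le (f := fun x => wt N x * qf x ^ k * h x) zero_le_one
    (by fun_prop) (fun x hx => ?_) ((by fun_prop : Continuous _).intervalIntegrable _ _)]
  · simp [wt, qf]
  · refine (((hasDerivAt_wt hx).fun_mul ((hasDerivAt_qf x).fun_pow k)).fun_mul (hh x)).congr_deriv ?_
    rcases k with _ | k
    · simp only [wt, Nat.cast_zero, zero_mul, pow_zero]; ring
    · simp only [Nat.add_sub_cancel, wt]; push_cast; ring

/-- Weighted form used for the Jacobi operator. -/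
lemma jacobi_div_identity {N : ℝ} (hN : 4 < N) (k : ℕ) {h h' : ℝ → ℝ}
    (hh : ∀ x, HasDerivAt h (h' x) x) (hh' : Continuous h') :
    ∫ x in (0:ℝ)..1, wt N x * qf x ^ k * ((bf N x + k * (1 - 2 * x)) * h x + qf x * h' x) = 0 := by
  refine Eq.trans ?_ (weighted_div_identity hN (k + 1) hh hh')
  congr 1; ext x; rw [wt]; push_cast; ring

/-- The weighted Sobolev seminorm `∫ wt qᵏ (f⁽ᵏ⁾)²`. -/
noncomputable def Hk (N : ℝ) (k : ℕ) (f : ℝ → ℝ) : ℝ :=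
  ∫ x in (0:ℝ)..1, wt N x * qf x ^ k * iteratedDeriv k f x ^ 2

lemma Hk_nonneg (N : ℝ) (k : ℕ) (f : ℝ → ℝ) : 0 ≤ Hk N k f :=
  integral_nonneg_cont fun _ hx =>
    mul_nonneg (mul_nonneg (wt_nonneg N hx) (pow_nonneg (qf_nonneg hx) _)) (sq_nonneg _)

lemma Kint_le_Hk {N : ℝ} (hN : 4 < N) {n k : ℕ} (h : gam N + k ≤ n) {f : ℝ → ℝ}
    (hf : ContDiff ℝ ∞ f) : Kint n k f ≤ Hk N k f := by
  have c1 := continuous_iteratedDeriv hf k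
  have ct := continuous_wt hN
  refine integral_mono_cont (by fun_prop) (by fun_prop) fun x hx => ?_
  refine mul_le_mul_of_nonneg_right ((qf_pow_anti hx h).trans ?_) (sq_nonneg _)
  rw [pow_add]
  exact mul_le_mul_of_nonneg_right (qf_pow_gam_le_wt hN hx) (pow_nonneg (qf_nonneg hx) _)

/-- Weighted Sobolev embedding. -/
lemma sobolev {N : ℝ} (hN : 4 < N) (s m : ℕ) : ∃ C : ℝ, 0 ≤ C ∧ ∀ f : ℝ → ℝ, ContDiff ℝ ∞ f →
    ∀ x ∈ Icc (0:ℝ) 1, qf x ^ (m - s) * iteratedDeriv m f x ^ 2 ≤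
      C * ∑ i ∈ Finset.range (m + (gam N + s + 3)), Hk N i f := by
  obtain ⟨C, hC, h⟩ := Kint_hardy_iter (gam N + s + 1)
  set r := gam N + s + 1 with hr
  refine ⟨(72 * (m - s : ℕ) + 2) * (C * (2 * (r + 1))), by positivity, fun f hf x hx => ?_⟩
  refine (sup_le_Kint (m - s) m hf hx).trans ?_
  rw [mul_assoc]
  refine mul_le_mul_of_nonneg_left ?_ (by positivity)
  set S := ∑ i ∈ Finset.range (m + (gam N + s + 3)), Hk N i f with hS
  have hS' : ∀ i < m + (gam N + s + 3), Hk N i f ≤ S := fun i hi =>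
    Finset.single_le_sum (f := fun i => Hk N i f) (fun i _ => Hk_nonneg _ _ _) (Finset.mem_range.2 hi)
  have key : ∀ m' ≤ m + 1, Kint (m - s) m' f ≤ C * ((r + 1) * S) := by
    intro m' hm'
    refine (h (m - s) m' f hf).trans (mul_le_mul_of_nonneg_left ?_ hC)
    have : ∀ i ∈ Finset.range (r + 1), Kint (m - s + 2 * r) (m' + i) f ≤ S := fun i hi => by
      have hi' := Finset.mem_range.1 hi
      exact (Kint_le_Hk hN (by omega) hf).trans (hS' _ (by omega))
    refine (Finset.sum_le_sum this).trans (le_of_eq ?_)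
    simp
  have k1 := key m (by omega)
  have k2 := key (m + 1) le_rfl
  linarith

end JacobiWave

namespace JacobiWave

open MeasureTheory intervalIntegral
open scoped ContDiff

/-- A nonnegative quadratic functional on continuous functions, subadditive up to constants. -/
structure IsQuad (Q : (ℝ → ℝ) → ℝ) : Prop where
  nonneg : ∀ f, 0 ≤ Q f
  smul : ∀ (c : ℝ) f, Q (fun x => c * f x) = c ^ 2 * Q f
  sum : ∀ {ι : Type} (s : Finset ι) (f : ι → ℝ → ℝ), (∀ i ∈ s, Continuous (f i)) →
    Q (fun x => ∑ i ∈ s, f i x) ≤ s.card * ∑ i ∈ s, Q (f i)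

lemma IsQuad.sum_le {Q : (ℝ → ℝ) → ℝ} (hQ : IsQuad Q) {ι : Type} (s : Finset ι) (f : ι → ℝ → ℝ)
    (hf : ∀ i ∈ s, Continuous (f i)) {B : ℝ} (hB : ∀ i ∈ s, Q (f i) ≤ B) :
    Q (fun x => ∑ i ∈ s, f i x) ≤ (s.card : ℝ) ^ 2 * B := by
  refine (hQ.sum s f hf).trans ?_
  have := Finset.sum_le_sum hB
  rw [Finset.sum_const, nsmul_eq_mul] at this
  calc _ ≤ (s.card : ℝ) * (s.card * B) := by gcongr
    _ = _ := by ring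

lemma IsQuad.add_le {Q : (ℝ → ℝ) → ℝ} (hQ : IsQuad Q) {f g : ℝ → ℝ} (hf : Continuous f)
    (hg : Continuous g) {B : ℝ} (h1 : Q f ≤ B) (h2 : Q g ≤ B) :
    Q (fun x => f x + g x) ≤ 4 * B := by
  have := hQ.sum_le (Finset.univ : Finset Bool) (fun b => if b then f else g)
    (by intro i _; cases i <;> simpa) (B := B) (by intro i _; cases i <;> simpa)
  simp at this
  linarith

/-- The weighted `L²` quadratic functional. -/
noncomputable def L2 (N : ℝ) (p : ℕ) (f : ℝ → ℝ) : ℝ := ∫ x in (0:ℝ)..1, wt N x * qf x ^ p * f x ^ 2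

lemma isQuad_L2 {N : ℝ} (hN : 4 < N) (p : ℕ) : IsQuad (L2 N p) where
  nonneg f := integral_nonneg_cont fun x hx =>
    mul_nonneg (mul_nonneg (wt_nonneg N hx) (pow_nonneg (qf_nonneg hx) _)) (sq_nonneg _)
  smul c f := by
    unfold L2; rw [← intervalIntegral.integral_const_mul]; congr 1; ext x; ring
  sum s f hf := by
    have ct := continuous_wt hN
    have cs : Continuous fun x => ∑ i ∈ s, f i x := continuous_finsetSum _ hf
    have cs2 : ∀ i ∈ s, Continuous fun x => wt N x * qf x ^ p * f i x ^ 2 := fun i hi => by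
      have := hf i hi; fun_prop
    unfold L2
    rw [← integral_finsetSum fun i hi => (cs2 i hi).intervalIntegrable _ _,
      ← intervalIntegral.integral_const_mul]
    refine integral_mono_cont (by fun_prop) (continuous_const.mul (continuous_finsetSum _ cs2))
      fun x hx => ?_
    rw [← Finset.mul_sum]
    have := mul_le_mul_of_nonneg_left (sq_sum_le_card_mul_sum_sq (s := s) (f := fun i => f i x))
      (mul_nonneg (wt_nonneg N hx) (pow_nonneg (qf_nonneg hx) p))
    exact this.trans (le_of_eq (by ring))

lemma isQuad_point (p : ℕ) {x : ℝ} (hx : x ∈ Icc (0:ℝ) 1) :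
    IsQuad (fun f => qf x ^ p * f x ^ 2) where
  nonneg f := mul_nonneg (pow_nonneg (qf_nonneg hx) _) (sq_nonneg _)
  smul c f := by ring
  sum s f hf := by
    rw [← Finset.mul_sum, ← mul_assoc, mul_comm (s.card : ℝ), mul_assoc]
    exact mul_le_mul_of_nonneg_left sq_sum_le_card_mul_sum_sq (pow_nonneg (qf_nonneg hx) _)

lemma L2_mono {N : ℝ} (hN : 4 < N) {p p' : ℕ} {f g : ℝ → ℝ} (hf : Continuous f) (hg : Continuous g)
    {c : ℝ} (h : ∀ x ∈ Icc (0:ℝ) 1, qf x ^ p * f x ^ 2 ≤ c * (qf x ^ p' * g x ^ 2)) :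
    L2 N p f ≤ c * L2 N p' g := by
  have ct := continuous_wt hN
  unfold L2
  rw [← intervalIntegral.integral_const_mul]
  refine integral_mono_cont (by fun_prop) (by fun_prop) fun x hx => ?_
  have := mul_le_mul_of_nonneg_left (h x hx) (wt_nonneg N hx)
  linarith

/-- Sup/`L²` weighted control of the derivatives of `f`; `S` and `H` bound squares. -/
structure AB (N : ℝ) (m n : ℕ) (f : ℝ → ℝ) (S H : ℝ) : Prop where
  sup : ∀ a ≤ n, a ≤ m → ∀ x ∈ Icc (0:ℝ) 1, qf x ^ (a - 1) * iteratedDeriv a f x ^ 2 ≤ S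
  int : ∀ a ≤ n, L2 N (a + 1) (iteratedDeriv a f) ≤ H

lemma AB.mono {N : ℝ} {m n m' n' : ℕ} {f : ℝ → ℝ} {S H S' H' : ℝ} (h : AB N m n f S H)
    (hm : m' ≤ m) (hn : n' ≤ n) (hS : S ≤ S') (hH : H ≤ H') : AB N m' n' f S' H' :=
  ⟨fun a ha ha' x hx => (h.sup a (ha.trans hn) (ha'.trans hm) x hx).trans hS,
    fun a ha => (h.int a (ha.trans hn)).trans hH⟩

lemma AB.nonneg_H {N : ℝ} (hN : 4 < N) {m n : ℕ} {f : ℝ → ℝ} {S H : ℝ} (h : AB N m n f S H) :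
    0 ≤ H := ((isQuad_L2 hN _).nonneg _).trans (h.int 0 (Nat.zero_le _))

lemma AB.nonneg_S {N : ℝ} {m n : ℕ} {f : ℝ → ℝ} {S H : ℝ} (h : AB N m n f S H) :
    0 ≤ S := by
  refine le_trans ?_ (h.sup 0 (Nat.zero_le _) (Nat.zero_le _) 0 (by simp))
  simp; positivity

lemma AB.pair_int {N : ℝ} (hN : 4 < N) {m n n' : ℕ} {f g : ℝ → ℝ} {S H S' H' : ℝ}
    (hfs : ContDiff ℝ ∞ f) (hgs : ContDiff ℝ ∞ g)
    (hf : AB N m n f S H) (hg : AB N m n' g S' H') {i b p : ℕ} (hi : i ≤ n) (hb : b ≤ n')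
    (hib : i + b ≤ 2 * m + 1) (h1 : i - 1 + (b + 1) ≤ p) (h2 : i + 1 + (b - 1) ≤ p) :
    L2 N p (fun x => iteratedDeriv i f x * iteratedDeriv b g x) ≤ S * H' + S' * H := by
  have c1 := continuous_iteratedDeriv hfs i
  have c2 := continuous_iteratedDeriv hgs b
  have aux : ∀ {i b : ℕ} {f g : ℝ → ℝ} {S H : ℝ}, Continuous (iteratedDeriv i f) →
      Continuous (iteratedDeriv b g) → i - 1 + (b + 1) ≤ p →
      (∀ x ∈ Icc (0:ℝ) 1, qf x ^ (i - 1) * iteratedDeriv i f x ^ 2 ≤ S) → 0 ≤ S →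
      L2 N (b + 1) (iteratedDeriv b g) ≤ H →
      L2 N p (fun x => iteratedDeriv i f x * iteratedDeriv b g x) ≤ S * H := by
    intro i b f g S H c1 c2 hp hs hS0 hH
    refine (L2_mono hN (by fun_prop) c2 (c := S) (p' := b + 1) fun x hx => ?_).trans
      (mul_le_mul_of_nonneg_left hH hS0)
    have hq := qf_nonneg hx
    calc qf x ^ p * (iteratedDeriv i f x * iteratedDeriv b g x) ^ 2
        ≤ qf x ^ (i - 1 + (b + 1)) * (iteratedDeriv i f x * iteratedDeriv b g x) ^ 2 :=
          mul_le_mul_of_nonneg_right (qf_pow_anti hx hp) (sq_nonneg _)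
      _ = (qf x ^ (i - 1) * iteratedDeriv i f x ^ 2) * (qf x ^ (b + 1) * iteratedDeriv b g x ^ 2) := by
          rw [pow_add]; ring
      _ ≤ _ := mul_le_mul_of_nonneg_right (hs x hx) (by positivity)
  have n1 := hf.nonneg_S
  have n2 := hg.nonneg_S
  have n3 := hf.nonneg_H hN
  have n4 := hg.nonneg_H hN
  rcases le_or_gt i m with him | him
  · have := aux c1 c2 h1 (hf.sup i hi him) n1 (hg.int b hb)
    nlinarith [mul_nonneg n2 n3]
  · have := aux c2 c1 (by omega) (hg.sup b hb (by omega)) n2 (hf.int i hi)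
    simp only [mul_comm (iteratedDeriv b g _)] at this
    nlinarith [mul_nonneg n1 n4]

lemma AB.pair_sup {N : ℝ} {m n n' : ℕ} {f g : ℝ → ℝ} {S H S' H' : ℝ}
    (hf : AB N m n f S H) (hg : AB N m n' g S' H') {i b p : ℕ} (hi : i ≤ n) (hb : b ≤ n')
    (him : i ≤ m) (hbm : b ≤ m) (h1 : i - 1 + (b - 1) ≤ p) {x : ℝ} (hx : x ∈ Icc (0:ℝ) 1) :
    qf x ^ p * (iteratedDeriv i f x * iteratedDeriv b g x) ^ 2 ≤ S * S' := by
  have hq := qf_nonneg hx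
  calc qf x ^ p * (iteratedDeriv i f x * iteratedDeriv b g x) ^ 2
      ≤ qf x ^ (i - 1 + (b - 1)) * (iteratedDeriv i f x * iteratedDeriv b g x) ^ 2 :=
        mul_le_mul_of_nonneg_right (qf_pow_anti hx h1) (sq_nonneg _)
    _ = (qf x ^ (i - 1) * iteratedDeriv i f x ^ 2) * (qf x ^ (b - 1) * iteratedDeriv b g x ^ 2) := by
        rw [pow_add]; ring
    _ ≤ _ := mul_le_mul (hf.sup i hi him x hx) (hg.sup b hb hbm x hx) (by positivity) hf.nonneg_S

end JacobiWave

namespace JacobiWave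

open MeasureTheory intervalIntegral
open scoped ContDiff

variable {d : ℕ}

/-- Substitution of jets `J` in `G(x, J)`. -/
def comp (G : ℝ × (Fin d → ℝ) → ℝ) (J : Fin d → ℝ → ℝ) (x : ℝ) : ℝ := G (x, fun c => J c x)

/-- Partial derivative in `x`. -/
noncomputable def dX (G : ℝ × (Fin d → ℝ) → ℝ) (p : ℝ × (Fin d → ℝ)) : ℝ := fderiv ℝ G p (1, 0)

/-- Partial derivative in the jet variable `c`. -/
noncomputable def dJ (G : ℝ × (Fin d → ℝ) → ℝ) (c : Fin d) (p : ℝ × (Fin d → ℝ)) : ℝ :=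
  fderiv ℝ G p (0, Pi.single c 1)

/-- Smooth and compactly supported. -/
structure Sm (G : ℝ × (Fin d → ℝ) → ℝ) : Prop where
  smooth : ContDiff ℝ ∞ G
  supp : HasCompactSupport G

lemma contDiff_fderiv_apply {E : Type*} [NormedAddCommGroup E] [NormedSpace ℝ E] {G : E → ℝ}
    (hG : ContDiff ℝ ∞ G) (v : E) : ContDiff ℝ ∞ (fun p => fderiv ℝ G p v) :=
  (hG.fderiv_right (m := ∞) (by simp)).clm_apply contDiff_const

lemma Sm.fderiv_apply {G : ℝ × (Fin d → ℝ) → ℝ} (hG : Sm G) (v : ℝ × (Fin d → ℝ)) :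
    Sm (fun p => fderiv ℝ G p v) :=
  ⟨contDiff_fderiv_apply hG.smooth v, hG.supp.fderiv_apply (𝕜 := ℝ) v⟩

lemma Sm.dX {G : ℝ × (Fin d → ℝ) → ℝ} (hG : Sm G) : Sm (dX G) := hG.fderiv_apply _
lemma Sm.dJ {G : ℝ × (Fin d → ℝ) → ℝ} (hG : Sm G) (c : Fin d) : Sm (dJ G c) := hG.fderiv_apply _

lemma Sm.bdd {G : ℝ × (Fin d → ℝ) → ℝ} (hG : Sm G) : ∃ C : ℝ, 0 ≤ C ∧ ∀ p, |G p| ≤ C := by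
  obtain ⟨C, hC⟩ := hG.supp.exists_bound_of_continuous hG.smooth.continuous
  exact ⟨C, (norm_nonneg _).trans (hC 0), fun p => by simpa using hC p⟩

lemma Sm.lip {G : ℝ × (Fin d → ℝ) → ℝ} (hG : Sm G) :
    ∃ C : ℝ, 0 ≤ C ∧ ∀ x z z', |G (x, z) - G (x, z')| ≤ C * ‖z - z'‖ := by
  obtain ⟨K, hK⟩ := hG.smooth.lipschitzWith_of_hasCompactSupport hG.supp (by simp)
  refine ⟨K, K.2, fun x z z' => ?_⟩
  have := hK.dist_le_mul (x, z) (x, z')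
  rwa [Real.dist_eq, Prod.dist_eq, dist_self, max_eq_right dist_nonneg, dist_eq_norm] at this

lemma contDiff_comp {G : ℝ × (Fin d → ℝ) → ℝ} (hG : ContDiff ℝ ∞ G) {J : Fin d → ℝ → ℝ}
    (hJ : ∀ c, ContDiff ℝ ∞ (J c)) : ContDiff ℝ ∞ (comp G J) :=
  hG.comp (contDiff_id.prodMk (contDiff_pi.2 hJ))

lemma fderiv_apply_eq_sum (G : ℝ × (Fin d → ℝ) → ℝ) (p : ℝ × (Fin d → ℝ)) (a : ℝ) (z : Fin d → ℝ) :
    fderiv ℝ G p (a, z) = a * dX G p + ∑ c, dJ G c p * z c := by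
  have e : ((a, z) : ℝ × (Fin d → ℝ)) = a • (1, 0) + ∑ c, z c • (0, Pi.single c 1) := by
    ext c
    · simp [Prod.fst_sum]
    · simp [Prod.snd_sum, Finset.sum_apply, Pi.single_apply]
  rw [e, map_add, map_smul, map_sum]
  simp only [map_smul, smul_eq_mul, dX, dJ]
  congr 1
  exact Finset.sum_congr rfl fun c _ => mul_comm _ _

lemma hasDerivAt_comp {G : ℝ × (Fin d → ℝ) → ℝ} (hG : Differentiable ℝ G) {J : Fin d → ℝ → ℝ}
    {J' : Fin d → ℝ} {x : ℝ} (hJ : ∀ c, HasDerivAt (J c) (J' c) x) :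
    HasDerivAt (comp G J) (comp (dX G) J x + ∑ c, comp (dJ G c) J x * J' c) x := by
  have h1 : HasDerivAt (fun x => (x, fun c => J c x)) ((1:ℝ), J') x :=
    (hasDerivAt_id' x).prodMk (hasDerivAt_pi.2 hJ)
  have := (hG (x, fun c => J c x)).hasFDerivAt.comp_hasDerivAt x h1
  rw [fderiv_apply_eq_sum, one_mul] at this
  exact this

lemma iteratedDeriv_comp_succ {G : ℝ × (Fin d → ℝ) → ℝ} (hG : ContDiff ℝ ∞ G) {J : Fin d → ℝ → ℝ}
    (hJ : ∀ c, ContDiff ℝ ∞ (J c)) (n : ℕ) (x : ℝ) :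
    iteratedDeriv (n + 1) (comp G J) x = iteratedDeriv n (comp (dX G) J) x +
      ∑ c, ∑ i ∈ Finset.range (n + 1), (n.choose i : ℝ) *
        (iteratedDeriv i (comp (dJ G c) J) x * iteratedDeriv (n - i + 1) (J c) x) := by
  have hd : deriv (comp G J) = fun x => comp (dX G) J x + ∑ c, comp (dJ G c) J x * deriv (J c) x := by
    ext x
    exact (hasDerivAt_comp (hG.differentiable (by simp)) fun c =>
      ((hJ c).differentiable (by simp) x).hasDerivAt).deriv
  have s1 : ContDiff ℝ ∞ (comp (dX G) J) := contDiff_comp (contDiff_fderiv_apply hG _) hJ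
  have s2 : ∀ c, ContDiff ℝ ∞ (comp (dJ G c) J) := fun c =>
    contDiff_comp (contDiff_fderiv_apply hG _) hJ
  have s3 : ∀ c, ContDiff ℝ ∞ (deriv (J c)) := fun c => (contDiff_infty_iff_deriv.1 (hJ c)).2
  have le : (n : WithTop ℕ∞) ≤ ∞ := by exact_mod_cast le_top
  rw [iteratedDeriv_succ', hd, iteratedDeriv_fun_add (s1.of_le le).contDiffAt
    ((ContDiff.sum fun c _ => (s2 c).mul (s3 c)).of_le le).contDiffAt]
  congr 1
  rw [iteratedDeriv_fun_sum fun c _ => (((s2 c).mul (s3 c)).of_le le).contDiffAt]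
  refine Finset.sum_congr rfl fun c _ => ?_
  rw [iteratedDeriv_fun_mul ((s2 c).of_le le).contDiffAt ((s3 c).of_le le).contDiffAt]
  refine Finset.sum_congr rfl fun i _ => ?_
  rw [← iteratedDeriv_succ', mul_assoc]

/-- Bounding a Faà di Bruno type sum by a bound on each of its pieces. -/
lemma IsQuad.star_le {Q : (ℝ → ℝ) → ℝ} (hQ : IsQuad Q) (n : ℕ) {g : ℝ → ℝ} (s : Finset ℕ)
    (hs : s ⊆ Finset.range (n + 1)) {f : Fin d → ℕ → ℝ → ℝ}
    (hg : Continuous g) (hf : ∀ c, ∀ i ∈ s, Continuous (f c i)) {B : ℝ}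
    (h1 : Q g ≤ B) (h2 : ∀ c, ∀ i ∈ s, Q (f c i) ≤ B) :
    Q (fun x => g x + ∑ c, ∑ i ∈ s, (n.choose i : ℝ) * f c i x) ≤
      4 * ((1 + d ^ 2 * ((n + 1) ^ 2 * (2 ^ n) ^ 2)) * B) := by
  have hB : 0 ≤ B := (hQ.nonneg g).trans h1
  have hsc : (s.card : ℝ) ≤ n + 1 := by
    have := Finset.card_le_card hs
    rw [Finset.card_range] at this
    exact_mod_cast this
  have k1 : ∀ c, ∀ i ∈ s, Q (fun x => (n.choose i : ℝ) * f c i x) ≤ (2 ^ n) ^ 2 * B := by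
    intro c i hi
    rw [hQ.smul]
    have : (n.choose i : ℝ) ≤ 2 ^ n := by exact_mod_cast Nat.choose_le_two_pow n i
    exact mul_le_mul (by gcongr) (h2 c i hi) (hQ.nonneg _) (by positivity)
  have c1 : ∀ c, ∀ i ∈ s, Continuous (fun x => (n.choose i : ℝ) * f c i x) := fun c i hi =>
    continuous_const.mul (hf c i hi)
  have k2 : ∀ c : Fin d, Q (fun x => ∑ i ∈ s, (n.choose i : ℝ) * f c i x) ≤
      (n + 1) ^ 2 * ((2 ^ n) ^ 2 * B) := fun c =>
    (hQ.sum_le s _ (c1 c) (k1 c)).trans (by gcongr)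
  have c2 : ∀ c : Fin d, Continuous (fun x => ∑ i ∈ s, (n.choose i : ℝ) * f c i x) := fun c =>
    continuous_finsetSum _ (c1 c)
  have k3 := hQ.sum_le Finset.univ _ (fun c _ => c2 c) (fun c _ => k2 c)
  rw [Finset.card_univ, Fintype.card_fin] at k3
  have hp : 0 ≤ (d:ℝ) ^ 2 * ((n + 1) ^ 2 * ((2 ^ n) ^ 2 * B)) := by positivity
  refine hQ.add_le hg (continuous_finsetSum _ fun c _ => c2 c) ?_ ?_
  · nlinarith
  · nlinarith

end JacobiWave

namespace JacobiWave

open MeasureTheory intervalIntegral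
open scoped ContDiff

variable {d : ℕ}

lemma dX_zero {G : ℝ × (Fin d → ℝ) → ℝ} (hG : Differentiable ℝ G)
    (h0 : ∀ x ∈ Icc (0:ℝ) 1, G (x, 0) = 0) {x : ℝ} (hx : x ∈ Icc (0:ℝ) 1) : dX G (x, 0) = 0 := by
  have h1 : HasDerivAt (fun x => G (x, 0)) (dX G (x, 0)) x :=
    (hG (x, 0)).hasFDerivAt.comp_hasDerivAt x ((hasDerivAt_id' x).prodMk (hasDerivAt_const x 0))
  have h2 : HasDerivWithinAt (fun x => G (x, 0)) 0 (Icc 0 1) x :=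
    (hasDerivWithinAt_const x (Icc (0:ℝ) 1) (0:ℝ)).congr h0 (h0 x hx)
  exact (uniqueDiffOn_Icc_zero_one x hx).eq_deriv _ h1.hasDerivWithinAt h2

lemma L2_le_of_bdd {N : ℝ} (hN : 4 < N) (p : ℕ) {f : ℝ → ℝ} (hf : Continuous f) {B : ℝ}
    (h : ∀ x ∈ Icc (0:ℝ) 1, qf x ^ p * f x ^ 2 ≤ B) : L2 N p f ≤ B := by
  have ct := continuous_wt hN
  have : L2 N p f ≤ ∫ x in (0:ℝ)..1, B := by
    refine integral_mono_cont (by fun_prop) (by fun_prop) fun x hx => ?_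
    rw [mul_assoc]
    have h0 : 0 ≤ qf x ^ p * f x ^ 2 := mul_nonneg (pow_nonneg (qf_nonneg hx) _) (sq_nonneg _)
    exact (mul_le_of_le_one_left h0 (wt_le_one hN hx)).trans (h x hx)
  simpa using this

lemma L2_anti {N : ℝ} (hN : 4 < N) {p p' : ℕ} (h : p ≤ p') {f : ℝ → ℝ} (hf : Continuous f) :
    L2 N p' f ≤ L2 N p f := by
  have := L2_mono hN hf hf (c := 1) (p := p') (p' := p) fun x hx => by
    rw [one_mul]; exact mul_le_mul_of_nonneg_right (qf_pow_anti hx h) (sq_nonneg _)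
  simpa using this

/-- The squared Lipschitz bound of `G(x, J)` when `G(x, 0) = 0`. -/
lemma comp_sq_le {G : ℝ × (Fin d → ℝ) → ℝ} {C : ℝ}
    (hC : ∀ x z z', |G (x, z) - G (x, z')| ≤ C * ‖z - z'‖) {J : Fin d → ℝ → ℝ}
    {x : ℝ} (h0 : G (x, 0) = 0) : comp G J x ^ 2 ≤ C ^ 2 * ∑ c, J c x ^ 2 := by
  have h1 := hC x (fun c => J c x) 0
  rw [h0, sub_zero, sub_zero] at h1
  have h2 : ‖fun c => J c x‖ ^ 2 ≤ ∑ c, J c x ^ 2 := by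
    have : ‖fun c => J c x‖ ≤ √(∑ c, J c x ^ 2) := by
      refine (pi_norm_le_iff_of_nonneg (sqrt_nonneg _)).2 fun c => ?_
      rw [Real.norm_eq_abs]
      refine abs_le_sqrt ?_
      exact Finset.single_le_sum (f := fun c => J c x ^ 2) (fun _ _ => sq_nonneg _)
        (Finset.mem_univ c)
    calc _ ≤ √(∑ c, J c x ^ 2) ^ 2 := by gcongr
      _ = _ := sq_sqrt (Finset.sum_nonneg fun _ _ => sq_nonneg _)
  calc comp G J x ^ 2 = |comp G J x| ^ 2 := (sq_abs _).symm
    _ ≤ (C * ‖fun c => J c x‖) ^ 2 := by gcongr; exact h1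
    _ = C ^ 2 * ‖fun c => J c x‖ ^ 2 := by ring
    _ ≤ _ := by gcongr

/-- Tame composition estimate in the weighted spaces. -/
theorem comp_AB {N : ℝ} (hN : 4 < N) (m : ℕ) {M : ℝ} (hM : 0 ≤ M) (n : ℕ) (hn : n ≤ 2 * m + 1) :
    ∀ G : ℝ × (Fin d → ℝ) → ℝ, Sm G → ∃ C : ℝ, 0 ≤ C ∧ ∀ (J : Fin d → ℝ → ℝ) (S H : ℝ),
      (∀ c, ContDiff ℝ ∞ (J c)) → 0 ≤ S → S ≤ M → S ≤ H → (∀ c, AB N m n (J c) S H) →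
      AB N m n (comp G J) C (C * (1 + H)) ∧
        ((∀ x ∈ Icc (0:ℝ) 1, G (x, 0) = 0) → AB N m n (comp G J) C (C * H)) := by
  induction n with
  | zero =>
    intro G hG
    obtain ⟨C, hC0, hC⟩ := hG.bdd
    obtain ⟨L, hL0, hL⟩ := hG.lip
    refine ⟨C ^ 2 + L ^ 2 * d, by positivity, fun J S H hJ hS hSM hSH hAB => ?_⟩
    have hH : 0 ≤ H := hS.trans hSH
    have cc := (contDiff_comp hG.smooth hJ).continuous
    have hsq : ∀ x, comp G J x ^ 2 ≤ C ^ 2 := fun x => sq_le_sq' (abs_le.1 (hC _)).1 (abs_le.1 (hC _)).2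
    have hsup : ∀ a ≤ 0, a ≤ m → ∀ x ∈ Icc (0:ℝ) 1,
        qf x ^ (a - 1) * iteratedDeriv a (comp G J) x ^ 2 ≤ C ^ 2 + L ^ 2 * d := by
      intro a ha _ x _
      obtain rfl : a = 0 := by omega
      simp only [zero_tsub, pow_zero, one_mul, iteratedDeriv_zero]
      have := hsq x
      have : 0 ≤ L ^ 2 * d := by positivity
      linarith
    refine ⟨⟨hsup, fun a ha => ?_⟩, fun h0 => ⟨hsup, fun a ha => ?_⟩⟩
    · obtain rfl : a = 0 := by omega
      rw [iteratedDeriv_zero]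
      refine L2_le_of_bdd hN _ cc fun x hx => ?_
      have h1 := hsq x
      have h2 := mul_le_of_le_one_left (sq_nonneg (comp G J x)) (pow_le_one₀ (n := 0 + 1) (qf_nonneg hx) (qf_le_one hx))
      have : 0 ≤ L ^ 2 * d := by positivity
      nlinarith [sq_nonneg C, mul_nonneg (sq_nonneg C) hH, mul_nonneg this hH]
    · obtain rfl : a = 0 := by omega
      rw [iteratedDeriv_zero]
      have ct := continuous_wt hN
      have cJ := fun c => (hJ c).continuous
      have h1 : L2 N (0 + 1) (comp G J) ≤ L ^ 2 * ∑ c, L2 N (0 + 1) (J c) := by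
        have cs : ∀ c ∈ Finset.univ, Continuous fun x => wt N x * qf x ^ (0 + 1) * J c x ^ 2 :=
          fun c _ => by have := cJ c; fun_prop
        unfold L2
        rw [← integral_finsetSum fun i hi => (cs i hi).intervalIntegrable _ _,
          ← intervalIntegral.integral_const_mul]
        refine integral_mono_cont (by fun_prop) (continuous_const.mul (continuous_finsetSum _ cs))
          fun x hx => ?_
        rw [← Finset.mul_sum]
        have := mul_le_mul_of_nonneg_left (comp_sq_le hL (J := J) (h0 x hx))
          (mul_nonneg (wt_nonneg N hx) (pow_nonneg (qf_nonneg hx) (0 + 1)))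
        exact this.trans (le_of_eq (by ring))
      have h2 : ∑ c, L2 N (0 + 1) (J c) ≤ d * H := by
        refine (Finset.sum_le_sum fun c _ => (hAB c).int 0 le_rfl).trans (le_of_eq ?_)
        simp
      nlinarith [mul_le_mul_of_nonneg_left h2 (sq_nonneg L), mul_nonneg (sq_nonneg C) hH]
  | succ n ih =>
    intro G hG
    have ih := ih (by omega)
    obtain ⟨C1, hC1, h1⟩ := ih G hG
    obtain ⟨CX, hCX, hX⟩ := ih (dX G) hG.dX
    choose Cc hCc hc using fun c => ih (dJ G c) (hG.dJ c)
    set CS := ∑ c, Cc c with hCS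
    have hCS0 : 0 ≤ CS := Finset.sum_nonneg fun c _ => hCc c
    have hcS : ∀ c, Cc c ≤ CS := fun c =>
      Finset.single_le_sum (f := Cc) (fun c _ => hCc c) (Finset.mem_univ c)
    set K : ℝ := 4 * (1 + d ^ 2 * ((n + 1) ^ 2 * (2 ^ n) ^ 2)) with hK
    have hK0 : 0 ≤ K := by positivity
    set D := CX + CS * (2 + M) with hD
    have hD0 : 0 ≤ D := by positivity
    refine ⟨C1 + K * D, by positivity, fun J S H hJ hS hSM hSH hAB => ?_⟩
    have hH : 0 ≤ H := hS.trans hSH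
    have hABn : ∀ c, AB N m n (J c) S H := fun c => (hAB c).mono le_rfl (by omega) le_rfl le_rfl
    obtain ⟨g1, g2⟩ := h1 J S H hJ hS hSM hSH hABn
    obtain ⟨x1, x2⟩ := hX J S H hJ hS hSM hSH hABn
    have c1 := fun c => (hc c J S H hJ hS hSM hSH hABn).1
    have sX : ContDiff ℝ ∞ (comp (dX G) J) := contDiff_comp hG.dX.smooth hJ
    have sc : ∀ c, ContDiff ℝ ∞ (comp (dJ G c) J) := fun c => contDiff_comp (hG.dJ c).smooth hJ
    have e : iteratedDeriv (n + 1) (comp G J) = fun x => iteratedDeriv n (comp (dX G) J) x +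
      ∑ c, ∑ i ∈ Finset.range (n + 1), (n.choose i : ℝ) *
        (iteratedDeriv i (comp (dJ G c) J) x * iteratedDeriv (n - i + 1) (J c) x) :=
      funext (iteratedDeriv_comp_succ hG.smooth hJ n)
    have cpc : ∀ c, ∀ i ∈ Finset.range (n + 1), Continuous fun x =>
        iteratedDeriv i (comp (dJ G c) J) x * iteratedDeriv (n - i + 1) (J c) x := fun c i _ =>
      (continuous_iteratedDeriv (sc c) i).mul (continuous_iteratedDeriv (hJ c) _)
    have hdX : ∀ κ : ℝ, 0 ≤ κ → AB N m n (comp (dX G) J) CX (CX * (κ + H)) →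
        L2 N (n + 1 + 1) (iteratedDeriv (n + 1) (comp G J)) ≤ K * D * (κ + H) := by
      intro κ hκ hx
      have := (isQuad_L2 hN (n + 1 + 1)).star_le n (Finset.range (n + 1)) subset_rfl
        (continuous_iteratedDeriv sX n) cpc (B := D * (κ + H)) ?_ ?_
      · rw [e]; refine this.trans (le_of_eq ?_); rw [hK]; ring
      · refine (L2_anti hN (by omega) (continuous_iteratedDeriv sX n)).trans
          ((hx.int n le_rfl).trans ?_)
        exact mul_le_mul_of_nonneg_right (by rw [hD]; nlinarith) (by positivity)
      · intro c i hi
        have hi' := Finset.mem_range.1 hi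
        refine ((c1 c).pair_int hN (sc c) (hJ c) (hAB c) (i := i) (b := n - i + 1) (by omega)
          (by omega) (by omega) (by omega) (by omega)).trans ?_
        have a1 : Cc c * H + S * (Cc c * (1 + H)) ≤ CS * (2 + M) * H := by
          have : H + S * (1 + H) ≤ (2 + M) * H := by nlinarith
          calc _ = Cc c * (H + S * (1 + H)) := by ring
            _ ≤ CS * ((2 + M) * H) := mul_le_mul (hcS c) this (by positivity) hCS0
            _ = _ := by ring
        refine a1.trans ?_
        have : 0 ≤ CS * (2 + M) := by positivity
        rw [hD]; nlinarith [mul_nonneg hCX (add_nonneg hκ hH), mul_nonneg this hκ]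
    have hsup : n + 1 ≤ m → ∀ x ∈ Icc (0:ℝ) 1,
        qf x ^ (n + 1 - 1) * iteratedDeriv (n + 1) (comp G J) x ^ 2 ≤ C1 + K * D := by
      intro hnm x hx
      have := (isQuad_point (n + 1 - 1) hx).star_le n (Finset.range (n + 1)) subset_rfl
        (continuous_iteratedDeriv sX n) cpc (B := D) ?_ ?_
      · simp only [e]; refine this.trans ?_; rw [hK]; nlinarith
      · refine (mul_le_mul_of_nonneg_right (qf_pow_anti hx (by omega : n - 1 ≤ n + 1 - 1))
          (sq_nonneg _)).trans ((x1.sup n le_rfl (by omega) x hx).trans ?_)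
        rw [hD]; nlinarith
      · intro c i hi
        have hi' := Finset.mem_range.1 hi
        refine ((c1 c).pair_sup (hAB c) (i := i) (b := n - i + 1) (by omega) (by omega) (by omega)
          (by omega) (by omega) hx).trans ?_
        have : Cc c * S ≤ CS * M := mul_le_mul (hcS c) hSM hS hCS0
        rw [hD]; nlinarith
    have hKD : 0 ≤ K * D := by positivity
    have fin : ∀ κ : ℝ, 0 ≤ κ → AB N m n (comp G J) C1 (C1 * (κ + H)) →
        AB N m n (comp (dX G) J) CX (CX * (κ + H)) →
        AB N m (n + 1) (comp G J) (C1 + K * D) ((C1 + K * D) * (κ + H)) := by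
      intro κ hκ hg hx
      have hκH : 0 ≤ κ + H := by positivity
      refine ⟨fun a ha ham x hxx => ?_, fun a ha => ?_⟩
      · rcases Nat.lt_or_ge a (n + 1) with h | h
        · exact (hg.sup a (by omega) ham x hxx).trans (by linarith)
        · obtain rfl : a = n + 1 := by omega
          exact hsup ham x hxx
      · rw [add_mul]
        rcases Nat.lt_or_ge a (n + 1) with h | h
        · exact (hg.int a (by omega)).trans (by nlinarith [mul_nonneg hKD hκH])
        · obtain rfl : a = n + 1 := by omega
          exact (hdX κ hκ hx).trans (by nlinarith [mul_nonneg hC1 hκH])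
    refine ⟨fin 1 zero_le_one g1 x1, fun h0 => ?_⟩
    have := fin 0 le_rfl (by simpa using g2 h0)
      (by simpa using x2 fun x hx => dX_zero (hG.smooth.differentiable (by simp)) h0 hx)
    simpa using this

end JacobiWave

namespace JacobiWave

open MeasureTheory intervalIntegral
open scoped ContDiff

/-- The jets entering the wave equation. -/
noncomputable def jets (y u : ℝ → ℝ) : Fin 5 → ℝ → ℝ :=
  ![y, iteratedDeriv 1 y, fun x => qf x * iteratedDeriv 2 y x, u, iteratedDeriv 1 u]

lemma iteratedDeriv_iteratedDeriv (a b : ℕ) (f : ℝ → ℝ) :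
    iteratedDeriv a (iteratedDeriv b f) = iteratedDeriv (a + b) f := by
  induction a with
  | zero => simp
  | succ a ih => rw [iteratedDeriv_succ, ih, ← iteratedDeriv_succ]; congr 1; omega

lemma contDiff_jets {y u : ℝ → ℝ} (hy : ContDiff ℝ ∞ y) (hu : ContDiff ℝ ∞ u) (c : Fin 5) :
    ContDiff ℝ ∞ (jets y u c) := by
  fin_cases c
  · exact hy
  · exact contDiff_iteratedDeriv hy 1
  · exact contDiff_qf.mul (contDiff_iteratedDeriv hy 2)
  · exact hu
  · exact contDiff_iteratedDeriv hu 1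

lemma iteratedDeriv_qf_mul {y : ℝ → ℝ} (hy : ContDiff ℝ ∞ y) (a : ℕ) :
    iteratedDeriv a (fun x => qf x * iteratedDeriv 2 y x) = fun x =>
      qf x * iteratedDeriv (a + 2) y x + a * (1 - 2 * x) * iteratedDeriv (a + 1) y x
        - a * (a - 1) * iteratedDeriv a y x := by
  induction a with
  | zero => ext x; simp
  | succ a ih =>
    ext x
    rw [iteratedDeriv_succ, ih]
    have h := hasDerivAt_iteratedDeriv hy
    have hl : HasDerivAt (fun x : ℝ => (a:ℝ) * (1 - 2 * x)) (a * (-2)) x := by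
      simpa using (((hasDerivAt_id' x).const_mul 2).const_sub 1).const_mul (a:ℝ)
    have := ((((hasDerivAt_qf x).fun_mul (h (a + 2) x)).fun_add (hl.fun_mul (h (a + 1) x))).fun_sub
      ((h a x).const_mul ((a:ℝ) * (a - 1))))
    rw [this.deriv]
    push_cast
    rw [show a + 1 + 2 = a + 2 + 1 by ring, show a + 1 + 1 = a + 2 by ring]
    ring

/-- The total energy of order `k`. -/
noncomputable def En (N : ℝ) (k : ℕ) (y u : ℝ → ℝ) : ℝ :=
  ∑ i ∈ Finset.range (k + 2), Hk N i y + ∑ i ∈ Finset.range (k + 1), Hk N i u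

lemma En_nonneg (N : ℝ) (k : ℕ) (y u : ℝ → ℝ) : 0 ≤ En N k y u :=
  add_nonneg (Finset.sum_nonneg fun _ _ => Hk_nonneg _ _ _)
    (Finset.sum_nonneg fun _ _ => Hk_nonneg _ _ _)

lemma En_mono (N : ℝ) {k k' : ℕ} (h : k ≤ k') (y u : ℝ → ℝ) : En N k y u ≤ En N k' y u :=
  add_le_add
    (Finset.sum_le_sum_of_subset_of_nonneg (Finset.range_mono (by omega))
      fun _ _ _ => Hk_nonneg _ _ _)
    (Finset.sum_le_sum_of_subset_of_nonneg (Finset.range_mono (by omega))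
      fun _ _ _ => Hk_nonneg _ _ _)

lemma Hk_le_En_left (N : ℝ) {k i : ℕ} (h : i ≤ k + 1) (y u : ℝ → ℝ) : Hk N i y ≤ En N k y u := by
  have h1 := Finset.single_le_sum (f := fun i => Hk N i y) (fun _ _ => Hk_nonneg _ _ _)
    (Finset.mem_range.2 (by omega : i < k + 2))
  have h2 : 0 ≤ ∑ i ∈ Finset.range (k + 1), Hk N i u := Finset.sum_nonneg fun _ _ => Hk_nonneg _ _ _
  unfold En; linarith

lemma Hk_le_En_right (N : ℝ) {k i : ℕ} (h : i ≤ k) (y u : ℝ → ℝ) : Hk N i u ≤ En N k y u := by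
  have h1 := Finset.single_le_sum (f := fun i => Hk N i u) (fun _ _ => Hk_nonneg _ _ _)
    (Finset.mem_range.2 (by omega : i < k + 1))
  have h2 : 0 ≤ ∑ i ∈ Finset.range (k + 2), Hk N i y := Finset.sum_nonneg fun _ _ => Hk_nonneg _ _ _
  unfold En; linarith

/-- Loss of derivatives in the Sobolev embedding. -/
noncomputable def sg (N : ℝ) : ℕ := gam N + 7

lemma sobolev_En {N : ℝ} (hN : 4 < N) (m : ℕ) : ∃ C : ℝ, 0 ≤ C ∧ ∀ y u : ℝ → ℝ, ContDiff ℝ ∞ y →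
    ContDiff ℝ ∞ u → ∀ a ≤ m + 2, ∀ x ∈ Icc (0:ℝ) 1,
      qf x ^ (a - 3) * iteratedDeriv a y x ^ 2 ≤ C * En N (m + sg N) y u ∧
      qf x ^ (a - 3) * iteratedDeriv a u x ^ 2 ≤ C * En N (m + sg N) y u := by
  choose C hC h using fun a => sobolev hN 3 a
  refine ⟨∑ a ∈ Finset.range (m + 3), C a, Finset.sum_nonneg fun a _ => hC a,
    fun y u hy hu a ha x hx => ?_⟩
  have hCa : C a ≤ ∑ a ∈ Finset.range (m + 3), C a :=
    Finset.single_le_sum (fun a _ => hC a) (Finset.mem_range.2 (by omega))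
  have hs1 : 0 ≤ ∑ i ∈ Finset.range (m + sg N + 2), Hk N i y := Finset.sum_nonneg fun _ _ => Hk_nonneg _ _ _
  have hs2 : 0 ≤ ∑ i ∈ Finset.range (m + sg N + 1), Hk N i u := Finset.sum_nonneg fun _ _ => Hk_nonneg _ _ _
  have m1 : ∀ {f : ℝ → ℝ} {l : ℕ}, a + (gam N + 3 + 3) ≤ l →
      ∑ i ∈ Finset.range (a + (gam N + 3 + 3)), Hk N i f ≤ ∑ i ∈ Finset.range l, Hk N i f :=
    fun hl => Finset.sum_le_sum_of_subset_of_nonneg (Finset.range_mono hl) fun _ _ _ => Hk_nonneg _ _ _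
  have hl : a + (gam N + 3 + 3) ≤ m + sg N + 1 := by unfold sg; omega
  constructor
  · refine (h a y hy x hx).trans (mul_le_mul hCa ((m1 (hl.trans (Nat.le_succ _))).trans ?_)
      (Finset.sum_nonneg fun _ _ => Hk_nonneg _ _ _) (Finset.sum_nonneg fun a _ => hC a))
    unfold En; linarith
  · refine (h a u hu x hx).trans (mul_le_mul hCa ((m1 hl).trans ?_)
      (Finset.sum_nonneg fun _ _ => Hk_nonneg _ _ _) (Finset.sum_nonneg fun a _ => hC a))
    unfold En; linarith

/-- Weighted control of the jets by the energies. -/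
lemma jets_AB {N : ℝ} (hN : 4 < N) (m n : ℕ) : ∃ C : ℝ, 1 ≤ C ∧ ∀ y u : ℝ → ℝ, ContDiff ℝ ∞ y →
    ContDiff ℝ ∞ u → ∀ c, AB N m n (jets y u c) (C * En N (m + sg N) y u) (C * En N (n + 1) y u) := by
  obtain ⟨C, hC, h⟩ := sobolev_En hN m
  set P : ℝ := 9 * (1 + (m + n) ^ 2 + (m + n) ^ 4) with hP
  have hP1 : 9 ≤ P := by
    have : (0:ℝ) ≤ (m + n) ^ 2 + (m + n) ^ 4 := by positivity
    rw [hP]; linarith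
  refine ⟨P * (C + 1), by nlinarith, fun y u hy hu c => ?_⟩
  set E := En N (m + sg N) y u
  set E' := En N (n + 1) y u
  have hE : 0 ≤ E := En_nonneg _ _ _ _
  have hE' : 0 ≤ E' := En_nonneg _ _ _ _
  have b1 : C * E ≤ P * (C + 1) * E := by
    have : 0 ≤ C * E := by positivity
    nlinarith
  have b2 : E' ≤ P * (C + 1) * E' := by nlinarith [mul_nonneg (by linarith : 0 ≤ P) hC]
  have hpol : ∀ a ≤ m + n, (a:ℝ) ^ 2 ≤ P / 9 ∧ ((a:ℝ) * (a - 1)) ^ 2 ≤ P / 9 := by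
    intro a ha
    have ha' : (a:ℝ) ≤ m + n := by exact_mod_cast ha
    have h0 : (0:ℝ) ≤ a := Nat.cast_nonneg a
    have h2 : (a:ℝ) ^ 2 ≤ (m + n) ^ 2 := by gcongr
    have h4 : (a:ℝ) ^ 4 ≤ (m + n) ^ 4 := by gcongr
    have h5 : ((a:ℝ) * (a - 1)) ^ 2 ≤ (a:ℝ) ^ 4 := by
      rcases Nat.eq_zero_or_pos a with rfl | hpos
      · simp
      have h1 : (1:ℝ) ≤ a := by exact_mod_cast hpos
      have : ((a:ℝ) - 1) ^ 2 ≤ (a:ℝ) ^ 2 := by gcongr; linarith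
      calc ((a:ℝ) * (a - 1)) ^ 2 = (a:ℝ) ^ 2 * (a - 1) ^ 2 := by ring
        _ ≤ (a:ℝ) ^ 2 * (a:ℝ) ^ 2 := by gcongr
        _ = _ := by ring
    have p2 : (0:ℝ) ≤ (m + n) ^ 2 := by positivity
    have p4 : (0:ℝ) ≤ (m + n) ^ 4 := by positivity
    constructor <;> rw [hP] <;> linarith
  have r1 : ∀ x ∈ Icc (0:ℝ) 1, (1 - 2 * x) ^ 2 ≤ 1 := fun x hx => by nlinarith [hx.1, hx.2]
  have cy := fun a => continuous_iteratedDeriv hy a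
  have cu := fun a => continuous_iteratedDeriv hu a
  have wk : ∀ {x : ℝ} {p p' : ℕ} {z : ℝ}, x ∈ Icc (0:ℝ) 1 → p' ≤ p → qf x ^ p * z ^ 2 ≤ qf x ^ p' * z ^ 2 :=
    fun hx h => mul_le_mul_of_nonneg_right (qf_pow_anti hx h) (sq_nonneg _)
  have zexp : ∀ a ≤ m + n, ∀ x ∈ Icc (0:ℝ) 1, ∀ p : ℕ,
      qf x ^ p * (qf x * iteratedDeriv (a + 2) y x + a * (1 - 2 * x) * iteratedDeriv (a + 1) y x
        - a * (a - 1) * iteratedDeriv a y x) ^ 2 ≤ P / 3 * (qf x ^ (p + 2) * iteratedDeriv (a + 2) y x ^ 2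
          + qf x ^ p * iteratedDeriv (a + 1) y x ^ 2 + qf x ^ p * iteratedDeriv a y x ^ 2) := by
    intro a ha x hx p
    have hq := qf_nonneg hx
    obtain ⟨p1, p2⟩ := hpol a ha
    have h3 : ∀ A B C : ℝ, (A + B - C) ^ 2 ≤ 3 * (A ^ 2 + B ^ 2 + C ^ 2) := fun A B C => by
      nlinarith [sq_nonneg (A - B), sq_nonneg (A + C), sq_nonneg (B + C)]
    have e1 : (a * (1 - 2 * x) * iteratedDeriv (a + 1) y x) ^ 2 ≤ P / 9 * iteratedDeriv (a + 1) y x ^ 2 := by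
      rw [mul_pow, mul_pow]
      refine mul_le_mul_of_nonneg_right ?_ (sq_nonneg _)
      calc (a:ℝ) ^ 2 * (1 - 2 * x) ^ 2 ≤ (a:ℝ) ^ 2 * 1 := by gcongr; exact r1 x hx
        _ ≤ P / 9 := by linarith
    have e2 : (a * (a - 1) * iteratedDeriv a y x) ^ 2 ≤ P / 9 * iteratedDeriv a y x ^ 2 := by
      rw [mul_pow]; exact mul_le_mul_of_nonneg_right p2 (sq_nonneg _)
    have e3 : (qf x * iteratedDeriv (a + 2) y x) ^ 2 ≤ P / 9 * (qf x ^ 2 * iteratedDeriv (a + 2) y x ^ 2) := by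
      rw [mul_pow]
      have : 0 ≤ qf x ^ 2 * iteratedDeriv (a + 2) y x ^ 2 := by positivity
      nlinarith
    calc _ ≤ qf x ^ p * (3 * (P / 9 * (qf x ^ 2 * iteratedDeriv (a + 2) y x ^ 2)
          + P / 9 * iteratedDeriv (a + 1) y x ^ 2 + P / 9 * iteratedDeriv a y x ^ 2)) := by
          refine mul_le_mul_of_nonneg_left ((h3 _ _ _).trans ?_) (pow_nonneg hq p)
          linarith
      _ = _ := by ring
  constructor
  · intro a ha ham x hx
    have hs := h y u hy hu
    fin_cases c
    · exact ((wk hx (by omega : a - 3 ≤ a - 1)).trans (hs a (by omega) x hx).1).trans b1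
    · show qf x ^ (a - 1) * iteratedDeriv a (iteratedDeriv 1 y) x ^ 2 ≤ _
      rw [iteratedDeriv_iteratedDeriv]
      exact ((wk hx (by omega : a + 1 - 3 ≤ a - 1)).trans (hs (a + 1) (by omega) x hx).1).trans b1
    · show qf x ^ (a - 1) * iteratedDeriv a (fun x => qf x * iteratedDeriv 2 y x) x ^ 2 ≤ _
      rw [iteratedDeriv_qf_mul hy]
      refine (zexp a (by omega) x hx (a - 1)).trans ?_
      have h1 := (wk hx (by omega : a + 2 - 3 ≤ a - 1 + 2)).trans (hs (a + 2) (by omega) x hx).1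
      have h2 := (wk hx (by omega : a + 1 - 3 ≤ a - 1)).trans (hs (a + 1) (by omega) x hx).1
      have h3 := (wk hx (by omega : a - 3 ≤ a - 1)).trans (hs a (by omega) x hx).1
      calc _ ≤ P / 3 * (C * E + C * E + C * E) := by gcongr
        _ = P * (C * E) := by ring
        _ ≤ _ := by nlinarith [mul_nonneg (by linarith : 0 ≤ P) hE]
    · exact ((wk hx (by omega : a - 3 ≤ a - 1)).trans (hs a (by omega) x hx).2).trans b1
    · show qf x ^ (a - 1) * iteratedDeriv a (iteratedDeriv 1 u) x ^ 2 ≤ _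
      rw [iteratedDeriv_iteratedDeriv]
      exact ((wk hx (by omega : a + 1 - 3 ≤ a - 1)).trans (hs (a + 1) (by omega) x hx).2).trans b1
  · intro a ha
    have y0 : ∀ i ≤ n + 2, ∀ p, i ≤ p → L2 N p (iteratedDeriv i y) ≤ E' := fun i hi p hp =>
      (L2_anti hN hp (cy i)).trans (Hk_le_En_left N (by omega) y u)
    have u0 : ∀ i ≤ n + 1, ∀ p, i ≤ p → L2 N p (iteratedDeriv i u) ≤ E' := fun i hi p hp =>
      (L2_anti hN hp (cu i)).trans (Hk_le_En_right N (by omega) y u)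
    fin_cases c
    · exact (y0 a (by omega) _ (by omega)).trans b2
    · show L2 N (a + 1) (iteratedDeriv a (iteratedDeriv 1 y)) ≤ _
      rw [iteratedDeriv_iteratedDeriv]
      exact (y0 (a + 1) (by omega) _ le_rfl).trans b2
    · show L2 N (a + 1) (iteratedDeriv a (fun x => qf x * iteratedDeriv 2 y x)) ≤ _
      rw [iteratedDeriv_qf_mul hy]
      have ct := continuous_wt hN
      have k1 := cy (a + 2)
      have k2 := cy (a + 1)
      have k3 := cy a
      have : L2 N (a + 1) (fun x => qf x * iteratedDeriv (a + 2) y x + a * (1 - 2 * x) * iteratedDeriv (a + 1) y x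
        - a * (a - 1) * iteratedDeriv a y x) ≤ P / 3 * (L2 N (a + 3) (iteratedDeriv (a + 2) y) +
          L2 N (a + 1) (iteratedDeriv (a + 1) y) + L2 N (a + 1) (iteratedDeriv a y)) := by
        unfold L2
        rw [← integral_add ((by fun_prop : Continuous _).intervalIntegrable _ _)
          ((by fun_prop : Continuous _).intervalIntegrable _ _),
          ← integral_add ((by fun_prop : Continuous _).intervalIntegrable _ _)
          ((by fun_prop : Continuous _).intervalIntegrable _ _), ← intervalIntegral.integral_const_mul]
        refine integral_mono_cont (by fun_prop) (by fun_prop) fun x hx => ?_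
        have := mul_le_mul_of_nonneg_left (zexp a (by omega) x hx (a + 1)) (wt_nonneg N hx)
        calc _ = _ := mul_assoc _ _ _
          _ ≤ _ := this
          _ = _ := by ring
      refine this.trans ?_
      have h1 := y0 (a + 2) (by omega) (a + 3) (by omega)
      have h2 := y0 (a + 1) (by omega) (a + 1) (by omega)
      have h3 := y0 a (by omega) (a + 1) (by omega)
      calc _ ≤ P / 3 * (E' + E' + E') := by gcongr
        _ = P * E' := by ring
        _ ≤ _ := by nlinarith [mul_nonneg (mul_nonneg (by linarith : 0 ≤ P) hC) hE']
    · exact (u0 a (by omega) _ (by omega)).trans b2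
    · show L2 N (a + 1) (iteratedDeriv a (iteratedDeriv 1 u)) ≤ _
      rw [iteratedDeriv_iteratedDeriv]
      exact (u0 (a + 1) (by omega) _ le_rfl).trans b2

end JacobiWave

namespace JacobiWave

open MeasureTheory intervalIntegral
open scoped ContDiff

variable {d : ℕ}

/-- The commutator of a derivative with substitution, in the weighted spaces. -/
lemma comp_commutator {N : ℝ} (hN : 4 < N) (m : ℕ) {M : ℝ} (hM : 0 ≤ M) (n : ℕ) (hn : n ≤ 2 * m)
    {G : ℝ × (Fin d → ℝ) → ℝ} (hG : Sm G) (h0 : ∀ x ∈ Icc (0:ℝ) 1, G (x, 0) = 0) :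
    ∃ C : ℝ, 0 ≤ C ∧ ∀ (J : Fin d → ℝ → ℝ) (S H : ℝ),
      (∀ c, ContDiff ℝ ∞ (J c)) → 0 ≤ S → S ≤ M → S ≤ H → (∀ c, AB N m n (J c) S H) →
      ∀ i ≤ n, L2 N (i + 1) (fun x => iteratedDeriv (i + 1) (comp G J) x -
        ∑ c, comp (dJ G c) J x * iteratedDeriv (i + 1) (J c) x) ≤ C * H := by
  obtain ⟨C1, hC1, k1⟩ := comp_AB (d := d) hN m hM n (by omega) (dX G) hG.dX
  choose C2 hC2 k2 using fun c => comp_AB (d := d) hN m hM n (by omega) (dJ G c) (hG.dJ c)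
  set B := C1 + ∑ c, C2 c * (2 + M) with hB
  have hC2s : ∀ c, C2 c * (2 + M) ≤ ∑ c, C2 c * (2 + M) := fun c =>
    Finset.single_le_sum (f := fun c => C2 c * (2 + M)) (fun c _ => mul_nonneg (hC2 c) (by linarith))
      (Finset.mem_univ c)
  have hC2n : 0 ≤ ∑ c, C2 c * (2 + M) := Finset.sum_nonneg fun c _ => mul_nonneg (hC2 c) (by linarith)
  refine ⟨4 * ((1 + d ^ 2 * ((n + 1) ^ 2 * (2 ^ n) ^ 2)) * B), by positivity,
    fun J S H hJ hS hSM hSH hAB i hi => ?_⟩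
  have hH : 0 ≤ H := hS.trans hSH
  have e : (fun x => iteratedDeriv (i + 1) (comp G J) x -
        ∑ c, comp (dJ G c) J x * iteratedDeriv (i + 1) (J c) x) = fun x =>
      iteratedDeriv i (comp (dX G) J) x + ∑ c, ∑ l ∈ Finset.Ico 1 (i + 1), (i.choose l : ℝ) *
        (iteratedDeriv l (comp (dJ G c) J) x * iteratedDeriv (i - l + 1) (J c) x) := by
    ext x
    rw [iteratedDeriv_comp_succ hG.smooth hJ, add_sub_assoc, ← Finset.sum_sub_distrib]
    congr 1
    refine Finset.sum_congr rfl fun c _ => ?_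
    rw [Finset.range_eq_Ico, Finset.sum_eq_sum_Ico_succ_bot (by omega)]
    simp
  rw [e]
  have s1 := contDiff_comp hG.dX.smooth hJ
  have s2 := fun c => contDiff_comp (hG.dJ c).smooth hJ
  refine ((isQuad_L2 hN (i + 1)).star_le i (Finset.Ico 1 (i + 1)) (B := B * H) ?_
    (continuous_iteratedDeriv s1 i) (fun c l _ => (continuous_iteratedDeriv (s2 c) l).mul
      (continuous_iteratedDeriv (hJ c) _)) ?_ ?_).trans ?_
  · intro l hl; rw [Finset.mem_Ico] at hl; exact Finset.mem_range.2 hl.2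
  · refine ((((k1 J S H hJ hS hSM hSH hAB).2 fun x hx =>
      dX_zero (hG.smooth.differentiable (by simp)) h0 hx).int i hi)).trans ?_
    rw [hB]; nlinarith [mul_nonneg hC2n hH]
  · intro c l hl
    rw [Finset.mem_Ico] at hl
    refine ((k2 c J S H hJ hS hSM hSH hAB).1.pair_int hN (s2 c) (hJ c) (hAB c) (by omega) (by omega)
      (by omega) (by omega) (by omega)).trans ?_
    have : C2 c * H + S * (C2 c * (1 + H)) ≤ C2 c * (2 + M) * H := by
      have : S * (1 + H) ≤ H + M * H := by nlinarith
      nlinarith [mul_le_mul_of_nonneg_left this (hC2 c)]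
    refine this.trans (mul_le_mul_of_nonneg_right ?_ hH)
    rw [hB]; linarith [hC2s c]
  · have hin : (i:ℝ) ≤ n := by exact_mod_cast hi
    have hBn : 0 ≤ B := by positivity
    calc 4 * ((1 + (d:ℝ) ^ 2 * ((i + 1) ^ 2 * (2 ^ i) ^ 2)) * (B * H))
        ≤ 4 * ((1 + (d:ℝ) ^ 2 * ((n + 1) ^ 2 * (2 ^ n) ^ 2)) * (B * H)) := by gcongr; norm_num
      _ = _ := by ring

/-- Structure of the right-hand side of the scalar wave equation `∂ₜ²y = F(x, jets)`. -/
structure Adm (N ρ : ℝ) (F : ℝ × (Fin 5 → ℝ) → ℝ) : Prop where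
  sm : Sm F
  zero : ∀ x ∈ Icc (0:ℝ) 1, F (x, 0) = 0
  lo : ∀ x ∈ Icc (0:ℝ) 1, ∀ z : Fin 5 → ℝ, (∀ c, |z c| ≤ ρ) → 1 / 2 ≤ dJ F 2 (x, z)
  hi : ∀ x ∈ Icc (0:ℝ) 1, ∀ z : Fin 5 → ℝ, (∀ c, |z c| ≤ ρ) → dJ F 2 (x, z) ≤ 2
  drift : ∃ B : ℝ, 0 ≤ B ∧ ∀ x ∈ Icc (0:ℝ) 1, ∀ z : Fin 5 → ℝ, (∀ c, |z c| ≤ ρ) →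
    |dJ F 1 (x, z) - dJ F 2 (x, z) * bf N x| ≤ B * (qf x + |z 2|) ∧ |dJ F 4 (x, z)| ≤ B * qf x

/-- The Galerkin relation satisfied by the acceleration `g` at order `k`. -/
structure Gal (N : ℝ) (k : ℕ) (F : ℝ × (Fin 5 → ℝ) → ℝ) (y u g : ℝ → ℝ) : Prop where
  pair : ∀ i ≤ k, ∫ x in (0:ℝ)..1, wt N x * qf x ^ i * (iteratedDeriv i u x * iteratedDeriv i g x) =
    ∫ x in (0:ℝ)..1, wt N x * qf x ^ i * (iteratedDeriv i u x * iteratedDeriv i (comp F (jets y u)) x)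
  le : ∀ i ≤ k, Hk N i g ≤ Hk N i (comp F (jets y u))

/-- Time derivative of the leading coefficient. -/
noncomputable def At (F : ℝ × (Fin 5 → ℝ) → ℝ) (y u g : ℝ → ℝ) (x : ℝ) : ℝ :=
  ∑ c, comp (dJ (dJ F 2) c) (jets y u) x * jets u g c x

/-- Pointwise control of the coefficients of the linearised equation by a low order energy. -/
lemma coeff_bounds {N : ℝ} (hN : 4 < N) {ρ : ℝ} {F : ℝ × (Fin 5 → ℝ) → ℝ} (hF : Adm N ρ F) {m : ℕ}
    (hm : gam N + 4 ≤ m) {M : ℝ} (hM : 0 ≤ M) : ∃ B : ℝ, 0 ≤ B ∧ ∀ y u g : ℝ → ℝ, ContDiff ℝ ∞ y →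
    ContDiff ℝ ∞ u → ContDiff ℝ ∞ g → En N (m + sg N) y u ≤ M → Gal N m F y u g →
    (∀ c, ∀ x ∈ Icc (0:ℝ) 1, |jets y u c x| ≤ ρ) → ∀ x ∈ Icc (0:ℝ) 1,
      (∀ c, |comp (dJ F c) (jets y u) x| ≤ B) ∧ (∀ c, |iteratedDeriv 1 (comp (dJ F c) (jets y u)) x| ≤ B) ∧
      |At F y u g x| ≤ B ∧
      |comp (dJ F 1) (jets y u) x - comp (dJ F 2) (jets y u) x * bf N x| ≤ B * qf x ∧
      |comp (dJ F 4) (jets y u) x| ≤ B * qf x := by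
  obtain ⟨C1, hC1, k1⟩ := jets_AB hN m m
  obtain ⟨Cs, hCs, ks⟩ := sobolev_En hN m
  choose C2 hC2 k2 using fun c => comp_AB (d := 5) hN m (by positivity : 0 ≤ C1 * M) m (by omega)
    (dJ F c) (hF.sm.dJ c)
  obtain ⟨C3, hC3, k3⟩ := comp_AB (d := 5) hN m (by positivity : 0 ≤ C1 * M) m (by omega) F hF.sm
  choose b hb kb using fun c => (hF.sm.dJ c).bdd
  choose b' hb' kb' using fun c => ((hF.sm.dJ 2).dJ c).bdd
  obtain ⟨D, hD, kD⟩ := hF.drift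
  obtain ⟨P0, hP0, p0⟩ := sobolev hN 1 0
  obtain ⟨P1, hP1, p1⟩ := sobolev hN 1 1
  set X := √(Cs * M) + √((P0 + P1) * ((m + 1) * C3)) with hX
  set B := ∑ c, b c + ∑ c, √(C2 c) + (∑ c, b' c) * X + D * (1 + X) with hBdef
  have hXn : 0 ≤ X := by positivity
  have n1 : 0 ≤ ∑ c, b c := Finset.sum_nonneg fun c _ => hb c
  have n2 : 0 ≤ ∑ c, √(C2 c) := Finset.sum_nonneg fun c _ => sqrt_nonneg _
  have n3 : 0 ≤ ∑ c, b' c := Finset.sum_nonneg fun c _ => hb' c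
  have n4 : 0 ≤ (∑ c, b' c) * X := mul_nonneg n3 hXn
  have n5 : 0 ≤ D * (1 + X) := by positivity
  refine ⟨B, by positivity, fun y u g hy hu hg hE hG hρ x hx => ?_⟩
  have hEn := En_nonneg N (m + sg N) y u
  have hE0 : C1 * En N (m + sg N) y u ≤ C1 * M := by gcongr
  have hJ := contDiff_jets hy hu
  set H := C1 * (En N (m + sg N) y u + En N (m + 1) y u)
  have hAB : ∀ c, AB N m m (jets y u c) (C1 * En N (m + sg N) y u) H := fun c =>
    (k1 y u hy hu c).mono le_rfl le_rfl le_rfl (by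
      have := En_nonneg N (m + sg N) y u
      exact mul_le_mul_of_nonneg_left (by linarith) (by linarith))
  have hSH : C1 * En N (m + sg N) y u ≤ H := by
    have := En_nonneg N (m + 1) y u
    exact mul_le_mul_of_nonneg_left (by linarith) (by linarith)
  have hS0 : 0 ≤ C1 * En N (m + sg N) y u := by positivity
  have a2 := fun c => (k2 c _ _ _ hJ hS0 hE0 hSH hAB).1
  have a3 := (k3 _ _ _ hJ hS0 hE0 hSH hAB).1
  have hq := qf_nonneg hx
  have hq1 := qf_le_one hx
  -- bounds for `g`
  have hgH : ∀ i ≤ m, Hk N i g ≤ C3 := fun i hi => (hG.le i hi).trans <|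
    L2_le_of_bdd hN i (continuous_iteratedDeriv (contDiff_comp hF.sm.smooth hJ) i) fun x hx =>
      (mul_le_mul_of_nonneg_right (qf_pow_anti hx (Nat.sub_le i 1)) (sq_nonneg _)).trans
        (a3.sup i hi hi x hx)
  have hgs : ∀ l ≤ m + 1, ∑ i ∈ Finset.range l, Hk N i g ≤ (m + 1) * C3 := by
    intro l hl
    refine (Finset.sum_le_card_nsmul _ _ C3 fun i hi => hgH i (by
      rw [Finset.mem_range] at hi; omega)).trans ?_
    rw [Finset.card_range, nsmul_eq_mul]
    have : (l:ℝ) ≤ m + 1 := by exact_mod_cast hl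
    gcongr
  have sq : ∀ {z K : ℝ}, z ^ 2 ≤ K → |z| ≤ √K := fun h => abs_le_sqrt h
  have hm3 : (0:ℝ) ≤ (m + 1) * C3 := by positivity
  have g0 : |g x| ≤ X := by
    have h := p0 g hg x hx
    simp only [zero_tsub, pow_zero, one_mul, iteratedDeriv_zero] at h
    have h' : g x ^ 2 ≤ (P0 + P1) * ((m + 1) * C3) := h.trans
      (mul_le_mul (by linarith) (hgs _ (by omega)) (Finset.sum_nonneg fun _ _ => Hk_nonneg _ _ _) (by positivity))
    have := sq h'
    have := sqrt_nonneg (Cs * M)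
    linarith
  have g1 : |iteratedDeriv 1 g x| ≤ X := by
    have h := p1 g hg x hx
    simp only [le_refl, tsub_eq_zero_of_le, pow_zero, one_mul] at h
    have h' := h.trans
      (mul_le_mul (by linarith : P1 ≤ P0 + P1) (hgs _ (by omega)) (Finset.sum_nonneg fun _ _ => Hk_nonneg _ _ _) (by positivity))
    have := sq h'
    have := sqrt_nonneg (Cs * M)
    linarith
  have hyu : ∀ a ≤ 2, |iteratedDeriv a y x| ≤ X ∧ |iteratedDeriv a u x| ≤ X := by
    intro a ha
    have h := ks y u hy hu a (by omega) x hx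
    rw [show a - 3 = 0 by omega, pow_zero, one_mul, one_mul] at h
    have hc : Cs * En N (m + sg N) y u ≤ Cs * M := by gcongr
    have h1 := sq (h.1.trans hc)
    have h2 := sq (h.2.trans hc)
    have := sqrt_nonneg ((P0 + P1) * ((m + 1) * C3))
    constructor <;> linarith
  have hJt : ∀ c, |jets u g c x| ≤ X := by
    intro c
    fin_cases c
    · exact (hyu 0 (by omega)).2
    · exact (hyu 1 (by omega)).2
    · show |qf x * iteratedDeriv 2 u x| ≤ X
      rw [abs_mul, abs_of_nonneg hq]
      exact (mul_le_of_le_one_left (abs_nonneg _) hq1).trans (hyu 2 le_rfl).2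
    · exact g0
    · exact g1
  have hz : ∀ c, |(fun c => jets y u c x) c| ≤ ρ := fun c => hρ c x hx
  refine ⟨fun c => (kb c _).trans ?_, fun c => ?_, ?_, ?_, ?_⟩
  · have := Finset.single_le_sum (f := b) (fun c _ => hb c) (Finset.mem_univ c)
    linarith
  · have h := (a2 c).sup 1 (by omega) (by omega) x hx
    simp only [le_refl, tsub_eq_zero_of_le, pow_zero, one_mul] at h
    have h2 := sq h
    have := Finset.single_le_sum (f := fun c => √(C2 c)) (fun c _ => sqrt_nonneg _) (Finset.mem_univ c)
    linarith
  · have : |At F y u g x| ≤ (∑ c, b' c) * X := by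
      rw [At, Finset.sum_mul]
      refine (Finset.abs_sum_le_sum_abs _ _).trans (Finset.sum_le_sum fun c _ => ?_)
      rw [abs_mul]
      exact mul_le_mul (kb' c _) (hJt c) (abs_nonneg _) (hb' c)
    linarith
  · refine (kD x hx _ hz).1.trans ?_
    have e : |jets y u 2 x| ≤ qf x * X := by
      show |qf x * iteratedDeriv 2 y x| ≤ _
      rw [abs_mul, abs_of_nonneg hq]
      exact mul_le_mul_of_nonneg_left (hyu 2 le_rfl).1 hq
    calc D * (qf x + |jets y u 2 x|) ≤ D * (qf x + qf x * X) := by gcongr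
      _ = D * (1 + X) * qf x := by ring
      _ ≤ B * qf x := by
        refine mul_le_mul_of_nonneg_right ?_ hq
        linarith
  · refine (kD x hx _ hz).2.trans (mul_le_mul_of_nonneg_right ?_ hq)
    nlinarith

end JacobiWave

namespace JacobiWave

open MeasureTheory intervalIntegral
open scoped ContDiff

lemma Gal.mono {N : ℝ} {k k' : ℕ} {F : ℝ × (Fin 5 → ℝ) → ℝ} {y u g : ℝ → ℝ} (h : Gal N k F y u g)
    (hk : k' ≤ k) : Gal N k' F y u g :=
  ⟨fun i hi => h.pair i (hi.trans hk), fun i hi => h.le i (hi.trans hk)⟩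

/-- Formal time derivative of the energy of order `i`. -/
noncomputable def Dt (N : ℝ) (F : ℝ × (Fin 5 → ℝ) → ℝ) (i : ℕ) (y u g : ℝ → ℝ) : ℝ :=
  ∫ x in (0:ℝ)..1, (wt N x * qf x ^ i * (2 * (iteratedDeriv i u x * iteratedDeriv i g x)
      + 2 * (iteratedDeriv i y x * iteratedDeriv i u x))
    + wt N x * qf x ^ (i + 1) * (At F y u g x * iteratedDeriv (i + 1) y x ^ 2
      + 2 * (comp (dJ F 2) (jets y u) x * (iteratedDeriv (i + 1) y x * iteratedDeriv (i + 1) u x))))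

lemma abs_two_mul_le {a b c B : ℝ} (h : |c| ≤ B) : |2 * (c * (a * b))| ≤ B * (a ^ 2 + b ^ 2) := by
  rw [abs_mul, abs_mul, abs_two, abs_mul]
  have h1 : 2 * (|a| * |b|) ≤ a ^ 2 + b ^ 2 := by
    rw [← sq_abs a, ← sq_abs b]; nlinarith [sq_nonneg (|a| - |b|)]
  have h0 : 0 ≤ B := (abs_nonneg c).trans h
  calc 2 * (|c| * (|a| * |b|)) = |c| * (2 * (|a| * |b|)) := by ring
    _ ≤ B * (a ^ 2 + b ^ 2) := mul_le_mul h h1 (by positivity) h0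

lemma energy_pointwise {B ι q R F0 D1 A F3 At A' F4' y0 Y W : ℝ} (hq : 0 ≤ q) (hq1 : q ≤ 1)
    (hι : 0 ≤ ι) (h0 : |F0| ≤ B) (h1 : |D1| ≤ B * q) (h2 : |A| ≤ B) (h3 : |F3| ≤ B) (h4 : |At| ≤ B)
    (h5 : |A'| ≤ B) (h6 : |F4'| ≤ B) :
    |2 * (W * (R + F0 * y0 + D1 * Y - A * ι * y0 + F3 * W)) + 2 * (y0 * W) + q * At * Y ^ 2
      - 2 * (q * A' * (Y * W)) - F4' * W ^ 2| ≤ (2 + (10 + ι) * B) * (R ^ 2 + W ^ 2 + y0 ^ 2 + q * Y ^ 2) := by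
  have hB : 0 ≤ B := (abs_nonneg _).trans h0
  have one : |(1:ℝ)| ≤ 1 := by simp
  have e1 := abs_two_mul_le (a := W) (b := R) one
  have e2 := abs_two_mul_le (a := W) (b := y0) h0
  have e3 := abs_two_mul_le (a := W) (b := Y) h1
  have h2' : |A * ι| ≤ B * ι := by rw [abs_mul, abs_of_nonneg hι]; gcongr
  have e4 := abs_two_mul_le (a := W) (b := y0) h2'
  have e5 := abs_two_mul_le (a := W) (b := W) h3
  have e6 := abs_two_mul_le (a := y0) (b := W) one
  have h5' : |q * A'| ≤ B * q := by rw [abs_mul, abs_of_nonneg hq, mul_comm]; gcongr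
  have e7 := abs_two_mul_le (a := Y) (b := W) h5'
  have e8 : |q * At * Y ^ 2| ≤ B * (q * Y ^ 2) := by
    rw [abs_mul, abs_mul, abs_of_nonneg hq, abs_of_nonneg (sq_nonneg Y)]
    calc q * |At| * Y ^ 2 = |At| * (q * Y ^ 2) := by ring
      _ ≤ _ := by gcongr
  have e9 : |F4' * W ^ 2| ≤ B * W ^ 2 := by
    rw [abs_mul, abs_of_nonneg (sq_nonneg W)]; gcongr
  rw [abs_le] at *
  have p1 : 0 ≤ q * Y ^ 2 := by positivity
  have p2 : B * q * W ^ 2 ≤ B * W ^ 2 := by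
    have : q * W ^ 2 ≤ 1 * W ^ 2 := by gcongr
    nlinarith
  have p3 := mul_nonneg hB (sq_nonneg R)
  have p4 := mul_nonneg hB (sq_nonneg W)
  have p5 := mul_nonneg hB (sq_nonneg y0)
  have p6 := mul_nonneg hB p1
  have p7 := mul_nonneg (mul_nonneg hB hι) (sq_nonneg R)
  have p8 := mul_nonneg (mul_nonneg hB hι) (sq_nonneg W)
  have p9 := mul_nonneg (mul_nonneg hB hι) (sq_nonneg y0)
  have p10 := mul_nonneg (mul_nonneg hB hι) p1
  have s1 := sq_nonneg R
  have s2 := sq_nonneg W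
  have s3 := sq_nonneg y0
  constructor <;> linarith [e1.1, e1.2, e2.1, e2.2, e3.1, e3.2, e4.1, e4.2, e5.1, e5.2, e6.1, e6.2, e7.1, e7.2, e8.1, e8.2, e9.1, e9.2]

/-- Remainder after extracting the top order part of the equation. -/
lemma remainder_bound {N : ℝ} (hN : 4 < N) {ρ : ℝ} {F : ℝ × (Fin 5 → ℝ) → ℝ} (hF : Adm N ρ F)
    {m k : ℕ} (hk : k ≤ 2 * m + 1) (hmk : m + sg N ≤ k) {M : ℝ} (hM : 0 ≤ M) :
    ∃ C : ℝ, 0 ≤ C ∧ ∀ y u : ℝ → ℝ, ContDiff ℝ ∞ y → ContDiff ℝ ∞ u → En N (m + sg N) y u ≤ M →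
      ∀ i ≤ k, L2 N i (fun x => iteratedDeriv i (comp F (jets y u)) x -
        ∑ c, comp (dJ F c) (jets y u) x * iteratedDeriv i (jets y u c) x) ≤ C * En N k y u := by
  have hk1 : 1 ≤ k := by unfold sg at hmk; omega
  obtain ⟨C1, hC1, k1⟩ := jets_AB hN m (k - 1)
  rw [Nat.sub_add_cancel hk1] at k1
  obtain ⟨C2, hC2, k2⟩ := comp_commutator hN m (by positivity : 0 ≤ C1 * M) (k - 1) (by omega)
    hF.sm hF.zero
  obtain ⟨L, hL, kL⟩ := hF.sm.lip
  choose b hb kb using fun c => (hF.sm.dJ c).bdd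
  set D := 5 * (2 * L ^ 2 + 10 * ∑ c, b c ^ 2) with hD
  have nb : 0 ≤ ∑ c, b c ^ 2 := Finset.sum_nonneg fun c _ => sq_nonneg _
  refine ⟨(C2 + D) * C1, by positivity, fun y u hy hu hE i hi => ?_⟩
  have hJ := contDiff_jets hy hu
  have hEE := En_mono N hmk y u
  have hEn := En_nonneg N (m + sg N) y u
  have hEk := En_nonneg N k y u
  have hSM : C1 * En N (m + sg N) y u ≤ C1 * M := by gcongr
  have hSH : C1 * En N (m + sg N) y u ≤ C1 * En N k y u := by gcongr
  have hH : 0 ≤ C1 * En N k y u := by positivity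
  rcases i with _ | i
  · have hfc : Continuous (fun x => iteratedDeriv 0 (comp F (jets y u)) x -
        ∑ c, comp (dJ F c) (jets y u) x * iteratedDeriv 0 (jets y u c) x) := by
      refine (continuous_iteratedDeriv (contDiff_comp hF.sm.smooth hJ) 0).sub
        (continuous_finsetSum _ fun c _ => ?_)
      exact (contDiff_comp (hF.sm.dJ c).smooth hJ).continuous.mul (continuous_iteratedDeriv (hJ c) 0)
    refine (L2_le_of_bdd hN 0 hfc (B := D * (C1 * En N k y u)) fun x hx => ?_).trans ?_
    · simp only [pow_zero, one_mul, iteratedDeriv_zero]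
      have hs : ∀ c, jets y u c x ^ 2 ≤ C1 * En N k y u := fun c => by
        have := (k1 y u hy hu c).sup 0 (by omega) (by omega) x hx
        simp only [zero_tsub, pow_zero, one_mul, iteratedDeriv_zero] at this
        exact this.trans hSH
      have s1 := comp_sq_le kL (J := jets y u) (hF.zero x hx)
      have s2 : ∑ c, jets y u c x ^ 2 ≤ 5 * (C1 * En N k y u) := by
        refine (Finset.sum_le_card_nsmul _ _ _ fun c _ => hs c).trans ?_
        simp
      have s3 : (∑ c, comp (dJ F c) (jets y u) x * jets y u c x) ^ 2 ≤
          (∑ c, b c ^ 2) * (5 * (C1 * En N k y u)) := by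
        refine (Finset.sum_mul_sq_le_sq_mul_sq _ _ _).trans (mul_le_mul ?_ s2
          (Finset.sum_nonneg fun c _ => sq_nonneg _) nb)
        refine Finset.sum_le_sum fun c _ => ?_
        have := kb c (x, fun c => jets y u c x)
        exact sq_le_sq' (abs_le.1 this).1 (abs_le.1 this).2
      have s4 := mul_le_mul_of_nonneg_left s2 (sq_nonneg L)
      have : ∀ a b : ℝ, (a - b) ^ 2 ≤ 2 * a ^ 2 + 2 * b ^ 2 := fun a b => by nlinarith [sq_nonneg (a + b)]
      refine (this _ _).trans ?_
      rw [hD]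
      have h8 : 0 ≤ (∑ c, b c ^ 2) * (C1 * En N k y u) := by positivity
      nlinarith
    · nlinarith [mul_nonneg hC2 hH]
  · refine (k2 (jets y u) _ _ hJ (by positivity) hSM hSH (k1 y u hy hu) i (by omega)).trans ?_
    have : 0 ≤ D := by positivity
    nlinarith [mul_nonneg this hH]

end JacobiWave

namespace JacobiWave

open MeasureTheory intervalIntegral
open scoped ContDiff

lemma continuous_At {F : ℝ × (Fin 5 → ℝ) → ℝ} (hF : Sm F) {y u g : ℝ → ℝ} (hy : ContDiff ℝ ∞ y)
    (hu : ContDiff ℝ ∞ u) (hg : ContDiff ℝ ∞ g) : Continuous (At F y u g) :=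
  continuous_finsetSum _ fun c _ => (contDiff_comp ((hF.dJ 2).dJ c).smooth (contDiff_jets hy hu)).continuous.mul
    (contDiff_jets hu hg c).continuous

set_option maxHeartbeats 1600000 in
/-- The energy inequality at order `i`, integrated by parts. -/
lemma energy_identity {N : ℝ} (hN : 4 < N) {F : ℝ × (Fin 5 → ℝ) → ℝ} (hF : Sm F)
    {k i : ℕ} (hi : i ≤ k) {B : ℝ} {y u g : ℝ → ℝ} (hy : ContDiff ℝ ∞ y)
    (hu : ContDiff ℝ ∞ u) (hg : ContDiff ℝ ∞ g) (hG : Gal N k F y u g)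
    (hc : ∀ x ∈ Icc (0:ℝ) 1,
      (∀ c, |comp (dJ F c) (jets y u) x| ≤ B) ∧ (∀ c, |iteratedDeriv 1 (comp (dJ F c) (jets y u)) x| ≤ B) ∧
      |At F y u g x| ≤ B ∧
      |comp (dJ F 1) (jets y u) x - comp (dJ F 2) (jets y u) x * bf N x| ≤ B * qf x ∧
      |comp (dJ F 4) (jets y u) x| ≤ B * qf x) :
    |Dt N F i y u g| ≤ (2 + (10 + i ^ 2) * B + (10 + N + i) * B) *
      (L2 N i (fun x => iteratedDeriv i (comp F (jets y u)) x -
        ∑ c, comp (dJ F c) (jets y u) x * iteratedDeriv i (jets y u c) x)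
        + Hk N i u + Hk N i y + Hk N (i + 1) y) := by
  have hJ := contDiff_jets hy hu
  have ct := continuous_wt hN
  have cm := continuous_wm hN
  have cb := continuous_bf (N := N)
  have cq := continuous_qf
  have cAt := continuous_At hF hy hu hg
  have cy := fun a => continuous_iteratedDeriv hy a
  have cu := fun a => continuous_iteratedDeriv hu a
  have cg := continuous_iteratedDeriv hg i
  have sG := fun c => contDiff_comp (hF.dJ c).smooth hJ
  have cG := fun c => (sG c).continuous
  have cG' := fun c => continuous_iteratedDeriv (sG c) 1
  have cFJ := continuous_iteratedDeriv (contDiff_comp hF.smooth hJ) i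
  have dy := hasDerivAt_iteratedDeriv hy
  have du := hasDerivAt_iteratedDeriv hu
  have dG : ∀ c x, HasDerivAt (comp (dJ F c) (jets y u)) (iteratedDeriv 1 (comp (dJ F c) (jets y u)) x) x := fun c x => by
    simpa using hasDerivAt_iteratedDeriv (sG c) 0 x
  have cR : Continuous (fun x => iteratedDeriv i (comp F (jets y u)) x -
        ∑ c, comp (dJ F c) (jets y u) x * iteratedDeriv i (jets y u c) x) :=
    cFJ.sub (continuous_finsetSum _ fun c _ => (cG c).mul (continuous_iteratedDeriv (hJ c) i))
  have hR : ∀ x, iteratedDeriv i (comp F (jets y u)) x = (iteratedDeriv i (comp F (jets y u)) x -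
        ∑ c, comp (dJ F c) (jets y u) x * iteratedDeriv i (jets y u c) x) +
      (comp (dJ F 0) (jets y u) x * iteratedDeriv i y x + comp (dJ F 1) (jets y u) x * iteratedDeriv (i + 1) y x
       + comp (dJ F 2) (jets y u) x * (qf x * iteratedDeriv (i + 2) y x
          + i * (1 - 2 * x) * iteratedDeriv (i + 1) y x - i * (i - 1) * iteratedDeriv i y x)
       + comp (dJ F 3) (jets y u) x * iteratedDeriv i u x
       + comp (dJ F 4) (jets y u) x * iteratedDeriv (i + 1) u x) := by
    intro x
    have e0 : iteratedDeriv i (jets y u 0) x = iteratedDeriv i y x := rfl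
    have e1 : iteratedDeriv i (jets y u 1) x = iteratedDeriv (i + 1) y x :=
      congrFun (iteratedDeriv_iteratedDeriv i 1 y) x
    have e2 : iteratedDeriv i (jets y u 2) x = _ := congrFun (iteratedDeriv_qf_mul hy i) x
    have e3 : iteratedDeriv i (jets y u 3) x = iteratedDeriv i u x := rfl
    have e4 : iteratedDeriv i (jets y u 4) x = iteratedDeriv (i + 1) u x :=
      congrFun (iteratedDeriv_iteratedDeriv i 1 u) x
    rw [Fin.sum_univ_five, e0, e1, e2, e3, e4]
    ring
  set R := fun x => iteratedDeriv i (comp F (jets y u)) x -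
        ∑ c, comp (dJ F c) (jets y u) x * iteratedDeriv i (jets y u c) x with hRdef
  set A := comp (dJ F 2) (jets y u) with hA
  set Y := iteratedDeriv (i + 1) y with hY
  set W := iteratedDeriv i u with hW
  set y0 := iteratedDeriv i y with hy0
  have i1 := jacobi_div_identity hN i (h := fun x => A x * (Y x * W x))
    (fun x => (dG 2 x).fun_mul ((dy (i + 1) x).fun_mul (du i x))) (by fun_prop)
  have i2 := weighted_div_identity hN i (h := fun x => comp (dJ F 4) (jets y u) x * (W x * W x))
    (fun x => (dG 4 x).fun_mul ((du i x).fun_mul (du i x))) (by fun_prop)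
  have II : ∀ {f : ℝ → ℝ}, Continuous f → IntervalIntegrable f volume 0 1 := fun h => h.intervalIntegrable _ _
  set Φ := fun x => wt N x * qf x ^ i * (2 * (W x * iteratedDeriv i (comp F (jets y u)) x)
      + 2 * (y0 x * W x))
    + wt N x * qf x ^ (i + 1) * (At F y u g x * Y x ^ 2
      + 2 * (A x * (Y x * iteratedDeriv (i + 1) u x))) with hΦ
  have hD : Dt N F i y u g = ∫ x in (0:ℝ)..1, Φ x := by
    have : Dt N F i y u g - ∫ x in (0:ℝ)..1, Φ x =
        2 * (∫ x in (0:ℝ)..1, wt N x * qf x ^ i * (W x * iteratedDeriv i g x)) -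
        2 * ∫ x in (0:ℝ)..1, wt N x * qf x ^ i * (W x * iteratedDeriv i (comp F (jets y u)) x) := by
      rw [← intervalIntegral.integral_const_mul, ← intervalIntegral.integral_const_mul, Dt,
        ← integral_sub (II (by fun_prop)) (II (by fun_prop)),
        ← integral_sub (II (by fun_prop)) (II (by fun_prop))]
      congr 1; ext x; simp only [hΦ]; ring
    rw [hG.pair i hi, sub_self, sub_eq_zero] at this
    exact this
  set ψ1 := fun x => wt N x * qf x ^ i * ((bf N x + i * (1 - 2 * x)) * (A x * (Y x * W x)) +
    qf x * (iteratedDeriv 1 A x * (Y x * W x) + A x * (iteratedDeriv (i + 1 + 1) y x * W x +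
      Y x * iteratedDeriv (i + 1) u x))) with hψ1
  set ψ2 := fun x => wm N x * qf x ^ i * (bf N x + (i - 1) * (1 - 2 * x)) *
      (comp (dJ F 4) (jets y u) x * (W x * W x)) + wt N x * qf x ^ i *
      (iteratedDeriv 1 (comp (dJ F 4) (jets y u)) x * (W x * W x) + comp (dJ F 4) (jets y u) x *
        (iteratedDeriv (i + 1) u x * W x + W x * iteratedDeriv (i + 1) u x)) with hψ2
  have c1 : Continuous ψ1 := by fun_prop
  have c2 : Continuous ψ2 := by fun_prop
  have cΦ : Continuous Φ := by fun_prop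
  have hΘ : ∫ x in (0:ℝ)..1, Φ x = ∫ x in (0:ℝ)..1, (Φ x - 2 * ψ1 x - ψ2 x) := by
    rw [integral_sub (II (by fun_prop)) (II c2), integral_sub (II cΦ) (II (by fun_prop)),
      intervalIntegral.integral_const_mul, i1, i2]
    ring
  set K := 2 + (10 + (i:ℝ) ^ 2) * B + (10 + N + i) * B with hK
  have hB : 0 ≤ B := (abs_nonneg _).trans ((hc 0 (by simp)).1 0)
  have key : ∀ x ∈ Icc (0:ℝ) 1, |Φ x - 2 * ψ1 x - ψ2 x| ≤
      K * (wt N x * qf x ^ i * R x ^ 2 + wt N x * qf x ^ i * W x ^ 2 + wt N x * qf x ^ i * y0 x ^ 2 +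
        wt N x * qf x ^ (i + 1) * Y x ^ 2) := by
    intro x hx
    obtain ⟨b1, b2, b3, b4, b5⟩ := hc x hx
    have hq := qf_nonneg hx
    have hq1 := qf_le_one hx
    have hι : (0:ℝ) ≤ (i:ℝ) * (i - 1) := by
      rcases Nat.eq_zero_or_pos i with h | h
      · simp [h]
      · have : (1:ℝ) ≤ i := by exact_mod_cast h
        exact mul_nonneg (by linarith) (by linarith)
    have hι2 : (i:ℝ) * (i - 1) ≤ i ^ 2 := by have : (0:ℝ) ≤ i := Nat.cast_nonneg i; nlinarith
    have hp := energy_pointwise (R := R x) (y0 := y0 x) (Y := Y x) (W := W x) hq hq1 hι (b1 0) b4 (b1 2) (b1 3) b3 (b2 2) (b2 4)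
    have e : Φ x - 2 * ψ1 x - ψ2 x = wt N x * qf x ^ i * (2 * (W x * (R x + comp (dJ F 0) (jets y u) x * y0 x
        + (comp (dJ F 1) (jets y u) x - A x * bf N x) * Y x - A x * (i * (i - 1)) * y0 x
        + comp (dJ F 3) (jets y u) x * W x)) + 2 * (y0 x * W x) + qf x * At F y u g x * Y x ^ 2
      - 2 * (qf x * iteratedDeriv 1 A x * (Y x * W x)) - iteratedDeriv 1 (comp (dJ F 4) (jets y u)) x * W x ^ 2)
      - wm N x * qf x ^ i * (bf N x + (i - 1) * (1 - 2 * x)) * (comp (dJ F 4) (jets y u) x * W x ^ 2) := by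
      simp only [hΦ, hψ1, hψ2]
      rw [hR x]
      ring
    rw [e]
    have hw := wt_nonneg N hx
    have hm := wm_nonneg N hx
    have hqi : 0 ≤ qf x ^ i := pow_nonneg hq i
    set Q := R x ^ 2 + W x ^ 2 + y0 x ^ 2 + qf x * Y x ^ 2 with hQ
    have hQ0 : 0 ≤ Q := by positivity
    have hbb : |bf N x + (i - 1) * (1 - 2 * x)| ≤ 10 + N + i := by
      have h0 : (0:ℝ) ≤ i := Nat.cast_nonneg i
      unfold bf
      rw [abs_le]
      constructor <;> nlinarith [hx.1, hx.2, mul_nonneg h0 hx.1, mul_nonneg h0 (sub_nonneg.2 hx.2)]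
    have t2 : |wm N x * qf x ^ i * (bf N x + (i - 1) * (1 - 2 * x)) * (comp (dJ F 4) (jets y u) x * W x ^ 2)|
        ≤ wt N x * qf x ^ i * ((10 + N + i) * B * Q) := by
      rw [abs_mul, abs_mul, abs_mul, abs_mul, abs_of_nonneg hm, abs_of_nonneg hqi, abs_of_nonneg (sq_nonneg (W x))]
      calc wm N x * qf x ^ i * |bf N x + (i - 1) * (1 - 2 * x)| * (|comp (dJ F 4) (jets y u) x| * W x ^ 2)
          ≤ wm N x * qf x ^ i * (10 + N + i) * (B * qf x * Q) := by
            refine mul_le_mul (by gcongr) (mul_le_mul b5 ?_ (sq_nonneg _) (by positivity)) (by positivity) (by positivity)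
            rw [hQ]; nlinarith [sq_nonneg (R x), sq_nonneg (y0 x), mul_nonneg hq (sq_nonneg (Y x))]
        _ = _ := by rw [wt]; ring
    have t1 := mul_le_mul_of_nonneg_left hp (mul_nonneg hw hqi)
    refine (abs_sub _ _).trans ?_
    rw [abs_mul, abs_of_nonneg (mul_nonneg hw hqi)]
    have hwq := mul_nonneg hw hqi
    have t3 : wt N x * qf x ^ i * ((2 + (10 + i * (i - 1)) * B) * Q) ≤
        wt N x * qf x ^ i * ((2 + (10 + i ^ 2) * B) * Q) := by gcongr
    calc _ ≤ wt N x * qf x ^ i * ((2 + (10 + i ^ 2) * B) * Q) + wt N x * qf x ^ i * ((10 + N + i) * B * Q) :=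
          add_le_add (t1.trans t3) t2
      _ = _ := by rw [hQ, hK]; ring
  rw [hD, hΘ]
  refine (abs_integral_le_integral_abs zero_le_one).trans ((integral_mono_cont (by fun_prop) (by fun_prop) key).trans ?_)
  rw [intervalIntegral.integral_const_mul, integral_add (II (by fun_prop)) (II (by fun_prop)),
    integral_add (II (by fun_prop)) (II (by fun_prop)), integral_add (II (by fun_prop)) (II (by fun_prop))]
  rfl

/-- A priori bound of the time derivative of the energies. -/
theorem energy_static {N : ℝ} (hN : 4 < N) {ρ : ℝ} {F : ℝ × (Fin 5 → ℝ) → ℝ} (hF : Adm N ρ F)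
    {m k : ℕ} (hk : k ≤ 2 * m + 1) (hm : gam N + 4 ≤ m) (hmk : m + sg N ≤ k) {M : ℝ} (hM : 0 ≤ M) :
    ∃ C : ℝ, 0 ≤ C ∧ ∀ y u g : ℝ → ℝ, ContDiff ℝ ∞ y → ContDiff ℝ ∞ u → ContDiff ℝ ∞ g →
      En N (m + sg N) y u ≤ M → Gal N k F y u g →
      (∀ c, ∀ x ∈ Icc (0:ℝ) 1, |jets y u c x| ≤ ρ) →
      ∀ i ≤ k, |Dt N F i y u g| ≤ C * En N k y u := by
  obtain ⟨B, hB, kB⟩ := coeff_bounds hN hF hm hM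
  obtain ⟨C, hC, kC⟩ := remainder_bound hN hF hk hmk hM
  refine ⟨(2 + (10 + k ^ 2) * B + (10 + N + k) * B) * (C + 3), by positivity,
    fun y u g hy hu hg hE hG hρ i hi => ?_⟩
  have h1 := energy_identity hN hF.sm hi hy hu hg hG
    (kB y u g hy hu hg hE (hG.mono (by omega)) hρ)
  have h2 := kC y u hy hu hE i hi
  have h3 := Hk_le_En_right N hi y u
  have h4 := Hk_le_En_left N (by omega : i ≤ k + 1) y u
  have h5 := Hk_le_En_left N (by omega : i + 1 ≤ k + 1) y u
  have hEn := En_nonneg N k y u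
  have hik : (i:ℝ) ≤ k := by exact_mod_cast hi
  refine h1.trans ?_
  rw [mul_assoc]
  refine mul_le_mul (by gcongr) (by linarith) ?_ (by positivity)
  exact add_nonneg (add_nonneg (add_nonneg ((isQuad_L2 hN i).nonneg _) (Hk_nonneg _ _ _)) (Hk_nonneg _ _ _)) (Hk_nonneg _ _ _)

end JacobiWave

namespace JacobiWave

open MeasureTheory intervalIntegral Polynomial
open scoped ContDiff

/-- The weighted `L²` pairing. -/
noncomputable def ip (N : ℝ) (f g : ℝ → ℝ) : ℝ := ∫ x in (0:ℝ)..1, wt N x * (f x * g x)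

lemma iteratedDeriv_eval (p : ℝ[X]) (k : ℕ) :
    iteratedDeriv k (fun x => p.eval x) = fun x => (derivative^[k] p).eval x := by
  induction k with
  | zero => simp
  | succ k ih =>
    rw [iteratedDeriv_succ, ih, Function.iterate_succ_apply']
    ext x
    exact Polynomial.deriv _

lemma ip_comm (N : ℝ) (f g : ℝ → ℝ) : ip N f g = ip N g f := by
  unfold ip; simp only [mul_comm (f _)]

lemma ip_add_left {N : ℝ} (hN : 4 < N) {f f' g : ℝ → ℝ} (hf : Continuous f) (hf' : Continuous f')
    (hg : Continuous g) : ip N (fun x => f x + f' x) g = ip N f g + ip N f' g := by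
  have := continuous_wt hN
  unfold ip
  rw [← integral_add (Continuous.intervalIntegrable (by fun_prop) _ _)
    (Continuous.intervalIntegrable (by fun_prop) _ _)]
  congr 1; ext x; ring

lemma ip_smul_left {N : ℝ} (c : ℝ) (f g : ℝ → ℝ) :
    ip N (fun x => c * f x) g = c * ip N f g := by
  unfold ip
  rw [← intervalIntegral.integral_const_mul]
  congr 1; ext x; ring

lemma ip_sum_left {N : ℝ} (hN : 4 < N) {ι : Type} (s : Finset ι) {f : ι → ℝ → ℝ} {g : ℝ → ℝ}
    (c : ι → ℝ) (hf : ∀ i, Continuous (f i)) (hg : Continuous g) :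
    ip N (fun x => ∑ i ∈ s, c i * f i x) g = ∑ i ∈ s, c i * ip N (f i) g := by
  classical
  induction s using Finset.induction_on with
  | empty => simp [ip]
  | insert a s ha ih =>
    simp only [Finset.sum_insert ha]
    rw [ip_add_left hN (by fun_prop) (by fun_prop) hg, ip_smul_left, ih]

lemma wt_pos (N : ℝ) {x : ℝ} (hx : x ∈ Ioo (0:ℝ) 1) : 0 < wt N x := by
  unfold wt wm qf
  have h1 : 0 < 1 - x := by linarith [hx.2]
  have h0 := hx.1
  positivity

lemma ip_self_pos {N : ℝ} (hN : 4 < N) {p : ℝ[X]} (hp : p ≠ 0) :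
    0 < ip N (fun x => p.eval x) (fun x => p.eval x) := by
  have hw := continuous_wt hN
  have : ∃ c ∈ Ioo (0:ℝ) 1, p.eval c ≠ 0 := by
    by_contra! h
    refine hp (eq_zero_of_infinite_isRoot p ((Ioo_infinite (zero_lt_one' ℝ)).mono fun x hx => h x hx))
  obtain ⟨c, hc, hpc⟩ := this
  have := p.continuous
  refine integral_pos zero_lt_one (by fun_prop) (fun x hx => ?_) ⟨c, ⟨hc.1.le, hc.2.le⟩, ?_⟩
  · exact mul_nonneg (wt_nonneg N ⟨hx.1.le, hx.2⟩) (mul_self_nonneg _)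
  · exact mul_pos (wt_pos N hc) (mul_self_pos.2 hpc)

/-- The weighted pairing as a bilinear form on polynomials of bounded degree. -/
noncomputable def ipForm {N : ℝ} (hN : 4 < N) (n : ℕ) : LinearMap.BilinForm ℝ (degreeLT ℝ n) :=
  LinearMap.mk₂ ℝ (fun p q => ip N (fun x => p.1.eval x) (fun x => q.1.eval x))
    (fun p p' q => by
      simp only [Submodule.coe_add, eval_add]
      exact ip_add_left hN p.1.continuous p'.1.continuous q.1.continuous)
    (fun c p q => by
      simp only [Submodule.coe_smul, eval_smul, smul_eq_mul]
      exact ip_smul_left c _ _)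
    (fun p q q' => by
      simp only [Submodule.coe_add, eval_add]
      rw [ip_comm, ip_add_left hN q.1.continuous q'.1.continuous p.1.continuous, ip_comm,
        ip_comm N (fun x => q'.1.eval x)])
    (fun c p q => by
      simp only [Submodule.coe_smul, eval_smul, smul_eq_mul]
      rw [ip_comm, ip_smul_left, ip_comm])

lemma exists_orthonormal {N : ℝ} (hN : 4 < N) (n : ℕ) : ∃ (r : ℕ) (e : Fin r → ℝ[X]),
    (∀ i, e i ∈ degreeLT ℝ n) ∧
    (∀ i j, ip N (fun x => (e i).eval x) (fun x => (e j).eval x) = if i = j then 1 else 0) ∧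
    ∀ p ∈ degreeLT ℝ n, ∀ x, p.eval x =
      ∑ i, ip N (fun x => p.eval x) (fun x => (e i).eval x) * (e i).eval x := by
  have hsymm : LinearMap.IsSymm (ipForm hN n) := ⟨fun p q => ip_comm N _ _⟩
  have : Module.Finite ℝ (degreeLT ℝ n) := Module.Finite.equiv (degreeLTEquiv ℝ n).symm
  obtain ⟨v, hv⟩ := LinearMap.BilinForm.exists_orthogonal_basis hsymm
  set a : _ → ℝ := fun i => ipForm hN n (v i) (v i) with ha
  have hapos : ∀ i, 0 < a i := fun i => ip_self_pos hN fun h => v.ne_zero i (Subtype.ext h)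
  have hoff : ∀ i j, i ≠ j → ipForm hN n (v i) (v j) = 0 := fun i j hij => hv hij
  have hs : ∀ i, √(a i) * √(a i) = a i := fun i => mul_self_sqrt (hapos i).le
  have hsp : ∀ i, 0 < √(a i) := fun i => sqrt_pos.2 (hapos i)
  set e : Fin (Module.finrank ℝ (degreeLT ℝ n)) → degreeLT ℝ n := fun i => (√(a i))⁻¹ • v i with he
  have hee : ∀ i j, ipForm hN n (e i) (e j) = if i = j then 1 else 0 := by
    intro i j
    simp only [he, map_smul, LinearMap.smul_apply, smul_eq_mul]
    split_ifs with h
    · subst h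
      have h1 := hs i
      have h2 := hsp i
      change (√(a i))⁻¹ * ((√(a i))⁻¹ * a i) = 1
      field_simp
      rw [sq, h1]
    · rw [hoff i j h]; simp
  refine ⟨_, fun i => (e i).1, fun i => (e i).2, hee, fun p hp x => ?_⟩
  set P : degreeLT ℝ n := ⟨p, hp⟩
  have hP : P = ∑ i, ipForm hN n P (e i) • e i := by
    have h1 : P = ∑ i, (v.repr P i * √(a i)) • e i := by
      conv_lhs => rw [← v.sum_repr P]
      refine Finset.sum_congr rfl fun i _ => ?_
      rw [he, smul_smul, mul_assoc, mul_inv_cancel₀ (hsp i).ne', mul_one]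
    have h2 : ∀ j, ipForm hN n P (e j) = v.repr P j * √(a j) := by
      intro j
      conv_lhs => rw [h1]
      simp [map_sum, LinearMap.sum_apply, hee]
    simp only [h2]
    exact h1
  have := congrArg (fun q : degreeLT ℝ n => q.1.eval x) hP
  simp only [AddSubmonoidClass.coe_finsetSum, eval_finsetSum, Submodule.coe_smul, eval_smul,
    smul_eq_mul] at this
  exact this

end JacobiWave

namespace JacobiWave

open MeasureTheory intervalIntegral Polynomial
open scoped ContDiff

/-- The Jacobi operator with shifted parameters, acting on polynomials. -/
noncomputable def jacP (N : ℝ) (j : ℕ) (p : ℝ[X]) : ℝ[X] :=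
  -(X * (1 - X) * derivative (derivative p) +
    (C (5 / 2) * (1 - X) - C (N / 2) * X + C (j : ℝ) * (1 - 2 * X)) * derivative p)

lemma derivative_jacP (N : ℝ) (j : ℕ) (p : ℝ[X]) :
    derivative (jacP N j p) =
      jacP N (j + 1) (derivative p) + C (5 / 2 + N / 2 + 2 * j) * derivative p := by
  unfold jacP
  simp only [derivative_neg, derivative_mul, derivative_sub, derivative_X,
    derivative_one, derivative_C, derivative_ofNat, map_add, map_mul, Nat.cast_add, Nat.cast_one,
    map_one]
  have : (C (2:ℝ) : ℝ[X]) = 2 := rfl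
  rw [this]
  ring

lemma jacP_mem {N : ℝ} {n : ℕ} {p : ℝ[X]} (hp : p ∈ degreeLT ℝ n) : jacP N 0 p ∈ degreeLT ℝ n := by
  rw [mem_degreeLT, degree_lt_iff_coeff_zero] at *
  intro m hm
  have e : jacP N 0 p = X * (X * derivative (derivative p)) - X * derivative (derivative p)
      + C (5 / 2 + N / 2) * (X * derivative p) - C (5 / 2) * derivative p := by
    unfold jacP
    simp only [map_add, Nat.cast_zero, map_zero]
    ring
  have h0 := hp m hm
  have h1 := hp (m + 1) (by omega)
  rw [e]
  simp only [coeff_add, coeff_sub, coeff_C_mul, coeff_derivative, h1]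
  rcases m with _ | m
  · simp
  · rw [coeff_X_mul, coeff_X_mul, coeff_X_mul]
    rcases m with _ | m
    · simp [coeff_derivative, h0, h1]
    · rw [coeff_X_mul]
      simp [coeff_derivative, h0, h1]

lemma iterate_derivative_jacP (N : ℝ) (j : ℕ) (p : ℝ[X]) : ∃ s : ℝ,
    jacP N j (derivative^[j] p) = derivative^[j] (jacP N 0 p + C s * p) := by
  induction j with
  | zero => exact ⟨0, by simp⟩
  | succ j ih =>
    obtain ⟨s, hs⟩ := ih
    refine ⟨s - (5 / 2 + N / 2 + 2 * j), ?_⟩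
    rw [Function.iterate_succ_apply', Function.iterate_succ_apply']
    have := derivative_jacP N j (derivative^[j] p)
    rw [hs] at this
    rw [← sub_eq_iff_eq_add] at this
    rw [← this]
    rw [map_sub, sub_mul, ← add_sub_assoc, iterate_derivative_sub, iterate_derivative_C_mul,
      derivative_sub, derivative_C_mul]

lemma contDiff_eval (p : ℝ[X]) : ContDiff ℝ ∞ fun x => p.eval x := by
  induction p using Polynomial.induction_on' with
  | add p q hp hq => simpa only [eval_add] using hp.add hq
  | monomial n a => simp only [eval_monomial]; fun_prop

/-- Integration by parts against a polynomial derivative. -/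
lemma ibp_eval {N : ℝ} (hN : 4 < N) (j : ℕ) (p : ℝ[X]) {h h' : ℝ → ℝ}
    (hh : ∀ x, HasDerivAt h (h' x) x) (hh' : Continuous h') :
    ∫ x in (0:ℝ)..1, wt N x * qf x ^ (j + 1) * (h' x * (derivative p).eval x) =
      ∫ x in (0:ℝ)..1, wt N x * qf x ^ j * (h x * (jacP N j p).eval x) := by
  have hw := continuous_wt hN
  have hq := continuous_qf
  have hb := continuous_bf (N := N)
  have hhc : Continuous h := continuous_iff_continuousAt.2 fun x => (hh x).continuousAt
  have e1 := (derivative p).continuous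
  have e2 := (derivative (derivative p)).continuous
  have e3 := (jacP N j p).continuous
  have := jacobi_div_identity hN j
    (h := fun x => h x * (derivative p).eval x)
    (h' := fun x => h' x * (derivative p).eval x + h x * (derivative (derivative p)).eval x)
    (fun x => (hh x).fun_mul ((derivative p).hasDerivAt x)) (by fun_prop)
  rw [← sub_eq_zero, ← integral_sub (Continuous.intervalIntegrable (by fun_prop) _ _)
    (Continuous.intervalIntegrable (by fun_prop) _ _), ← this]
  congr 1; ext x
  simp only [jacP, eval_neg, eval_add, eval_mul, eval_sub, eval_X, eval_C, eval_one, eval_ofNat,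
    bf, qf]
  ring

lemma exists_representer {N : ℝ} (hN : 4 < N) (n k : ℕ) : ∀ p ∈ degreeLT ℝ n,
    ∃ r ∈ degreeLT ℝ n, ∀ f : ℝ → ℝ, ContDiff ℝ ∞ f →
      ∫ x in (0:ℝ)..1, wt N x * qf x ^ k * (iteratedDeriv k f x * (derivative^[k] p).eval x) =
        ip N f (fun x => r.eval x) := by
  induction k with
  | zero =>
    intro p hp
    exact ⟨p, hp, fun f _ => by simp [ip]⟩
  | succ k ih =>
    intro p hp
    obtain ⟨s, hs⟩ := iterate_derivative_jacP N k p
    obtain ⟨r, hr, h⟩ := ih (jacP N 0 p + C s * p)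
      (Submodule.add_mem _ (jacP_mem hp) (by rw [← smul_eq_C_mul]; exact Submodule.smul_mem _ _ hp))
    refine ⟨r, hr, fun f hf => ?_⟩
    rw [← h f hf, ← hs, Function.iterate_succ_apply']
    exact ibp_eval hN k _ (hasDerivAt_iteratedDeriv hf k) (continuous_iteratedDeriv hf (k + 1))

/-- The projection onto the span of a family. -/
noncomputable def proj {r : ℕ} (N : ℝ) (e : Fin r → ℝ → ℝ) (f : ℝ → ℝ) (x : ℝ) : ℝ :=
  ∑ i, ip N f (e i) * e i x

/-- An orthonormal family whose projection is compatible with all the weighted Sobolev forms. -/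
structure GBasis (N : ℝ) {r : ℕ} (e : Fin r → ℝ → ℝ) : Prop where
  smooth : ∀ i, ContDiff ℝ ∞ (e i)
  orth : ∀ i j, ip N (e i) (e j) = if i = j then 1 else 0
  pair : ∀ f, ContDiff ℝ ∞ f → ∀ k i,
    ∫ x in (0:ℝ)..1, wt N x * qf x ^ k * (iteratedDeriv k (e i) x * iteratedDeriv k (proj N e f) x) =
    ∫ x in (0:ℝ)..1, wt N x * qf x ^ k * (iteratedDeriv k (e i) x * iteratedDeriv k f x)

lemma ip_proj {N : ℝ} (hN : 4 < N) {r : ℕ} {e : Fin r → ℝ → ℝ}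
    (hs : ∀ i, ContDiff ℝ ∞ (e i))
    (ho : ∀ i j, ip N (e i) (e j) = if i = j then 1 else 0) (f : ℝ → ℝ) (j : Fin r) :
    ip N (proj N e f) (e j) = ip N f (e j) := by
  unfold proj
  rw [ip_sum_left hN _ _ (fun i => (hs i).continuous) (hs j).continuous]
  simp [ho]

lemma continuous_proj {N : ℝ} {r : ℕ} {e : Fin r → ℝ → ℝ} (hs : ∀ i, ContDiff ℝ ∞ (e i))
    (f : ℝ → ℝ) : Continuous (proj N e f) := by
  have := fun i => (hs i).continuous
  unfold proj; fun_prop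

lemma ip_proj_proj {N : ℝ} (hN : 4 < N) {r : ℕ} {e : Fin r → ℝ → ℝ}
    (hs : ∀ i, ContDiff ℝ ∞ (e i)) (ho : ∀ i j, ip N (e i) (e j) = if i = j then 1 else 0)
    {f : ℝ → ℝ} (hf : Continuous f) (g : ℝ → ℝ) :
    ip N (proj N e f) (proj N e g) = ip N f (proj N e g) := by
  have h : ∀ f', Continuous f' →
      ip N f' (proj N e g) = ∑ i, ip N g (e i) * ip N (e i) f' := fun f' hf' => by
    rw [ip_comm]
    exact ip_sum_left hN _ _ (fun i => (hs i).continuous) hf'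
  rw [h _ (continuous_proj hs f), h f hf]
  refine Finset.sum_congr rfl fun j _ => ?_
  rw [ip_comm N _ f, ip_comm N _ (proj N e f), ip_proj hN hs ho]

lemma exists_gBasis {N : ℝ} (hN : 4 < N) (n : ℕ) : ∃ (r : ℕ) (e : Fin r → ℝ → ℝ), GBasis N e ∧
    ∀ p ∈ degreeLT ℝ n, ∀ x, p.eval x = proj N e (fun x => p.eval x) x := by
  obtain ⟨r, e, hm, ho, hp⟩ := exists_orthonormal hN n
  have hs : ∀ i, ContDiff ℝ ∞ (fun x => (e i).eval x) := fun i => contDiff_eval (e i)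
  refine ⟨r, fun i x => (e i).eval x, ⟨hs, ho, fun f hf k i => ?_⟩, hp⟩
  obtain ⟨q, hq, h⟩ := exists_representer hN n k (e i) (hm i)
  have hPs : ContDiff ℝ ∞ (proj N (fun i x => (e i).eval x) f) := by
    unfold proj; exact ContDiff.sum fun i _ => contDiff_const.mul (hs i)
  have h1 := h f hf
  have h2 := h _ hPs
  have h3 : ip N (proj N (fun i x => (e i).eval x) f) (fun x => q.eval x) =
      ip N f (fun x => q.eval x) := by
    have : (fun x => q.eval x) = proj N (fun i x => (e i).eval x) (fun x => q.eval x) :=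
      funext (hp q hq)
    rw [this]
    exact ip_proj_proj hN hs ho hf.continuous (fun x => q.eval x)
  rw [h3, ← h1] at h2
  simp only [iteratedDeriv_eval] at *
  simpa only [mul_comm (eval _ _)] using h2

end JacobiWave

namespace JacobiWave

open MeasureTheory intervalIntegral Polynomial
open scoped ContDiff

lemma iteratedDeriv_lincomb {r : ℕ} {e : Fin r → ℝ → ℝ} (hs : ∀ i, ContDiff ℝ ∞ (e i))
    (c : Fin r → ℝ) (k : ℕ) :
    iteratedDeriv k (fun x => ∑ i, c i * e i x) = fun x => ∑ i, c i * iteratedDeriv k (e i) x := by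
  induction k with
  | zero => simp
  | succ k ih =>
    rw [iteratedDeriv_succ, ih]
    ext x
    exact (HasDerivAt.fun_sum fun i _ => (hasDerivAt_iteratedDeriv (hs i) k x).const_mul (c i)).deriv

lemma contDiff_lincomb {r : ℕ} {e : Fin r → ℝ → ℝ} (hs : ∀ i, ContDiff ℝ ∞ (e i))
    (c : Fin r → ℝ) : ContDiff ℝ ∞ (fun x => ∑ i, c i * e i x) :=
  ContDiff.sum fun i _ => contDiff_const.mul (hs i)

lemma contDiff_proj {N : ℝ} {r : ℕ} {e : Fin r → ℝ → ℝ} (hs : ∀ i, ContDiff ℝ ∞ (e i))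
    (f : ℝ → ℝ) : ContDiff ℝ ∞ (proj N e f) := contDiff_lincomb hs _

lemma GBasis.pair_sum {N : ℝ} (hN : 4 < N) {r : ℕ} {e : Fin r → ℝ → ℝ} (he : GBasis N e)
    (c : Fin r → ℝ) {f : ℝ → ℝ} (hf : ContDiff ℝ ∞ f) (k : ℕ) :
    ∫ x in (0:ℝ)..1, wt N x * qf x ^ k *
      (iteratedDeriv k (fun x => ∑ i, c i * e i x) x * iteratedDeriv k (proj N e f) x) =
    ∫ x in (0:ℝ)..1, wt N x * qf x ^ k *
      (iteratedDeriv k (fun x => ∑ i, c i * e i x) x * iteratedDeriv k f x) := by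
  have hw := continuous_wt hN
  have hq := continuous_qf
  have key : ∀ g : ℝ → ℝ, Continuous g → ∫ x in (0:ℝ)..1, wt N x * qf x ^ k *
      (iteratedDeriv k (fun x => ∑ i, c i * e i x) x * g x) =
      ∑ i, c i * ∫ x in (0:ℝ)..1, wt N x * qf x ^ k * (iteratedDeriv k (e i) x * g x) := by
    intro g hg
    have h1 := fun i => continuous_iteratedDeriv (he.smooth i) k
    simp only [← intervalIntegral.integral_const_mul]
    rw [← integral_finsetSum fun i _ => Continuous.intervalIntegrable (by fun_prop) _ _]
    rw [iteratedDeriv_lincomb he.smooth]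
    congr 1; ext x
    rw [Finset.sum_mul, Finset.mul_sum]
    exact Finset.sum_congr rfl fun i _ => by ring
  rw [key _ (continuous_iteratedDeriv (contDiff_proj he.smooth f) k),
    key _ (continuous_iteratedDeriv hf k)]
  simp only [he.pair f hf k]

lemma GBasis.Hk_proj_le {N : ℝ} (hN : 4 < N) {r : ℕ} {e : Fin r → ℝ → ℝ} (he : GBasis N e)
    {f : ℝ → ℝ} (hf : ContDiff ℝ ∞ f) (k : ℕ) : Hk N k (proj N e f) ≤ Hk N k f := by
  have hw := continuous_wt hN
  have hq := continuous_qf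
  have h := he.pair_sum hN (fun i => ip N f (e i)) hf k
  have h1 := continuous_iteratedDeriv (contDiff_proj (N := N) he.smooth f) k
  have h2 := continuous_iteratedDeriv hf k
  change ∫ x in (0:ℝ)..1, wt N x * qf x ^ k *
      (iteratedDeriv k (proj N e f) x * iteratedDeriv k (proj N e f) x) =
    ∫ x in (0:ℝ)..1, wt N x * qf x ^ k * (iteratedDeriv k (proj N e f) x * iteratedDeriv k f x) at h
  have h3 : 0 ≤ ∫ x in (0:ℝ)..1, wt N x * qf x ^ k *
      (iteratedDeriv k f x - iteratedDeriv k (proj N e f) x) ^ 2 := integral_nonneg_cont fun x hx =>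
    mul_nonneg (mul_nonneg (wt_nonneg N hx) (pow_nonneg (qf_nonneg hx) k)) (sq_nonneg _)
  have h4 : ∫ x in (0:ℝ)..1, wt N x * qf x ^ k *
      (iteratedDeriv k f x - iteratedDeriv k (proj N e f) x) ^ 2 = Hk N k f - 2 * (∫ x in (0:ℝ)..1,
        wt N x * qf x ^ k * (iteratedDeriv k (proj N e f) x * iteratedDeriv k f x))
        + Hk N k (proj N e f) := by
    unfold Hk
    rw [← intervalIntegral.integral_const_mul, ← integral_sub (Continuous.intervalIntegrable
      (by fun_prop) _ _) (Continuous.intervalIntegrable (by fun_prop) _ _),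
      ← integral_add (Continuous.intervalIntegrable (by fun_prop) _ _)
      (Continuous.intervalIntegrable (by fun_prop) _ _)]
    congr 1; ext x; ring
  have h5 : Hk N k (proj N e f) = ∫ x in (0:ℝ)..1, wt N x * qf x ^ k *
      (iteratedDeriv k (proj N e f) x * iteratedDeriv k (proj N e f) x) := by
    unfold Hk; congr 1; ext x; ring
  linarith

/-- Bernstein polynomials approximate Lipschitz functions. -/
lemma exists_poly_approx {f : ℝ → ℝ} {K : ℝ} (hK : 0 ≤ K)
    (hf : ∀ x ∈ Icc (0:ℝ) 1, ∀ y ∈ Icc (0:ℝ) 1, |f x - f y| ≤ K * |x - y|) (n : ℕ) (hn : n ≠ 0) :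
    ∃ p ∈ degreeLT ℝ (n + 1), ∀ x ∈ Icc (0:ℝ) 1, (f x - p.eval x) ^ 2 ≤ K ^ 2 / n := by
  refine ⟨∑ k : Fin (n + 1), C (f (bernstein.z k)) * bernsteinPolynomial ℝ n k,
    Submodule.sum_mem _ fun k _ => ?_, fun x hx => ?_⟩
  · rw [← smul_eq_C_mul]
    refine Submodule.smul_mem _ _ ?_
    rw [mem_degreeLT]
    refine (degree_le_natDegree).trans_lt ?_
    have : (bernsteinPolynomial ℝ n k).natDegree ≤ n := by
      unfold bernsteinPolynomial
      have hk := k.is_le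
      refine natDegree_mul_le.trans ?_
      have h1 : ((n.choose k : ℝ[X]) * X ^ (k:ℕ)).natDegree ≤ (k:ℕ) := by
        refine natDegree_mul_le.trans ?_
        simp
      have h2 : ((1 - X : ℝ[X]) ^ (n - (k:ℕ))).natDegree ≤ n - (k:ℕ) := by
        refine natDegree_pow_le.trans ?_
        have : (1 - X : ℝ[X]).natDegree ≤ 1 := by
          refine (natDegree_sub_le _ _).trans ?_
          simp
        nlinarith
      omega
    exact_mod_cast Nat.lt_succ_of_le this
  · set b : Fin (n + 1) → ℝ := fun k => bernstein n k ⟨x, hx⟩ with hb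
    have hb0 : ∀ k, 0 ≤ b k := fun k => bernstein_nonneg
    have hb1 : ∑ k, b k = 1 := bernstein.probability n ⟨x, hx⟩
    have hv : ∑ k, (x - (bernstein.z k : ℝ)) ^ 2 * b k = x * (1 - x) / n :=
      bernstein.variance hn ⟨x, hx⟩
    have he : f x - (∑ k : Fin (n + 1), C (f (bernstein.z k)) * bernsteinPolynomial ℝ n k).eval x
        = ∑ k, b k * (f x - f (bernstein.z k)) := by
      simp only [mul_sub, Finset.sum_sub_distrib, ← Finset.sum_mul, hb1, one_mul, eval_finsetSum,
        eval_mul, eval_C]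
      congr 1
      refine Finset.sum_congr rfl fun k _ => ?_
      rw [mul_comm]
      rfl
    have hcs := Finset.sum_mul_sq_le_sq_mul_sq Finset.univ (fun k => √(b k))
      (fun k => √(b k) * (f x - f (bernstein.z k)))
    simp only [← mul_assoc, mul_self_sqrt (hb0 _), sq_sqrt (hb0 _), hb1, one_mul, mul_pow] at hcs
    rw [he]
    refine hcs.trans ?_
    have hn' : (0:ℝ) < n := by positivity
    calc ∑ k, b k * (f x - f (bernstein.z k)) ^ 2
        ≤ ∑ k, K ^ 2 * ((x - (bernstein.z k : ℝ)) ^ 2 * b k) := by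
          refine Finset.sum_le_sum fun k _ => ?_
          have := hf x hx _ (bernstein.z k).2
          have h2 : (f x - f (bernstein.z k)) ^ 2 ≤ K ^ 2 * (x - (bernstein.z k : ℝ)) ^ 2 := by
            rw [← mul_pow, sq_le_sq, abs_mul, abs_of_nonneg hK]; exact this
          nlinarith [mul_le_mul_of_nonneg_left h2 (hb0 k)]
      _ = K ^ 2 * (x * (1 - x) / n) := by rw [← Finset.mul_sum, hv]
      _ ≤ K ^ 2 / n := by
          rw [← mul_div_assoc]
          have := qf_le_one hx
          unfold qf at this
          gcongr
          nlinarith [sq_nonneg K]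

lemma GBasis.L2_sub_proj_le {N : ℝ} (hN : 4 < N) {r : ℕ} {e : Fin r → ℝ → ℝ} (he : GBasis N e)
    {f p : ℝ → ℝ} (hf : Continuous f) (hp : Continuous p) (hpe : ∀ x, p x = proj N e p x) :
    L2 N 0 (fun x => f x - proj N e f x) ≤ L2 N 0 (fun x => f x - p x) := by
  have hw := continuous_wt hN
  set h : ℝ → ℝ := fun x => f x - p x with hh
  have hhc : Continuous h := by fun_prop
  have e1 : (fun x => f x - proj N e f x) = fun x => h x - proj N e h x := by
    ext x
    have : proj N e h x = proj N e f x - proj N e p x := by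
      unfold proj
      rw [← Finset.sum_sub_distrib]
      refine Finset.sum_congr rfl fun i _ => ?_
      have := ip_add_left hN (f := f) (f' := fun x => (-1) * p x) (g := e i) hf (by fun_prop)
        (he.smooth i).continuous
      rw [ip_smul_left] at this
      have e2 : h = fun x => f x + -1 * p x := by ext x; rw [hh]; ring
      rw [e2, this]; ring
    rw [this, ← hpe x, hh]; ring
  have hP := continuous_proj (N := N) he.smooth h
  have h1 := ip_proj_proj hN he.smooth he.orth hhc h
  have h2 : ∫ x in (0:ℝ)..1, wt N x * qf x ^ 0 * (h x - proj N e h x) ^ 2 =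
      L2 N 0 h - 2 * ip N h (proj N e h) + ip N (proj N e h) (proj N e h) := by
    unfold L2 ip
    rw [← intervalIntegral.integral_const_mul, ← integral_sub (Continuous.intervalIntegrable
      (by fun_prop) _ _) (Continuous.intervalIntegrable (by fun_prop) _ _),
      ← integral_add (Continuous.intervalIntegrable (by fun_prop) _ _)
      (Continuous.intervalIntegrable (by fun_prop) _ _)]
    congr 1; ext x; ring
  have h3 : 0 ≤ ip N (proj N e h) (proj N e h) := integral_nonneg_cont fun x hx =>
    mul_nonneg (wt_nonneg N hx) (mul_self_nonneg _)
  rw [e1]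
  change ∫ x in (0:ℝ)..1, wt N x * qf x ^ 0 * (h x - proj N e h x) ^ 2 ≤ _
  rw [h2]; linarith

/-- Finite-dimensional projections compatible with all energies, with an approximation rate. -/
lemma exists_gBasis_rate {N : ℝ} (hN : 4 < N) (n : ℕ) (hn : n ≠ 0) :
    ∃ (r : ℕ) (e : Fin r → ℝ → ℝ), GBasis N e ∧ ∀ f : ℝ → ℝ, ContDiff ℝ ∞ f → ∀ K : ℝ, 0 ≤ K →
      (∀ x ∈ Icc (0:ℝ) 1, |iteratedDeriv 1 f x| ≤ K) →
      L2 N 0 (fun x => f x - proj N e f x) ≤ K ^ 2 / n := by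
  obtain ⟨r, e, he, hp⟩ := exists_gBasis hN (n + 1)
  refine ⟨r, e, he, fun f hf K hK hb => ?_⟩
  have hlip : ∀ x ∈ Icc (0:ℝ) 1, ∀ y ∈ Icc (0:ℝ) 1, |f x - f y| ≤ K * |x - y| := by
    intro x hx y hy
    exact Convex.norm_image_sub_le_of_norm_hasDerivWithin_le
      (fun z _ => ((hasDerivAt_iteratedDeriv hf 0 z).hasDerivWithinAt)) hb (convex_Icc 0 1) hy hx
  obtain ⟨p, hpm, hpb⟩ := exists_poly_approx hK hlip n hn
  refine (he.L2_sub_proj_le hN hf.continuous p.continuous (hp p hpm)).trans ?_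
  exact L2_le_of_bdd hN 0 (hf.continuous.sub p.continuous) (fun x hx => by
    rw [pow_zero, one_mul]; exact hpb x hx)

end JacobiWave

namespace JacobiWave

open MeasureTheory intervalIntegral
open scoped ContDiff NNReal

/-- A second order system cut off in time has global solutions. -/
lemma exists_global_ode {V : Type*} [NormedAddCommGroup V] [NormedSpace ℝ V] [CompleteSpace V]
    {κ : ℝ → ℝ} (hκ : Continuous κ) (hκ1 : ∀ t, |κ t| ≤ 1) {R : ℝ} (hR : 0 < R)
    (hκ0 : ∀ t, R ≤ |t| → κ t = 0) {Φ : V → V → V} {K M : ℝ} (hK : 0 ≤ K) (hM : 0 ≤ M)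
    (hΦ : ∀ a b a' b', ‖Φ a b - Φ a' b'‖ ≤ K * (‖a - a'‖ + ‖b - b'‖)) (hΦM : ∀ a b, ‖Φ a b‖ ≤ M)
    (c₀ d₀ : V) : ∃ c d : ℝ → V, c 0 = c₀ ∧ d 0 = d₀ ∧
      (∀ t, HasDerivAt c (κ t • d t) t) ∧ ∀ t, HasDerivAt d (κ t • Φ (c t) (d t)) t := by
  set l : ℝ := 1 / (2 * R) with hl
  have hl0 : 0 < l := by positivity
  have hlR : R * l = 1 / 2 := by rw [hl]; field_simp
  set f : ℝ → V × V → V × V := fun t z => (κ t • (l • z.2), κ t • Φ (l⁻¹ • z.1) z.2) with hf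
  set a : ℝ := ‖d₀‖ + R * M with ha
  have ha0 : 0 ≤ a := by positivity
  set Λ : ℝ := l + K * (l⁻¹ + 1) with hΛ
  have hΛ0 : 0 ≤ Λ := by positivity
  have hlip : ∀ t, LipschitzWith Λ.toNNReal (f t) := fun t => by
    refine LipschitzWith.of_dist_le_mul fun z z' => ?_
    rw [dist_eq_norm, dist_eq_norm, Real.coe_toNNReal _ hΛ0, Prod.norm_def]
    have h1 : ‖z.1 - z'.1‖ ≤ ‖z - z'‖ := norm_fst_le (z - z')
    have h2 : ‖z.2 - z'.2‖ ≤ ‖z - z'‖ := norm_snd_le (z - z')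
    have hn := norm_nonneg (z - z')
    have hk := hκ1 t
    have hl0' : 0 < l⁻¹ := inv_pos.2 hl0
    refine max_le ?_ ?_
    · change ‖κ t • (l • z.2) - κ t • (l • z'.2)‖ ≤ _
      rw [← smul_sub, ← smul_sub, norm_smul, norm_smul, Real.norm_eq_abs, Real.norm_eq_abs,
        abs_of_pos hl0]
      calc |κ t| * (l * ‖z.2 - z'.2‖) ≤ 1 * (l * ‖z - z'‖) := by gcongr
        _ ≤ Λ * ‖z - z'‖ := by
          rw [one_mul, hΛ]; gcongr
          have : 0 ≤ K * (l⁻¹ + 1) := by positivity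
          linarith
    · change ‖κ t • Φ (l⁻¹ • z.1) z.2 - κ t • Φ (l⁻¹ • z'.1) z'.2‖ ≤ _
      rw [← smul_sub, norm_smul, Real.norm_eq_abs]
      have h3 := hΦ (l⁻¹ • z.1) z.2 (l⁻¹ • z'.1) z'.2
      rw [← smul_sub, norm_smul, Real.norm_eq_abs, abs_of_pos hl0'] at h3
      calc |κ t| * _ ≤ 1 * (K * (l⁻¹ * ‖z - z'‖ + ‖z - z'‖)) := by
            gcongr
            refine h3.trans ?_
            gcongr
        _ ≤ Λ * ‖z - z'‖ := by
          rw [hΛ]; nlinarith [mul_nonneg hl0.le hn]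
  have hfc : ∀ z, Continuous fun t => f t z := fun z => by
    simp only [hf]; fun_prop
  have hcont : Continuous (Function.uncurry f) :=
    continuous_prod_of_continuous_lipschitzWith' _ Λ.toNNReal hlip hfc
  set L : ℝ := l * (‖d₀‖ + a) + M with hL
  have hL0 : 0 ≤ L := by positivity
  set x₀ : V × V := (l • c₀, d₀) with hx₀
  have hpl : IsPicardLindelof f (tmin := -R) (tmax := R) ⟨0, by constructor <;> linarith⟩ x₀
      (2 * a).toNNReal 0 (max (l * (‖d₀‖ + 2 * a)) M).toNNReal Λ.toNNReal := by
    refine ⟨fun t _ => (hlip t).lipschitzOnWith, fun x _ => (hfc x).continuousOn,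
      fun t _ x hx => ?_, ?_⟩
    · rw [Metric.mem_closedBall, dist_eq_norm, Real.coe_toNNReal _ (by positivity)] at hx
      have h2 : ‖x.2 - d₀‖ ≤ 2 * a := (norm_snd_le (x - x₀)).trans hx
      have h3 : ‖x.2‖ ≤ ‖d₀‖ + 2 * a := by
        have := norm_le_norm_add_norm_sub' x.2 d₀; linarith
      rw [Real.coe_toNNReal _ (by positivity), Prod.norm_def]
      refine max_le_max ?_ ?_
      · change ‖κ t • (l • x.2)‖ ≤ _
        rw [norm_smul, norm_smul, Real.norm_eq_abs, Real.norm_eq_abs, abs_of_pos hl0]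
        calc |κ t| * (l * ‖x.2‖) ≤ 1 * (l * (‖d₀‖ + 2 * a)) := by gcongr; exact hκ1 t
          _ = _ := one_mul _
      · change ‖κ t • Φ (l⁻¹ • x.1) x.2‖ ≤ _
        rw [norm_smul, Real.norm_eq_abs]
        calc |κ t| * _ ≤ 1 * M := by gcongr; exacts [hκ1 t, hΦM _ _]
          _ = _ := one_mul _
    · simp only [sub_zero, zero_sub, neg_neg, max_self, NNReal.coe_zero]
      rw [Real.coe_toNNReal _ (by positivity), Real.coe_toNNReal _ (by positivity)]
      rw [max_mul_of_nonneg _ _ hR.le]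
      refine max_le ?_ ?_
      · have : l * (‖d₀‖ + 2 * a) * R = (1 / 2) * (‖d₀‖ + 2 * a) := by rw [← hlR]; ring
        rw [this]
        have : 0 ≤ R * M := by positivity
        have := norm_nonneg d₀
        linarith
      · have := norm_nonneg d₀
        nlinarith
  obtain ⟨α, hα0, hα⟩ := hpl.exists_eq_forall_mem_Icc_hasDerivWithinAt₀
  change α 0 = x₀ at hα0
  have hαc : ContinuousOn α (Icc (-R) R) := fun t ht => (hα t ht).continuousWithinAt
  have hRR : -R ≤ R := by linarith
  set w : ℝ → V × V := fun s => f s (IccExtend hRR ((Icc (-R) R).domRestrict α) s) with hw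
  have hwc : Continuous w := hcont.comp (continuous_id.prodMk
    ((continuousOn_iff_continuous_domRestrict.1 hαc).Icc_extend'))
  set z : ℝ → V × V := fun t => x₀ + ∫ s in (0:ℝ)..t, w s with hz
  have hzd : ∀ t, HasDerivAt z (w t) t := fun t =>
    (integral_hasDerivAt_right (hwc.intervalIntegrable _ _) (hwc.stronglyMeasurableAtFilter _ _)
      hwc.continuousAt).const_add _
  have hwα : ∀ t ∈ Icc (-R) R, w t = f t (α t) := fun t ht => by
    simp only [hw]; rw [IccExtend_of_mem _ _ ht]; rfl
  have hzα : ∀ t ∈ Icc (-R) R, z t = α t := by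
    intro t ht
    have h0 : (0:ℝ) ∈ Icc (-R) R := by constructor <;> linarith
    have := Convex.norm_image_sub_le_of_norm_hasDerivWithin_le (𝕜 := ℝ) (f := fun t => z t - α t)
      (f' := fun _ => 0) (C := 0) (s := Icc (-R) R) (x := 0) (y := t) (fun s hs => by
        have := (hzd s).hasDerivWithinAt.sub (hα s hs)
        rwa [hwα s hs, sub_self] at this) (by simp) (convex_Icc _ _) h0 ht
    simp only [hα0, zero_mul, norm_le_zero_iff] at this
    have hz0 : z 0 = x₀ := by simp [hz]
    rw [hz0, sub_self, sub_zero] at this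
    exact sub_eq_zero.1 this
  have hwz : ∀ t, w t = f t (z t) := by
    intro t
    by_cases ht : t ∈ Icc (-R) R
    · rw [hwα t ht, hzα t ht]
    · have : κ t = 0 := hκ0 t (by
        by_contra! h
        exact ht ⟨(abs_lt.1 h).1.le, (abs_lt.1 h).2.le⟩)
      simp [hw, hf, this]
  have hz0 : z 0 = x₀ := by simp [hz]
  refine ⟨fun t => l⁻¹ • (z t).1, fun t => (z t).2, ?_, ?_, fun t => ?_, fun t => ?_⟩
  · simp [hz0, hx₀, smul_smul, hl0.ne']
  · simp [hz0, hx₀]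
  · have h : HasDerivAt (fun t => (z t).1) (f t (z t)).1 t := by rw [← hwz t]; exact (hzd t).fst
    have h2 := h.const_smul l⁻¹
    have e : l⁻¹ • (f t (z t)).1 = κ t • (z t).2 := by
      change l⁻¹ • (κ t • (l • (z t).2)) = _
      rw [smul_comm (κ t), smul_smul l⁻¹, inv_mul_cancel₀ hl0.ne', one_smul]
    rw [e] at h2
    exact h2
  · have h : HasDerivAt (fun t => (z t).2) (f t (z t)).2 t := by rw [← hwz t]; exact (hzd t).snd
    exact h

end JacobiWave

namespace JacobiWave

open MeasureTheory intervalIntegral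
open scoped ContDiff

/-- Linear combination of a finite family. -/
def lc {r : ℕ} (e : Fin r → ℝ → ℝ) (c : Fin r → ℝ) (x : ℝ) : ℝ := ∑ i, c i * e i x

lemma abs_lc_sub_le {r : ℕ} {e : Fin r → ℝ → ℝ} (hs : ∀ i, ContDiff ℝ ∞ (e i)) {B x : ℝ} {j : ℕ}
    (hB : ∀ i, |iteratedDeriv j (e i) x| ≤ B) (c c' : Fin r → ℝ) :
    |iteratedDeriv j (lc e c) x - iteratedDeriv j (lc e c') x| ≤ r * B * ‖c - c'‖ := by
  have h1 := fun c => congrFun (iteratedDeriv_lincomb hs c j) x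
  change |iteratedDeriv j (fun x => ∑ i, c i * e i x) x -
    iteratedDeriv j (fun x => ∑ i, c' i * e i x) x| ≤ _
  rw [h1, h1, ← Finset.sum_sub_distrib]
  refine (Finset.abs_sum_le_sum_abs _ _).trans ?_
  have : ∀ i ∈ Finset.univ, |c i * iteratedDeriv j (e i) x - c' i * iteratedDeriv j (e i) x| ≤
      B * ‖c - c'‖ := by
    intro i _
    rw [← sub_mul, abs_mul, mul_comm]
    exact mul_le_mul (hB i) (norm_le_pi_norm (c - c') i) (abs_nonneg _)
      ((abs_nonneg _).trans (hB i))
  refine (Finset.sum_le_card_nsmul _ _ _ this).trans ?_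
  simp [mul_assoc]

lemma jets_sub_le {y u y' u' : ℝ → ℝ} {x D : ℝ} (hx : x ∈ Icc (0:ℝ) 1)
    (hy : ∀ j ≤ 2, |iteratedDeriv j y x - iteratedDeriv j y' x| ≤ D)
    (hu : ∀ j ≤ 2, |iteratedDeriv j u x - iteratedDeriv j u' x| ≤ D) :
    ∀ c, |jets y u c x - jets y' u' c x| ≤ D := by
  intro c
  fin_cases c
  · simpa [jets] using hy 0 (by norm_num)
  · exact hy 1 (by norm_num)
  · change |qf x * _ - qf x * _| ≤ D
    rw [← mul_sub, abs_mul, abs_of_nonneg (qf_nonneg hx)]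
    calc _ ≤ 1 * |iteratedDeriv 2 y x - iteratedDeriv 2 y' x| := by
          gcongr; exact qf_le_one hx
      _ ≤ D := by rw [one_mul]; exact hy 2 le_rfl
  · simpa [jets] using hu 0 (by norm_num)
  · exact hu 1 (by norm_num)

/-- A field on space-time, smooth in space and continuous in time with all spatial derivatives. -/
structure STF (f : ℝ → ℝ → ℝ) : Prop where
  smooth : ∀ t, ContDiff ℝ ∞ (f t)
  cont : ∀ j, Continuous fun p : ℝ × ℝ => iteratedDeriv j (f p.1) p.2

/-- All spatial derivatives satisfy `∂ₜ f = κ f'`. -/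
def DtRel (κ : ℝ → ℝ) (f f' : ℝ → ℝ → ℝ) : Prop :=
  ∀ j t x, HasDerivAt (fun s => iteratedDeriv j (f s) x) (κ t * iteratedDeriv j (f' t) x) t

/-- Solutions of the Galerkin system. -/
structure GSol (N : ℝ) (F : ℝ × (Fin 5 → ℝ) → ℝ) (κ : ℝ → ℝ) {r : ℕ} (e : Fin r → ℝ → ℝ)
    (y u g : ℝ → ℝ → ℝ) : Prop where
  sy : STF y
  su : STF u
  sg : STF g
  dy : DtRel κ y u
  du : DtRel κ u g
  span : ∀ t, ∃ d : Fin r → ℝ, u t = lc e d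
  eq : ∀ t, g t = proj N e (comp F (jets (y t) (u t)))

lemma stf_lc {r : ℕ} {e : Fin r → ℝ → ℝ} (hs : ∀ i, ContDiff ℝ ∞ (e i)) {c : ℝ → Fin r → ℝ}
    (hc : Continuous c) : STF fun t => lc e (c t) := by
  refine ⟨fun t => contDiff_lincomb hs _, fun j => ?_⟩
  have h1 := fun i => continuous_iteratedDeriv (hs i) j
  have : (fun p : ℝ × ℝ => iteratedDeriv j (lc e (c p.1)) p.2) =
      fun p => ∑ i, c p.1 i * iteratedDeriv j (e i) p.2 := by
    ext p; exact congrFun (iteratedDeriv_lincomb hs (c p.1) j) p.2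
  rw [this]
  fun_prop

lemma dtRel_lc {κ : ℝ → ℝ} {r : ℕ} {e : Fin r → ℝ → ℝ} (hs : ∀ i, ContDiff ℝ ∞ (e i))
    {c c' : ℝ → Fin r → ℝ} (hc : ∀ t, HasDerivAt c (κ t • c' t) t) :
    DtRel κ (fun t => lc e (c t)) (fun t => lc e (c' t)) := by
  intro j t x
  have h1 : ∀ c : Fin r → ℝ, iteratedDeriv j (lc e c) x = ∑ i, c i * iteratedDeriv j (e i) x :=
    fun c => congrFun (iteratedDeriv_lincomb hs c j) x
  simp only [h1, Finset.mul_sum]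
  refine HasDerivAt.fun_sum fun i _ => ?_
  have := (hasDerivAt_pi.1 (hc t) i).mul_const (iteratedDeriv j (e i) x)
  simpa [mul_assoc] using this

lemma exists_bound_iteratedDeriv {r : ℕ} {e : Fin r → ℝ → ℝ} (hs : ∀ i, ContDiff ℝ ∞ (e i)) :
    ∃ B : ℝ, 0 ≤ B ∧ ∀ j ≤ 2, ∀ i, ∀ x ∈ Icc (0:ℝ) 1, |iteratedDeriv j (e i) x| ≤ B := by
  have := fun (j : ℕ) (i : Fin r) => isCompact_Icc.exists_bound_of_continuousOn
    (continuous_iteratedDeriv (hs i) j).continuousOn (s := Icc (0:ℝ) 1)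
  choose B hB using this
  refine ⟨∑ j ∈ Finset.range 3, ∑ i, |B j i|, by positivity, fun j hj i x hx => ?_⟩
  calc _ ≤ |B j i| := (hB j i x hx).trans (le_abs_self _)
    _ ≤ ∑ i, |B j i| := Finset.single_le_sum (f := fun i => |B j i|) (fun _ _ => abs_nonneg _)
        (Finset.mem_univ i)
    _ ≤ _ := Finset.single_le_sum (f := fun j => ∑ i, |B j i|)
        (fun _ _ => Finset.sum_nonneg fun _ _ => abs_nonneg _) (Finset.mem_range.2 (by omega))

lemma abs_ip_le {N : ℝ} (hN : 4 < N) {f g : ℝ → ℝ} (hf : Continuous f) (hg : Continuous g) {A B : ℝ}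
    (hA : ∀ x ∈ Icc (0:ℝ) 1, |f x| ≤ A) (hB : ∀ x ∈ Icc (0:ℝ) 1, |g x| ≤ B) :
    |ip N f g| ≤ A * B := by
  have hw := continuous_wt hN
  refine (abs_integral_le_integral_abs zero_le_one).trans ?_
  have : ∫ x in (0:ℝ)..1, |wt N x * (f x * g x)| ≤ ∫ x in (0:ℝ)..1, A * B := by
    refine integral_mono_cont (by fun_prop) continuous_const fun x hx => ?_
    rw [abs_mul, abs_mul, abs_of_nonneg (wt_nonneg N hx)]
    have h1 := mul_le_mul (hA x hx) (hB x hx) (abs_nonneg _) ((abs_nonneg _).trans (hA x hx))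
    have h2 : 0 ≤ |f x| * |g x| := by positivity
    calc _ ≤ 1 * (|f x| * |g x|) := by gcongr; exact wt_le_one hN hx
      _ ≤ _ := by rwa [one_mul]
  simpa using this

lemma exists_gSol {N : ℝ} (hN : 4 < N) {F : ℝ × (Fin 5 → ℝ) → ℝ} (hF : Sm F)
    {κ : ℝ → ℝ} (hκ : Continuous κ) (hκ1 : ∀ t, |κ t| ≤ 1) {R : ℝ} (hR : 0 < R)
    (hκ0 : ∀ t, R ≤ |t| → κ t = 0) {r : ℕ} {e : Fin r → ℝ → ℝ} (he : GBasis N e) (ψ φ : ℝ → ℝ) :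
    ∃ y u g : ℝ → ℝ → ℝ, GSol N F κ e y u g ∧ y 0 = proj N e ψ ∧ u 0 = proj N e φ := by
  obtain ⟨B, hB, hBe⟩ := exists_bound_iteratedDeriv he.smooth
  obtain ⟨A, hA, hFA⟩ := hF.bdd
  obtain ⟨C, hC, hFC⟩ := hF.lip
  have hsm := fun c => contDiff_lincomb he.smooth c
  have hcc : ∀ c d : Fin r → ℝ, Continuous (comp F (jets (lc e c) (lc e d))) := fun c d =>
    (contDiff_comp hF.smooth (contDiff_jets (hsm c) (hsm d))).continuous
  set Φ : (Fin r → ℝ) → (Fin r → ℝ) → (Fin r → ℝ) := fun c d i =>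
    ip N (comp F (jets (lc e c) (lc e d))) (e i) with hΦ
  have hBx : ∀ i, ∀ x ∈ Icc (0:ℝ) 1, |e i x| ≤ B := fun i x hx => by
    simpa using hBe 0 (by norm_num) i x hx
  obtain ⟨c, d, hc0, hd0, hc, hd⟩ := exists_global_ode hκ hκ1 hR hκ0 (Φ := Φ)
    (K := C * (r * B) * B) (M := A * B) (by positivity) (by positivity)
    (fun a b a' b' => by
      refine (pi_norm_le_iff_of_nonneg (by positivity)).2 fun i => ?_
      have h1 : Φ a b i - Φ a' b' i = ip N (fun x => comp F (jets (lc e a) (lc e b)) x +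
          (-1) * comp F (jets (lc e a') (lc e b')) x) (e i) := by
        have h2 := ip_add_left hN (f := comp F (jets (lc e a) (lc e b)))
          (f' := fun x => (-1) * comp F (jets (lc e a') (lc e b')) x) (hcc a b)
          (continuous_const.mul (hcc a' b')) (he.smooth i).continuous
        rw [h2, ip_smul_left]
        simp only [hΦ]; ring
      rw [Pi.sub_apply, h1, Real.norm_eq_abs]
      have := abs_ip_le hN (f := fun x => comp F (jets (lc e a) (lc e b)) x +
          (-1) * comp F (jets (lc e a') (lc e b')) x) (g := e i)
          (A := C * (r * B * (‖a - a'‖ + ‖b - b'‖))) (B := B)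
          ((hcc a b).add (continuous_const.mul (hcc a' b'))) (he.smooth i).continuous
          (fun x hx => ?_) (hBx i)
      · refine this.trans (le_of_eq (by ring))
      · have h2 : comp F (jets (lc e a) (lc e b)) x + (-1) * comp F (jets (lc e a') (lc e b')) x =
          F (x, fun k => jets (lc e a) (lc e b) k x) - F (x, fun k => jets (lc e a') (lc e b') k x) := by
          unfold comp; ring
        rw [h2]
        refine (hFC _ _ _).trans (mul_le_mul_of_nonneg_left ?_ hC)
        refine (pi_norm_le_iff_of_nonneg (by positivity)).2 fun k => ?_
        refine jets_sub_le hx (fun j hj => ?_) (fun j hj => ?_) k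
        · refine (abs_lc_sub_le he.smooth (fun i => hBe j hj i x hx) a a').trans ?_
          have := norm_nonneg (b - b')
          gcongr; linarith
        · refine (abs_lc_sub_le he.smooth (fun i => hBe j hj i x hx) b b').trans ?_
          have := norm_nonneg (a - a')
          gcongr; linarith)
    (fun a b => (pi_norm_le_iff_of_nonneg (by positivity)).2 fun i =>
      abs_ip_le hN (hcc a b) (he.smooth i).continuous (fun x _ => hFA _) (hBx i))
    (fun i => ip N ψ (e i)) (fun i => ip N φ (e i))
  have hcC : Continuous c := continuous_iff_continuousAt.2 fun t => (hc t).continuousAt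
  have hdC : Continuous d := continuous_iff_continuousAt.2 fun t => (hd t).continuousAt
  have hΦC : Continuous fun t => Φ (c t) (d t) := by
    refine continuous_pi fun i => ?_
    have hw := continuous_wt hN
    have hei := (he.smooth i).continuous
    have hj : ∀ k, Continuous fun p : ℝ × ℝ => jets (lc e (c p.1)) (lc e (d p.1)) k p.2 := by
      intro k
      have h1 := (stf_lc he.smooth hcC).cont
      have h2 := (stf_lc he.smooth hdC).cont
      have h3 := continuous_qf
      fin_cases k
      · simpa [jets] using h1 0
      · exact h1 1
      · exact (h3.comp continuous_snd).mul (h1 2)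
      · simpa [jets] using h2 0
      · exact h2 1
    have hFc := hF.smooth.continuous
    refine continuous_parametric_intervalIntegral_of_continuous' ?_ 0 1
    unfold comp Function.uncurry
    have : Continuous fun p : ℝ × ℝ => F (p.2, fun k => jets (lc e (c p.1)) (lc e (d p.1)) k p.2) :=
      hFc.comp (continuous_snd.prodMk (continuous_pi hj))
    exact (hw.comp continuous_snd).mul (this.mul (hei.comp continuous_snd))
  refine ⟨fun t => lc e (c t), fun t => lc e (d t), fun t => lc e (Φ (c t) (d t)),
    ⟨stf_lc he.smooth hcC, stf_lc he.smooth hdC, stf_lc he.smooth hΦC, dtRel_lc he.smooth hc,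
      dtRel_lc he.smooth hd, fun t => ⟨_, rfl⟩, fun t => rfl⟩, ?_, ?_⟩
  · simp only [hc0]; rfl
  · simp only [hd0]; rfl

lemma GSol.gal {N : ℝ} (hN : 4 < N) {F : ℝ × (Fin 5 → ℝ) → ℝ} (hF : Sm F) {κ : ℝ → ℝ} {r : ℕ}
    {e : Fin r → ℝ → ℝ} (he : GBasis N e) {y u g : ℝ → ℝ → ℝ} (h : GSol N F κ e y u g)
    (k : ℕ) (t : ℝ) : Gal N k F (y t) (u t) (g t) := by
  have hs := contDiff_comp hF.smooth (contDiff_jets (h.sy.smooth t) (h.su.smooth t))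
  obtain ⟨d, hd⟩ := h.span t
  refine ⟨fun i _ => ?_, fun i _ => ?_⟩
  · have := he.pair_sum hN d hs i
    rw [h.eq t]
    rw [hd] at this ⊢
    exact this
  · rw [h.eq t]
    exact he.Hk_proj_le hN hs i

end JacobiWave

namespace JacobiWave

open MeasureTheory intervalIntegral
open scoped ContDiff

lemma hasDerivAt_integral_of_cont {f f' : ℝ → ℝ → ℝ} (hf : ∀ t, Continuous (f t))
    (hf' : Continuous fun p : ℝ × ℝ => f' p.1 p.2)
    (h : ∀ t x, HasDerivAt (fun s => f s x) (f' t x) t) (t : ℝ) :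
    HasDerivAt (fun s => ∫ x in (0:ℝ)..1, f s x) (∫ x in (0:ℝ)..1, f' t x) t := by
  obtain ⟨C, hC⟩ := (isCompact_Icc.prod isCompact_Icc :
    IsCompact (Icc (t - 1) (t + 1) ×ˢ Icc (0:ℝ) 1)).exists_bound_of_continuousOn hf'.continuousOn
  refine (hasDerivAt_integral_of_dominated_loc_of_deriv_le (F := f) (bound := fun _ => C)
    (Icc_mem_nhds (by linarith : t - 1 < t) (by linarith : t < t + 1))
    (Eventually.of_forall fun s => (hf s).aestronglyMeasurable) ((hf t).intervalIntegrable _ _)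
    (by fun_prop : Continuous (f' t)).aestronglyMeasurable
    (Eventually.of_forall fun x hx s hs => ?_) (by simp) (Eventually.of_forall fun x _ s _ => h s x)).2
  rw [uIoc_of_le zero_le_one] at hx
  exact hC (s, x) ⟨hs, Ioc_subset_Icc_self hx⟩

/-- Energy density of order `i`. -/
noncomputable def Ee (N : ℝ) (F : ℝ × (Fin 5 → ℝ) → ℝ) (i : ℕ) (y u : ℝ → ℝ) : ℝ :=
  ∫ x in (0:ℝ)..1, (wt N x * qf x ^ i * (iteratedDeriv i u x ^ 2 + iteratedDeriv i y x ^ 2)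
    + wt N x * qf x ^ (i + 1) * (comp (dJ F 2) (jets y u) x * iteratedDeriv (i + 1) y x ^ 2))

lemma continuous_jets_stf {y u : ℝ → ℝ → ℝ} (hy : STF y) (hu : STF u) (c : Fin 5) :
    Continuous fun p : ℝ × ℝ => jets (y p.1) (u p.1) c p.2 := by
  fin_cases c
  · simpa [jets] using hy.cont 0
  · exact hy.cont 1
  · exact (continuous_qf.comp continuous_snd).mul (hy.cont 2)
  · simpa [jets] using hu.cont 0
  · exact hu.cont 1

lemma continuous_comp_stf {G : ℝ × (Fin 5 → ℝ) → ℝ} (hG : Continuous G) {y u : ℝ → ℝ → ℝ}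
    (hy : STF y) (hu : STF u) :
    Continuous fun p : ℝ × ℝ => comp G (jets (y p.1) (u p.1)) p.2 :=
  hG.comp (continuous_snd.prodMk (continuous_pi (continuous_jets_stf hy hu)))

lemma hasDerivAt_jets_time {κ : ℝ → ℝ} {y u g : ℝ → ℝ → ℝ} (hy : DtRel κ y u) (hu : DtRel κ u g)
    (t x : ℝ) (c : Fin 5) :
    HasDerivAt (fun s => jets (y s) (u s) c x) (κ t * jets (u t) (g t) c x) t := by
  fin_cases c
  · simpa [jets] using hy 0 t x
  · exact hy 1 t x
  · have := (hy 2 t x).const_mul (qf x)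
    change HasDerivAt _ (κ t * (qf x * iteratedDeriv 2 (u t) x)) t
    refine this.congr_deriv ?_
    ring
  · simpa [jets] using hu 0 t x
  · exact hu 1 t x

lemma hasDerivAt_comp_time {κ : ℝ → ℝ} {y u g : ℝ → ℝ → ℝ} (hy : DtRel κ y u) (hu : DtRel κ u g)
    {G : ℝ × (Fin 5 → ℝ) → ℝ} (hG : Differentiable ℝ G) (t x : ℝ) :
    HasDerivAt (fun s => comp G (jets (y s) (u s)) x)
      (κ t * ∑ c, comp (dJ G c) (jets (y t) (u t)) x * jets (u t) (g t) c x) t := by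
  have h1 : HasDerivAt (fun s => (x, fun c => jets (y s) (u s) c x))
      ((0:ℝ), fun c => κ t * jets (u t) (g t) c x) t :=
    (hasDerivAt_const t x).prodMk (hasDerivAt_pi.2 fun c => hasDerivAt_jets_time hy hu t x c)
  have := (hG (x, fun c => jets (y t) (u t) c x)).hasFDerivAt.comp_hasDerivAt t h1
  rw [fderiv_apply_eq_sum, zero_mul, zero_add] at this
  refine this.congr_deriv ?_
  rw [Finset.mul_sum]
  exact Finset.sum_congr rfl fun c _ => by unfold comp; ring

lemma hasDerivAt_Ee {N : ℝ} (hN : 4 < N) {F : ℝ × (Fin 5 → ℝ) → ℝ} (hF : Sm F) {κ : ℝ → ℝ}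
    (hκ : Continuous κ) {r : ℕ} {e : Fin r → ℝ → ℝ} {y u g : ℝ → ℝ → ℝ} (h : GSol N F κ e y u g)
    (i : ℕ) (t : ℝ) :
    HasDerivAt (fun s => Ee N F i (y s) (u s)) (κ t * Dt N F i (y t) (u t) (g t)) t := by
  have hw := continuous_wt hN
  have hq := continuous_qf
  have hA := continuous_comp_stf (hF.dJ 2).smooth.continuous h.sy h.su
  have hAt : Continuous fun p : ℝ × ℝ => At F (y p.1) (u p.1) (g p.1) p.2 := by
    refine continuous_finsetSum _ fun c _ => ?_
    exact (continuous_comp_stf ((hF.dJ 2).dJ c).smooth.continuous h.sy h.su).mul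
      (continuous_jets_stf h.su h.sg c)
  have cy := h.sy.cont
  have cu := h.su.cont
  have cg := h.sg.cont
  unfold Dt Ee
  rw [← intervalIntegral.integral_const_mul]
  refine hasDerivAt_integral_of_cont (f' := fun t x => κ t * (wt N x * qf x ^ i *
      (2 * (iteratedDeriv i (u t) x * iteratedDeriv i (g t) x)
      + 2 * (iteratedDeriv i (y t) x * iteratedDeriv i (u t) x))
    + wt N x * qf x ^ (i + 1) * (At F (y t) (u t) (g t) x * iteratedDeriv (i + 1) (y t) x ^ 2
      + 2 * (comp (dJ F 2) (jets (y t) (u t)) x *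
        (iteratedDeriv (i + 1) (y t) x * iteratedDeriv (i + 1) (u t) x))))) ?_ ?_ ?_ t
  · intro t
    have h1 := continuous_iteratedDeriv (h.sy.smooth t)
    have h2 := continuous_iteratedDeriv (h.su.smooth t)
    have h3 := (contDiff_comp (hF.dJ 2).smooth (contDiff_jets (h.sy.smooth t) (h.su.smooth t))).continuous
    have := h1 i
    have := h1 (i + 1)
    have := h2 i
    fun_prop
  · have := cy i
    have := cy (i + 1)
    have := cu i
    have := cu (i + 1)
    have := cg i
    have hw2 := hw.comp (continuous_snd (X := ℝ) (Y := ℝ))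
    have hq2 := hq.comp (continuous_snd (X := ℝ) (Y := ℝ))
    have hκ2 := hκ.comp (continuous_fst (X := ℝ) (Y := ℝ))
    simp only [Function.comp_def] at hw2 hq2 hκ2
    fun_prop
  · intro t x
    have d1 := (h.du i t x).fun_pow 2
    have d2 := (h.dy i t x).fun_pow 2
    have d3 := (h.dy (i + 1) t x).fun_pow 2
    have d4 := hasDerivAt_comp_time h.dy h.du ((hF.dJ 2).smooth.differentiable (by simp)) t x
    have := ((d1.fun_add d2).const_mul (wt N x * qf x ^ i)).fun_add
      ((d4.fun_mul d3).const_mul (wt N x * qf x ^ (i + 1)))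
    refine this.congr_deriv ?_
    unfold At
    simp only [Nat.cast_ofNat, Nat.add_one_sub_one, pow_one]
    ring

lemma continuous_Hk_stf {N : ℝ} (hN : 4 < N) {y : ℝ → ℝ → ℝ} (hy : STF y) (i : ℕ) :
    Continuous fun t => Hk N i (y t) := by
  refine continuous_parametric_intervalIntegral_of_continuous' ?_ 0 1
  have hw := continuous_wt hN
  have hq := continuous_qf
  have := hy.cont i
  unfold Function.uncurry
  have hw2 := hw.comp (continuous_snd (X := ℝ) (Y := ℝ))
  have hq2 := hq.comp (continuous_snd (X := ℝ) (Y := ℝ))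
  simp only [Function.comp_def] at hw2 hq2
  fun_prop

lemma continuous_En_stf {N : ℝ} (hN : 4 < N) {y u : ℝ → ℝ → ℝ} (hy : STF y) (hu : STF u) (k : ℕ) :
    Continuous fun t => En N k (y t) (u t) :=
  (continuous_finsetSum _ fun i _ => continuous_Hk_stf hN hy i).add
    (continuous_finsetSum _ fun i _ => continuous_Hk_stf hN hu i)

lemma Ee_bounds {N : ℝ} (hN : 4 < N) {ρ : ℝ} {F : ℝ × (Fin 5 → ℝ) → ℝ} (hF : Adm N ρ F)
    {y u : ℝ → ℝ} (hy : ContDiff ℝ ∞ y) (hu : ContDiff ℝ ∞ u)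
    (hρ : ∀ c, ∀ x ∈ Icc (0:ℝ) 1, |jets y u c x| ≤ ρ) (i : ℕ) :
    Hk N i u + Hk N i y + 1 / 2 * Hk N (i + 1) y ≤ Ee N F i y u ∧
    Ee N F i y u ≤ Hk N i u + Hk N i y + 2 * Hk N (i + 1) y := by
  have hw := continuous_wt hN
  have hq := continuous_qf
  have h1 := continuous_iteratedDeriv hy i
  have h1' := continuous_iteratedDeriv hy (i + 1)
  have h2 := continuous_iteratedDeriv hu i
  have h3 := (contDiff_comp (hF.sm.dJ 2).smooth (contDiff_jets hy hu)).continuous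
  have key : ∀ a : ℝ, Hk N i u + Hk N i y + a * Hk N (i + 1) y = ∫ x in (0:ℝ)..1,
      (wt N x * qf x ^ i * (iteratedDeriv i u x ^ 2 + iteratedDeriv i y x ^ 2)
      + wt N x * qf x ^ (i + 1) * (a * iteratedDeriv (i + 1) y x ^ 2)) := by
    intro a
    unfold Hk
    rw [← intervalIntegral.integral_const_mul, ← intervalIntegral.integral_add
      (Continuous.intervalIntegrable (by fun_prop) _ _)
      (Continuous.intervalIntegrable (by fun_prop) _ _),
      ← intervalIntegral.integral_add (Continuous.intervalIntegrable (by fun_prop) _ _)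
      (Continuous.intervalIntegrable (by fun_prop) _ _)]
    congr 1; ext x; ring
  rw [key, key]
  refine ⟨integral_mono_cont (by fun_prop) (by fun_prop) fun x hx => ?_,
    integral_mono_cont (by fun_prop) (by fun_prop) fun x hx => ?_⟩
  · have := hF.lo x hx (fun c => jets y u c x) (fun c => hρ c x hx)
    have := wt_nonneg N hx
    have := qf_nonneg hx
    gcongr
    assumption
  · have := hF.hi x hx (fun c => jets y u c x) (fun c => hρ c x hx)
    have := wt_nonneg N hx
    have := qf_nonneg hx
    gcongr
    assumption

/-- Total energy of order `k`. -/
noncomputable def Es (N : ℝ) (F : ℝ × (Fin 5 → ℝ) → ℝ) (k : ℕ) (y u : ℝ → ℝ) : ℝ :=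
  ∑ i ∈ Finset.range (k + 1), Ee N F i y u

lemma Es_bounds {N : ℝ} (hN : 4 < N) {ρ : ℝ} {F : ℝ × (Fin 5 → ℝ) → ℝ} (hF : Adm N ρ F)
    {y u : ℝ → ℝ} (hy : ContDiff ℝ ∞ y) (hu : ContDiff ℝ ∞ u)
    (hρ : ∀ c, ∀ x ∈ Icc (0:ℝ) 1, |jets y u c x| ≤ ρ) (k : ℕ) :
    En N k y u ≤ 2 * Es N F k y u ∧ Es N F k y u ≤ 3 * En N k y u := by
  have hb := Ee_bounds hN hF hy hu hρ
  have h0 : 0 ≤ ∑ i ∈ Finset.range (k + 1), Hk N i u := Finset.sum_nonneg fun _ _ => Hk_nonneg _ _ _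
  have h0' : 0 ≤ ∑ i ∈ Finset.range (k + 1), Hk N i y := Finset.sum_nonneg fun _ _ => Hk_nonneg _ _ _
  have h0'' : 0 ≤ ∑ i ∈ Finset.range (k + 1), Hk N (i + 1) y :=
    Finset.sum_nonneg fun _ _ => Hk_nonneg _ _ _
  have e1 : ∑ i ∈ Finset.range (k + 2), Hk N i y =
    ∑ i ∈ Finset.range (k + 1), Hk N (i + 1) y + Hk N 0 y := Finset.sum_range_succ' _ _
  have e2 : ∑ i ∈ Finset.range (k + 2), Hk N i y =
    ∑ i ∈ Finset.range (k + 1), Hk N i y + Hk N (k + 1) y := Finset.sum_range_succ _ _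
  have h3 := Hk_nonneg N (k + 1) y
  have h4 := Hk_nonneg N 0 y
  have h5 : Hk N 0 y ≤ ∑ i ∈ Finset.range (k + 1), Hk N i y :=
    Finset.single_le_sum (f := fun i => Hk N i y) (fun _ _ => Hk_nonneg _ _ _)
      (Finset.mem_range.2 (by omega))
  have l1 := Finset.sum_le_sum (s := Finset.range (k + 1)) fun i _ => (hb i).1
  have l2 := Finset.sum_le_sum (s := Finset.range (k + 1)) fun i _ => (hb i).2
  simp only [Finset.sum_add_distrib, ← Finset.mul_sum] at l1 l2
  unfold En Es
  constructor
  · rw [e1]; linarith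
  · linarith

end JacobiWave

namespace JacobiWave

open MeasureTheory intervalIntegral
open scoped ContDiff

lemma bootstrap_forward {Q S D : ℝ → ℝ} {C ε R : ℝ} (hQ : Continuous Q) (hC : 0 ≤ C) (hQ0 : ∀ t, 0 ≤ Q t)
    (hS : ∀ t, HasDerivAt S (D t) t)
    (h : ∀ t ∈ Icc 0 R, Q t ≤ ε → D t ≤ C * Q t ∧ Q t ≤ 2 * S t ∧ S t ≤ 3 * Q t)
    (hsmall : 6 * Q 0 * exp (2 * C * R) < ε) {t : ℝ} (ht : t ∈ Icc 0 R) :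
    Q t ≤ 6 * Q 0 * exp (2 * C * R) := by
  by_contra! hlt
  set B := 6 * Q 0 * exp (2 * C * R) with hB
  have hR : 0 ≤ R := ht.1.trans ht.2
  have hexp : 1 ≤ exp (2 * C * R) := one_le_exp (by positivity)
  have hQB : Q 0 ≤ B := by have := hQ0 0; nlinarith
  set ε' := min (Q t) ε with hε'
  have hε'B : B < ε' := lt_min hlt hsmall
  have hcomp : IsCompact (Icc 0 R ∩ {s | ε' ≤ Q s}) :=
    isCompact_Icc.inter_right (isClosed_le continuous_const hQ)
  obtain ⟨s, ⟨hs, hsQ⟩, hmin⟩ := hcomp.exists_isLeast ⟨t, ht, (min_le_left _ _ : ε' ≤ Q t)⟩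
  have hlt : ∀ τ ∈ Ico 0 s, Q τ < ε' := fun τ hτ => by
    by_contra! hc
    exact absurd (hmin ⟨⟨hτ.1, hτ.2.le.trans hs.2⟩, hc⟩) (not_le.2 hτ.2)
  have hs0 : 0 < s := by
    rcases hs.1.eq_or_lt with h0 | h0
    · subst h0; exact absurd hsQ (not_le.2 (hQB.trans_lt hε'B))
    · exact h0
  have hle : ∀ τ ∈ Icc 0 s, Q τ ≤ ε := by
    have h1 : Icc 0 s ⊆ {τ | Q τ ≤ ε'} := by
      rw [← closure_Ico hs0.ne]
      exact closure_minimal (fun τ hτ => (hlt τ hτ).le) (isClosed_le hQ continuous_const)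
    exact fun τ hτ => (h1 hτ).trans (min_le_right _ _)
  have hder : ∀ τ, HasDerivAt (fun τ => S τ * exp (-(2 * C) * τ))
      (D τ * exp (-(2 * C) * τ) + S τ * (exp (-(2 * C) * τ) * (-(2 * C)))) τ := fun τ => by
    have := ((hasDerivAt_id' τ).const_mul (-(2 * C))).exp
    exact (hS τ).fun_mul (by simpa using this)
  have hanti : AntitoneOn (fun τ => S τ * exp (-(2 * C) * τ)) (Icc 0 s) := by
    refine antitoneOn_of_deriv_nonpos (convex_Icc _ _) (fun τ _ => (hder τ).continuousAt.continuousWithinAt)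
      (fun τ _ => (hder τ).differentiableAt.differentiableWithinAt) fun τ hτ => ?_
    rw [interior_Icc] at hτ
    have hτ' := Ioo_subset_Icc_self hτ
    obtain ⟨a, b, -⟩ := h τ ⟨hτ'.1, hτ'.2.trans hs.2⟩ (hle τ hτ')
    rw [(hder τ).deriv]
    have he := exp_pos (-(2 * C) * τ)
    have : D τ - 2 * C * S τ ≤ 0 := by nlinarith
    nlinarith
  have h1 := hanti (left_mem_Icc.2 hs0.le) (right_mem_Icc.2 hs0.le) hs0.le
  simp only [mul_zero, exp_zero, mul_one] at h1
  obtain ⟨-, b, -⟩ := h s hs (hle s (right_mem_Icc.2 hs0.le))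
  obtain ⟨-, -, c⟩ := h 0 ⟨le_rfl, hR⟩ (hle 0 (left_mem_Icc.2 hs0.le))
  have h2 : S s = S s * exp (-(2 * C) * s) * exp (2 * C * s) := by
    rw [mul_assoc, ← exp_add]; simp
  have h3 : exp (2 * C * s) ≤ exp (2 * C * R) := exp_le_exp.2 (by nlinarith [hs.2])
  have h4 := exp_pos (2 * C * s)
  have h5 : S s ≤ 3 * Q 0 * exp (2 * C * R) := by
    have h6 := hQ0 0
    have h7 := mul_le_mul_of_nonneg_right (h1.trans c) h4.le
    rw [← h2] at h7
    exact h7.trans (by gcongr)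
  have : Q s ≤ B := by rw [hB]; linarith
  exact absurd hsQ (not_le.2 (this.trans_lt hε'B))

lemma bootstrap {Q S D : ℝ → ℝ} {C ε R : ℝ} (hQ : Continuous Q) (hC : 0 ≤ C) (hQ0 : ∀ t, 0 ≤ Q t)
    (hS : ∀ t, HasDerivAt S (D t) t)
    (h : ∀ t, Q t ≤ ε → |D t| ≤ C * Q t ∧ Q t ≤ 2 * S t ∧ S t ≤ 3 * Q t)
    (hsmall : 6 * Q 0 * exp (2 * C * R) < ε) {t : ℝ} (ht : |t| ≤ R) :
    Q t ≤ 6 * Q 0 * exp (2 * C * R) := by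
  rcases le_total 0 t with h0 | h0
  · rw [abs_of_nonneg h0] at ht
    exact bootstrap_forward hQ hC hQ0 hS (fun t _ hq => ⟨(le_abs_self _).trans (h t hq).1, (h t hq).2⟩)
      hsmall ⟨h0, ht⟩
  · rw [abs_of_nonpos h0] at ht
    have := bootstrap_forward (Q := fun t => Q (-t)) (S := fun t => S (-t)) (D := fun t => -D (-t))
      (R := R) (hQ.comp continuous_neg) hC (fun t => hQ0 _)
      (fun t => by
        have := (hS (-t)).comp t (hasDerivAt_neg t)
        simpa [Function.comp_def] using this)
      (fun t _ hq => ⟨(neg_le_abs _).trans (h (-t) hq).1, (h (-t) hq).2⟩)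
      (by simpa using hsmall) (t := -t) ⟨by linarith, ht⟩
    simpa using this

lemma DtRel.eq_clamp {κ : ℝ → ℝ} {R : ℝ} (hR : 0 < R) (hκ0 : ∀ t, R ≤ |t| → κ t = 0)
    {f f' : ℝ → ℝ → ℝ} (h : DtRel κ f f') (t : ℝ) : f t = f (max (-R) (min R t)) := by
  have hd : ∀ t, R ≤ |t| → ∀ x, HasDerivAt (fun s => f s x) 0 t := fun t ht x => by
    simpa [hκ0 t ht] using h 0 t x
  have hc : ∀ t x, ContinuousAt (fun s => f s x) t := fun t x => by
    simpa using (h 0 t x).continuousAt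
  rcases le_total t (-R) with h1 | h1
  · rw [min_eq_right (by linarith), max_eq_left h1]
    ext x
    refine (constant_of_has_deriv_right_zero (f := fun s => f s x) (a := t) (b := -R)
      (fun s _ => (hc s x).continuousWithinAt) (fun s hs => ?_) (-R) (right_mem_Icc.2 h1)).symm
    exact (hd s (by rw [abs_of_neg (by linarith [hs.2])]; linarith [hs.2]) x).hasDerivWithinAt
  · rcases le_total t R with h2 | h2
    · rw [min_eq_right h2, max_eq_right h1]
    · rw [min_eq_left h2, max_eq_right (by linarith)]
      ext x
      refine constant_of_has_deriv_right_zero (f := fun s => f s x) (a := R) (b := t)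
        (fun s _ => (hc s x).continuousWithinAt) (fun s hs => ?_) t (right_mem_Icc.2 h2)
      exact (hd s (by rw [abs_of_nonneg (by linarith [hs.1])]; exact hs.1) x).hasDerivWithinAt

lemma hasDerivAt_Es {N : ℝ} (hN : 4 < N) {F : ℝ × (Fin 5 → ℝ) → ℝ} (hF : Sm F) {κ : ℝ → ℝ}
    (hκ : Continuous κ) {r : ℕ} {e : Fin r → ℝ → ℝ} {y u g : ℝ → ℝ → ℝ} (h : GSol N F κ e y u g)
    (k : ℕ) (t : ℝ) :
    HasDerivAt (fun s => Es N F k (y s) (u s))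
      (κ t * ∑ i ∈ Finset.range (k + 1), Dt N F i (y t) (u t) (g t)) t := by
  rw [Finset.mul_sum]
  exact HasDerivAt.fun_sum fun i _ => hasDerivAt_Ee hN hF hκ h i t

lemma En_proj_le {N : ℝ} (hN : 4 < N) {r : ℕ} {e : Fin r → ℝ → ℝ} (he : GBasis N e) {ψ φ : ℝ → ℝ}
    (hψ : ContDiff ℝ ∞ ψ) (hφ : ContDiff ℝ ∞ φ) (k : ℕ) :
    En N k (proj N e ψ) (proj N e φ) ≤ En N k ψ φ :=
  add_le_add (Finset.sum_le_sum fun i _ => he.Hk_proj_le hN hψ i)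
    (Finset.sum_le_sum fun i _ => he.Hk_proj_le hN hφ i)

/-- Uniform energy bounds of all orders for Galerkin solutions with small data. -/
theorem exists_uniform_bound {N : ℝ} (hN : 4 < N) {ρ : ℝ} (hρ : 0 < ρ) {F : ℝ × (Fin 5 → ℝ) → ℝ}
    (hF : Adm N ρ F) {κ : ℝ → ℝ} (hκ : Continuous κ) (hκ1 : ∀ t, |κ t| ≤ 1) {R : ℝ} (hR : 0 < R)
    (hκ0 : ∀ t, R ≤ |t| → κ t = 0) :
    ∃ δ : ℝ, 0 < δ ∧ ∀ ψ φ : ℝ → ℝ, ContDiff ℝ ∞ ψ → ContDiff ℝ ∞ φ → En N (2 * sg N) ψ φ ≤ δ →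
      ∀ k, ∃ B : ℝ, 0 ≤ B ∧ ∀ (r : ℕ) (e : Fin r → ℝ → ℝ) (y u g : ℝ → ℝ → ℝ), GBasis N e →
        GSol N F κ e y u g → y 0 = proj N e ψ → u 0 = proj N e φ →
        ∀ t, (∀ c, ∀ x ∈ Icc (0:ℝ) 1, |jets (y t) (u t) c x| ≤ ρ) ∧ En N k (y t) (u t) ≤ B := by
  obtain ⟨Cs, hCs, hsob⟩ := sobolev_En hN 0
  set k₀ := 2 * sg N with hk₀
  have hsg : sg N = gam N + 7 := rfl
  have hjets : ∀ y u : ℝ → ℝ, ContDiff ℝ ∞ y → ContDiff ℝ ∞ u → Cs * En N k₀ y u ≤ ρ ^ 2 →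
      ∀ c, ∀ x ∈ Icc (0:ℝ) 1, |jets y u c x| ≤ ρ := by
    intro y u hy hu hE c x hx
    have h0 := En_mono N (by omega : 0 + sg N ≤ k₀) y u
    have hb : ∀ a ≤ 2, |iteratedDeriv a y x| ≤ ρ ∧ |iteratedDeriv a u x| ≤ ρ := by
      intro a ha
      obtain ⟨h1, h2⟩ := hsob y u hy hu a (by omega) x hx
      rw [Nat.sub_eq_zero_of_le (by omega), pow_zero, one_mul] at h1 h2
      have h3 := (mul_le_mul_of_nonneg_left h0 hCs).trans hE
      exact ⟨abs_le_of_sq_le_sq (h1.trans h3) hρ.le, abs_le_of_sq_le_sq (h2.trans h3) hρ.le⟩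
    fin_cases c
    · simpa [jets] using (hb 0 (by norm_num)).1
    · exact (hb 1 (by norm_num)).1
    · change |qf x * iteratedDeriv 2 y x| ≤ ρ
      rw [abs_mul, abs_of_nonneg (qf_nonneg hx)]
      exact (mul_le_of_le_one_left (abs_nonneg _) (qf_le_one hx)).trans (hb 2 le_rfl).1
    · simpa [jets] using (hb 0 (by norm_num)).2
    · exact (hb 1 (by norm_num)).2
  -- differential inequality of order `k`, given control at a lower order
  have hstep : ∀ m k : ℕ, k ≤ 2 * m + 1 → sg N ≤ m → m + sg N ≤ k → ∀ M : ℝ, 0 ≤ M →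
      ∃ C : ℝ, 0 ≤ C ∧ ∀ (r : ℕ) (e : Fin r → ℝ → ℝ) (y u g : ℝ → ℝ → ℝ), GBasis N e →
        GSol N F κ e y u g → ∀ t, En N (m + sg N) (y t) (u t) ≤ M →
        (∀ c, ∀ x ∈ Icc (0:ℝ) 1, |jets (y t) (u t) c x| ≤ ρ) →
        |κ t * ∑ i ∈ Finset.range (k + 1), Dt N F i (y t) (u t) (g t)| ≤ C * En N k (y t) (u t) := by
    intro m k h1 h2 h3 M hM
    obtain ⟨C, hC, hst⟩ := energy_static hN hF h1 (by omega) h3 hM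
    refine ⟨(k + 1) * C, by positivity, fun r e y u g he h t hE hj => ?_⟩
    rw [abs_mul]
    have h4 := Finset.abs_sum_le_sum_abs (fun i => Dt N F i (y t) (u t) (g t)) (Finset.range (k + 1))
    have h5 : ∑ i ∈ Finset.range (k + 1), |Dt N F i (y t) (u t) (g t)| ≤
        (k + 1) * C * En N k (y t) (u t) := by
      refine (Finset.sum_le_card_nsmul _ _ (C * En N k (y t) (u t)) fun i hi => ?_).trans
        (le_of_eq (by simp [mul_assoc]))
      exact hst _ _ _ (h.sy.smooth t) (h.su.smooth t) (h.sg.smooth t) hE (h.gal hN hF.sm he k t) hj i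
        (by have := Finset.mem_range.1 hi; omega)
    calc _ ≤ 1 * |∑ i ∈ Finset.range (k + 1), Dt N F i (y t) (u t) (g t)| := by gcongr; exact hκ1 t
      _ ≤ _ := by rw [one_mul]; exact h4.trans h5
  obtain ⟨C, hC, hC'⟩ := hstep (sg N) k₀ (by omega) le_rfl (by omega) 1 zero_le_one
  set ε := min 1 (ρ ^ 2 / (Cs + 1)) with hε
  have hε0 : 0 < ε := lt_min one_pos (by positivity)
  have hερ : Cs * ε ≤ ρ ^ 2 := by
    calc Cs * ε ≤ (Cs + 1) * (ρ ^ 2 / (Cs + 1)) := by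
          gcongr
          · linarith
          · exact min_le_right _ _
      _ = ρ ^ 2 := by field_simp
  have hE0 := exp_pos (2 * C * R)
  refine ⟨ε / (7 * exp (2 * C * R)), by positivity, fun ψ φ hψ hφ hE => ?_⟩
  have hlow : ∀ (r : ℕ) (e : Fin r → ℝ → ℝ) (y u g : ℝ → ℝ → ℝ), GBasis N e →
      GSol N F κ e y u g → y 0 = proj N e ψ → u 0 = proj N e φ → ∀ t, |t| ≤ R →
      En N k₀ (y t) (u t) ≤ ε := by
    intro r e y u g he h hy0 hu0 t ht
    have hdat : En N k₀ (y 0) (u 0) ≤ ε / (7 * exp (2 * C * R)) := by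
      rw [hy0, hu0]; exact (En_proj_le hN he hψ hφ k₀).trans hE
    rw [le_div_iff₀ (by positivity)] at hdat
    have hsm : 6 * En N k₀ (y 0) (u 0) * exp (2 * C * R) < ε := by
      have := En_nonneg N k₀ (y 0) (u 0)
      rcases this.eq_or_lt with h0 | h0
      · rw [← h0]; simpa using hε0
      · have : 0 < En N k₀ (y 0) (u 0) * exp (2 * C * R) := by positivity
        nlinarith
    refine (bootstrap (Q := fun t => En N k₀ (y t) (u t)) (S := fun t => Es N F k₀ (y t) (u t))
      (C := C) (ε := ε) (R := R) (continuous_En_stf hN h.sy h.su k₀) hC (fun t => En_nonneg _ _ _ _)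
      (fun t => hasDerivAt_Es hN hF.sm hκ h k₀ t) (fun t hq => ?_) hsm ht).trans hsm.le
    have hj := hjets _ _ (h.sy.smooth t) (h.su.smooth t) ((mul_le_mul_of_nonneg_left hq hCs).trans hερ)
    exact ⟨hC' r e y u g he h t (by rw [← two_mul]; exact hq.trans (min_le_left _ _)) hj,
      Es_bounds hN hF (h.sy.smooth t) (h.su.smooth t) hj k₀⟩
  have hclamp : ∀ t, |max (-R) (min R t)| ≤ R := fun t =>
    abs_le.2 ⟨le_max_left _ _, max_le (by linarith) (min_le_left _ _)⟩
  have hlow' : ∀ (r : ℕ) (e : Fin r → ℝ → ℝ) (y u g : ℝ → ℝ → ℝ), GBasis N e →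
      GSol N F κ e y u g → y 0 = proj N e ψ → u 0 = proj N e φ → ∀ t,
      En N k₀ (y t) (u t) ≤ ε := by
    intro r e y u g he h hy0 hu0 t
    rw [h.dy.eq_clamp hR hκ0 t, h.du.eq_clamp hR hκ0 t]
    exact hlow r e y u g he h hy0 hu0 _ (hclamp t)
  have hj' : ∀ (r : ℕ) (e : Fin r → ℝ → ℝ) (y u g : ℝ → ℝ → ℝ), GBasis N e →
      GSol N F κ e y u g → y 0 = proj N e ψ → u 0 = proj N e φ → ∀ t,
      (∀ c, ∀ x ∈ Icc (0:ℝ) 1, |jets (y t) (u t) c x| ≤ ρ) := fun r e y u g he h hy0 hu0 t =>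
    hjets _ _ (h.sy.smooth t) (h.su.smooth t)
      ((mul_le_mul_of_nonneg_left (hlow' r e y u g he h hy0 hu0 t) hCs).trans hερ)
  intro k
  induction k using Nat.strong_induction_on with
  | _ k ih =>
  by_cases hk : k ≤ k₀
  · exact ⟨ε, hε0.le, fun r e y u g he h hy0 hu0 t => ⟨hj' r e y u g he h hy0 hu0 t,
      (En_mono N hk _ _).trans (hlow' r e y u g he h hy0 hu0 t)⟩⟩
  · obtain ⟨M, hM, hM'⟩ := ih (k / 2 + sg N) (by omega)
    obtain ⟨D, hD, hD'⟩ := hstep (k / 2) k (by omega) (by omega) (by omega) M hM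
    have hEk := En_nonneg N k ψ φ
    refine ⟨6 * En N k ψ φ * exp (2 * D * R), by positivity, fun r e y u g he h hy0 hu0 t =>
      ⟨hj' r e y u g he h hy0 hu0 t, ?_⟩⟩
    rw [h.dy.eq_clamp hR hκ0 t, h.du.eq_clamp hR hκ0 t]
    have hdat : En N k (y 0) (u 0) ≤ En N k ψ φ := by
      rw [hy0, hu0]; exact En_proj_le hN he hψ hφ k
    refine (bootstrap (Q := fun t => En N k (y t) (u t)) (S := fun t => Es N F k (y t) (u t))
      (C := D) (ε := 6 * En N k (y 0) (u 0) * exp (2 * D * R) + 1) (R := R)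
      (continuous_En_stf hN h.sy h.su k) hD (fun t => En_nonneg _ _ _ _)
      (fun t => hasDerivAt_Es hN hF.sm hκ h k t) (fun t _ => ?_) (by linarith) (hclamp t)).trans ?_
    · have hb := hM' r e y u g he h hy0 hu0 t
      exact ⟨hD' r e y u g he h t hb.2 hb.1,
        Es_bounds hN hF (h.sy.smooth t) (h.su.smooth t) hb.1 k⟩
    · gcongr

end JacobiWave

namespace JacobiWave

open MeasureTheory intervalIntegral
open scoped ContDiff

variable {d : ℕ}

/-- Derivatives of a composition are pointwise bounded by those of the inner function. -/
lemma abs_iteratedDeriv_comp_le (a : ℕ) : ∀ {G : ℝ × (Fin d → ℝ) → ℝ}, Sm G → ∀ C : ℝ, ∃ B : ℝ, 0 ≤ B ∧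
    ∀ J : Fin d → ℝ → ℝ, (∀ c, ContDiff ℝ ∞ (J c)) → ∀ x,
    (∀ c, ∀ j ≤ a, |iteratedDeriv j (J c) x| ≤ C) → |iteratedDeriv a (comp G J) x| ≤ B := by
  induction a using Nat.strong_induction_on with
  | _ a ih =>
  intro G hG C
  rcases a with _ | n
  · obtain ⟨B, hB, h⟩ := hG.bdd
    exact ⟨B, hB, fun J _ x _ => by rw [iteratedDeriv_zero]; exact h _⟩
  · obtain ⟨B₀, hB₀, h₀⟩ := ih n (by omega) hG.dX C
    have h1 : ∀ i : ℕ, ∀ c : Fin d, ∃ B : ℝ, 0 ≤ B ∧ (i < n + 1 → ∀ J : Fin d → ℝ → ℝ,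
        (∀ c, ContDiff ℝ ∞ (J c)) → ∀ x, (∀ c, ∀ j ≤ i, |iteratedDeriv j (J c) x| ≤ C) →
        |iteratedDeriv i (comp (dJ G c) J) x| ≤ B) := by
      intro i c
      by_cases hi : i < n + 1
      · obtain ⟨B, hB, h⟩ := ih i hi (hG.dJ c) C
        exact ⟨B, hB, fun _ => h⟩
      · exact ⟨0, le_rfl, fun h => absurd h hi⟩
    choose B hB hBJ using h1
    refine ⟨B₀ + ∑ c, ∑ i ∈ Finset.range (n + 1), (n.choose i : ℝ) * (B i c * |C|), ?_,
      fun J hJ x hx => ?_⟩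
    · have : 0 ≤ ∑ c, ∑ i ∈ Finset.range (n + 1), (n.choose i : ℝ) * (B i c * |C|) :=
        Finset.sum_nonneg fun c _ => Finset.sum_nonneg fun i _ => by have := hB i c; positivity
      linarith
    rw [iteratedDeriv_comp_succ hG.smooth hJ]
    refine (abs_add_le _ _).trans (add_le_add (h₀ J hJ x fun c j hj => hx c j (by omega)) ?_)
    refine (Finset.abs_sum_le_sum_abs _ _).trans (Finset.sum_le_sum fun c _ => ?_)
    refine (Finset.abs_sum_le_sum_abs _ _).trans (Finset.sum_le_sum fun i hi => ?_)
    have hi' := Finset.mem_range.1 hi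
    rw [abs_mul, abs_mul, Nat.abs_cast]
    have e1 := hBJ i c hi' J hJ x fun c j hj => hx c j (by omega)
    have e2 := (hx c (n - i + 1) (by omega)).trans (le_abs_self C)
    gcongr
    exact hB i c

/-- Derivatives of a composition depend in a Lipschitz way on those of the inner function. -/
lemma abs_iteratedDeriv_comp_sub_le (a : ℕ) : ∀ {G : ℝ × (Fin d → ℝ) → ℝ}, Sm G → ∀ C : ℝ, 0 ≤ C →
    ∃ L : ℝ, 0 ≤ L ∧
    ∀ J J' : Fin d → ℝ → ℝ, (∀ c, ContDiff ℝ ∞ (J c)) → (∀ c, ContDiff ℝ ∞ (J' c)) → ∀ x ε, 0 ≤ ε →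
    (∀ c, ∀ j ≤ a, |iteratedDeriv j (J c) x| ≤ C) → (∀ c, ∀ j ≤ a, |iteratedDeriv j (J' c) x| ≤ C) →
    (∀ c, ∀ j ≤ a, |iteratedDeriv j (J c) x - iteratedDeriv j (J' c) x| ≤ ε) →
    |iteratedDeriv a (comp G J) x - iteratedDeriv a (comp G J') x| ≤ L * ε := by
  induction a using Nat.strong_induction_on with
  | _ a ih =>
  intro G hG C hC
  rcases a with _ | n
  · obtain ⟨B, hB, h⟩ := hG.lip
    refine ⟨B, hB, fun J J' _ _ x ε hε _ _ hd => ?_⟩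
    simp only [iteratedDeriv_zero]
    refine (h x _ _).trans (mul_le_mul_of_nonneg_left ?_ hB)
    exact (pi_norm_le_iff_of_nonneg hε).2 fun c => by simpa using hd c 0 le_rfl
  · obtain ⟨L₀, hL₀, h₀⟩ := ih n (by omega) hG.dX C hC
    have h1 : ∀ i : ℕ, ∀ c : Fin d, ∃ L : ℝ, 0 ≤ L ∧ (i < n + 1 → ∀ J J' : Fin d → ℝ → ℝ,
        (∀ c, ContDiff ℝ ∞ (J c)) → (∀ c, ContDiff ℝ ∞ (J' c)) → ∀ x ε, 0 ≤ ε →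
        (∀ c, ∀ j ≤ i, |iteratedDeriv j (J c) x| ≤ C) →
        (∀ c, ∀ j ≤ i, |iteratedDeriv j (J' c) x| ≤ C) →
        (∀ c, ∀ j ≤ i, |iteratedDeriv j (J c) x - iteratedDeriv j (J' c) x| ≤ ε) →
        |iteratedDeriv i (comp (dJ G c) J) x - iteratedDeriv i (comp (dJ G c) J') x| ≤ L * ε) := by
      intro i c
      by_cases hi : i < n + 1
      · obtain ⟨B, hB, h⟩ := ih i hi (hG.dJ c) C hC
        exact ⟨B, hB, fun _ => h⟩
      · exact ⟨0, le_rfl, fun h => absurd h hi⟩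
    choose L hL hLJ using h1
    choose B hB hBJ using fun (i : ℕ) (c : Fin d) => abs_iteratedDeriv_comp_le i (hG.dJ c) C
    refine ⟨L₀ + ∑ c, ∑ i ∈ Finset.range (n + 1), (n.choose i : ℝ) * (L i c * C + B i c), ?_,
      fun J J' hJ hJ' x ε hε hx hx' hd => ?_⟩
    · have : 0 ≤ ∑ c, ∑ i ∈ Finset.range (n + 1), (n.choose i : ℝ) * (L i c * C + B i c) :=
        Finset.sum_nonneg fun c _ => Finset.sum_nonneg fun i _ => by
          have := hL i c; have := hB i c; positivity
      linarith
    rw [iteratedDeriv_comp_succ hG.smooth hJ, iteratedDeriv_comp_succ hG.smooth hJ', add_sub_add_comm,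
      ← Finset.sum_sub_distrib, add_mul, Finset.sum_mul]
    refine (abs_add_le _ _).trans (add_le_add (h₀ J J' hJ hJ' x ε hε (fun c j hj => hx c j (by omega))
      (fun c j hj => hx' c j (by omega)) (fun c j hj => hd c j (by omega))) ?_)
    refine (Finset.abs_sum_le_sum_abs _ _).trans (Finset.sum_le_sum fun c _ => ?_)
    rw [← Finset.sum_sub_distrib, Finset.sum_mul]
    refine (Finset.abs_sum_le_sum_abs _ _).trans (Finset.sum_le_sum fun i hi => ?_)
    have hi' := Finset.mem_range.1 hi
    have e1 := hLJ i c hi' J J' hJ hJ' x ε hε (fun c j hj => hx c j (by omega))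
      (fun c j hj => hx' c j (by omega)) (fun c j hj => hd c j (by omega))
    have e2 := hx c (n - i + 1) (by omega)
    have e3 := hBJ i c J' hJ' x fun c j hj => hx' c j (by omega)
    have e4 := hd c (n - i + 1) (by omega)
    rw [← mul_sub, abs_mul, Nat.abs_cast, mul_assoc]
    refine mul_le_mul_of_nonneg_left ?_ (Nat.cast_nonneg _)
    have : ∀ p q p' q' : ℝ, p * q - p' * q' = (p - p') * q + p' * (q - q') := fun _ _ _ _ => by ring
    rw [this]
    refine (abs_add_le _ _).trans ?_
    rw [abs_mul, abs_mul]
    have f1 := mul_le_mul e1 e2 (abs_nonneg _) (by have := hL i c; positivity)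
    have f2 := mul_le_mul e3 e4 (abs_nonneg _) (hB i c)
    linarith

/-- First order Taylor estimate from a Lipschitz derivative. -/
lemma abs_taylor_le {f f' : ℝ → ℝ} {s : Set ℝ} (hs : Convex ℝ s) {L : ℝ}
    (h : ∀ x ∈ s, HasDerivWithinAt f (f' x) s x) (hL : ∀ x ∈ s, ∀ y ∈ s, |f' x - f' y| ≤ L * |x - y|)
    {x y : ℝ} (hx : x ∈ s) (hy : y ∈ s) : |f y - f x - (y - x) * f' x| ≤ L * (y - x) ^ 2 := by
  have hsub : uIcc x y ⊆ s := hs.ordConnected.uIcc_subset hx hy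
  have hL0 : 0 ≤ L * |y - x| := (abs_nonneg _).trans (hL y hy x hx)
  have := Convex.norm_image_sub_le_of_norm_hasDerivWithin_le (f := fun z => f z - z * f' x)
    (f' := fun z => f' z - f' x) (s := uIcc x y) (C := L * |y - x|) (x := x) (y := y)
    (fun z hz => by
      have := ((h z (hsub hz)).mono hsub).fun_sub ((hasDerivAt_id' z).hasDerivWithinAt.mul_const (f' x))
      simpa using this)
    (fun z hz => by
      refine (hL z (hsub hz) x hx).trans ?_
      have : |z - x| ≤ |y - x| := abs_sub_left_of_mem_uIcc hz
      by_cases h0 : y = x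
      · subst h0; simp at this hz; simp [hz]
      · have : 0 < |y - x| := abs_pos.2 (sub_ne_zero.2 h0)
        have : 0 ≤ L := by by_contra! hc; nlinarith
        gcongr)
    (convex_uIcc _ _) left_mem_uIcc right_mem_uIcc
  simp only [Real.norm_eq_abs] at this
  calc _ = |f y - y * f' x - (f x - x * f' x)| := by congr 1; ring
    _ ≤ _ := this
    _ = _ := by rw [mul_assoc, abs_mul_abs_self]; ring

lemma hasDerivWithinAt_of_taylor {f : ℝ → ℝ} {f' L x : ℝ} {s : Set ℝ}
    (h : ∀ y ∈ s, |f y - f x - (y - x) * f'| ≤ L * (y - x) ^ 2) : HasDerivWithinAt f f' s x := by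
  rw [hasDerivWithinAt_iff_isLittleO]
  have h1 : (fun y => f y - f x - (y - x) • f') =O[nhdsWithin x s] fun y => (y - x) ^ 2 := by
    refine Asymptotics.IsBigO.of_bound L ?_
    filter_upwards [self_mem_nhdsWithin] with y hy
    simpa using h y hy
  refine h1.trans_isLittleO ?_
  have h2 : (fun y : ℝ => (y - x) ^ 2) =o[nhds x] fun y => y - x := by
    have := (Asymptotics.isLittleO_pow_id (𝕜 := ℝ) (by norm_num : 1 < 2)).comp_tendsto
      (k := fun y : ℝ => y - x) (l' := nhds x) (by
        have : Tendsto (fun y : ℝ => y - x) (nhds x) (nhds (x - x)) := tendsto_id.sub_const x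
        simpa using this)
    simpa [Function.comp_def] using this
  exact h2.mono nhdsWithin_le_nhds

lemma abs_le_of_L2_le {N : ℝ} (hN : 4 < N) {x₀ η K : ℝ} (hx₀ : x₀ ∈ Icc (0:ℝ) 1) (hη : 0 < η)
    (hK : 0 ≤ K) : ∃ θ : ℝ, 0 < θ ∧ ∀ h : ℝ → ℝ, Continuous h →
      (∀ x ∈ Icc (0:ℝ) 1, |h x - h x₀| ≤ K * |x - x₀|) → L2 N 0 h ≤ θ → |h x₀| ≤ η := by
  set r := η / (2 * (K + 1)) with hr
  have hr0 : 0 < r := by positivity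
  have hKr : K * r ≤ η / 2 := by
    calc K * r ≤ (K + 1) * r := by gcongr; linarith
      _ = η / 2 := by rw [hr]; field_simp
  set a := max 0 (x₀ - r) with ha
  set b := min 1 (x₀ + r) with hb
  have hab : a < b := by
    refine max_lt (lt_min one_pos (by linarith [hx₀.1])) (lt_min (by linarith [hx₀.2]) (by linarith))
  have ha0 : 0 ≤ a := le_max_left _ _
  have hb1 : b ≤ 1 := min_le_left _ _
  have hw := continuous_wt hN
  have hI : 0 < ∫ x in a..b, wt N x := by
    refine intervalIntegral_pos_of_pos_on (hw.intervalIntegrable _ _) (fun x hx => ?_) hab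
    exact wt_pos N ⟨ha0.trans_lt hx.1, hx.2.trans_le hb1⟩
  refine ⟨η ^ 2 / 8 * ∫ x in a..b, wt N x, by positivity, fun h hc hl hL => ?_⟩
  by_contra! hlt
  have h1 : ∫ x in a..b, η ^ 2 / 4 * wt N x ≤ ∫ x in a..b, wt N x * qf x ^ 0 * h x ^ 2 := by
    refine integral_mono_on hab.le (Continuous.intervalIntegrable (by fun_prop) _ _)
      (Continuous.intervalIntegrable (by fun_prop) _ _) fun x hx => ?_
    have hx' : x ∈ Icc (0:ℝ) 1 := ⟨ha0.trans hx.1, hx.2.trans hb1⟩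
    have h2 : |x - x₀| ≤ r := abs_le.2 ⟨by linarith [(le_max_right 0 (x₀ - r)).trans hx.1],
      by linarith [hx.2.trans (min_le_right 1 (x₀ + r))]⟩
    have h3 := (hl x hx').trans ((mul_le_mul_of_nonneg_left h2 hK).trans hKr)
    have h4 : η / 2 ≤ |h x| := by
      have := abs_sub_abs_le_abs_sub (h x₀) (h x)
      rw [abs_sub_comm] at this
      linarith
    have h5 : η ^ 2 / 4 ≤ h x ^ 2 := by rw [← sq_abs (h x)]; nlinarith
    have := wt_nonneg N hx'
    rw [pow_zero, mul_one, mul_comm]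
    gcongr
  have hq := continuous_qf
  have h2 : ∫ x in a..b, wt N x * qf x ^ 0 * h x ^ 2 ≤ L2 N 0 h := by
    refine integral_mono_interval ha0 hab.le hb1 ?_ (Continuous.intervalIntegrable (by fun_prop) _ _)
    refine (ae_restrict_iff' measurableSet_Ioc).2 (Eventually.of_forall fun x hx => ?_)
    have := wt_nonneg N (Ioc_subset_Icc_self hx)
    simp only [Pi.zero_apply]
    positivity
  rw [intervalIntegral.integral_const_mul] at h1
  nlinarith [sq_pos_of_pos hη]

end JacobiWave

namespace JacobiWave

open MeasureTheory intervalIntegral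
open scoped ContDiff

lemma Hk_le_sq {N : ℝ} (hN : 4 < N) {f : ℝ → ℝ} (hf : ContDiff ℝ ∞ f) {k : ℕ} {A : ℝ}
    (h : ∀ x ∈ Icc (0:ℝ) 1, |iteratedDeriv k f x| ≤ A) : Hk N k f ≤ A ^ 2 := by
  have hw := continuous_wt hN
  have hq := continuous_qf
  have hf' := continuous_iteratedDeriv hf k
  have : Hk N k f ≤ ∫ x in (0:ℝ)..1, A ^ 2 := by
    refine integral_mono_cont (by fun_prop) continuous_const fun x hx => ?_
    have h1 : wt N x * qf x ^ k ≤ 1 :=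
      mul_le_one₀ (wt_le_one hN hx) (pow_nonneg (qf_nonneg hx) k)
        (pow_le_one₀ (qf_nonneg hx) (qf_le_one hx))
    have h2 : iteratedDeriv k f x ^ 2 ≤ A ^ 2 := by
      rw [← sq_abs]; exact pow_le_pow_left₀ (abs_nonneg _) (h x hx) 2
    calc _ ≤ 1 * iteratedDeriv k f x ^ 2 := by gcongr
      _ ≤ _ := by rwa [one_mul]
  simpa using this

/-- Pointwise bounds from bounds of the weighted norms. -/
lemma exists_abs_iteratedDeriv_le {N : ℝ} (hN : 4 < N) (a : ℕ) : ∃ C : ℝ, 0 ≤ C ∧ ∀ f : ℝ → ℝ,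
    ContDiff ℝ ∞ f → ∀ A, 0 ≤ A → (∀ i ≤ a + (gam N + a + 3), Hk N i f ≤ A ^ 2) →
    ∀ x ∈ Icc (0:ℝ) 1, |iteratedDeriv a f x| ≤ C * A := by
  obtain ⟨C, hC, h⟩ := sobolev hN a a
  set n := a + (gam N + a + 3) with hn
  refine ⟨C * n + 1, by positivity, fun f hf A hA hb x hx => ?_⟩
  have h1 := h f hf x hx
  rw [Nat.sub_self, pow_zero, one_mul] at h1
  have h2 : ∑ i ∈ Finset.range n, Hk N i f ≤ n * A ^ 2 := by
    refine (Finset.sum_le_card_nsmul _ _ _ fun i hi => hb i (Finset.mem_range.1 hi).le).trans ?_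
    simp
  refine abs_le_of_sq_le_sq ?_ (by positivity)
  refine h1.trans ((mul_le_mul_of_nonneg_left h2 hC).trans ?_)
  have : C * n ≤ (C * n + 1) ^ 2 := by nlinarith [mul_nonneg hC (Nat.cast_nonneg n : (0:ℝ) ≤ n)]
  nlinarith [sq_nonneg A]

lemma exists_abs_proj_le {N : ℝ} (hN : 4 < N) (a : ℕ) : ∃ C : ℝ, 0 ≤ C ∧ ∀ (r : ℕ) (e : Fin r → ℝ → ℝ),
    GBasis N e → ∀ f : ℝ → ℝ, ContDiff ℝ ∞ f → ∀ A, 0 ≤ A →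
    (∀ j ≤ a + (gam N + a + 3), ∀ x ∈ Icc (0:ℝ) 1, |iteratedDeriv j f x| ≤ A) →
    ∀ x ∈ Icc (0:ℝ) 1, |iteratedDeriv a (proj N e f) x| ≤ C * A := by
  obtain ⟨C, hC, h⟩ := exists_abs_iteratedDeriv_le hN a
  exact ⟨C, hC, fun r e he f hf A hA hb x hx => h _ (contDiff_proj he.smooth f) A hA
    (fun i hi => (he.Hk_proj_le hN hf i).trans (Hk_le_sq hN hf (hb i hi))) x hx⟩

lemma proj_sub {N : ℝ} (hN : 4 < N) {r : ℕ} {e : Fin r → ℝ → ℝ} (he : ∀ i, ContDiff ℝ ∞ (e i))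
    {f f' : ℝ → ℝ} (hf : Continuous f) (hf' : Continuous f') :
    proj N e (fun x => f x - f' x) = fun x => proj N e f x - proj N e f' x := by
  ext x
  unfold proj
  rw [← Finset.sum_sub_distrib]
  refine Finset.sum_congr rfl fun i _ => ?_
  have h1 := ip_add_left hN (f := f) (f' := fun x => (-1) * f' x) (g := e i) hf
    (continuous_const.mul hf') (he i).continuous
  rw [ip_smul_left] at h1
  have h2 : (fun x => f x - f' x) = fun x => f x + (-1) * f' x := by ext x; ring
  rw [h2, h1]
  ring

lemma abs_iteratedDeriv_jets_le {y u : ℝ → ℝ} (hy : ContDiff ℝ ∞ y) {a : ℕ}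
    {x D : ℝ} (hx : x ∈ Icc (0:ℝ) 1)
    (h : ∀ j ≤ a + 2, |iteratedDeriv j y x| ≤ D ∧ |iteratedDeriv j u x| ≤ D) (c : Fin 5) {j : ℕ}
    (hj : j ≤ a) : |iteratedDeriv j (jets y u c) x| ≤ (1 + a + a ^ 2) * D := by
  have hD : 0 ≤ D := (abs_nonneg _).trans (h 0 (by omega)).1
  have h1 : D ≤ (1 + a + a ^ 2) * D := le_mul_of_one_le_left hD (by nlinarith [(Nat.cast_nonneg a : (0:ℝ) ≤ a)])
  fin_cases c
  · exact (h j (by omega)).1.trans h1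
  · change |iteratedDeriv j (iteratedDeriv 1 y) x| ≤ _
    rw [iteratedDeriv_iteratedDeriv]
    exact (h _ (by omega)).1.trans h1
  · change |iteratedDeriv j (fun x => qf x * iteratedDeriv 2 y x) x| ≤ _
    rw [iteratedDeriv_qf_mul hy]
    have e1 := (h (j + 2) (by omega)).1
    have e2 := (h (j + 1) (by omega)).1
    have e3 := (h j (by omega)).1
    have hja : (j:ℝ) ≤ a := by exact_mod_cast hj
    have hj0 : (0:ℝ) ≤ j := Nat.cast_nonneg j
    have f1 : |qf x * iteratedDeriv (j + 2) y x| ≤ 1 * D := by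
      rw [abs_mul, abs_of_nonneg (qf_nonneg hx)]
      exact mul_le_mul (qf_le_one hx) e1 (abs_nonneg _) zero_le_one
    have f2 : |(j * (1 - 2 * x)) * iteratedDeriv (j + 1) y x| ≤ a * D := by
      rw [abs_mul, abs_mul, abs_of_nonneg hj0]
      have : |1 - 2 * x| ≤ 1 := abs_le.2 ⟨by linarith [hx.2], by linarith [hx.1]⟩
      refine mul_le_mul ?_ e2 (abs_nonneg _) (by positivity)
      calc _ ≤ (j:ℝ) * 1 := by gcongr
        _ ≤ a := by linarith
    have f3 : |(j * (j - 1 : ℝ)) * iteratedDeriv j y x| ≤ a ^ 2 * D := by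
      rw [abs_mul]
      refine mul_le_mul ?_ e3 (abs_nonneg _) (by positivity)
      rcases Nat.eq_zero_or_pos j with h0 | h0
      · subst h0; simp
      · have : (1:ℝ) ≤ j := by exact_mod_cast h0
        rw [abs_of_nonneg (by nlinarith)]
        nlinarith
    refine (abs_sub _ _).trans ((add_le_add (abs_add_le _ _) le_rfl).trans ?_)
    linarith
  · exact (h j (by omega)).2.trans h1
  · change |iteratedDeriv j (iteratedDeriv 1 u) x| ≤ _
    rw [iteratedDeriv_iteratedDeriv]
    exact (h _ (by omega)).2.trans h1

lemma iteratedDeriv_sub_fun {f g : ℝ → ℝ} (hf : ContDiff ℝ ∞ f) (hg : ContDiff ℝ ∞ g) (n : ℕ) (x : ℝ) :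
    iteratedDeriv n (fun x => f x - g x) x = iteratedDeriv n f x - iteratedDeriv n g x := by
  have le : (n : WithTop ℕ∞) ≤ ∞ := by exact_mod_cast le_top
  exact iteratedDeriv_fun_sub (hf.of_le le).contDiffAt (hg.of_le le).contDiffAt

lemma jets_sub {y u y' u' : ℝ → ℝ} (hy : ContDiff ℝ ∞ y) (hu : ContDiff ℝ ∞ u) (hy' : ContDiff ℝ ∞ y')
    (hu' : ContDiff ℝ ∞ u') (c : Fin 5) :
    jets (fun x => y x - y' x) (fun x => u x - u' x) c = fun x => jets y u c x - jets y' u' c x := by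
  ext x
  fin_cases c
  · rfl
  · exact iteratedDeriv_sub_fun hy hy' 1 x
  · change qf x * iteratedDeriv 2 (fun x => y x - y' x) x = qf x * _ - qf x * _
    rw [iteratedDeriv_sub_fun hy hy' 2 x, mul_sub]
  · rfl
  · exact iteratedDeriv_sub_fun hu hu' 1 x

lemma DtRel.lip {κ : ℝ → ℝ} (hκ1 : ∀ t, |κ t| ≤ 1) {f f' : ℝ → ℝ → ℝ} (h : DtRel κ f f') {j : ℕ} {x C : ℝ}
    (hC : ∀ t, |iteratedDeriv j (f' t) x| ≤ C) (t s : ℝ) :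
    |iteratedDeriv j (f t) x - iteratedDeriv j (f s) x| ≤ C * |t - s| := by
  have := Convex.norm_image_sub_le_of_norm_hasDerivWithin_le (f := fun t => iteratedDeriv j (f t) x)
    (s := univ) (C := C) (x := s) (y := t) (fun t _ => (h j t x).hasDerivWithinAt)
    (fun t _ => by
      rw [Real.norm_eq_abs, abs_mul]
      exact (mul_le_of_le_one_left (abs_nonneg _) (hκ1 t)).trans (hC t)) convex_univ trivial trivial
  simpa using this

/-- All spatial derivatives of small Galerkin solutions are bounded and Lipschitz in time, uniformly
in the Galerkin space. -/
theorem exists_pointwise_bound {N : ℝ} (hN : 4 < N) {ρ : ℝ} (hρ : 0 < ρ) {F : ℝ × (Fin 5 → ℝ) → ℝ}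
    (hF : Adm N ρ F) {κ : ℝ → ℝ} (hκ : Continuous κ) (hκ1 : ∀ t, |κ t| ≤ 1) {R : ℝ} (hR : 0 < R)
    (hκ0 : ∀ t, R ≤ |t| → κ t = 0) :
    ∃ δ : ℝ, 0 < δ ∧ ∀ ψ φ : ℝ → ℝ, ContDiff ℝ ∞ ψ → ContDiff ℝ ∞ φ → En N (2 * sg N) ψ φ ≤ δ →
      ∀ j, ∃ B : ℝ, 0 ≤ B ∧ ∀ (r : ℕ) (e : Fin r → ℝ → ℝ) (y u g : ℝ → ℝ → ℝ), GBasis N e →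
        GSol N F κ e y u g → y 0 = proj N e ψ → u 0 = proj N e φ →
        ∀ x ∈ Icc (0:ℝ) 1, (∀ t, (∀ c, |jets (y t) (u t) c x| ≤ ρ) ∧ |iteratedDeriv j (y t) x| ≤ B ∧
          |iteratedDeriv j (u t) x| ≤ B ∧ |iteratedDeriv j (g t) x| ≤ B ∧
          |iteratedDeriv j (comp F (jets (y t) (u t))) x| ≤ B) ∧
          ∀ t s, |iteratedDeriv j (y t) x - iteratedDeriv j (y s) x| ≤ B * |t - s| ∧
            |iteratedDeriv j (u t) x - iteratedDeriv j (u s) x| ≤ B * |t - s| ∧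
            |iteratedDeriv j (g t) x - iteratedDeriv j (g s) x| ≤ B * |t - s| := by
  obtain ⟨δ, hδ, hδ'⟩ := exists_uniform_bound hN hρ hF hκ hκ1 hR hκ0
  refine ⟨δ, hδ, fun ψ φ hψ hφ hE => ?_⟩
  have hu := hδ' ψ φ hψ hφ hE
  -- bounds of `y` and `u`
  have s1 : ∀ j, ∃ B : ℝ, 0 ≤ B ∧ ∀ (r : ℕ) (e : Fin r → ℝ → ℝ) (y u g : ℝ → ℝ → ℝ), GBasis N e →
      GSol N F κ e y u g → y 0 = proj N e ψ → u 0 = proj N e φ → ∀ i ≤ j,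
      ∀ x ∈ Icc (0:ℝ) 1, ∀ t, |iteratedDeriv i (y t) x| ≤ B ∧ |iteratedDeriv i (u t) x| ≤ B := by
    intro j
    choose C hC hCb using exists_abs_iteratedDeriv_le hN
    choose B hB hBb using hu
    refine ⟨∑ i ∈ Finset.range (j + 1), C i * (B (i + (gam N + i + 3)) + 1),
      Finset.sum_nonneg fun i _ => by have := hC i; have := hB (i + (gam N + i + 3)); positivity,
      fun r e y u g he h hy0 hu0 i hi x hx t => ?_⟩
    have hle : C i * (B (i + (gam N + i + 3)) + 1) ≤
        ∑ i ∈ Finset.range (j + 1), C i * (B (i + (gam N + i + 3)) + 1) :=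
      Finset.single_le_sum (f := fun i => C i * (B (i + (gam N + i + 3)) + 1))
        (fun i _ => by have := hC i; have := hB (i + (gam N + i + 3)); positivity)
        (Finset.mem_range.2 (by omega))
    set k := i + (gam N + i + 3) with hk
    have hb := (hBb k r e y u g he h hy0 hu0 t).2
    have hB1 : B k ≤ (B k + 1) ^ 2 := by have := hB k; nlinarith
    exact ⟨(hCb i _ (h.sy.smooth t) (B k + 1) (by have := hB k; positivity)
        (fun l hl => (Hk_le_En_left N (by omega) _ _).trans (hb.trans hB1)) x hx).trans hle,
      (hCb i _ (h.su.smooth t) (B k + 1) (by have := hB k; positivity)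
        (fun l hl => (Hk_le_En_right N (by omega) _ _).trans (hb.trans hB1)) x hx).trans hle⟩
  -- bounds and Lipschitz bounds of the nonlinearity
  have s2 : ∀ j, ∃ B : ℝ, 0 ≤ B ∧ ∀ (r : ℕ) (e : Fin r → ℝ → ℝ) (y u g : ℝ → ℝ → ℝ), GBasis N e →
      GSol N F κ e y u g → y 0 = proj N e ψ → u 0 = proj N e φ → ∀ i ≤ j,
      ∀ x ∈ Icc (0:ℝ) 1, ∀ t, |iteratedDeriv i (comp F (jets (y t) (u t))) x| ≤ B := by
    intro j
    obtain ⟨A, hA, hA'⟩ := s1 (j + 2)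
    choose C hC hCb using fun a => abs_iteratedDeriv_comp_le a hF.sm ((1 + j + j ^ 2) * A)
    refine ⟨∑ i ∈ Finset.range (j + 1), C i, Finset.sum_nonneg fun i _ => hC i,
      fun r e y u g he h hy0 hu0 i hi x hx t => ?_⟩
    refine (hCb i _ (contDiff_jets (h.sy.smooth t) (h.su.smooth t)) x fun c l hl => ?_).trans
      (Finset.single_le_sum (f := C) (fun i _ => hC i) (Finset.mem_range.2 (by omega)))
    exact abs_iteratedDeriv_jets_le (h.sy.smooth t) hx
      (fun m hm => hA' r e y u g he h hy0 hu0 m hm x hx t) c (hl.trans hi)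
  have s3 : ∀ j, ∃ B : ℝ, 0 ≤ B ∧ ∀ (r : ℕ) (e : Fin r → ℝ → ℝ) (y u g : ℝ → ℝ → ℝ), GBasis N e →
      GSol N F κ e y u g → y 0 = proj N e ψ → u 0 = proj N e φ → ∀ i ≤ j,
      ∀ x ∈ Icc (0:ℝ) 1, ∀ t, |iteratedDeriv i (g t) x| ≤ B := by
    intro j
    choose C hC hCb using exists_abs_proj_le hN
    choose B hB hBb using s2
    refine ⟨∑ i ∈ Finset.range (j + 1), C i * B (i + (gam N + i + 3)),
      Finset.sum_nonneg fun i _ => by have := hC i; have := hB (i + (gam N + i + 3)); positivity,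
      fun r e y u g he h hy0 hu0 i hi x hx t => ?_⟩
    refine le_trans ?_ (Finset.single_le_sum (f := fun i => C i * B (i + (gam N + i + 3)))
        (fun i _ => by have := hC i; have := hB (i + (gam N + i + 3)); positivity)
        (Finset.mem_range.2 (by omega : i < j + 1)))
    rw [h.eq t]
    exact hCb i r e he _ (contDiff_comp hF.sm.smooth (contDiff_jets (h.sy.smooth t) (h.su.smooth t))) _
      (hB _) (fun l hl x hx => hBb _ r e y u g he h hy0 hu0 l hl x hx t) x hx
  have s4 : ∀ j, ∃ B : ℝ, 0 ≤ B ∧ ∀ (r : ℕ) (e : Fin r → ℝ → ℝ) (y u g : ℝ → ℝ → ℝ), GBasis N e →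
      GSol N F κ e y u g → y 0 = proj N e ψ → u 0 = proj N e φ → ∀ i ≤ j,
      ∀ x ∈ Icc (0:ℝ) 1, ∀ t s,
      |iteratedDeriv i (comp F (jets (y t) (u t))) x - iteratedDeriv i (comp F (jets (y s) (u s))) x| ≤
        B * |t - s| := by
    intro j
    obtain ⟨A, hA, hA'⟩ := s1 (j + 2)
    obtain ⟨A₂, hA₂, hA₂'⟩ := s3 (j + 2)
    choose C hC hCb using fun a => abs_iteratedDeriv_comp_sub_le a hF.sm ((1 + j + j ^ 2) * A)
      (by positivity)
    refine ⟨∑ i ∈ Finset.range (j + 1), C i * ((1 + j + j ^ 2) * (A + A₂)),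
      Finset.sum_nonneg fun i _ => by have := hC i; positivity,
      fun r e y u g he h hy0 hu0 i hi x hx t s => ?_⟩
    have hj := fun t => contDiff_jets (h.sy.smooth t) (h.su.smooth t)
    have hb : ∀ t c l, l ≤ i → |iteratedDeriv l (jets (y t) (u t) c) x| ≤ (1 + j + j ^ 2) * A :=
      fun t c l hl => abs_iteratedDeriv_jets_le (h.sy.smooth t) hx
        (fun m hm => hA' r e y u g he h hy0 hu0 m hm x hx t) c (hl.trans hi)
    refine (hCb i (jets (y t) (u t)) (jets (y s) (u s)) (hj t) (hj s) x
      ((1 + j + j ^ 2) * ((A + A₂) * |t - s|)) (by positivity) (hb t) (hb s) fun c l hl => ?_).trans ?_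
    · rw [← iteratedDeriv_sub_fun (hj t c) (hj s c),
        ← jets_sub (h.sy.smooth t) (h.su.smooth t) (h.sy.smooth s) (h.su.smooth s) c]
      refine abs_iteratedDeriv_jets_le ((h.sy.smooth t).sub (h.sy.smooth s)) hx (fun m hm => ?_) c (hl.trans hi)
      rw [iteratedDeriv_sub_fun (h.sy.smooth t) (h.sy.smooth s),
        iteratedDeriv_sub_fun (h.su.smooth t) (h.su.smooth s)]
      have e1 := h.dy.lip hκ1 (fun t => (hA' r e y u g he h hy0 hu0 m hm x hx t).2) t s
      have e2 := h.du.lip hκ1 (fun t => hA₂' r e y u g he h hy0 hu0 m hm x hx t) t s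
      have e3 := abs_nonneg (t - s)
      constructor <;> nlinarith
    · have := Finset.single_le_sum (f := fun i => C i * ((1 + j + j ^ 2) * (A + A₂)))
        (fun i _ => by have := hC i; positivity) (Finset.mem_range.2 (by omega : i < j + 1))
      calc _ = C i * ((1 + j + j ^ 2) * (A + A₂)) * |t - s| := by ring
        _ ≤ _ := by gcongr
  intro j
  obtain ⟨B₁, hB₁, k1⟩ := s1 j
  obtain ⟨B₂, hB₂, k2⟩ := s2 j
  obtain ⟨B₃, hB₃, k3⟩ := s3 j
  obtain ⟨B₄, hB₄, k4⟩ := s4 (j + (gam N + j + 3))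
  obtain ⟨C, hC, k5⟩ := exists_abs_proj_le hN j
  obtain ⟨B₀, hB₀, k0⟩ := hu 0
  have hCB : 0 ≤ C * B₄ := by positivity
  refine ⟨B₁ + B₂ + B₃ + C * B₄, by positivity, fun r e y u g he h hy0 hu0 x hx =>
    ⟨fun t => ⟨fun c => (k0 r e y u g he h hy0 hu0 t).1 c x hx, ?_, ?_, ?_, ?_⟩, fun t s => ⟨?_, ?_, ?_⟩⟩⟩
  · linarith [(k1 r e y u g he h hy0 hu0 j le_rfl x hx t).1]
  · linarith [(k1 r e y u g he h hy0 hu0 j le_rfl x hx t).2]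
  · linarith [k3 r e y u g he h hy0 hu0 j le_rfl x hx t]
  · linarith [k2 r e y u g he h hy0 hu0 j le_rfl x hx t]
  · refine (h.dy.lip hκ1 (fun t => (k1 r e y u g he h hy0 hu0 j le_rfl x hx t).2) t s).trans ?_
    gcongr; linarith
  · refine (h.du.lip hκ1 (fun t => k3 r e y u g he h hy0 hu0 j le_rfl x hx t) t s).trans ?_
    gcongr; linarith
  · have hc := fun t => contDiff_comp hF.sm.smooth (contDiff_jets (h.sy.smooth t) (h.su.smooth t))
    have e1 : iteratedDeriv j (g t) x - iteratedDeriv j (g s) x =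
        iteratedDeriv j (proj N e fun x => comp F (jets (y t) (u t)) x - comp F (jets (y s) (u s)) x) x := by
      rw [proj_sub hN he.smooth (hc t).continuous (hc s).continuous,
        iteratedDeriv_sub_fun (contDiff_proj he.smooth _) (contDiff_proj he.smooth _), ← h.eq, ← h.eq]
    rw [e1]
    refine (k5 r e he _ ((hc t).sub (hc s)) (B₄ * |t - s|) (by positivity) (fun l hl x hx => ?_) x hx).trans ?_
    · rw [iteratedDeriv_sub_fun (hc t) (hc s)]
      exact k4 r e y u g he h hy0 hu0 l hl x hx t s
    · rw [← mul_assoc]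
      gcongr; linarith

end JacobiWave

namespace JacobiWave

open MeasureTheory intervalIntegral
open scoped ContDiff

/-- The limit of a bounded real sequence along a fixed nonprincipal ultrafilter. -/
noncomputable def ulim (a : ℕ → ℝ) : ℝ := limUnder (hyperfilter ℕ : Filter ℕ) a

lemma tendsto_ulim {a : ℕ → ℝ} {B : ℝ} (h : ∀ n, |a n| ≤ B) :
    Tendsto a (hyperfilter ℕ) (nhds (ulim a)) := by
  obtain ⟨l, -, hl⟩ := (isCompact_Icc (a := -B) (b := B)).ultrafilter_le_nhds
    ((hyperfilter ℕ).map a) (by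
      rw [le_principal_iff]
      exact Filter.mem_map.2 (univ_mem' fun n => abs_le.1 (h n)))
  exact tendsto_nhds_limUnder ⟨l, hl⟩

lemma ulim_eq {a : ℕ → ℝ} {l : ℝ} (h : Tendsto a (hyperfilter ℕ) (nhds l)) : ulim a = l :=
  h.limUnder_eq

lemma abs_ulim_le {a : ℕ → ℝ} {B : ℝ} (h : ∀ n, |a n| ≤ B) : |ulim a| ≤ B :=
  le_of_tendsto (tendsto_ulim h).abs (Eventually.of_forall h)

lemma exists_abs_iteratedDeriv_one_le {f : ℝ → ℝ} (hf : ContDiff ℝ ∞ f) :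
    ∃ C : ℝ, ∀ x ∈ Icc (0:ℝ) 1, |iteratedDeriv 1 f x| ≤ C :=
  isCompact_Icc.exists_bound_of_continuousOn (continuous_iteratedDeriv hf 1).continuousOn

/-- A family of functions `f j`, each being the spatial derivative of the preceding one. -/
def XFam (f : ℕ → ℝ → ℝ → ℝ) : Prop :=
  ∀ j t, ∀ x ∈ Icc (0:ℝ) 1, HasDerivWithinAt (f j t) (f (j + 1) t x) (Icc 0 1) x

/-- The limits of the spatial derivatives of a sequence of functions. -/
noncomputable def ufam (f : ℕ → ℝ → ℝ → ℝ) (j : ℕ) (t x : ℝ) : ℝ :=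
  ulim fun n => iteratedDeriv j (f n t) x

lemma abs_iteratedDeriv_sub_le {f : ℝ → ℝ} (hf : ContDiff ℝ ∞ f) {j : ℕ} {B : ℝ}
    (hB : ∀ x ∈ Icc (0:ℝ) 1, |iteratedDeriv (j + 1) f x| ≤ B) {x y : ℝ} (hx : x ∈ Icc (0:ℝ) 1)
    (hy : y ∈ Icc (0:ℝ) 1) : |iteratedDeriv j f x - iteratedDeriv j f y| ≤ B * |x - y| := by
  have := Convex.norm_image_sub_le_of_norm_hasDerivWithin_le (f := iteratedDeriv j f)
    (f' := iteratedDeriv (j + 1) f) (s := Icc (0:ℝ) 1) (C := B) (x := y) (y := x)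
    (fun z _ => (hasDerivAt_iteratedDeriv hf j z).hasDerivWithinAt)
    (fun z hz => hB z hz) (convex_Icc _ _) hy hx
  simpa using this

lemma xFam_ufam {f : ℕ → ℝ → ℝ → ℝ} (hf : ∀ n t, ContDiff ℝ ∞ (f n t))
    (hB : ∀ j, ∃ B : ℝ, ∀ n t, ∀ x ∈ Icc (0:ℝ) 1, |iteratedDeriv j (f n t) x| ≤ B) :
    XFam (ufam f) := by
  intro j t x hx
  obtain ⟨B, hBB⟩ := hB (j + 2)
  obtain ⟨B₀, hB₀⟩ := hB j
  obtain ⟨B₁, hB₁⟩ := hB (j + 1)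
  refine hasDerivWithinAt_of_taylor (L := B) fun y hy => ?_
  have h1 : ∀ n, |iteratedDeriv j (f n t) y - iteratedDeriv j (f n t) x -
      (y - x) * iteratedDeriv (j + 1) (f n t) x| ≤ B * (y - x) ^ 2 := fun n =>
    abs_taylor_le (s := Icc (0:ℝ) 1) (convex_Icc _ _)
      (fun z _ => (hasDerivAt_iteratedDeriv (hf n t) j z).hasDerivWithinAt)
      (fun z hz w hw => abs_iteratedDeriv_sub_le (hf n t) (hBB n t) hz hw) hx hy
  exact le_of_tendsto (((tendsto_ulim fun n => hB₀ n t y hy).sub (tendsto_ulim fun n => hB₀ n t x hx)).sub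
    ((tendsto_ulim fun n => hB₁ n t x hx).const_mul (y - x))).abs (Eventually.of_forall h1)

lemma hasDerivAt_ufam {κ : ℝ → ℝ} {M : ℝ} (hκ1 : ∀ t, |κ t| ≤ 1) (hκL : ∀ t s, |κ t - κ s| ≤ M * |t - s|)
    {f f' : ℕ → ℝ → ℝ → ℝ} (hd : ∀ n, DtRel κ (f n) (f' n)) {j : ℕ} {B : ℝ} {x : ℝ}
    (h1 : ∀ n t, |iteratedDeriv j (f n t) x| ≤ B) (h2 : ∀ n t, |iteratedDeriv j (f' n t) x| ≤ B)
    (h3 : ∀ n t s, |iteratedDeriv j (f' n t) x - iteratedDeriv j (f' n s) x| ≤ B * |t - s|) (t : ℝ) :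
    HasDerivAt (fun s => ufam f j s x) (κ t * ufam f' j t x) t := by
  rw [← hasDerivWithinAt_univ]
  refine hasDerivWithinAt_of_taylor (L := M * B + B) fun s _ => ?_
  have h4 : ∀ n, |iteratedDeriv j (f n s) x - iteratedDeriv j (f n t) x -
      (s - t) * (κ t * iteratedDeriv j (f' n t) x)| ≤ (M * B + B) * (s - t) ^ 2 := fun n => by
    refine abs_taylor_le (s := univ) (f := fun s => iteratedDeriv j (f n s) x)
      (f' := fun s => κ s * iteratedDeriv j (f' n s) x) convex_univ
      (fun z _ => (hd n j z x).hasDerivWithinAt) (fun z _ w _ => ?_) (mem_univ _) (mem_univ _)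
    calc |κ z * iteratedDeriv j (f' n z) x - κ w * iteratedDeriv j (f' n w) x|
        = |(κ z - κ w) * iteratedDeriv j (f' n z) x +
          κ w * (iteratedDeriv j (f' n z) x - iteratedDeriv j (f' n w) x)| := by ring_nf
      _ ≤ |κ z - κ w| * |iteratedDeriv j (f' n z) x| +
          |κ w| * |iteratedDeriv j (f' n z) x - iteratedDeriv j (f' n w) x| := by
          rw [← abs_mul, ← abs_mul]; exact abs_add_le _ _
      _ ≤ (M * |z - w|) * B + 1 * (B * |z - w|) := by
          refine add_le_add (mul_le_mul (hκL z w) (h2 n z) (abs_nonneg _)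
            ((abs_nonneg _).trans (hκL z w)))
            (mul_le_mul (hκ1 w) (h3 n z w) (abs_nonneg _) zero_le_one)
      _ = _ := by ring
  exact le_of_tendsto (((tendsto_ulim fun n => h1 n s).sub (tendsto_ulim fun n => h1 n t)).sub
    (((tendsto_ulim fun n => h2 n t).const_mul (κ t)).const_mul (s - t))).abs (Eventually.of_forall h4)

/-- Errors of the projections tend to zero pointwise. -/
lemma tendsto_zero_of_L2_rate {N : ℝ} (hN : 4 < N) {h : ℕ → ℝ → ℝ} (hc : ∀ n, Continuous (h n)) {K C : ℝ}
    (hK : 0 ≤ K) (hL : ∀ n, ∀ x ∈ Icc (0:ℝ) 1, ∀ y ∈ Icc (0:ℝ) 1, |h n x - h n y| ≤ K * |x - y|)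
    (h2 : ∀ n : ℕ, L2 N 0 (h n) ≤ C / (n + 1 : ℕ)) {x : ℝ} (hx : x ∈ Icc (0:ℝ) 1) :
    Tendsto (fun n => h n x) (hyperfilter ℕ) (nhds 0) := by
  refine Tendsto.mono_left ?_ Nat.hyperfilter_le_atTop
  rw [Metric.tendsto_atTop]
  intro ε hε
  obtain ⟨θ, hθ, hh⟩ := abs_le_of_L2_le hN hx (half_pos hε) hK
  have hl : Tendsto (fun n : ℕ => C / ((n + 1 : ℕ) : ℝ)) atTop (nhds 0) :=
    (tendsto_const_div_atTop_nhds_zero_nat C).comp (tendsto_add_atTop_nat 1)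
  obtain ⟨n₀, hn₀⟩ := eventually_atTop.1 (hl.eventually (gt_mem_nhds hθ))
  refine ⟨n₀, fun n hn => ?_⟩
  have := hh (h n) (hc n) (fun y hy => hL n y hy x hx) ((h2 n).trans (hn₀ n hn).le)
  simpa using this.trans_lt (by linarith)

/-- Classical solutions, described by the families of their spatial derivatives. -/
structure Sol (ρ : ℝ) (F : ℝ × (Fin 5 → ℝ) → ℝ) (κ : ℝ → ℝ) (ψ φ : ℝ → ℝ) (Y U G : ℕ → ℝ → ℝ → ℝ) :
    Prop where
  xY : XFam Y
  xU : XFam U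
  xG : XFam G
  bdd : ∀ j, ∃ B : ℝ, ∀ t, ∀ x ∈ Icc (0:ℝ) 1, |Y j t x| ≤ B ∧ |U j t x| ≤ B ∧ |G j t x| ≤ B
  tY : ∀ j t, ∀ x ∈ Icc (0:ℝ) 1, HasDerivAt (fun s => Y j s x) (κ t * U j t x) t
  tU : ∀ j t, ∀ x ∈ Icc (0:ℝ) 1, HasDerivAt (fun s => U j s x) (κ t * G j t x) t
  eq : ∀ t, ∀ x ∈ Icc (0:ℝ) 1, G 0 t x = F (x, ![Y 0 t x, Y 1 t x, qf x * Y 2 t x, U 0 t x, U 1 t x])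
  small : ∀ t, ∀ x ∈ Icc (0:ℝ) 1, ∀ c, |![Y 0 t x, Y 1 t x, qf x * Y 2 t x, U 0 t x, U 1 t x] c| ≤ ρ
  initY : ∀ x ∈ Icc (0:ℝ) 1, Y 0 0 x = ψ x
  initU : ∀ x ∈ Icc (0:ℝ) 1, U 0 0 x = φ x

theorem exists_sol {N : ℝ} (hN : 4 < N) {ρ : ℝ} (hρ : 0 < ρ) {F : ℝ × (Fin 5 → ℝ) → ℝ}
    (hF : Adm N ρ F) {κ : ℝ → ℝ} {M : ℝ} (hκ : Continuous κ) (hκ1 : ∀ t, |κ t| ≤ 1)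
    (hκL : ∀ t s, |κ t - κ s| ≤ M * |t - s|) {R : ℝ} (hR : 0 < R) (hκ0 : ∀ t, R ≤ |t| → κ t = 0) :
    ∃ δ : ℝ, 0 < δ ∧ ∀ ψ φ : ℝ → ℝ, ContDiff ℝ ∞ ψ → ContDiff ℝ ∞ φ → En N (2 * sg N) ψ φ ≤ δ →
      ∃ Y U G : ℕ → ℝ → ℝ → ℝ, Sol ρ F κ ψ φ Y U G := by
  obtain ⟨δ, hδ, hb⟩ := exists_pointwise_bound hN hρ hF hκ hκ1 hR hκ0
  refine ⟨δ, hδ, fun ψ φ hψ hφ hE => ?_⟩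
  choose B hB0 hB using hb ψ φ hψ hφ hE
  choose r e he hrate using fun n : ℕ => exists_gBasis_rate hN (n + 1) (Nat.succ_ne_zero n)
  choose y u g hG hy0 hu0 using fun n => exists_gSol hN hF.sm hκ hκ1 hR hκ0 (he n) ψ φ
  have hb := fun j n x (hx : x ∈ Icc (0:ℝ) 1) =>
    hB j (r n) (e n) (y n) (u n) (g n) (he n) (hG n) (hy0 n) (hu0 n) x hx
  have by' : ∀ j n t, ∀ x ∈ Icc (0:ℝ) 1, |iteratedDeriv j (y n t) x| ≤ B j :=
    fun j n t x hx => ((hb j n x hx).1 t).2.1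
  have bu : ∀ j n t, ∀ x ∈ Icc (0:ℝ) 1, |iteratedDeriv j (u n t) x| ≤ B j :=
    fun j n t x hx => ((hb j n x hx).1 t).2.2.1
  have bg : ∀ j n t, ∀ x ∈ Icc (0:ℝ) 1, |iteratedDeriv j (g n t) x| ≤ B j :=
    fun j n t x hx => ((hb j n x hx).1 t).2.2.2.1
  have bf : ∀ j n t, ∀ x ∈ Icc (0:ℝ) 1, |iteratedDeriv j (comp F (jets (y n t) (u n t))) x| ≤ B j :=
    fun j n t x hx => ((hb j n x hx).1 t).2.2.2.2
  have sf : ∀ n t, ContDiff ℝ ∞ (comp F (jets (y n t) (u n t))) := fun n t =>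
    contDiff_comp hF.sm.smooth (contDiff_jets ((hG n).sy.smooth t) ((hG n).su.smooth t))
  have tJ : ∀ t, ∀ x ∈ Icc (0:ℝ) 1, Tendsto (fun n => fun c => jets (y n t) (u n t) c x) (hyperfilter ℕ)
      (nhds ![ufam y 0 t x, ufam y 1 t x, qf x * ufam y 2 t x, ufam u 0 t x, ufam u 1 t x]) := by
    intro t x hx
    rw [tendsto_pi_nhds]
    intro c
    have e1 := fun j => tendsto_ulim fun n => by' j n t x hx
    have e2 := fun j => tendsto_ulim fun n => bu j n t x hx
    fin_cases c
    · simpa [jets, ufam] using e1 0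
    · simpa [jets, ufam] using e1 1
    · simpa [jets, ufam] using (e1 2).const_mul (qf x)
    · simpa [jets, ufam] using e2 0
    · simpa [jets, ufam] using e2 1
  have pz : ∀ (h p : ℕ → ℝ → ℝ) (K : ℝ), 0 ≤ K → (∀ n, ContDiff ℝ ∞ (h n)) →
      (∀ n, p n = proj N (e n) (h n)) → (∀ n, ∀ x ∈ Icc (0:ℝ) 1, |iteratedDeriv 1 (h n) x| ≤ K) →
      (∀ n, ∀ x ∈ Icc (0:ℝ) 1, |iteratedDeriv 1 (p n) x| ≤ K) → ∀ x ∈ Icc (0:ℝ) 1,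
      Tendsto (fun n => h n x - p n x) (hyperfilter ℕ) (nhds 0) := by
    intro h p K hK hh hp h1 h2 x hx
    have sp : ∀ n, ContDiff ℝ ∞ (p n) := fun n => by rw [hp]; exact contDiff_proj (he n).smooth _
    refine tendsto_zero_of_L2_rate hN (h := fun n x => h n x - p n x) (K := 2 * K) (C := K ^ 2)
      (fun n => ((hh n).sub (sp n)).continuous) (by positivity) (fun n x hx y hy => ?_) (fun n => ?_) hx
    · have a1 := abs_iteratedDeriv_sub_le (hh n) (j := 0) (h1 n) hx hy
      have a2 := abs_iteratedDeriv_sub_le (sp n) (j := 0) (h2 n) hx hy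
      simp only [iteratedDeriv_zero] at a1 a2
      have : h n x - p n x - (h n y - p n y) = (h n x - h n y) - (p n x - p n y) := by ring
      rw [this]
      refine (abs_sub _ _).trans ?_
      linarith
    · simp only [hp]
      exact hrate n (h n) (hh n) K hK (h1 n)
  refine ⟨ufam y, ufam u, ufam g, ?_⟩
  constructor
  · exact xFam_ufam (fun n t => (hG n).sy.smooth t) fun j => ⟨B j, fun n t => by' j n t⟩
  · exact xFam_ufam (fun n t => (hG n).su.smooth t) fun j => ⟨B j, fun n t => bu j n t⟩
  · exact xFam_ufam (fun n t => (hG n).sg.smooth t) fun j => ⟨B j, fun n t => bg j n t⟩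
  · exact fun j => ⟨B j, fun t x hx => ⟨abs_ulim_le fun n => by' j n t x hx,
      abs_ulim_le fun n => bu j n t x hx, abs_ulim_le fun n => bg j n t x hx⟩⟩
  · intro j t x hx
    exact hasDerivAt_ufam hκ1 hκL (fun n => (hG n).dy) (fun n t => by' j n t x hx)
      (fun n t => bu j n t x hx) (fun n t s => ((hb j n x hx).2 t s).2.1) t
  · intro j t x hx
    exact hasDerivAt_ufam hκ1 hκL (fun n => (hG n).du) (fun n t => bu j n t x hx)
      (fun n t => bg j n t x hx) (fun n t s => ((hb j n x hx).2 t s).2.2) t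
  · intro t x hx
    have h1 : Tendsto (fun n => comp F (jets (y n t) (u n t)) x) (hyperfilter ℕ)
        (nhds (F (x, ![ufam y 0 t x, ufam y 1 t x, qf x * ufam y 2 t x, ufam u 0 t x, ufam u 1 t x]))) :=
      (hF.sm.smooth.continuous.tendsto _).comp (tendsto_const_nhds.prodMk_nhds (tJ t x hx))
    have h2 := pz (fun n => comp F (jets (y n t) (u n t))) (fun n => g n t) (B 1) (hB0 1)
      (fun n => sf n t) (fun n => (hG n).eq t) (fun n => bf 1 n t) (fun n => bg 1 n t) x hx
    have h3 := h1.sub h2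
    simp only [sub_sub_cancel, sub_zero] at h3
    exact ulim_eq (by simpa using h3)
  · intro t x hx c
    exact le_of_tendsto ((tendsto_pi_nhds.1 (tJ t x hx) c).abs)
      (Eventually.of_forall fun n => ((hb 0 n x hx).1 t).1 c)
  · intro x hx
    obtain ⟨C, hCb⟩ := exists_abs_iteratedDeriv_one_le hψ
    have h2 := pz (fun n => ψ) (fun n => y n 0) (max C (B 1)) (le_max_of_le_right (hB0 1))
      (fun n => hψ) hy0 (fun n x hx => (hCb x hx).trans (le_max_left _ _))
      (fun n x hx => (by' 1 n 0 x hx).trans (le_max_right _ _)) x hx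
    have h3 := (tendsto_const_nhds (x := ψ x)).sub h2
    simp only [sub_sub_cancel, sub_zero] at h3
    exact ulim_eq (by simpa using h3)
  · intro x hx
    obtain ⟨C, hCb⟩ := exists_abs_iteratedDeriv_one_le hφ
    have h2 := pz (fun n => φ) (fun n => u n 0) (max C (B 1)) (le_max_of_le_right (hB0 1))
      (fun n => hφ) hu0 (fun n x hx => (hCb x hx).trans (le_max_left _ _))
      (fun n x hx => (bu 1 n 0 x hx).trans (le_max_right _ _)) x hx
    have h3 := (tendsto_const_nhds (x := φ x)).sub h2
    simp only [sub_sub_cancel, sub_zero] at h3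
    exact ulim_eq (by simpa using h3)

end JacobiWave

namespace JacobiWave

open MeasureTheory intervalIntegral
open scoped ContDiff

/-- Differentiability on `ℝ × s` from a continuous partial derivative in the first variable and a
partial derivative in the second variable. -/
lemma hasFDerivWithinAt_of_partials {f a b : ℝ × ℝ → ℝ} {s : Set ℝ}
    (ht : ∀ p ∈ univ ×ˢ s, HasDerivAt (fun t => f (t, p.2)) (a p) p.1)
    (hx : ∀ p ∈ univ ×ˢ s, HasDerivWithinAt (fun x => f (p.1, x)) (b p) s p.2)
    (ha : ContinuousOn a (univ ×ˢ s)) {p : ℝ × ℝ} (hp : p ∈ univ ×ˢ s) :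
    HasFDerivWithinAt f (a p • ContinuousLinearMap.fst ℝ ℝ ℝ + b p • ContinuousLinearMap.snd ℝ ℝ ℝ)
      (univ ×ˢ s) p := by
  rw [hasFDerivWithinAt_iff_isLittleO, Asymptotics.isLittleO_iff]
  intro c hc
  obtain ⟨ε, hε, hεa⟩ := Metric.continuousWithinAt_iff.1 (ha p hp) (c / 2) (half_pos hc)
  have h1 := (Asymptotics.isLittleO_iff.1 (hasDerivWithinAt_iff_isLittleO.1 (hx p hp))) (half_pos hc)
  obtain ⟨ε', hε', h1⟩ := Metric.mem_nhdsWithin_iff.1 h1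
  refine Metric.mem_nhdsWithin_iff.2 ⟨min ε ε', lt_min hε hε', fun q ⟨hq, hqs⟩ => ?_⟩
  have hqs2 : q.2 ∈ s := hqs.2
  have hd : dist q p < min ε ε' := hq
  have hd1 : dist q.1 p.1 ≤ dist q p := by rw [Prod.dist_eq]; exact le_max_left _ _
  have hd2 : dist q.2 p.2 ≤ dist q p := by rw [Prod.dist_eq]; exact le_max_right _ _
  have h2 := h1 ⟨Metric.mem_ball.2 (hd2.trans_lt (hd.trans_le (min_le_right _ _))), hqs2⟩
  have h3 := Convex.norm_image_sub_le_of_norm_hasDerivWithin_le (f := fun t => f (t, q.2) - t * a p)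
    (f' := fun t => a (t, q.2) - a p) (s := uIcc p.1 q.1) (C := c / 2) (x := p.1) (y := q.1)
    (fun t _ => by
      have := (ht (t, q.2) ⟨mem_univ _, hqs2⟩).fun_sub ((hasDerivAt_id' t).mul_const (a p))
      simpa using this.hasDerivWithinAt)
    (fun t ht' => by
      have h4 : |t - p.1| ≤ |q.1 - p.1| := abs_sub_left_of_mem_uIcc ht'
      have := @hεa (t, q.2) ⟨mem_univ _, hqs2⟩ (by
        rw [Prod.dist_eq]
        refine (max_le ?_ hd2).trans_lt (hd.trans_le (min_le_left _ _))
        exact le_trans h4 hd1)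
      exact this.le) (convex_uIcc _ _) left_mem_uIcc right_mem_uIcc
  simp only [norm_eq_abs, smul_eq_mul, mem_ofPred_eq, add_apply,
    smul_apply, ContinuousLinearMap.coe_fst', ContinuousLinearMap.coe_snd',
    Prod.fst_sub, Prod.snd_sub] at h2 h3 ⊢
  have e1 : f q - f p - (a p * (q.1 - p.1) + b p * (q.2 - p.2)) =
      (f (q.1, q.2) - q.1 * a p - (f (p.1, q.2) - p.1 * a p)) +
      (f (p.1, q.2) - f (p.1, p.2) - (q.2 - p.2) * b p) := by
    ring
  rw [e1]
  have n1 : |q.1 - p.1| ≤ ‖q - p‖ := norm_fst_le (q - p)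
  have n2 : |q.2 - p.2| ≤ ‖q - p‖ := norm_snd_le (q - p)
  calc _ ≤ c / 2 * |q.1 - p.1| + c / 2 * |q.2 - p.2| := (abs_add_le _ _).trans (add_le_add h3 h2)
    _ ≤ c / 2 * ‖q - p‖ + c / 2 * ‖q - p‖ := by gcongr
    _ = _ := by ring

lemma contDiffOn_succ_of_partials {f a b : ℝ × ℝ → ℝ} {s : Set ℝ} (hs : UniqueDiffOn ℝ s)
    (ht : ∀ p ∈ univ ×ˢ s, HasDerivAt (fun t => f (t, p.2)) (a p) p.1)
    (hx : ∀ p ∈ univ ×ˢ s, HasDerivWithinAt (fun x => f (p.1, x)) (b p) s p.2)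
    {n : ℕ} (ha : ContDiffOn ℝ n a (univ ×ˢ s)) (hb : ContDiffOn ℝ n b (univ ×ˢ s)) :
    ContDiffOn ℝ (n + 1 : ℕ) f (univ ×ˢ s) := by
  have := (contDiffOn_succ_iff_hasFDerivWithinAt_of_uniqueDiffOn (𝕜 := ℝ) (n := n) (f := f)
    (uniqueDiffOn_univ.prod hs)).2 ⟨by simp, fun p =>
      a p • ContinuousLinearMap.fst ℝ ℝ ℝ + b p • ContinuousLinearMap.snd ℝ ℝ ℝ,
      (ha.smul contDiffOn_const).add (hb.smul contDiffOn_const),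
      fun p hp => hasFDerivWithinAt_of_partials ht hx ha.continuousOn hp⟩
  simpa using this

lemma continuousOn_of_partials_bdd {f a b : ℝ × ℝ → ℝ} {s : Set ℝ} (hs : Convex ℝ s) {B : ℝ}
    (ht : ∀ p ∈ univ ×ˢ s, HasDerivAt (fun t => f (t, p.2)) (a p) p.1)
    (hx : ∀ p ∈ univ ×ˢ s, HasDerivWithinAt (fun x => f (p.1, x)) (b p) s p.2)
    (ha : ∀ p ∈ univ ×ˢ s, |a p| ≤ B) (hb : ∀ p ∈ univ ×ˢ s, |b p| ≤ B) :
    ContinuousOn f (univ ×ˢ s) := by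
  refine LipschitzOnWith.continuousOn (K := Real.toNNReal (2 * B)) (LipschitzOnWith.of_dist_le_mul ?_)
  intro p hp q hq
  have hB : 0 ≤ B := (abs_nonneg _).trans (ha p hp)
  have h1 := Convex.norm_image_sub_le_of_norm_hasDerivWithin_le (f := fun t => f (t, p.2))
    (f' := fun t => a (t, p.2)) (s := univ) (C := B) (x := q.1) (y := p.1)
    (fun t _ => (ht (t, p.2) ⟨mem_univ _, hp.2⟩).hasDerivWithinAt)
    (fun t _ => ha (t, p.2) ⟨mem_univ _, hp.2⟩) convex_univ (mem_univ _) (mem_univ _)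
  have h2 := Convex.norm_image_sub_le_of_norm_hasDerivWithin_le (f := fun x => f (q.1, x))
    (f' := fun x => b (q.1, x)) (s := s) (C := B) (x := q.2) (y := p.2)
    (fun x hx' => hx (q.1, x) ⟨mem_univ _, hx'⟩)
    (fun x hx' => hb (q.1, x) ⟨mem_univ _, hx'⟩) hs hq.2 hp.2
  rw [Real.coe_toNNReal _ (by positivity)]
  calc dist (f p) (f q) ≤ dist (f (p.1, p.2)) (f (q.1, p.2)) + dist (f (q.1, p.2)) (f (q.1, q.2)) :=
        dist_triangle _ _ _
    _ ≤ B * dist p.1 q.1 + B * dist p.2 q.2 := add_le_add h1 h2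
    _ ≤ B * dist p q + B * dist p q := by
        rw [Prod.dist_eq]; gcongr
        · exact le_max_left _ _
        · exact le_max_right _ _
    _ = _ := by ring

/-- `ℝ × [0, 1]`. -/
def strip : Set (ℝ × ℝ) := univ ×ˢ Icc (0:ℝ) 1

/-- Functions on the strip with `m` spatial derivatives, all of class `C^n`. -/
def XC (n : ℕ) : ℕ → (ℝ × ℝ → ℝ) → Prop
  | 0, f => ContDiffOn ℝ n f strip
  | m + 1, f => ContDiffOn ℝ n f strip ∧ ∃ f', XC n m f' ∧
      ∀ p ∈ strip, HasDerivWithinAt (fun x => f (p.1, x)) (f' p) (Icc 0 1) p.2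

lemma XC.contDiffOn {n m : ℕ} {f : ℝ × ℝ → ℝ} (h : XC n m f) : ContDiffOn ℝ n f strip := by
  cases m with
  | zero => exact h
  | succ m => exact h.1

lemma XC.pred {n m : ℕ} {f : ℝ × ℝ → ℝ} (h : XC n (m + 1) f) : XC n m f := by
  induction m generalizing f with
  | zero => exact h.1
  | succ m ih => exact ⟨h.1, let ⟨f', h1, h2⟩ := h.2; ⟨f', ih h1, h2⟩⟩

lemma XC.add {n m : ℕ} {f g : ℝ × ℝ → ℝ} (hf : XC n m f) (hg : XC n m g) :
    XC n m (fun p => f p + g p) := by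
  induction m generalizing f g with
  | zero => exact ContDiffOn.add hf hg
  | succ m ih =>
    obtain ⟨h1, f', h2, h3⟩ := hf
    obtain ⟨k1, g', k2, k3⟩ := hg
    exact ⟨h1.add k1, _, ih h2 k2, fun p hp => (h3 p hp).fun_add (k3 p hp)⟩

lemma XC.mul {n m : ℕ} {f g : ℝ × ℝ → ℝ} (hf : XC n m f) (hg : XC n m g) :
    XC n m (fun p => f p * g p) := by
  induction m generalizing f g with
  | zero => exact ContDiffOn.mul hf hg
  | succ m ih =>
    have hf' := hf.pred
    have hg' := hg.pred
    obtain ⟨h1, f', h2, h3⟩ := hf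
    obtain ⟨k1, g', k2, k3⟩ := hg
    exact ⟨h1.mul k1, _, (ih h2 hg').add (ih hf' k2), fun p hp => (h3 p hp).fun_mul (k3 p hp)⟩

lemma xC_const (n m : ℕ) (c : ℝ) : XC n m fun _ => c := by
  induction m generalizing c with
  | zero => exact contDiffOn_const
  | succ m ih => exact ⟨contDiffOn_const, _, ih 0, fun p _ => hasDerivWithinAt_const _ _ _⟩

lemma xC_snd (n m : ℕ) : XC n m fun p => p.2 := by
  cases m with
  | zero => exact contDiffOn_snd
  | succ m => exact ⟨contDiffOn_snd, _, xC_const n m 1, fun p _ => (hasDerivAt_id' _).hasDerivWithinAt⟩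

lemma XC.sum {n m : ℕ} {ι : Type} (s : Finset ι) {f : ι → ℝ × ℝ → ℝ} (hf : ∀ i ∈ s, XC n m (f i)) :
    XC n m (fun p => ∑ i ∈ s, f i p) := by
  classical
  induction s using Finset.induction_on with
  | empty => simpa using xC_const n m 0
  | insert i s hi ih =>
    simp only [Finset.sum_insert hi]
    exact (hf i (Finset.mem_insert_self _ _)).add (ih fun j hj => hf j (Finset.mem_insert_of_mem hj))

lemma XC.comp {d n m : ℕ} {G : ℝ × (Fin d → ℝ) → ℝ} (hG : ContDiff ℝ ∞ G) {J : Fin d → ℝ × ℝ → ℝ}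
    (hJ : ∀ c, XC n m (J c)) : XC n m fun p => G (p.2, fun c => J c p) := by
  have h0 : ∀ {G : ℝ × (Fin d → ℝ) → ℝ}, ContDiff ℝ ∞ G → ∀ {m} {J : Fin d → ℝ × ℝ → ℝ},
      (∀ c, XC n m (J c)) → ContDiffOn ℝ n (fun p => G (p.2, fun c => J c p)) strip := fun hG m J hJ =>
    ContDiff.comp_contDiffOn (hG.of_le (by exact_mod_cast le_top))
      (contDiffOn_snd.prodMk (contDiffOn_pi.2 fun c => (hJ c).contDiffOn))
  induction m generalizing G J with
  | zero => exact h0 hG hJ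
  | succ m ih =>
    refine ⟨h0 hG hJ, ?_⟩
    have hJ1 := fun c => (hJ c).pred
    choose h1 J' h2 h3 using hJ
    refine ⟨fun p => dX G (p.2, fun c => J c p) + ∑ c, dJ G c (p.2, fun c => J c p) * J' c p,
      (ih (contDiff_fderiv_apply hG _) hJ1).add (XC.sum _ fun c _ =>
        (ih (contDiff_fderiv_apply hG _) hJ1).mul (h2 c)), fun p hp => ?_⟩
    have e1 : HasDerivWithinAt (fun x => ((x, fun c => J c (p.1, x)) : ℝ × (Fin d → ℝ)))
        (1, fun c => J' c p) (Icc 0 1) p.2 :=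
      (hasDerivAt_id' _).hasDerivWithinAt.prodMk (hasDerivWithinAt_pi.2 fun c => h3 c p hp)
    have e2 := (hG.differentiable (by simp) (p.2, fun c => J c p)).hasFDerivAt.comp_hasDerivWithinAt p.2 e1
    refine e2.congr_deriv ?_
    rw [fderiv_apply_eq_sum]
    simp [dX, dJ, mul_comm]

lemma XC.of_xFam {n : ℕ} {f : ℕ → ℝ → ℝ → ℝ} (hf : XFam f)
    (hc : ∀ j, ContDiffOn ℝ n (fun p : ℝ × ℝ => f j p.1 p.2) strip) (m j : ℕ) :
    XC n m fun p => f j p.1 p.2 := by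
  induction m generalizing j with
  | zero => exact hc j
  | succ m ih => exact ⟨hc j, _, ih (j + 1), fun p hp => hf j p.1 p.2 hp.2⟩

lemma XC.xFam_contDiffOn {n m : ℕ} {f : ℕ → ℝ → ℝ → ℝ} (hf : XFam f) {i : ℕ} {g : ℝ × ℝ → ℝ}
    (hg : XC n m g) (he : ∀ p ∈ strip, f i p.1 p.2 = g p) :
    ContDiffOn ℝ n (fun p : ℝ × ℝ => f (i + m) p.1 p.2) strip := by
  induction m generalizing i g with
  | zero => exact ContDiffOn.congr hg he
  | succ m ih =>
    obtain ⟨h1, g', h2, h3⟩ := hg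
    have := ih (i := i + 1) h2 fun p hp => ?_
    · rwa [add_right_comm] at this
    · have e1 := hf i p.1 p.2 hp.2
      have e2 : HasDerivWithinAt (fun x => f i p.1 x) (g' p) (Icc 0 1) p.2 :=
        (h3 p hp).congr (fun x hx => he (p.1, x) ⟨mem_univ _, hx⟩) (he p hp)
      exact (uniqueDiffOn_Icc_zero_one p.2 hp.2).eq_deriv _ e1 e2

/-- Classical solutions are smooth. -/
theorem Sol.contDiffOn {ρ : ℝ} {F : ℝ × (Fin 5 → ℝ) → ℝ} {κ : ℝ → ℝ} {ψ φ : ℝ → ℝ}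
    {Y U G : ℕ → ℝ → ℝ → ℝ} (h : Sol ρ F κ ψ φ Y U G) (hF : ContDiff ℝ ∞ F) (hκ : ContDiff ℝ ∞ κ)
    (hκ1 : ∀ t, |κ t| ≤ 1) (n j : ℕ) :
    ContDiffOn ℝ n (fun p : ℝ × ℝ => Y j p.1 p.2) strip ∧
      ContDiffOn ℝ n (fun p : ℝ × ℝ => U j p.1 p.2) strip := by
  induction n generalizing j with
  | zero =>
    obtain ⟨B, hB⟩ := h.bdd j
    obtain ⟨B', hB'⟩ := h.bdd (j + 1)
    have hm : ∀ t a b c : ℝ, |a| ≤ b → |κ t * a| ≤ max b c := fun t a b c hab => by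
      rw [abs_mul]
      refine le_max_of_le_left (le_trans ?_ hab)
      exact mul_le_of_le_one_left (abs_nonneg _) (hκ1 t)
    simp only [CharP.cast_eq_zero, contDiffOn_zero]
    constructor
    · exact continuousOn_of_partials_bdd (convex_Icc _ _) (a := fun p => κ p.1 * U j p.1 p.2)
        (b := fun p => Y (j + 1) p.1 p.2) (B := max B B')
        (fun p hp => h.tY j p.1 p.2 hp.2) (fun p hp => h.xY j p.1 p.2 hp.2)
        (fun p hp => hm _ _ _ _ (hB p.1 p.2 hp.2).2.1)
        (fun p hp => le_max_of_le_right (hB' p.1 p.2 hp.2).1)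
    · exact continuousOn_of_partials_bdd (convex_Icc _ _) (a := fun p => κ p.1 * G j p.1 p.2)
        (b := fun p => U (j + 1) p.1 p.2) (B := max B B')
        (fun p hp => h.tU j p.1 p.2 hp.2) (fun p hp => h.xU j p.1 p.2 hp.2)
        (fun p hp => hm _ _ _ _ (hB p.1 p.2 hp.2).2.2)
        (fun p hp => le_max_of_le_right (hB' p.1 p.2 hp.2).2.1)
  | succ n ih =>
    have hG : ∀ j, ContDiffOn ℝ n (fun p : ℝ × ℝ => G j p.1 p.2) strip := by
      intro j
      have hY := XC.of_xFam h.xY (fun j => (ih j).1) j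
      have hU := XC.of_xFam h.xU (fun j => (ih j).2) j
      have hq : XC n j fun p => qf p.2 * Y 2 p.1 p.2 := by
        have e : (fun p : ℝ × ℝ => qf p.2 * Y 2 p.1 p.2) =
            fun p => (p.2 * (1 + (-1) * p.2)) * Y 2 p.1 p.2 := by
          ext p; simp only [qf]; ring
        rw [e]
        exact ((xC_snd n j).mul ((xC_const n j 1).add ((xC_const n j (-1)).mul (xC_snd n j)))).mul (hY 2)
      have h1 := XC.comp (n := n) (m := j) hF (J := ![fun p => Y 0 p.1 p.2, fun p => Y 1 p.1 p.2,
        fun p => qf p.2 * Y 2 p.1 p.2, fun p => U 0 p.1 p.2, fun p => U 1 p.1 p.2]) (by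
          intro c
          fin_cases c
          exacts [hY 0, hY 1, hq, hU 0, hU 1])
      have h2 := h1.xFam_contDiffOn h.xG (i := 0) (fun p hp => by
        rw [h.eq p.1 p.2 hp.2]
        congr 2
        ext c
        fin_cases c <;> rfl)
      simpa using h2
    have hκ' : ContDiffOn ℝ n (fun p : ℝ × ℝ => κ p.1) strip :=
      ((hκ.comp contDiff_fst).of_le (by exact_mod_cast le_top)).contDiffOn
    exact ⟨contDiffOn_succ_of_partials uniqueDiffOn_Icc_zero_one
        (fun p hp => h.tY j p.1 p.2 hp.2) (fun p hp => h.xY j p.1 p.2 hp.2) (hκ'.mul (ih j).2) (ih (j + 1)).1,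
      contDiffOn_succ_of_partials uniqueDiffOn_Icc_zero_one
        (fun p hp => h.tU j p.1 p.2 hp.2) (fun p hp => h.xU j p.1 p.2 hp.2) (hκ'.mul (hG j)) (ih (j + 1)).2⟩

end JacobiWave

namespace JacobiWave

open MeasureTheory intervalIntegral
open scoped ContDiff

/-- The Taylor coefficients of the entire function `∏ (1 - z / 2 ^ i)`. -/
noncomputable def eulerCoeff : ℕ → ℝ
  | 0 => 1
  | n + 1 => -2 * eulerCoeff n / (2 ^ (n + 1) - 1)

lemma eulerCoeff_succ_mul (n : ℕ) : (2 ^ (n + 1) - 1) * eulerCoeff (n + 1) = -2 * eulerCoeff n := by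
  have : (1:ℝ) < 2 ^ (n + 1) := one_lt_pow₀ (by norm_num) (by omega)
  rw [eulerCoeff]
  field_simp [(by linarith : (2:ℝ) ^ (n + 1) - 1 ≠ 0)]

lemma eulerCoeff_ne_zero (n : ℕ) : eulerCoeff n ≠ 0 := by
  induction n with
  | zero => simp [eulerCoeff]
  | succ n ih =>
    intro h
    have := eulerCoeff_succ_mul n
    rw [h, mul_zero] at this
    exact ih (by linarith)

lemma abs_eulerCoeff_succ (n : ℕ) : |eulerCoeff (n + 1)| = 2 / (2 ^ (n + 1) - 1) * |eulerCoeff n| := by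
  have : (1:ℝ) < 2 ^ (n + 1) := one_lt_pow₀ (by norm_num) (by omega)
  rw [eulerCoeff, abs_div, abs_mul, abs_of_pos (by linarith : (0:ℝ) < 2 ^ (n + 1) - 1)]
  norm_num
  ring

lemma summable_eulerCoeff (z : ℝ) : Summable fun n => |eulerCoeff n| * |z| ^ n := by
  rcases eq_or_ne z 0 with rfl | hz
  · exact summable_of_ne_finset_zero (s := {0}) fun n hn => by
      have : n ≠ 0 := by simpa using hn
      simp [this]
  refine summable_of_ratio_test_tendsto_lt_one (l := 0) (by norm_num)
    (Eventually.of_forall fun n => mul_ne_zero (abs_ne_zero.2 (eulerCoeff_ne_zero n))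
      (pow_ne_zero _ (abs_ne_zero.2 hz))) ?_
  have h1 : Tendsto (fun n : ℕ => 2 * |z| / ((2:ℝ) ^ (n + 1) - 1)) atTop (nhds 0) := by
    refine Tendsto.div_atTop tendsto_const_nhds ?_
    exact tendsto_atTop_add_const_right _ _
      ((tendsto_pow_atTop_atTop_of_one_lt (by norm_num)).comp (tendsto_add_atTop_nat 1))
  refine h1.congr fun n => ?_
  have : (1:ℝ) < 2 ^ (n + 1) := one_lt_pow₀ (by norm_num) (by omega)
  have h2 := abs_ne_zero.2 (eulerCoeff_ne_zero n)
  have h3 := abs_ne_zero.2 hz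
  rw [norm_mul, norm_mul, norm_pow, norm_pow, Real.norm_eq_abs, Real.norm_eq_abs, Real.norm_eq_abs,
    abs_abs, abs_abs, abs_abs, abs_eulerCoeff_succ, pow_succ |z|]
  field_simp

/-- The entire function `∏ (1 - z / 2 ^ i)`. -/
noncomputable def eulerFun (z : ℝ) : ℝ := ∑' n, eulerCoeff n * z ^ n

/-- The coefficients of the solution `A` of `A (2 z) + A z = eulerFun z`. -/
noncomputable def seeleyCoeff (n : ℕ) : ℝ := eulerCoeff n / (2 ^ n + 1)

noncomputable def seeleyFun (z : ℝ) : ℝ := ∑' n, seeleyCoeff n * z ^ n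

lemma summable_eulerCoeff' (z : ℝ) : Summable fun n => eulerCoeff n * z ^ n := by
  refine Summable.of_norm ?_
  simpa [abs_mul, abs_pow] using summable_eulerCoeff z

lemma abs_seeleyCoeff_le (n : ℕ) : |seeleyCoeff n| ≤ |eulerCoeff n| := by
  have : (0:ℝ) < 2 ^ n := by positivity
  rw [seeleyCoeff, abs_div, abs_of_pos (by linarith : (0:ℝ) < 2 ^ n + 1)]
  exact div_le_self (abs_nonneg _) (by linarith)

lemma summable_seeleyCoeff (z : ℝ) : Summable fun n => |seeleyCoeff n| * |z| ^ n :=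
  (summable_eulerCoeff z).of_nonneg_of_le (fun n => by positivity)
    fun n => mul_le_mul_of_nonneg_right (abs_seeleyCoeff_le n) (by positivity)

lemma summable_seeleyCoeff' (z : ℝ) : Summable fun n => seeleyCoeff n * z ^ n := by
  refine Summable.of_norm ?_
  simpa [abs_mul, abs_pow] using summable_seeleyCoeff z

lemma eulerFun_two_mul (z : ℝ) : eulerFun (2 * z) = (1 - 2 * z) * eulerFun z := by
  have h := summable_eulerCoeff'
  have e1 : eulerFun (2 * z) - eulerFun z = ∑' n, (2 ^ n - 1) * eulerCoeff n * z ^ n := by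
    rw [eulerFun, eulerFun, ← (h _).tsum_sub (h _)]
    exact tsum_congr fun n => by rw [mul_pow]; ring
  have h2 : Summable fun n => (2 ^ n - 1) * eulerCoeff n * z ^ n :=
    ((h (2 * z)).sub (h z)).congr fun n => by rw [mul_pow]; ring
  have e2 : ∑' n, (2 ^ n - 1) * eulerCoeff n * z ^ n = -2 * z * eulerFun z := by
    rw [h2.tsum_eq_zero_add, eulerFun, ← tsum_mul_left]
    simp only [pow_zero, sub_self, zero_mul, zero_add]
    exact tsum_congr fun n => by rw [eulerCoeff_succ_mul]; ring
  linarith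

lemma eulerFun_two_pow (j : ℕ) : eulerFun (2 ^ j) = 0 := by
  induction j with
  | zero => have := eulerFun_two_mul (1 / 2); norm_num at this; simpa using this
  | succ j ih => rw [pow_succ', eulerFun_two_mul, ih, mul_zero]

lemma seeleyFun_two_mul (z : ℝ) : seeleyFun (2 * z) + seeleyFun z = eulerFun z := by
  rw [seeleyFun, seeleyFun, ← (summable_seeleyCoeff' _).tsum_add (summable_seeleyCoeff' _), eulerFun]
  refine tsum_congr fun n => ?_
  have : (0:ℝ) < 2 ^ n := by positivity
  rw [seeleyCoeff, mul_pow]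
  field_simp

lemma seeleyFun_two_pow (j : ℕ) : seeleyFun (2 ^ j) = (-1) ^ j * seeleyFun 1 := by
  induction j with
  | zero => simp
  | succ j ih =>
    have := seeleyFun_two_mul (2 ^ j)
    rw [eulerFun_two_pow, ← pow_succ'] at this
    rw [pow_succ (-1 : ℝ)]
    linarith

lemma seeleyFun_one_pos : 0 < seeleyFun 1 := by
  have hb : ∀ n, |eulerCoeff (n + 4)| ≤ 16 / 315 * (1 / 2) ^ n := by
    intro n
    induction n with
    | zero => norm_num [eulerCoeff]
    | succ n ih =>
      have h5 : (5:ℝ) ≤ 2 ^ (n + 4 + 1) := by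
        calc (5:ℝ) ≤ 2 ^ 5 := by norm_num
          _ ≤ _ := pow_le_pow_right₀ (by norm_num) (by omega)
      rw [show n + 1 + 4 = n + 4 + 1 by ring, abs_eulerCoeff_succ, pow_succ]
      calc 2 / (2 ^ (n + 4 + 1) - 1) * |eulerCoeff (n + 4)| ≤ 1 / 2 * (16 / 315 * (1 / 2) ^ n) := by
            refine mul_le_mul ?_ ih (abs_nonneg _) (by norm_num)
            rw [div_le_div_iff₀ (by linarith) (by norm_num)]
            linarith
        _ = _ := by ring
  have hg : Summable fun n : ℕ => (16 / 315 / 17 : ℝ) * (1 / 2) ^ n :=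
    (summable_geometric_of_lt_one (by norm_num) (by norm_num)).mul_left _
  have hb' : ∀ n : ℕ, ‖seeleyCoeff (n + 4) * 1 ^ (n + 4)‖ ≤ (16 / 315 / 17 : ℝ) * (1 / 2) ^ n := by
    intro n
    have h16 : (16:ℝ) ≤ 2 ^ (n + 4) := by
      calc (16:ℝ) = 2 ^ 4 := by norm_num
        _ ≤ _ := pow_le_pow_right₀ (by norm_num) (by omega)
    rw [one_pow, mul_one, norm_eq_abs, seeleyCoeff, abs_div,
      abs_of_pos (by linarith : (0:ℝ) < 2 ^ (n + 4) + 1), div_le_iff₀ (by linarith)]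
    refine (hb n).trans ?_
    have : (0:ℝ) ≤ (1 / 2) ^ n := by positivity
    nlinarith
  have h1 := tsum_of_norm_bounded hg.hasSum hb'
  have h2 := (summable_seeleyCoeff' 1).sum_add_tsum_nat_add 4
  rw [tsum_mul_left, tsum_geometric_two] at h1
  rw [seeleyFun, ← h2]
  have h3 := (abs_le.1 h1).1
  norm_num [Finset.sum_range_succ, seeleyCoeff, eulerCoeff] at h3 ⊢
  linarith

/-- Seeley's coefficients. -/
lemma exists_seeley : ∃ a : ℕ → ℝ, (∀ j : ℕ, Summable fun k => |a k| * ((2:ℝ) ^ k) ^ j) ∧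
    ∀ j : ℕ, ∑' k, a k * (-(2:ℝ) ^ k) ^ j = 1 := by
  have h0 := seeleyFun_one_pos
  refine ⟨fun k => seeleyCoeff k / seeleyFun 1, fun j => ?_, fun j => ?_⟩
  · have := (summable_seeleyCoeff (2 ^ j)).mul_left (seeleyFun 1)⁻¹
    refine this.congr fun k => ?_
    rw [abs_div, abs_of_pos h0, abs_of_pos (show (0:ℝ) < 2 ^ j by positivity), ← pow_mul,
      ← pow_mul, mul_comm j k]
    field_simp
  · have e : ∀ k, seeleyCoeff k / seeleyFun 1 * (-(2:ℝ) ^ k) ^ j =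
        (-1) ^ j / seeleyFun 1 * (seeleyCoeff k * (2 ^ j) ^ k) := fun k => by
      rw [neg_pow, ← pow_mul, ← pow_mul, mul_comm j k]; ring
    simp only [e]
    rw [tsum_mul_left]
    change (-1) ^ j / seeleyFun 1 * seeleyFun (2 ^ j) = 1
    rw [seeleyFun_two_pow, div_mul_eq_mul_div, ← mul_assoc, ← pow_add, Even.neg_one_pow ⟨j, rfl⟩]
    field_simp

end JacobiWave

namespace JacobiWave

open MeasureTheory intervalIntegral
open scoped ContDiff

/-- `ℝ × [0, ∞)`. -/
def halfPlane : Set (ℝ × ℝ) := univ ×ˢ Ici (0:ℝ)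

lemma uniqueDiffOn_halfPlane : UniqueDiffOn ℝ halfPlane := uniqueDiffOn_univ.prod (uniqueDiffOn_Ici 0)

/-- Smooth functions on the half plane with compact support. -/
structure CSH (f : ℝ × ℝ → ℝ) : Prop where
  smooth : ContDiffOn ℝ ∞ f halfPlane
  supp : ∃ R : ℝ, ∀ p ∈ halfPlane, (R < |p.1| ∨ R < p.2) → f p = 0

/-- Directional derivatives on the half plane. -/
noncomputable def hd (v : ℝ × ℝ) (f : ℝ × ℝ → ℝ) (p : ℝ × ℝ) : ℝ := fderivWithin ℝ f halfPlane p v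

lemma CSH.hd {f : ℝ × ℝ → ℝ} (hf : CSH f) (v : ℝ × ℝ) : CSH (hd v f) where
  smooth := (hf.smooth.fderivWithin uniqueDiffOn_halfPlane (m := ∞) (by simp)).clm_apply contDiffOn_const
  supp := by
    obtain ⟨R, hR⟩ := hf.supp
    refine ⟨R, fun p hp h => ?_⟩
    have ho : IsOpen {q : ℝ × ℝ | R < |q.1| ∨ R < q.2} :=
      (isOpen_lt continuous_const (continuous_abs.comp continuous_fst)).union
        (isOpen_lt continuous_const continuous_snd)
    have he : f =ᶠ[nhdsWithin p halfPlane] fun _ => 0 := by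
      filter_upwards [self_mem_nhdsWithin, mem_nhdsWithin_of_mem_nhds (ho.mem_nhds h)] with q h1 h2
      exact hR q h1 h2
    rw [JacobiWave.hd, he.fderivWithin_eq (hR p hp h)]
    simp

lemma CSH.bdd {f : ℝ × ℝ → ℝ} (hf : CSH f) : ∃ C : ℝ, 0 ≤ C ∧ ∀ p ∈ halfPlane, |f p| ≤ C := by
  obtain ⟨R, hR⟩ := hf.supp
  obtain ⟨C, hC⟩ := (isCompact_Icc (a := -R) (b := R)).prod (isCompact_Icc (a := (0:ℝ)) (b := R))
    |>.exists_bound_of_continuousOn (hf.smooth.continuousOn.mono (prod_mono (subset_univ _) fun x hx => hx.1))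
  refine ⟨max C 0, le_max_right _ _, fun p hp => ?_⟩
  by_cases h : R < |p.1| ∨ R < p.2
  · rw [hR p hp h, abs_zero]; exact le_max_right _ _
  · push Not at h
    exact (hC p ⟨abs_le.1 h.1, hp.2, h.2⟩).trans (le_max_left _ _)

lemma CSH.hasDerivAt_fst {f : ℝ × ℝ → ℝ} (hf : CSH f) {t x : ℝ} (hx : 0 ≤ x) :
    HasDerivAt (fun t => f (t, x)) (JacobiWave.hd (1, 0) f (t, x)) t := by
  have h1 := (hf.smooth.differentiableOn (by simp) (t, x) ⟨mem_univ _, hx⟩).hasFDerivWithinAt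
  have h2 : HasDerivWithinAt (fun s : ℝ => (s, x)) (1, 0) univ t :=
    ((hasDerivAt_id' t).prodMk (hasDerivAt_const t x)).hasDerivWithinAt
  have hm : MapsTo (fun s : ℝ => (s, x)) univ halfPlane := fun s _ => ⟨mem_univ _, hx⟩
  exact (h1.comp_hasDerivWithinAt t h2 hm).hasDerivAt univ_mem

lemma CSH.hasDerivWithinAt_snd {f : ℝ × ℝ → ℝ} (hf : CSH f) {t x : ℝ} (hx : 0 ≤ x) :
    HasDerivWithinAt (fun x => f (t, x)) (JacobiWave.hd (0, 1) f (t, x)) (Ici 0) x := by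
  have h1 := (hf.smooth.differentiableOn (by simp) (t, x) ⟨mem_univ _, hx⟩).hasFDerivWithinAt
  have h2 : HasDerivWithinAt (fun s : ℝ => (t, s)) (0, 1) (Ici 0) x :=
    ((hasDerivAt_const x t).prodMk (hasDerivAt_id' x)).hasDerivWithinAt
  have hm : MapsTo (fun s : ℝ => (t, s)) (Ici 0) halfPlane := fun s hs => ⟨mem_univ _, hs⟩
  exact h1.comp_hasDerivWithinAt x h2 hm

lemma CSH.hasDerivAt_snd {f : ℝ × ℝ → ℝ} (hf : CSH f) {t x : ℝ} (hx : 0 < x) :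
    HasDerivAt (fun x => f (t, x)) (JacobiWave.hd (0, 1) f (t, x)) x :=
  (hf.hasDerivWithinAt_snd hx.le).hasDerivAt (Ici_mem_nhds hx)

/-- Seeley's extension operators. -/
noncomputable def seeley (a : ℕ → ℝ) (j : ℕ) (f : ℝ × ℝ → ℝ) (p : ℝ × ℝ) : ℝ :=
  f (p.1, max p.2 0) + ∑' k, a k * (-(2:ℝ) ^ k) ^ j * (f (p.1, max (-(2:ℝ) ^ k * p.2) 0) - f (p.1, 0))

lemma seeley_of_nonneg (a : ℕ → ℝ) (j : ℕ) (f : ℝ × ℝ → ℝ) {p : ℝ × ℝ} (hp : 0 ≤ p.2) :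
    seeley a j f p = f p := by
  have h : ∀ k : ℕ, max (-(2:ℝ) ^ k * p.2) 0 = 0 := fun k => by
    refine max_eq_right ?_
    have : 0 ≤ (2:ℝ) ^ k * p.2 := by positivity
    linarith
  simp only [seeley, h, max_eq_left hp, sub_self, mul_zero, tsum_zero, add_zero]

lemma CSH.abs_seeley_term_le {f : ℝ × ℝ → ℝ} {C : ℝ} (hC : ∀ p ∈ halfPlane, |f p| ≤ C) (c t x y : ℝ)
    (hx : 0 ≤ x) (hy : 0 ≤ y) : ‖c * (f (t, x) - f (t, y))‖ ≤ |c| * (2 * C) := by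
  rw [norm_mul, norm_eq_abs, norm_eq_abs]
  gcongr
  have h1 := abs_le.1 (hC (t, x) ⟨mem_univ _, hx⟩)
  have h2 := abs_le.1 (hC (t, y) ⟨mem_univ _, hy⟩)
  exact abs_le.2 ⟨by linarith, by linarith⟩

section
variable {a : ℕ → ℝ} (ha : ∀ j : ℕ, Summable fun k => |a k| * ((2:ℝ) ^ k) ^ j)
  (ha1 : ∀ j : ℕ, ∑' k, a k * (-(2:ℝ) ^ k) ^ j = 1)
include ha

lemma summable_seeley (j : ℕ) (C : ℝ) : Summable fun k => |a k * (-(2:ℝ) ^ k) ^ j| * C := by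
  refine ((ha j).mul_right C).congr fun k => ?_
  rw [abs_mul, abs_pow, abs_neg, abs_of_pos (by positivity : (0:ℝ) < 2 ^ k)]

lemma CSH.continuous_seeley {f : ℝ × ℝ → ℝ} (hf : CSH f) (j : ℕ) : Continuous (seeley a j f) := by
  obtain ⟨C, hC, hb⟩ := hf.bdd
  have hc : ∀ l : ℝ, Continuous fun p : ℝ × ℝ => f (p.1, max (l * p.2) 0) := fun l =>
    hf.smooth.continuousOn.comp_continuous (by fun_prop) fun p => ⟨mem_univ _, mem_Ici.2 (le_max_right _ _)⟩
  have h0 : Continuous fun p : ℝ × ℝ => f (p.1, 0) :=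
    hf.smooth.continuousOn.comp_continuous (by fun_prop) fun p => ⟨mem_univ _, mem_Ici.2 le_rfl⟩
  refine Continuous.add (by simpa using hc 1) ?_
  exact continuous_tsum (fun k => continuous_const.mul ((hc _).sub h0)) (summable_seeley ha j (2 * C))
    fun k p => CSH.abs_seeley_term_le hb _ _ _ _ (le_max_right _ _) le_rfl

lemma CSH.hasDerivAt_seeley_fst {f : ℝ × ℝ → ℝ} (hf : CSH f) (j : ℕ) (t x : ℝ) :
    HasDerivAt (fun t => seeley a j f (t, x)) (seeley a j (JacobiWave.hd (1, 0) f) (t, x)) t := by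
  obtain ⟨C, hC, hb⟩ := hf.bdd
  obtain ⟨C', hC', hb'⟩ := (hf.hd (1, 0)).bdd
  refine HasDerivAt.fun_add (hf.hasDerivAt_fst (le_max_right _ _)) ?_
  refine hasDerivAt_tsum (y₀ := t) (summable_seeley ha j (2 * C'))
    (fun k s => ((hf.hasDerivAt_fst (x := max (-(2:ℝ) ^ k * x) 0) (le_max_right _ _)).fun_sub
      (hf.hasDerivAt_fst le_rfl)).const_mul _)
    (fun k s => CSH.abs_seeley_term_le hb' _ _ _ _ (le_max_right _ _) le_rfl) ?_ t
  exact Summable.of_norm_bounded (summable_seeley ha j (2 * C))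
    fun k => CSH.abs_seeley_term_le hb _ _ _ _ (le_max_right _ _) le_rfl

include ha1

lemma CSH.seeley_of_neg {f : ℝ × ℝ → ℝ} (hf : CSH f) (j : ℕ) {t x : ℝ} (hx : x < 0) :
    seeley a j f (t, x) = ∑' k, a k * (-(2:ℝ) ^ k) ^ j * f (t, -(2:ℝ) ^ k * x) := by
  obtain ⟨C, hC, hb⟩ := hf.bdd
  have hp : ∀ k : ℕ, 0 ≤ -(2:ℝ) ^ k * x := fun k => by
    have : (0:ℝ) < 2 ^ k := by positivity
    nlinarith
  have hs : ∀ y : ℕ → ℝ, (∀ k, 0 ≤ y k) →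
      Summable fun k => a k * (-(2:ℝ) ^ k) ^ j * f (t, y k) := fun y hy =>
    Summable.of_norm_bounded (summable_seeley ha j C) fun k => by
      rw [norm_mul, norm_eq_abs, norm_eq_abs]
      gcongr
      exact hb _ ⟨mem_univ _, hy k⟩
  simp only [seeley, max_eq_right hx.le, max_eq_left (hp _), mul_sub]
  rw [(hs _ hp).tsum_sub (hs _ fun _ => le_rfl), tsum_mul_right, ha1]
  ring

lemma CSH.hasDerivAt_seeley_snd {f : ℝ × ℝ → ℝ} (hf : CSH f) (j : ℕ) (t x : ℝ) :
    HasDerivAt (fun x => seeley a j f (t, x)) (seeley a (j + 1) (JacobiWave.hd (0, 1) f) (t, x)) x := by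
  obtain ⟨C, hC, hb⟩ := hf.bdd
  have hf' := hf.hd (0, 1)
  obtain ⟨C', hC', hb'⟩ := hf'.bdd
  refine hasDerivAt_of_hasDerivAt_of_ne' (x := 0) (f := fun x => seeley a j f (t, x))
    (g := fun x => seeley a (j + 1) (JacobiWave.hd (0, 1) f) (t, x)) (fun y hy => ?_)
    ((hf.continuous_seeley ha j).comp (Continuous.prodMk_right t)).continuousAt
    ((hf'.continuous_seeley ha (j + 1)).comp (Continuous.prodMk_right t)).continuousAt x
  rcases lt_or_gt_of_ne hy with h | h
  · have e : (fun x => seeley a j f (t, x)) =ᶠ[nhds y]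
        fun x => ∑' k, a k * (-(2:ℝ) ^ k) ^ j * f (t, -(2:ℝ) ^ k * x) := by
      filter_upwards [Iio_mem_nhds h] with z hz
      exact hf.seeley_of_neg ha ha1 j hz
    refine HasDerivAt.congr_of_eventuallyEq ?_ e
    rw [hf'.seeley_of_neg ha ha1 (j + 1) h]
    have hp : ∀ k : ℕ, ∀ z < 0, 0 < -(2:ℝ) ^ k * z := fun k z hz => by
      have : (0:ℝ) < 2 ^ k := by positivity
      nlinarith
    refine hasDerivAt_tsum_of_isPreconnected (t := Iio 0) (y₀ := y)
      (g := fun k x => a k * (-(2:ℝ) ^ k) ^ j * f (t, -(2:ℝ) ^ k * x))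
      (g' := fun k x => a k * (-(2:ℝ) ^ k) ^ (j + 1) * JacobiWave.hd (0, 1) f (t, -(2:ℝ) ^ k * x)) (summable_seeley ha (j + 1) C')
      isOpen_Iio isPreconnected_Iio (fun k z hz => ?_) (fun k z hz => ?_) h ?_ h
    · have h1 := HasDerivAt.comp (h₂ := fun x => f (t, x)) z (hf.hasDerivAt_snd (t := t) (hp k z hz))
        ((hasDerivAt_id' z).const_mul (-(2:ℝ) ^ k))
      refine (h1.const_mul (a k * (-(2:ℝ) ^ k) ^ j)).congr_deriv ?_
      ring
    · rw [norm_mul, norm_eq_abs, norm_eq_abs]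
      gcongr
      exact hb' _ ⟨mem_univ _, (hp k z hz).le⟩
    · refine Summable.of_norm_bounded (summable_seeley ha j C) fun k => ?_
      rw [norm_mul, norm_eq_abs, norm_eq_abs]
      gcongr
      exact hb _ ⟨mem_univ _, (hp k y h).le⟩
  · have e : (fun x => seeley a j f (t, x)) =ᶠ[nhds y] fun x => f (t, x) := by
      filter_upwards [Ioi_mem_nhds h] with z hz
      exact seeley_of_nonneg a j f (p := (t, z)) (le_of_lt hz)
    refine HasDerivAt.congr_of_eventuallyEq ?_ e
    rw [seeley_of_nonneg a (j + 1) _ (p := (t, y)) h.le]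
    exact hf.hasDerivAt_snd h

lemma CSH.contDiff_seeley {f : ℝ × ℝ → ℝ} (hf : CSH f) (n j : ℕ) : ContDiff ℝ n (seeley a j f) := by
  induction n generalizing f j with
  | zero =>
    have := contDiff_zero (𝕜 := ℝ).2 (hf.continuous_seeley ha j)
    simpa using this
  | succ n ih =>
    rw [← contDiffOn_univ, ← univ_prod_univ]
    exact contDiffOn_succ_of_partials (a := seeley a j (JacobiWave.hd (1, 0) f))
      (b := seeley a (j + 1) (JacobiWave.hd (0, 1) f)) uniqueDiffOn_univ
      (fun p _ => hf.hasDerivAt_seeley_fst ha j p.1 p.2)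
      (fun p _ => (hf.hasDerivAt_seeley_snd ha ha1 j p.1 p.2).hasDerivWithinAt)
      (ih (hf.hd _) j).contDiffOn (ih (hf.hd _) (j + 1)).contDiffOn

end

lemma exists_extension_of_support {h : ℝ × ℝ → ℝ} (hh : ContDiffOn ℝ ∞ h strip) {R : ℝ}
    (h0 : ∀ p ∈ strip, (R ≤ |p.1| ∨ 2 / 3 ≤ p.2) → h p = 0) :
    ∃ g : ℝ × ℝ → ℝ, ContDiff ℝ ∞ g ∧ ∀ p ∈ strip, g p = h p := by
  classical
  obtain ⟨a, ha, ha1⟩ := exists_seeley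
  set f : ℝ × ℝ → ℝ := fun p => if p.2 ≤ 1 then h p else 0 with hf
  have hfz : ∀ p ∈ halfPlane, (R ≤ |p.1| ∨ 2 / 3 ≤ p.2) → f p = 0 := fun p hp hor => by
    simp only [hf]
    split_ifs with h1
    · exact h0 p ⟨mem_univ _, hp.2, h1⟩ hor
    · rfl
  have hfe : ∀ p ∈ strip, f p = h p := fun p hp => if_pos hp.2.2
  have hC : CSH f := by
    refine ⟨fun p hp => ?_, max R (2 / 3), fun p hp hor => hfz p hp (hor.imp
      (fun h => (le_max_left _ _).trans h.le) (fun h => (le_max_right _ _).trans h.le))⟩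
    rcases lt_or_ge p.2 1 with h1 | h1
    · have hps : p ∈ strip := ⟨mem_univ _, hp.2, h1.le⟩
      have h2 : ContDiffWithinAt ℝ ∞ f strip p := (hh p hps).congr hfe (hfe p hps)
      refine h2.mono_of_mem_nhdsWithin ?_
      filter_upwards [self_mem_nhdsWithin,
        mem_nhdsWithin_of_mem_nhds ((isOpen_lt continuous_snd continuous_const).mem_nhds h1)] with q hq hq1
      exact ⟨mem_univ _, hq.2, le_of_lt hq1⟩
    · have : f =ᶠ[nhdsWithin p halfPlane] fun _ => 0 := by
        filter_upwards [self_mem_nhdsWithin, mem_nhdsWithin_of_mem_nhds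
          ((isOpen_lt continuous_const continuous_snd).mem_nhds (show (2 / 3 : ℝ) < p.2 by linarith))] with q hq hq1
        exact hfz q hq (Or.inr (le_of_lt hq1))
      exact contDiffWithinAt_const.congr_of_eventuallyEq this (hfz p hp (Or.inr (by linarith)))
  refine ⟨seeley a 0 f, contDiff_infty.2 fun n => hC.contDiff_seeley ha ha1 n 0, fun p hp => ?_⟩
  rw [seeley_of_nonneg a 0 f hp.2.1, hfe p hp]

/-- Smooth functions on the strip extend to the plane, locally in time. -/
lemma exists_extension {f : ℝ × ℝ → ℝ} (hf : ContDiffOn ℝ ∞ f strip) (R : ℝ) :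
    ∃ g : ℝ × ℝ → ℝ, ContDiff ℝ ∞ g ∧ ∀ p ∈ strip, |p.1| ≤ R → g p = f p := by
  set θ : ℝ × ℝ → ℝ := fun p => smoothTransition (R + 1 - p.1) * smoothTransition (R + 1 + p.1) with hθ
  set χ : ℝ × ℝ → ℝ := fun p => smoothTransition (2 - 3 * p.2) with hχ
  have sθ : ContDiff ℝ ∞ θ := by
    have : ContDiff ℝ ∞ smoothTransition := smoothTransition.contDiff
    exact (this.comp (contDiff_const.sub contDiff_fst)).mul (this.comp (contDiff_const.add contDiff_fst))
  have sχ : ContDiff ℝ ∞ χ :=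
    smoothTransition.contDiff.comp (contDiff_const.sub (contDiff_const.mul contDiff_snd))
  have θ0 : ∀ p : ℝ × ℝ, R + 1 ≤ |p.1| → θ p = 0 := fun p hp => by
    rcases le_abs.1 hp with h | h
    · simp [hθ, smoothTransition.zero_of_nonpos (by linarith : R + 1 - p.1 ≤ 0)]
    · simp [hθ, smoothTransition.zero_of_nonpos (by linarith : R + 1 + p.1 ≤ 0)]
  have θ1 : ∀ p : ℝ × ℝ, |p.1| ≤ R → θ p = 1 := fun p hp => by
    have := abs_le.1 hp
    simp [hθ, smoothTransition.one_of_one_le (by linarith : 1 ≤ R + 1 - p.1),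
      smoothTransition.one_of_one_le (by linarith : 1 ≤ R + 1 + p.1)]
  set r : ℝ × ℝ → ℝ × ℝ := fun p => (p.1, 1 - p.2) with hr
  have sr : ContDiff ℝ ∞ r := contDiff_fst.prodMk (contDiff_const.sub contDiff_snd)
  have mr : ∀ p ∈ strip, r p ∈ strip := fun p hp =>
    ⟨mem_univ _, by simp [hr, hp.2.2], by simp [hr, hp.2.1]⟩
  have rr : ∀ p, r (r p) = p := fun p => by simp [hr]
  obtain ⟨g₁, s₁, h₁⟩ := exists_extension_of_support (h := fun p => θ p * χ p * f p)
    ((sθ.mul sχ).contDiffOn.mul hf) (R := R + 1) fun p hp h => by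
      rcases h with h | h
      · simp [θ0 p h]
      · simp [hχ, smoothTransition.zero_of_nonpos (by linarith : 2 - 3 * p.2 ≤ 0)]
  obtain ⟨g₂, s₂, h₂⟩ := exists_extension_of_support (h := fun p => θ (r p) * (1 - χ (r p)) * f (r p))
    (((sθ.comp sr).mul (contDiff_const.sub (sχ.comp sr))).contDiffOn.mul (hf.comp sr.contDiffOn mr))
    (R := R + 1) fun p hp h => by
      rcases h with h | h
      · simp [θ0 (r p) h]
      · simp [hχ, hr, smoothTransition.one_of_one_le (by linarith : 1 ≤ 2 - 3 * (1 - p.2))]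
  refine ⟨fun p => g₁ p + g₂ (r p), s₁.add (s₂.comp sr), fun p hp hR => ?_⟩
  simp only [h₁ p hp, h₂ (r p) (mr p hp), rr, θ1 p hR]
  ring

end JacobiWave

namespace JacobiWave

open MeasureTheory intervalIntegral
open scoped ContDiff

section
variable {E : Type*} [NormedAddCommGroup E]

/-- A property holding near the zero section over `[0, 1]` holds on a uniform tube. -/
lemma exists_tube {P : ℝ × E → Prop} (h : ∀ x ∈ Icc (0:ℝ) 1, ∀ᶠ p in nhds (x, (0:E)), P p) :
    ∃ r : ℝ, 0 < r ∧ ∀ x ∈ Icc (-r) (1 + r), ∀ e : E, ‖e‖ ≤ r → P (x, e) := by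
  have hK : IsCompact (Icc (0:ℝ) 1 ×ˢ {(0:E)}) := isCompact_Icc.prod isCompact_singleton
  obtain ⟨r, hr, hs⟩ := hK.exists_cthickening_subset_open (isOpen_interior (s := {p | P p})) (by
    rintro ⟨x, e⟩ ⟨hx, rfl⟩
    exact mem_interior_iff_mem_nhds.2 (h x hx))
  refine ⟨r, hr, fun x hx e he => ?_⟩
  have h1 : (max 0 (min x 1), (0:E)) ∈ Icc (0:ℝ) 1 ×ˢ {(0:E)} :=
    ⟨⟨le_max_left _ _, max_le zero_le_one (min_le_right _ _)⟩, rfl⟩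
  have h2 : dist (x, e) (max 0 (min x 1), (0:E)) ≤ r := by
    rw [Prod.dist_eq]
    refine max_le ?_ (by simpa using he)
    rw [dist_eq]
    rcases le_total x 1 with h1 | h1
    · rcases le_total x 0 with h0 | h0
      · rw [min_eq_left h1, max_eq_left h0]
        exact abs_le.2 ⟨by linarith [hx.1], by linarith⟩
      · rw [min_eq_left h1, max_eq_right h0]
        simpa using hr.le
    · rw [min_eq_right h1, max_eq_right zero_le_one]
      exact abs_le.2 ⟨by linarith, by linarith [hx.2]⟩
  have h3 := hs (Metric.mem_cthickening_of_dist_le _ _ _ _ h1 h2)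
  exact interior_subset h3

variable [NormedSpace ℝ E] [FiniteDimensional ℝ E]

/-- Analytic functions near the zero section over `[0, 1]` agree there with smooth functions of compact
support. -/
lemma exists_cutoff {f : ℝ × E → ℝ} (h : ∀ x ∈ Icc (0:ℝ) 1, AnalyticAt ℝ f (x, (0:E))) :
    ∃ g : ℝ × E → ℝ, ContDiff ℝ ∞ g ∧ HasCompactSupport g ∧
      ∀ x ∈ Icc (0:ℝ) 1, ∀ᶠ p in nhds (x, (0:E)), g p = f p := by
  obtain ⟨r, hr, ht⟩ := exists_tube fun x hx => (h x hx).eventually_analyticAt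
  let b : ContDiffBump (1 / 2 : ℝ) := ⟨1 / 2 + r / 2, 1 / 2 + r, by positivity, by linarith⟩
  let c : ContDiffBump (0 : E) := ⟨r / 2, r, by positivity, by linarith⟩
  have hc : ContDiff ℝ ∞ fun p : ℝ × E => b p.1 * c p.2 := by
    have h1 : ContDiff ℝ ∞ b := b.contDiff
    have h2 : ContDiff ℝ ∞ c := c.contDiff
    exact (h1.comp contDiff_fst).mul (h2.comp contDiff_snd)
  have hz : ∀ p : ℝ × E, ¬(dist p.1 (1 / 2) ≤ 1 / 2 + r ∧ dist p.2 0 ≤ r) → b p.1 * c p.2 * f p = 0 := by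
    intro p hp
    by_cases h1 : dist p.1 (1 / 2) ≤ 1 / 2 + r
    · have h2 : r ≤ dist p.2 0 := le_of_not_ge fun h2 => hp ⟨h1, h2⟩
      rw [c.zero_of_le_dist h2, mul_zero, zero_mul]
    · rw [b.zero_of_le_dist (le_of_not_ge h1), zero_mul, zero_mul]
  refine ⟨fun p => b p.1 * c p.2 * f p, contDiff_iff_contDiffAt.2 fun p => ?_, ?_, fun x hx => ?_⟩
  · by_cases hp : dist p.1 (1 / 2) ≤ 1 / 2 + r ∧ dist p.2 0 ≤ r
    · refine hc.contDiffAt.mul (AnalyticAt.contDiffAt (ht p.1 ?_ p.2 (by simpa using hp.2)))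
      have := hp.1
      rw [dist_eq] at this
      obtain ⟨h1, h2⟩ := abs_le.1 this
      exact ⟨by linarith, by linarith⟩
    · have ho : IsClosed (Metric.closedBall (1 / 2 : ℝ) (1 / 2 + r) ×ˢ Metric.closedBall (0:E) r) :=
        Metric.isClosed_closedBall.prod Metric.isClosed_closedBall
      refine contDiffAt_const (c := (0:ℝ)) |>.congr_of_eventuallyEq ?_
      filter_upwards [ho.isOpen_compl.mem_nhds fun h => hp h] with q hq using hz q fun h => hq h
  · refine HasCompactSupport.intro ((isCompact_closedBall (1 / 2 : ℝ) (1 / 2 + r)).prod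
      (isCompact_closedBall (0:E) r)) fun p hp => hz p fun h => hp h
  · have h1 : ∀ᶠ p : ℝ × E in nhds (x, 0), p.1 ∈ Metric.ball (1 / 2 : ℝ) (1 / 2 + r / 2) ∧
        p.2 ∈ Metric.ball (0:E) (r / 2) := by
      refine ((Metric.isOpen_ball.prod Metric.isOpen_ball).mem_nhds ⟨?_, ?_⟩)
      · rw [Metric.mem_ball, dist_eq]
        exact abs_lt.2 ⟨by linarith [hx.1], by linarith [hx.2]⟩
      · exact Metric.mem_ball_self (by positivity)
    filter_upwards [h1] with p hp
    rw [b.one_of_mem_closedBall (Metric.ball_subset_closedBall hp.1),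
      c.one_of_mem_closedBall (Metric.ball_subset_closedBall hp.2), one_mul, one_mul]

end

/-- A function vanishing at both end points is controlled by `qf`. -/
lemma abs_le_qf_of_boundary {g g' : ℝ → ℝ} {C : ℝ} (hC : 0 ≤ C)
    (hd : ∀ x ∈ Icc (0:ℝ) 1, HasDerivAt g (g' x) x) (hb : ∀ x ∈ Icc (0:ℝ) 1, |g' x| ≤ C)
    (h0 : g 0 = 0) (h1 : g 1 = 0) {x : ℝ} (hx : x ∈ Icc (0:ℝ) 1) : |g x| ≤ 2 * C * qf x := by
  have hl : ∀ y ∈ Icc (0:ℝ) 1, ‖g x - g y‖ ≤ C * ‖x - y‖ := fun y hy =>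
    (convex_Icc 0 1).norm_image_sub_le_of_norm_hasDerivWithin_le
      (fun z hz => (hd z hz).hasDerivWithinAt) hb hy hx
  have e0 := hl 0 (left_mem_Icc.2 zero_le_one)
  have e1 := hl 1 (right_mem_Icc.2 zero_le_one)
  rw [h0, sub_zero, sub_zero, norm_eq_abs, norm_eq_abs, abs_of_nonneg hx.1] at e0
  rw [h1, sub_zero, norm_eq_abs, norm_eq_abs, abs_sub_comm, abs_of_nonneg (sub_nonneg.2 hx.2)] at e1
  unfold qf
  rcases le_total x (1 / 2) with h | h
  · nlinarith [mul_nonneg hC hx.1]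
  · nlinarith [mul_nonneg hC (sub_nonneg.2 hx.2)]

end JacobiWave

namespace JacobiWave

open MeasureTheory intervalIntegral
open scoped ContDiff

variable {d : ℕ}

lemma Sm.hasDerivAt_fst {G : ℝ × (Fin d → ℝ) → ℝ} (hG : Sm G) (z : Fin d → ℝ) (x : ℝ) :
    HasDerivAt (fun x => G (x, z)) (JacobiWave.dX G (x, z)) x :=
  (hG.smooth.differentiable (by simp) (x, z)).hasFDerivAt.comp_hasDerivAt x
    ((hasDerivAt_id' x).prodMk (hasDerivAt_const x z))

/-- Boundary conditions making a smooth nonlinearity admissible. -/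
lemma exists_adm {N : ℝ} {F : ℝ × (Fin 5 → ℝ) → ℝ} (hF : Sm F) (h0 : ∀ x ∈ Icc (0:ℝ) 1, F (x, 0) = 0)
    (h1 : ∀ x ∈ Icc (0:ℝ) 1, dJ F 2 (x, 0) = 1) {r : ℝ} (hr : 0 < r)
    (b0 : ∀ z : Fin 5 → ℝ, ‖z‖ ≤ r → dJ F 1 (0, z) = dJ F 2 (0, z) * bf N 0)
    (b1 : ∀ z : Fin 5 → ℝ, ‖z‖ ≤ r → z 2 = 0 → dJ F 1 (1, z) = dJ F 2 (1, z) * bf N 1)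
    (c0 : ∀ z : Fin 5 → ℝ, ‖z‖ ≤ r → dJ F 4 (0, z) = 0)
    (c1 : ∀ z : Fin 5 → ℝ, ‖z‖ ≤ r → dJ F 4 (1, z) = 0) :
    ∃ ρ₀ : ℝ, 0 < ρ₀ ∧ ∀ ρ ≤ ρ₀, Adm N ρ F := by
  obtain ⟨B, hB, hl⟩ := (hF.dJ 2).lip
  have hpi : ∀ {ρ : ℝ} {z : Fin 5 → ℝ}, (∀ c, |z c| ≤ ρ) → ‖z‖ ≤ ρ := fun {ρ z} h =>
    (pi_norm_le_iff_of_nonneg ((abs_nonneg _).trans (h 0))).2 h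
  have hcl : ∀ ρ ≤ min r (1 / (2 * (B + 1))), ∀ x ∈ Icc (0:ℝ) 1, ∀ z : Fin 5 → ℝ, (∀ c, |z c| ≤ ρ) →
      |dJ F 2 (x, z) - 1| ≤ 1 / 2 := fun ρ hρ x hx z hz => by
    have h2 := hl x z 0
    rw [h1 x hx, sub_zero] at h2
    have h3 := (hpi hz).trans (hρ.trans (min_le_right _ _))
    calc |dJ F 2 (x, z) - 1| ≤ B * (1 / (2 * (B + 1))) := h2.trans (by gcongr)
      _ ≤ 1 / 2 := by
        rw [mul_one_div, div_le_div_iff₀ (by positivity) (by positivity)]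
        linarith
  have hDs : Sm fun p : ℝ × (Fin 5 → ℝ) => dJ F 1 p - dJ F 2 p * bf N p.1 := by
    have hb : ContDiff ℝ ∞ fun p : ℝ × (Fin 5 → ℝ) => bf N p.1 := by
      unfold bf
      fun_prop
    exact ⟨(hF.dJ 1).smooth.sub ((hF.dJ 2).smooth.mul hb), (hF.dJ 1).supp.sub (hF.dJ 2).supp.mul_right⟩
  obtain ⟨B₁, hB₁, hl₁⟩ := hDs.lip
  obtain ⟨B₂, -, hb₂⟩ := hDs.dX.bdd
  obtain ⟨B₃, -, hb₃⟩ := (hF.dJ 4).dX.bdd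
  refine ⟨min r (1 / (2 * (B + 1))), by positivity, fun ρ hρ => ⟨hF, h0, fun x hx z hz => ?_,
    fun x hx z hz => ?_, B₁ + 2 * max B₂ 0 + 2 * max B₃ 0, by positivity, fun x hx z hz => ⟨?_, ?_⟩⟩⟩
  · linarith [(abs_le.1 (hcl ρ hρ x hx z hz)).1]
  · linarith [(abs_le.1 (hcl ρ hρ x hx z hz)).2]
  · have hzr := (hpi hz).trans (hρ.trans (min_le_left _ _))
    set z₀ := Function.update z 2 0 with hz₀
    have hn : ‖z₀‖ ≤ r := by
      refine (pi_norm_le_iff_of_nonneg hr.le).2 fun c => ?_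
      rcases eq_or_ne c 2 with rfl | hc
      · simpa [hz₀] using hr.le
      · simpa [hz₀, hc] using (norm_le_pi_norm z c).trans hzr
    have hd : ‖z - z₀‖ ≤ |z 2| := by
      refine (pi_norm_le_iff_of_nonneg (abs_nonneg _)).2 fun c => ?_
      rcases eq_or_ne c 2 with rfl | hc
      · simp [hz₀]
      · simp [hz₀, hc]
    have e1 := (hl₁ x z z₀).trans (mul_le_mul_of_nonneg_left hd hB₁)
    have e2 := abs_le_qf_of_boundary (le_max_right B₂ 0) (fun x _ => hDs.hasDerivAt_fst z₀ x)
      (fun x _ => (hb₂ _).trans (le_max_left _ _)) (by simp only [b0 z₀ hn, sub_self])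
      (by simp only [b1 z₀ hn (by simp [hz₀]), sub_self]) hx
    have hq := qf_nonneg hx
    have e3 := abs_sub_abs_le_abs_sub (dJ F 1 (x, z) - dJ F 2 (x, z) * bf N x)
      (dJ F 1 (x, z₀) - dJ F 2 (x, z₀) * bf N x)
    simp only at e1 e2
    nlinarith [mul_nonneg hB₁ hq, mul_nonneg (le_max_right B₂ 0) (abs_nonneg (z 2)),
      mul_nonneg (le_max_right B₃ 0) (abs_nonneg (z 2)), mul_nonneg (le_max_right B₃ 0) hq]
  · have hzr := (hpi hz).trans (hρ.trans (min_le_left _ _))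
    have e2 := abs_le_qf_of_boundary (le_max_right B₃ 0) (fun x _ => (hF.dJ 4).hasDerivAt_fst z x)
      (fun x _ => (hb₃ _).trans (le_max_left _ _)) (c0 z hzr) (c1 z hzr) hx
    have hq := qf_nonneg hx
    refine e2.trans (mul_le_mul_of_nonneg_right ?_ hq)
    have := le_max_right B₂ 0
    linarith

end JacobiWave

namespace JacobiWave

open MeasureTheory intervalIntegral
open scoped ContDiff

/-- The coefficient functions of the first order system, together with the quotient `Ω` of `∂J/∂z` by
`1 - x`. -/
structure Coeffs where
  N : ℝ
  ℓ : ℝ → ℝ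
  L : ℝ → ℝ
  J : ℝ × ℝ × ℝ → ℝ
  Ω : ℝ × ℝ × ℝ → ℝ
  H₁ : ℝ × ℝ × ℝ × ℝ → ℝ
  H₂ : ℝ × ℝ × ℝ × ℝ × ℝ → ℝ

namespace Coeffs

/-- The local hypotheses on the coefficients. -/
structure Good (S : Coeffs) : Prop where
  hN : 4 < S.N
  anl : ∀ x ∈ Icc (0:ℝ) 1, AnalyticAt ℝ S.ℓ x
  anL : ∀ x ∈ Icc (0:ℝ) 1, AnalyticAt ℝ S.L x
  anJ : ∀ x ∈ Icc (0:ℝ) 1, AnalyticAt ℝ S.J (x, 0, 0)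
  anΩ : ∀ x ∈ Icc (0:ℝ) 1, AnalyticAt ℝ S.Ω (x, 0, 0)
  anH₁ : ∀ x ∈ Icc (0:ℝ) 1, AnalyticAt ℝ S.H₁ (x, 0, 0, 0)
  anH₂ : ∀ x ∈ Icc (0:ℝ) 1, AnalyticAt ℝ S.H₂ (x, 0, 0, 0, 0)
  Jpos : ∀ x ∈ Icc (0:ℝ) 1, 0 < S.J (x, 0, 0)
  JH₁ : ∀ x ∈ Icc (0:ℝ) 1, S.J (x, 0, 0) * S.H₁ (x, 0, 0, 0) = 1
  H₂0 : ∀ x ∈ Icc (0:ℝ) 1, S.H₂ (x, 0, 0, 0, 0) = 0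
  jz : ∀ x ∈ Icc (0:ℝ) 1, ∀ᶠ p in nhds (x, (0:ℝ), (0:ℝ)), fderiv ℝ S.J p (0, 0, 1) = (1 - p.1) * S.Ω p
  h1 : ∀ᶠ q : ℝ × ℝ × ℝ in nhds 0, deriv (fun z => S.H₁ (1, q.1, z, q.2.2)) q.2.1 *
      (S.L 1 * q.1 - bf S.N 1 * q.2.1) + deriv (fun z => S.H₂ (1, q.1, z, q.2.2, 0)) q.2.1 = 0
  h2 : ∀ᶠ q : ℝ × ℝ × ℝ × ℝ in nhds 0,
      deriv (fun w => S.H₂ (1, q.1, q.2.1, q.2.2.1, w)) q.2.2.2 = 0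

variable (S : Coeffs)

/-- The argument of `J`. -/
def arg (p : ℝ × (Fin 5 → ℝ)) : ℝ × ℝ × ℝ := (p.1, p.2 0, p.1 * p.2 1)

/-- The variable `v` in terms of the jet. -/
noncomputable def v (p : ℝ × (Fin 5 → ℝ)) : ℝ := p.2 3 / S.J (arg p)

/-- The variable `x * ∂ₓ v` in terms of the jet. -/
noncomputable def w (p : ℝ × (Fin 5 → ℝ)) : ℝ :=
  p.1 * p.2 4 / S.J (arg p) - p.2 3 / S.J (arg p) ^ 2 *
    (p.1 * fderiv ℝ S.J (arg p) (1, 0, 0) + p.1 * p.2 1 * fderiv ℝ S.J (arg p) (0, 1, 0) +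
      p.1 * p.2 1 * fderiv ℝ S.J (arg p) (0, 0, 1) + p.1 * S.Ω (arg p) * p.2 2)

/-- The operator `𝓛` in terms of the jet. -/
noncomputable def lop (p : ℝ × (Fin 5 → ℝ)) : ℝ :=
  -p.2 2 - bf S.N p.1 * p.2 1 + S.ℓ p.1 * qf p.1 * p.2 1 + S.L p.1 * p.2 0

/-- The right-hand side of the scalar second order equation. -/
noncomputable def rhs (p : ℝ × (Fin 5 → ℝ)) : ℝ :=
  (fderiv ℝ S.J (arg p) (0, 1, 0) * p.2 3 + fderiv ℝ S.J (arg p) (0, 0, 1) * (p.1 * p.2 4)) * S.v p -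
    S.J (arg p) * (S.H₁ (p.1, p.2 0, p.1 * p.2 1, S.v p) * S.lop p +
      S.H₂ (p.1, p.2 0, p.1 * p.2 1, S.v p, S.w p))

variable {S}

lemma analyticAt_coord (c : Fin 5) (p : ℝ × (Fin 5 → ℝ)) :
    AnalyticAt ℝ (fun p : ℝ × (Fin 5 → ℝ) => p.2 c) p :=
  ((ContinuousLinearMap.proj (R := ℝ) (φ := fun _ : Fin 5 => ℝ) c).analyticAt _).comp analyticAt_snd

lemma analyticAt_arg (p : ℝ × (Fin 5 → ℝ)) : AnalyticAt ℝ arg p :=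
  analyticAt_fst.prod ((analyticAt_coord 0 p).prod (analyticAt_fst.mul (analyticAt_coord 1 p)))

lemma arg_zero (x : ℝ) : arg (x, 0) = (x, 0, 0) := by simp [arg]

section
variable (hS : S.Good) {x : ℝ} (hx : x ∈ Icc (0:ℝ) 1)
include hS hx

lemma Good.analyticAt_J : AnalyticAt ℝ (fun p => S.J (arg p)) (x, 0) :=
  (hS.anJ x hx).comp_of_eq (analyticAt_arg _) (arg_zero x)

lemma Good.analyticAt_Ω : AnalyticAt ℝ (fun p => S.Ω (arg p)) (x, 0) :=
  (hS.anΩ x hx).comp_of_eq (analyticAt_arg _) (arg_zero x)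

lemma Good.analyticAt_fderiv (e : ℝ × ℝ × ℝ) : AnalyticAt ℝ (fun p => fderiv ℝ S.J (arg p) e) (x, 0) :=
  ((ContinuousLinearMap.apply ℝ ℝ e).analyticAt _).comp
    ((hS.anJ x hx).fderiv.comp_of_eq (analyticAt_arg _) (arg_zero x))

lemma Good.J_ne : S.J (arg (x, 0)) ≠ 0 := by
  rw [arg_zero]
  exact (hS.Jpos x hx).ne'

lemma Good.analyticAt_v : AnalyticAt ℝ S.v (x, 0) :=
  (analyticAt_coord 3 _).div (hS.analyticAt_J hx) (hS.J_ne hx)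

lemma Good.analyticAt_w : AnalyticAt ℝ S.w (x, 0) := by
  have h1 := hS.analyticAt_J hx
  have hc := fun c => analyticAt_coord c (x, 0)
  have hf := fun e => hS.analyticAt_fderiv hx e
  exact ((analyticAt_fst.mul (hc 4)).div h1 (hS.J_ne hx)).sub (((hc 3).div (h1.pow 2)
    (pow_ne_zero 2 (hS.J_ne hx))).mul ((((analyticAt_fst.mul (hf _)).add
      ((analyticAt_fst.mul (hc 1)).mul (hf _))).add ((analyticAt_fst.mul (hc 1)).mul (hf _))).add
      ((analyticAt_fst.mul (hS.analyticAt_Ω hx)).mul (hc 2))))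

lemma Good.analyticAt_lop : AnalyticAt ℝ S.lop (x, 0) := by
  have hc := fun c => analyticAt_coord c (x, 0)
  have hb : AnalyticAt ℝ (fun p : ℝ × (Fin 5 → ℝ) => bf S.N p.1) (x, 0) :=
    (analyticAt_const.mul (analyticAt_const.sub analyticAt_fst)).sub (analyticAt_const.mul analyticAt_fst)
  have hq : AnalyticAt ℝ (fun p : ℝ × (Fin 5 → ℝ) => qf p.1) (x, 0) :=
    analyticAt_fst.mul (analyticAt_const.sub analyticAt_fst)
  have hl : AnalyticAt ℝ (fun p : ℝ × (Fin 5 → ℝ) => S.ℓ p.1) (x, 0) :=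
    (hS.anl x hx).comp_of_eq analyticAt_fst rfl
  have hL : AnalyticAt ℝ (fun p : ℝ × (Fin 5 → ℝ) => S.L p.1) (x, 0) :=
    (hS.anL x hx).comp_of_eq analyticAt_fst rfl
  exact (((hc 2).neg.sub (hb.mul (hc 1))).add ((hl.mul hq).mul (hc 1))).add (hL.mul (hc 0))

lemma Good.analyticAt_rhs : AnalyticAt ℝ S.rhs (x, 0) := by
  have h1 := hS.analyticAt_J hx
  have hc := fun c => analyticAt_coord c (x, 0)
  have hf := fun e => hS.analyticAt_fderiv hx e
  have hv := hS.analyticAt_v hx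
  have hH₁ : AnalyticAt ℝ (fun p : ℝ × (Fin 5 → ℝ) => S.H₁ (p.1, p.2 0, p.1 * p.2 1, S.v p)) (x, 0) :=
    (hS.anH₁ x hx).comp_of_eq
      (analyticAt_fst.prod ((hc 0).prod ((analyticAt_fst.mul (hc 1)).prod hv))) (by simp [v])
  have hH₂ : AnalyticAt ℝ
      (fun p : ℝ × (Fin 5 → ℝ) => S.H₂ (p.1, p.2 0, p.1 * p.2 1, S.v p, S.w p)) (x, 0) :=
    (hS.anH₂ x hx).comp_of_eq (analyticAt_fst.prod ((hc 0).prod ((analyticAt_fst.mul (hc 1)).prod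
      (hv.prod (hS.analyticAt_w hx))))) (by simp [v, w])
  exact ((((hf _).mul (hc 3)).add ((hf _).mul (analyticAt_fst.mul (hc 4)))).mul hv).sub
    (h1.mul ((hH₁.mul (hS.analyticAt_lop hx)).add hH₂))

lemma Good.rhs_zero : S.rhs (x, 0) = 0 := by
  simp [rhs, v, w, lop, arg, hS.H₂0 x hx]

lemma Good.rhs_single (s : ℝ) : S.rhs (x, Function.update 0 2 s) = s := by
  have h := hS.JH₁ x hx
  have e : S.rhs (x, Function.update 0 2 s) = S.J (x, 0, 0) * S.H₁ (x, 0, 0, 0) * s := by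
    simp [rhs, v, w, lop, arg, hS.H₂0 x hx]
    ring
  rw [e, h, one_mul]

end

variable (S) in
lemma rhs_left : ∃ a b : ℝ × ℝ → ℝ, ∀ z : Fin 5 → ℝ,
    S.rhs (0, z) = a (z 0, z 3) + b (z 0, z 3) * (z 2 + bf S.N 0 * z 1) := by
  refine ⟨fun q => fderiv ℝ S.J (0, q.1, 0) (0, 1, 0) * q.2 * (q.2 / S.J (0, q.1, 0)) -
    S.J (0, q.1, 0) * (S.H₁ (0, q.1, 0, q.2 / S.J (0, q.1, 0)) * (S.L 0 * q.1) +
      S.H₂ (0, q.1, 0, q.2 / S.J (0, q.1, 0), 0)),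
    fun q => S.J (0, q.1, 0) * S.H₁ (0, q.1, 0, q.2 / S.J (0, q.1, 0)), fun z => ?_⟩
  simp [rhs, v, w, lop, arg, qf]
  ring

end Coeffs

end JacobiWave

namespace JacobiWave

open MeasureTheory intervalIntegral
open scoped ContDiff

lemma eventually_eq_of_hasDerivAt_zero {E : Type*} [NormedAddCommGroup E] {g : E × ℝ → ℝ}
    (h : ∀ᶠ q : E × ℝ in nhds 0, HasDerivAt (fun s => g (q.1, s)) 0 q.2) :
    ∀ᶠ q : E × ℝ in nhds 0, g q = g (q.1, 0) := by
  obtain ⟨r, hr, hb⟩ := Metric.eventually_nhds_iff_ball.1 h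
  filter_upwards [Metric.ball_mem_nhds (0 : E × ℝ) hr] with q hq
  have hq' := hq
  rw [← Prod.mk_zero_zero, ← ball_prod_same] at hq'
  have := (convex_ball (0:ℝ) r).norm_image_sub_le_of_norm_hasDerivWithin_le (f := fun s => g (q.1, s))
    (f' := fun _ => 0) (C := 0)
    (fun s hs => (hb (q.1, s) (by
      rw [← Prod.mk_zero_zero, ← ball_prod_same]
      exact ⟨hq'.1, hs⟩)).hasDerivWithinAt) (fun _ _ => by simp) (Metric.mem_ball_self hr) hq'.2
  rw [zero_mul] at this
  exact sub_eq_zero.1 (norm_le_zero_iff.1 this)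

variable {d : ℕ}

lemma Sm.hasDerivAt_update {G : ℝ × (Fin d → ℝ) → ℝ} (hG : Sm G) (x : ℝ) (z : Fin d → ℝ) (c : Fin d) :
    HasDerivAt (fun s => G (x, Function.update z c s)) (JacobiWave.dJ G c (x, z)) (z c) := by
  have h := (hG.smooth.differentiable (by simp) (x, z)).hasFDerivAt
  have h2 : HasDerivAt (fun s => (x, Function.update z c s)) (0, Pi.single c 1) (z c) :=
    (hasDerivAt_const _ x).prodMk (_root_.hasDerivAt_update z c (z c))
  refine HasFDerivAt.comp_hasDerivAt (l := G) (z c) ?_ h2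
  simpa using h

lemma eventually_update {f g : (Fin d → ℝ) → ℝ} {z : Fin d → ℝ} (h : ∀ᶠ z' in nhds z, f z' = g z')
    (c : Fin d) : (fun s => f (Function.update z c s)) =ᶠ[nhds (z c)] fun s => g (Function.update z c s) := by
  have : Tendsto (fun s => Function.update z c s) (nhds (z c)) (nhds z) := by
    have := (continuous_const.update c continuous_id : Continuous fun s : ℝ => Function.update z c s).tendsto (z c)
    simpa using this
  exact this.eventually h

namespace Coeffs
variable {S : Coeffs}

section
variable (hS : S.Good)
include hS

lemma Good.J_right : ∀ᶠ q : ℝ × ℝ in nhds 0, S.J (1, q) = S.J (1, q.1, 0) ∧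
    fderiv ℝ S.J (1, q) (0, 0, 1) = 0 ∧
    fderiv ℝ S.J (1, q) (0, 1, 0) = fderiv ℝ S.J (1, q.1, 0) (0, 1, 0) := by
  have h1 : (1:ℝ) ∈ Icc (0:ℝ) 1 := right_mem_Icc.2 zero_le_one
  have hc : Continuous fun q : ℝ × ℝ => ((1:ℝ), q) := by fun_prop
  have hc0 : Continuous fun q : ℝ × ℝ => (q.1, (0:ℝ)) := by fun_prop
  have ht := hc.tendsto 0
  have ht0 : Tendsto (fun q : ℝ × ℝ => (q.1, (0:ℝ))) (nhds 0) (nhds 0) := hc0.tendsto 0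
  have ha : ∀ᶠ q : ℝ × ℝ in nhds 0, DifferentiableAt ℝ S.J (1, q) := by
    filter_upwards [ht.eventually (hS.anJ 1 h1).eventually_analyticAt] with q hq using hq.differentiableAt
  have hz : ∀ᶠ q : ℝ × ℝ in nhds 0, fderiv ℝ S.J (1, q) (0, 0, 1) = 0 := by
    filter_upwards [ht.eventually (hS.jz 1 h1)] with q hq
    simpa using hq
  have hJ : ∀ᶠ q : ℝ × ℝ in nhds 0, S.J (1, q) = S.J (1, q.1, 0) := by
    refine eventually_eq_of_hasDerivAt_zero (g := fun q => S.J (1, q)) ?_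
    filter_upwards [ha, hz] with q h1 h2
    have := h1.hasFDerivAt.comp_hasDerivAt (f := fun s => ((1:ℝ), q.1, s)) q.2
      ((hasDerivAt_const _ _).prodMk ((hasDerivAt_const _ _).prodMk (hasDerivAt_id' q.2)))
    rw [h2] at this
    exact this
  filter_upwards [hJ, hz, hJ.eventually_nhds, ha, ht0.eventually ha] with q h1 h2 h3 h4 h5
  refine ⟨h1, h2, ?_⟩
  have e1 := h4.hasFDerivAt.comp_hasDerivAt (f := fun s => ((1:ℝ), s, q.2)) q.1
      ((hasDerivAt_const _ _).prodMk ((hasDerivAt_id' q.1).prodMk (hasDerivAt_const _ _)))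
  have e2 := h5.hasFDerivAt.comp_hasDerivAt (f := fun s => ((1:ℝ), s, (0:ℝ))) q.1
      ((hasDerivAt_const _ _).prodMk ((hasDerivAt_id' q.1).prodMk (hasDerivAt_const _ _)))
  refine e1.unique (e2.congr_of_eventuallyEq ?_)
  have hc1 : Continuous fun s : ℝ => (s, q.2) := by fun_prop
  exact (hc1.tendsto q.1).eventually h3

lemma Good.H₂_right : ∀ᶠ q : (ℝ × ℝ × ℝ) × ℝ in nhds 0,
    S.H₂ (1, q.1.1, q.1.2.1, q.1.2.2, q.2) = S.H₂ (1, q.1.1, q.1.2.1, q.1.2.2, 0) := by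
  have h1 : (1:ℝ) ∈ Icc (0:ℝ) 1 := right_mem_Icc.2 zero_le_one
  have hc : Continuous fun q : (ℝ × ℝ × ℝ) × ℝ => (q.1.1, q.1.2.1, q.1.2.2, q.2) := by fun_prop
  have ht : Tendsto (fun q : (ℝ × ℝ × ℝ) × ℝ => (q.1.1, q.1.2.1, q.1.2.2, q.2)) (nhds 0) (nhds 0) :=
    hc.tendsto 0
  have hc' : Continuous fun q : (ℝ × ℝ × ℝ) × ℝ => ((1:ℝ), q.1.1, q.1.2.1, q.1.2.2, q.2) := by fun_prop
  have ht' := hc'.tendsto 0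
  refine eventually_eq_of_hasDerivAt_zero (g := fun q : (ℝ × ℝ × ℝ) × ℝ =>
    S.H₂ (1, q.1.1, q.1.2.1, q.1.2.2, q.2)) ?_
  filter_upwards [ht.eventually hS.h2, ht'.eventually (hS.anH₂ 1 h1).eventually_analyticAt] with q e1 e2
  have hd : DifferentiableAt ℝ (fun w => S.H₂ (1, q.1.1, q.1.2.1, q.1.2.2, w)) q.2 :=
    DifferentiableAt.comp (g := S.H₂) q.2 e2.differentiableAt (by fun_prop)
  have := hd.hasDerivAt
  rw [e1] at this
  exact this

lemma Good.rhs_right : ∀ᶠ z : Fin 5 → ℝ in nhds 0, S.v (1, z) = z 3 / S.J (1, z 0, 0) ∧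
    S.rhs (1, z) = fderiv ℝ S.J (1, z 0, 0) (0, 1, 0) * z 3 * (z 3 / S.J (1, z 0, 0)) -
      S.J (1, z 0, 0) * (S.H₁ (1, z 0, z 1, z 3 / S.J (1, z 0, 0)) *
        (-z 2 - bf S.N 1 * z 1 + S.L 1 * z 0) + S.H₂ (1, z 0, z 1, z 3 / S.J (1, z 0, 0), 0)) := by
  have h1 : (1:ℝ) ∈ Icc (0:ℝ) 1 := right_mem_Icc.2 zero_le_one
  have hc : Continuous fun z : Fin 5 → ℝ => ((1:ℝ), z) := by fun_prop
  have hc2 : Continuous fun z : Fin 5 → ℝ => (z 0, z 1) := by fun_prop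
  have ht2 : Tendsto (fun z : Fin 5 → ℝ => (z 0, z 1)) (nhds 0) (nhds 0) := hc2.tendsto 0
  have hv : ContinuousAt (fun z => S.v (1, z)) 0 :=
    ContinuousAt.comp (g := S.v) (hS.analyticAt_v h1).continuousAt hc.continuousAt
  have hw : ContinuousAt (fun z => S.w (1, z)) 0 :=
    ContinuousAt.comp (g := S.w) (hS.analyticAt_w h1).continuousAt hc.continuousAt
  have h0 : ContinuousAt (fun z : Fin 5 → ℝ => z 0) 0 := (continuous_apply 0).continuousAt
  have h1' : ContinuousAt (fun z : Fin 5 → ℝ => z 1) 0 := (continuous_apply 1).continuousAt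
  have ht : Tendsto (fun z : Fin 5 → ℝ => ((z 0, z 1, S.v (1, z)), S.w (1, z))) (nhds 0) (nhds 0) := by
    have := ((h0.prodMk (h1'.prodMk hv)).prodMk hw).tendsto
    rw [show (0 : (ℝ × ℝ × ℝ) × ℝ) = ((0, 0, 0), 0) from rfl]
    simpa [v, w] using this
  filter_upwards [ht2.eventually hS.J_right, ht.eventually hS.H₂_right] with z e1 e2
  obtain ⟨a, b, c⟩ := e1
  have ev : S.v (1, z) = z 3 / S.J (1, z 0, 0) := by simp [v, arg, a]
  refine ⟨ev, ?_⟩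
  rw [ev] at e2
  simp only [rhs, lop, e2, arg, one_mul, a, b, c, ev, qf]
  ring

/-- The scalar equation, cut off away from the zero section, is admissible. -/
lemma Good.exists_adm : ∃ F : ℝ × (Fin 5 → ℝ) → ℝ, ∃ ρ₀ : ℝ, 0 < ρ₀ ∧
    (∀ x ∈ Icc (0:ℝ) 1, ∀ᶠ p in nhds (x, (0 : Fin 5 → ℝ)), F p = S.rhs p) ∧
    ∀ ρ ≤ ρ₀, Adm S.N ρ F := by
  obtain ⟨F, hF, hFc, he⟩ := exists_cutoff fun x hx => hS.analyticAt_rhs hx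
  have sF : Sm F := ⟨hF, hFc⟩
  have hc : ∀ x : ℝ, Tendsto (fun z : Fin 5 → ℝ => (x, z)) (nhds 0) (nhds (x, 0)) := fun x =>
    (Continuous.prodMk_right x).tendsto 0
  have hl : ∀ x ∈ Icc (0:ℝ) 1, ∀ᶠ z : Fin 5 → ℝ in nhds 0, ∀ᶠ z' in nhds z, F (x, z') = S.rhs (x, z') :=
    fun x hx => ((hc x).eventually (he x hx)).eventually_nhds
  have m0 : (0:ℝ) ∈ Icc (0:ℝ) 1 := left_mem_Icc.2 zero_le_one
  have m1 : (1:ℝ) ∈ Icc (0:ℝ) 1 := right_mem_Icc.2 zero_le_one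
  have key : ∀ᶠ z : Fin 5 → ℝ in nhds 0, (dJ F 1 (0, z) = dJ F 2 (0, z) * bf S.N 0 ∧ dJ F 4 (0, z) = 0) ∧
      (z 2 = 0 → dJ F 1 (1, z) = dJ F 2 (1, z) * bf S.N 1) ∧ dJ F 4 (1, z) = 0 := by
    obtain ⟨a, b, hab⟩ := S.rhs_left
    have hvc : Tendsto (fun z : Fin 5 → ℝ => (z 0, z 1, S.v (1, z))) (nhds 0) (nhds 0) := by
      have hv : ContinuousAt (fun z => S.v (1, z)) 0 :=
        ContinuousAt.comp (g := S.v) (hS.analyticAt_v m1).continuousAt (hc 1)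
      have := ((continuous_apply (0 : Fin 5)).continuousAt.prodMk
        ((continuous_apply (1 : Fin 5)).continuousAt.prodMk hv)).tendsto
      rw [show (0 : ℝ × ℝ × ℝ) = (0, 0, 0) from rfl]
      simpa [v] using this
    have hv1 : Tendsto (fun z : Fin 5 → ℝ => ((1:ℝ), z 0, z 1, S.v (1, z))) (nhds 0) (nhds (1, 0)) :=
      tendsto_const_nhds.prodMk_nhds hvc
    have hcc : Continuous fun q : ℝ × ℝ × ℝ => ((1:ℝ), q.1, q.2.1, q.2.2, (0:ℝ)) := by fun_prop
    have hv2 : Tendsto (fun z : Fin 5 → ℝ => ((1:ℝ), z 0, z 1, S.v (1, z), (0:ℝ))) (nhds 0)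
      (nhds (1, 0, 0, 0, 0)) := (hcc.tendsto 0).comp hvc
    filter_upwards [hl 0 m0, hl 1 m1, hS.rhs_right.eventually_nhds, hvc.eventually hS.h1,
      hv1.eventually (hS.anH₁ 1 m1).eventually_analyticAt,
      hv2.eventually (hS.anH₂ 1 m1).eventually_analyticAt] with z e0 e1 e2 e3 e4 e5
    have ev := e2.self_of_nhds.1
    have e6 : ∀ᶠ z' in nhds z, F (1, z') = fderiv ℝ S.J (1, z' 0, 0) (0, 1, 0) * z' 3 * (z' 3 / S.J (1, z' 0, 0)) -
      S.J (1, z' 0, 0) * (S.H₁ (1, z' 0, z' 1, z' 3 / S.J (1, z' 0, 0)) *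
        (-z' 2 - bf S.N 1 * z' 1 + S.L 1 * z' 0) + S.H₂ (1, z' 0, z' 1, z' 3 / S.J (1, z' 0, 0), 0)) := by
      filter_upwards [e1, e2] with z' h1 h2
      rw [h1, h2.2]
    refine ⟨⟨?_, ?_⟩, fun h2 => ?_, ?_⟩
    · have d1 := (sF.hasDerivAt_update 0 z 1).congr_of_eventuallyEq (eventually_update e0 1).symm
      have d2 := (sF.hasDerivAt_update 0 z 2).congr_of_eventuallyEq (eventually_update e0 2).symm
      simp only [hab, Function.update_self, Function.update_of_ne, ne_eq, Fin.reduceEq, not_false_eq_true] at d1 d2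
      have d1' := ((((hasDerivAt_id' (z 1)).const_mul (bf S.N 0)).const_add (z 2)).const_mul (b (z 0, z 3))).const_add
        (a (z 0, z 3))
      have d2' := (((hasDerivAt_id' (z 2)).add_const (bf S.N 0 * z 1)).const_mul (b (z 0, z 3))).const_add
        (a (z 0, z 3))
      rw [d1.unique d1', d2.unique d2']
      ring
    · have d1 := (sF.hasDerivAt_update 0 z 4).congr_of_eventuallyEq (eventually_update e0 4).symm
      simp only [hab, Function.update_of_ne, ne_eq, Fin.reduceEq, not_false_eq_true] at d1
      exact d1.unique (hasDerivAt_const _ _)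
    · have d1 := (sF.hasDerivAt_update 1 z 1).congr_of_eventuallyEq (eventually_update e6 1).symm
      have d2 := (sF.hasDerivAt_update 1 z 2).congr_of_eventuallyEq (eventually_update e6 2).symm
      simp only [Function.update_self, Function.update_of_ne, ne_eq, Fin.reduceEq, not_false_eq_true, ← ev] at d1 d2
      have g1 : DifferentiableAt ℝ (fun s => S.H₁ (1, z 0, s, S.v (1, z))) (z 1) :=
        DifferentiableAt.comp (g := S.H₁) (z 1) e4.differentiableAt (by fun_prop)
      have g2 : DifferentiableAt ℝ (fun s => S.H₂ (1, z 0, s, S.v (1, z), 0)) (z 1) :=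
        DifferentiableAt.comp (g := S.H₂) (z 1) e5.differentiableAt (by fun_prop)
      have d1' := (((g1.hasDerivAt.fun_mul ((((hasDerivAt_id' (z 1)).const_mul (bf S.N 1)).const_sub (-z 2)).add_const
        (S.L 1 * z 0))).fun_add g2.hasDerivAt).const_mul (S.J (1, z 0, 0))).const_sub
          (fderiv ℝ S.J (1, z 0, 0) (0, 1, 0) * z 3 * S.v (1, z))
      have d2' := ((((((hasDerivAt_id' (z 2)).fun_neg.sub_const (bf S.N 1 * z 1)).add_const
        (S.L 1 * z 0)).const_mul (S.H₁ (1, z 0, z 1, S.v (1, z)))).add_const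
          (S.H₂ (1, z 0, z 1, S.v (1, z), 0))).const_mul (S.J (1, z 0, 0))).const_sub
          (fderiv ℝ S.J (1, z 0, 0) (0, 1, 0) * z 3 * S.v (1, z))
      rw [d1.unique d1', d2.unique d2', h2]
      linear_combination (-S.J (1, z 0, 0)) * e3
    · have d1 := (sF.hasDerivAt_update 1 z 4).congr_of_eventuallyEq (eventually_update e6 4).symm
      simp only [Function.update_of_ne, ne_eq, Fin.reduceEq, not_false_eq_true] at d1
      exact d1.unique (hasDerivAt_const _ _)
  obtain ⟨r, hr, hb⟩ := Metric.nhds_basis_closedBall.eventually_iff.1 key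
  have hb' : ∀ z : Fin 5 → ℝ, ‖z‖ ≤ r → _ := fun z hz => hb (mem_closedBall_zero_iff.2 hz)
  obtain ⟨ρ₀, hρ₀, hA⟩ := JacobiWave.exists_adm (N := S.N) sF
    (fun x hx => by rw [(he x hx).self_of_nhds, hS.rhs_zero hx])
    (fun x hx => by
      have d := (sF.hasDerivAt_update x 0 2).congr_of_eventuallyEq
        (eventually_update (hl x hx).self_of_nhds 2).symm
      simp only [hS.rhs_single hx] at d
      exact d.unique (hasDerivAt_id' _))
    hr (fun z hz => (hb' z hz).1.1) (fun z hz => (hb' z hz).2.1) (fun z hz => (hb' z hz).1.2)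
    (fun z hz => (hb' z hz).2.2)
  exact ⟨F, ρ₀, hρ₀, he, hA⟩

end

end Coeffs

end JacobiWave

namespace JacobiWave

open MeasureTheory intervalIntegral
open scoped ContDiff

/-- Smooth nonlinearities of small data are small. -/
lemma exists_small_comp {G : ℝ × (Fin 3 → ℝ) → ℝ} (hG : Sm G)
    (h0 : ∀ x ∈ Icc (0:ℝ) 1, ∀ᶠ y in nhds x, G (y, 0) = 0) (n : ℕ) :
    ∃ L : ℝ, 0 ≤ L ∧ ∀ J : Fin 3 → ℝ → ℝ, (∀ c, ContDiff ℝ ∞ (J c)) → ∀ x ∈ Icc (0:ℝ) 1,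
      ∀ ε, 0 ≤ ε → ε ≤ 1 → (∀ c, ∀ j ≤ n, |iteratedDeriv j (J c) x| ≤ ε) →
      ∀ a ≤ n, |iteratedDeriv a (comp G J) x| ≤ L * ε := by
  choose L hL hb using fun a => abs_iteratedDeriv_comp_sub_le a hG 1 zero_le_one
  refine ⟨∑ a ∈ Finset.range (n + 1), L a, Finset.sum_nonneg fun a _ => hL a,
    fun J hJ x hx ε hε hε1 hj a ha => ?_⟩
  have hz : ∀ j : ℕ, iteratedDeriv j (fun _ : ℝ => (0:ℝ)) x = 0 := fun j => by
    simp
  have h1 := hb a J (fun _ _ => 0) hJ (fun _ => contDiff_const) x ε hε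
    (fun c j hja => (hj c j (hja.trans ha)).trans hε1) (fun c j _ => by simp [hz])
    (fun c j hja => by simpa [hz] using hj c j (hja.trans ha))
  have h2 : comp G (fun _ _ => 0) =ᶠ[nhds x] fun _ => 0 := by
    filter_upwards [h0 x hx] with y hy using hy
  rw [h2.iteratedDeriv_eq, hz, sub_zero] at h1
  refine h1.trans (mul_le_mul_of_nonneg_right ?_ hε)
  exact Finset.single_le_sum (f := L) (fun a _ => hL a) (Finset.mem_range.2 (by omega))

lemma En_le_of_pointwise {N : ℝ} (hN : 4 < N) {k : ℕ} {ψ φ : ℝ → ℝ} (hψ : ContDiff ℝ ∞ ψ)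
    (hφ : ContDiff ℝ ∞ φ) {a b : ℝ} (ha : ∀ i < k + 2, ∀ x ∈ Icc (0:ℝ) 1, |iteratedDeriv i ψ x| ≤ a)
    (hb : ∀ i < k + 1, ∀ x ∈ Icc (0:ℝ) 1, |iteratedDeriv i φ x| ≤ b) :
    En N k ψ φ ≤ (k + 2) * a ^ 2 + (k + 1) * b ^ 2 := by
  refine add_le_add ?_ ?_
  · refine (Finset.sum_le_card_nsmul _ _ (a ^ 2) fun i hi =>
      Hk_le_sq hN hψ (ha i (Finset.mem_range.1 hi))).trans (le_of_eq ?_)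
    simp
  · refine (Finset.sum_le_card_nsmul _ _ (b ^ 2) fun i hi =>
      Hk_le_sq hN hφ (hb i (Finset.mem_range.1 hi))).trans (le_of_eq ?_)
    simp

/-- Smooth cut-offs in time. -/
lemma exists_time_cutoff {T : ℝ} : ∃ κ : ℝ → ℝ, ∃ M : ℝ, ContDiff ℝ ∞ κ ∧ (∀ t, |κ t| ≤ 1) ∧
    (∀ t s, |κ t - κ s| ≤ M * |t - s|) ∧ (∀ t, T + 1 ≤ |t| → κ t = 0) ∧ ∀ t, |t| ≤ T → κ t = 1 := by
  have hs : ContDiff ℝ ∞ smoothTransition := smoothTransition.contDiff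
  have hc : ContDiff ℝ ∞ fun t : ℝ => smoothTransition (T + 1 - t) * smoothTransition (T + 1 + t) :=
    (hs.comp (contDiff_const.sub contDiff_id)).mul (hs.comp (contDiff_const.add contDiff_id))
  have h0 : ∀ t : ℝ, T + 1 ≤ |t| → smoothTransition (T + 1 - t) * smoothTransition (T + 1 + t) = 0 :=
    fun t ht => by
      rcases le_abs.1 ht with h | h
      · rw [smoothTransition.zero_of_nonpos (by linarith), zero_mul]
      · rw [smoothTransition.zero_of_nonpos (x := T + 1 + t) (by linarith), mul_zero]
  have hsupp : HasCompactSupport fun t : ℝ => smoothTransition (T + 1 - t) * smoothTransition (T + 1 + t) := by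
    refine HasCompactSupport.intro (isCompact_Icc (a := -(T + 1)) (b := T + 1)) fun t ht => h0 t ?_
    by_contra! h
    exact ht ⟨(abs_lt.1 h).1.le, (abs_lt.1 h).2.le⟩
  obtain ⟨M, hM⟩ := hc.lipschitzWith_of_hasCompactSupport hsupp (by simp)
  refine ⟨_, M, hc, fun t => ?_, fun t s => ?_, h0, fun t ht => ?_⟩
  · rw [abs_mul, abs_of_nonneg (smoothTransition.nonneg _), abs_of_nonneg (smoothTransition.nonneg _)]
    exact mul_le_one₀ (smoothTransition.le_one _) (smoothTransition.nonneg _) (smoothTransition.le_one _)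
  · exact hM.dist_le_mul t s
  · obtain ⟨h1, h2⟩ := abs_le.1 ht
    rw [smoothTransition.one_of_one_le (by linarith), smoothTransition.one_of_one_le (by linarith), one_mul]

namespace Coeffs
variable {S : Coeffs}

/-- Smooth extension of the initial velocity `J v` of the first component. -/
lemma Good.exists_velocity (hS : S.Good) : ∃ G : ℝ × (Fin 3 → ℝ) → ℝ, Sm G ∧
    (∀ x ∈ Icc (0:ℝ) 1, ∀ᶠ y in nhds x, G (y, 0) = 0) ∧
    ∃ r : ℝ, 0 < r ∧ ∀ x ∈ Icc (0:ℝ) 1, ∀ z : Fin 3 → ℝ, ‖z‖ ≤ r →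
      G (x, z) = S.J (x, z 0, x * z 1) * z 2 := by
  have hc : ∀ (c : Fin 3) (p : ℝ × (Fin 3 → ℝ)), AnalyticAt ℝ (fun p : ℝ × (Fin 3 → ℝ) => p.2 c) p :=
    fun c p => ((ContinuousLinearMap.proj (R := ℝ) (φ := fun _ : Fin 3 => ℝ) c).analyticAt _).comp
      analyticAt_snd
  have ha : ∀ x ∈ Icc (0:ℝ) 1, AnalyticAt ℝ (fun p : ℝ × (Fin 3 → ℝ) =>
      S.J (p.1, p.2 0, p.1 * p.2 1) * p.2 2) (x, 0) := fun x hx =>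
    ((hS.anJ x hx).comp_of_eq (analyticAt_fst.prod ((hc 0 _).prod (analyticAt_fst.mul (hc 1 _))))
      (by simp)).mul (hc 2 _)
  obtain ⟨G, h1, h2, h3⟩ := exists_cutoff ha
  obtain ⟨r, hr, ht⟩ := exists_tube h3
  refine ⟨G, ⟨h1, h2⟩, fun x hx => ?_, r, hr, fun x hx z hz => ht x ⟨?_, ?_⟩ z hz⟩
  · have hcx : Continuous fun y : ℝ => (y, (0 : Fin 3 → ℝ)) := by fun_prop
    filter_upwards [(hcx.tendsto x).eventually (h3 x hx)] with y hy
    simpa using hy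
  · linarith [hx.1]
  · linarith [hx.2]

end Coeffs

end JacobiWave

namespace JacobiWave

open MeasureTheory intervalIntegral
open scoped ContDiff

lemma hasDerivWithinAt_comp_triple {f : ℝ × ℝ × ℝ → ℝ} {a b c : ℝ → ℝ} {a' b' c' t : ℝ} {s : Set ℝ}
    (hf : DifferentiableAt ℝ f (a t, b t, c t)) (ha : HasDerivWithinAt a a' s t)
    (hb : HasDerivWithinAt b b' s t) (hc : HasDerivWithinAt c c' s t) :
    HasDerivWithinAt (fun r => f (a r, b r, c r)) (a' * fderiv ℝ f (a t, b t, c t) (1, 0, 0) +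
      b' * fderiv ℝ f (a t, b t, c t) (0, 1, 0) + c' * fderiv ℝ f (a t, b t, c t) (0, 0, 1)) s t := by
  have h := HasFDerivAt.comp_hasDerivWithinAt (f := fun r => (a r, b r, c r)) t hf.hasFDerivAt
    (ha.prodMk (hb.prodMk hc))
  have e : ((a', b', c') : ℝ × ℝ × ℝ) = a' • (1, 0, 0) + b' • (0, 1, 0) + c' • (0, 0, 1) := by simp
  rw [e, map_add, map_add, map_smul, map_smul, map_smul] at h
  simp only [smul_eq_mul] at h
  exact h

namespace Coeffs

variable {S : Coeffs}

/-- The jet of a family of spatial derivatives. -/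
def jet (Y U : ℕ → ℝ → ℝ → ℝ) (t x : ℝ) : ℝ × (Fin 5 → ℝ) :=
  (x, ![Y 0 t x, Y 1 t x, qf x * Y 2 t x, U 0 t x, U 1 t x])

lemma Good.exists_radius (hS : S.Good) {F : ℝ × (Fin 5 → ℝ) → ℝ}
    (he : ∀ x ∈ Icc (0:ℝ) 1, ∀ᶠ p in nhds (x, 0), F p = S.rhs p) :
    ∃ r : ℝ, 0 < r ∧ ∀ x ∈ Icc (0:ℝ) 1, ∀ z : Fin 5 → ℝ, (∀ c, |z c| ≤ r) → F (x, z) = S.rhs (x, z) ∧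
      AnalyticAt ℝ S.J (arg (x, z)) ∧ S.J (arg (x, z)) ≠ 0 ∧
      fderiv ℝ S.J (arg (x, z)) (0, 0, 1) = (1 - x) * S.Ω (arg (x, z)) := by
  obtain ⟨r, hr, h⟩ := exists_tube (E := Fin 5 → ℝ) (P := fun p => F p = S.rhs p ∧
      AnalyticAt ℝ S.J (arg p) ∧ S.J (arg p) ≠ 0 ∧
      fderiv ℝ S.J (arg p) (0, 0, 1) = (1 - p.1) * S.Ω (arg p)) fun x hx => by
    have ha : Tendsto arg (nhds (x, 0)) (nhds (x, 0, 0)) := by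
      have := (analyticAt_arg (x, 0)).continuousAt.tendsto
      rwa [arg_zero] at this
    filter_upwards [he x hx, ha.eventually (hS.anJ x hx).eventually_analyticAt,
      (hS.analyticAt_J hx).continuousAt.eventually_ne (hS.J_ne hx), ha.eventually (hS.jz x hx)]
      with p h1 h2 h3 h4 using ⟨h1, h2, h3, h4⟩
  exact ⟨r, hr, fun x hx z hz => h x ⟨by linarith [hx.1], by linarith [hx.2]⟩ z
    ((pi_norm_le_iff_of_nonneg hr.le).2 hz)⟩

section reconstruction

variable {ρ : ℝ} {F : ℝ × (Fin 5 → ℝ) → ℝ} {κ ψ φ : ℝ → ℝ} {Y U G : ℕ → ℝ → ℝ → ℝ}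
  (h : Sol ρ F κ ψ φ Y U G) (hr : ∀ x ∈ Icc (0:ℝ) 1, ∀ z : Fin 5 → ℝ, (∀ c, |z c| ≤ ρ) →
      F (x, z) = S.rhs (x, z) ∧
      AnalyticAt ℝ S.J (arg (x, z)) ∧ S.J (arg (x, z)) ≠ 0 ∧
      fderiv ℝ S.J (arg (x, z)) (0, 0, 1) = (1 - x) * S.Ω (arg (x, z)))
include h hr

lemma jet_props (t : ℝ) {x : ℝ} (hx : x ∈ Icc (0:ℝ) 1) : G 0 t x = S.rhs (jet Y U t x) ∧
    AnalyticAt ℝ S.J (x, Y 0 t x, x * Y 1 t x) ∧ S.J (x, Y 0 t x, x * Y 1 t x) ≠ 0 ∧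
    fderiv ℝ S.J (x, Y 0 t x, x * Y 1 t x) (0, 0, 1) = (1 - x) * S.Ω (x, Y 0 t x, x * Y 1 t x) := by
  have := hr x hx _ (h.small t x hx)
  rw [← h.eq t x hx] at this
  exact this

lemma contDiffOn_v (hF : ContDiff ℝ ∞ F) (hκ : ContDiff ℝ ∞ κ) (hκ1 : ∀ t, |κ t| ≤ 1) :
    ContDiffOn ℝ ∞ (fun p : ℝ × ℝ => S.v (jet Y U p.1 p.2)) strip := by
  have hY := fun j => contDiffOn_infty.2 fun n => (h.contDiffOn hF hκ hκ1 n j).1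
  have hU := fun j => contDiffOn_infty.2 fun n => (h.contDiffOn hF hκ hκ1 n j).2
  have ha : ContDiffOn ℝ ∞ (fun p : ℝ × ℝ => (p.2, Y 0 p.1 p.2, p.2 * Y 1 p.1 p.2)) strip :=
    contDiff_snd.contDiffOn.prodMk ((hY 0).prodMk (contDiff_snd.contDiffOn.mul (hY 1)))
  have hJ : ContDiffOn ℝ ∞ (fun p : ℝ × ℝ => S.J (p.2, Y 0 p.1 p.2, p.2 * Y 1 p.1 p.2)) strip := fun p hp =>
    ContDiffAt.comp_contDiffWithinAt (f := fun p : ℝ × ℝ => (p.2, Y 0 p.1 p.2, p.2 * Y 1 p.1 p.2)) (g := S.J) p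
      (jet_props h hr p.1 hp.2).2.1.contDiffAt (ha p hp)
  exact (hU 0).div hJ fun p hp => (jet_props h hr p.1 hp.2).2.2.1

lemma hasDerivAt_v {t : ℝ} (ht : κ t = 1) {x : ℝ} (hx : x ∈ Icc (0:ℝ) 1) :
    HasDerivAt (fun s => S.v (jet Y U s x))
      (-(S.H₁ (x, Y 0 t x, x * Y 1 t x, S.v (jet Y U t x)) * S.lop (jet Y U t x) +
        S.H₂ (x, Y 0 t x, x * Y 1 t x, S.v (jet Y U t x), S.w (jet Y U t x)))) t := by
  obtain ⟨h1, h2, h3, -⟩ := jet_props h hr t hx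
  have dY := fun j => h.tY j t x hx
  have dU := h.tU 0 t x hx
  simp only [ht, one_mul] at dY dU
  have dJ' := hasDerivWithinAt_comp_triple (f := S.J) (a := fun _ => x) (s := univ) h2.differentiableAt
    (hasDerivAt_const t x).hasDerivWithinAt (dY 0).hasDerivWithinAt ((dY 1).const_mul x).hasDerivWithinAt
  rw [hasDerivWithinAt_univ] at dJ'
  have := dU.fun_div dJ' h3
  rw [h1] at this
  refine this.congr_deriv ?_
  have e : S.v (jet Y U t x) = U 0 t x / S.J (x, Y 0 t x, x * Y 1 t x) := rfl
  have e2 : S.rhs (jet Y U t x) = (fderiv ℝ S.J (x, Y 0 t x, x * Y 1 t x) (0, 1, 0) * U 0 t x +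
      fderiv ℝ S.J (x, Y 0 t x, x * Y 1 t x) (0, 0, 1) * (x * U 1 t x)) * S.v (jet Y U t x) -
    S.J (x, Y 0 t x, x * Y 1 t x) * (S.H₁ (x, Y 0 t x, x * Y 1 t x, S.v (jet Y U t x)) * S.lop (jet Y U t x) +
      S.H₂ (x, Y 0 t x, x * Y 1 t x, S.v (jet Y U t x), S.w (jet Y U t x))) := rfl
  rw [e2]
  generalize S.H₁ (x, Y 0 t x, x * Y 1 t x, S.v (jet Y U t x)) * S.lop (jet Y U t x) +
      S.H₂ (x, Y 0 t x, x * Y 1 t x, S.v (jet Y U t x), S.w (jet Y U t x)) = A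
  rw [e]
  field_simp
  ring

lemma hasDerivWithinAt_v (t : ℝ) {x : ℝ} (hx : x ∈ Icc (0:ℝ) 1) :
    ∃ d, HasDerivWithinAt (fun r => S.v (jet Y U t r)) d (Icc 0 1) x ∧ x * d = S.w (jet Y U t x) := by
  obtain ⟨-, h2, h3, h4⟩ := jet_props h hr t hx
  have dJ' := hasDerivWithinAt_comp_triple (f := S.J) h2.differentiableAt
    (hasDerivAt_id' x).hasDerivWithinAt (h.xY 0 t x hx) ((hasDerivAt_id' x).hasDerivWithinAt.fun_mul (h.xY 1 t x hx))
  have hd : HasDerivWithinAt (fun r => U 0 t r / S.J (r, Y 0 t r, r * Y 1 t r)) _ _ _ :=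
    (h.xU 0 t x hx).fun_div dJ' h3
  refine ⟨_, hd, ?_⟩
  have e : S.w (jet Y U t x) = x * U 1 t x / S.J (x, Y 0 t x, x * Y 1 t x) -
    U 0 t x / S.J (x, Y 0 t x, x * Y 1 t x) ^ 2 *
    (x * fderiv ℝ S.J (x, Y 0 t x, x * Y 1 t x) (1, 0, 0) +
      x * Y 1 t x * fderiv ℝ S.J (x, Y 0 t x, x * Y 1 t x) (0, 1, 0) +
      x * Y 1 t x * fderiv ℝ S.J (x, Y 0 t x, x * Y 1 t x) (0, 0, 1) +
      x * S.Ω (x, Y 0 t x, x * Y 1 t x) * (qf x * Y 2 t x)) := rfl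
  rw [e, h4, qf]
  field_simp
  ring

end reconstruction

theorem Good.exists_solution (hS : S.Good) {T : ℝ} (hT : 0 < T) : ∃ δ₀ : ℝ, 0 < δ₀ ∧ ∃ K : ℕ,
    ∀ ψ₀ ψ₁ : ℝ → ℝ, ContDiff ℝ ∞ ψ₀ → ContDiff ℝ ∞ ψ₁ →
      (∀ k ≤ K, ∀ x ∈ Icc (0:ℝ) 1, |iteratedDeriv k ψ₀ x| ≤ δ₀ ∧ |iteratedDeriv k ψ₁ x| ≤ δ₀) →
      ∃ y v : ℝ → ℝ → ℝ, ContDiff ℝ ∞ (Function.uncurry y) ∧ ContDiff ℝ ∞ (Function.uncurry v) ∧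
        (∀ x ∈ Icc (0:ℝ) 1, y 0 x = ψ₀ x ∧ v 0 x = ψ₁ x) ∧
        ∀ t ∈ Icc (0:ℝ) T, ∀ x ∈ Icc (0:ℝ) 1,
          deriv (fun s => y s x) t = S.J (x, y t x, x * deriv (y t) x) * v t x ∧
          deriv (fun s => v s x) t = -(S.H₁ (x, y t x, x * deriv (y t) x, v t x) *
              (-(qf x * deriv (deriv (y t)) x) - bf S.N x * deriv (y t) x + S.ℓ x * qf x * deriv (y t) x +
                S.L x * y t x) +
            S.H₂ (x, y t x, x * deriv (y t) x, v t x, x * deriv (v t) x)) := by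
  obtain ⟨F, ρ₀, hρ₀, hFe, hA⟩ := hS.exists_adm
  obtain ⟨r, hr, hrad⟩ := hS.exists_radius hFe
  set ρ := min ρ₀ r
  have hρ : 0 < ρ := lt_min hρ₀ hr
  have hrad' := fun x hx z (hz : ∀ c, |z c| ≤ ρ) => hrad x hx z fun c => (hz c).trans (min_le_right _ _)
  have hAd := hA ρ (min_le_left _ _)
  obtain ⟨κ, M, sκ, hκ1, hκL, hκ0, hκT⟩ := exists_time_cutoff (T := T + 1)
  obtain ⟨δ, hδ, hsol⟩ := exists_sol hS.hN hρ hAd sκ.continuous hκ1 hκL (R := T + 1 + 1) (by linarith) hκ0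
  obtain ⟨V, sV, hV0, rV, hrV, hV⟩ := hS.exists_velocity
  set k := 2 * sg S.N
  obtain ⟨L, hL, hcomp⟩ := exists_small_comp sV (fun x hx => hV0 x hx) (k + 1)
  set δ₀ := min (min 1 rV) (δ / ((k + 2) + (k + 1) * L ^ 2))
  have hden : 0 < ((k:ℝ) + 2) + (k + 1) * L ^ 2 := by positivity
  have hδ₀ : 0 < δ₀ := lt_min (lt_min one_pos hrV) (div_pos hδ hden)
  have hδ1 : δ₀ ≤ 1 := (min_le_left _ _).trans (min_le_left _ _)
  have hδr : δ₀ ≤ rV := (min_le_left _ _).trans (min_le_right _ _)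
  have hδd : δ₀ * (((k:ℝ) + 2) + (k + 1) * L ^ 2) ≤ δ := (le_div_iff₀ hden).1 (min_le_right _ _)
  refine ⟨δ₀, hδ₀, k + 3, fun ψ₀ ψ₁ s₀ s₁ hsm => ?_⟩
  set I : Fin 3 → ℝ → ℝ := ![ψ₀, deriv ψ₀, ψ₁] with hI
  have sI : ∀ c, ContDiff ℝ ∞ (I c) := by
    intro c
    fin_cases c
    · exact s₀
    · exact (contDiff_infty_iff_deriv.1 s₀).2
    · exact s₁
  have hIs : ∀ x ∈ Icc (0:ℝ) 1, ∀ c, ∀ j ≤ k + 1, |iteratedDeriv j (I c) x| ≤ δ₀ := by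
    intro x hx c j hj
    fin_cases c
    · exact (hsm j (by omega) x hx).1
    · simpa [hI, iteratedDeriv_succ'] using (hsm (j + 1) (by omega) x hx).1
    · exact (hsm j (by omega) x hx).2
  have hφ : ∀ i < k + 1, ∀ x ∈ Icc (0:ℝ) 1, |iteratedDeriv i (comp V I) x| ≤ L * δ₀ := fun i hi x hx =>
    hcomp I sI x hx δ₀ hδ₀.le hδ1 (hIs x hx) i hi.le
  have sφ : ContDiff ℝ ∞ (comp V I) := contDiff_comp sV.1 sI
  have hEn : En S.N k ψ₀ (comp V I) ≤ δ := by
    refine (En_le_of_pointwise hS.hN s₀ sφ (fun i hi x hx => (hsm i (by omega) x hx).1) hφ).trans ?_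
    refine le_trans ?_ hδd
    have : δ₀ ^ 2 ≤ δ₀ := by nlinarith
    have h2 : 0 ≤ ((k:ℝ) + 1) * L ^ 2 := by positivity
    nlinarith
  obtain ⟨Y, U, G, h⟩ := hsol ψ₀ (comp V I) s₀ sφ hEn
  have hsF : ContDiff ℝ ∞ F := hAd.sm.1
  obtain ⟨ye, sy, hye⟩ := exists_extension
    (contDiffOn_infty.2 fun n => (h.contDiffOn hsF sκ hκ1 n 0).1) (T + 1)
  obtain ⟨ve, sv, hve⟩ := exists_extension (contDiffOn_v h hrad' hsF sκ hκ1) (T + 1)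
  have hy : ∀ t, |t| ≤ T + 1 → ∀ x ∈ Icc (0:ℝ) 1, ye (t, x) = Y 0 t x := fun t ht x hx => hye (t, x) ⟨trivial, hx⟩ ht
  have hv : ∀ t, |t| ≤ T + 1 → ∀ x ∈ Icc (0:ℝ) 1, ve (t, x) = S.v (jet Y U t x) :=
    fun t ht x hx => hve (t, x) ⟨trivial, hx⟩ ht
  have hxderiv : ∀ {f g : ℝ → ℝ} {d x : ℝ}, Differentiable ℝ f → (∀ x ∈ Icc (0:ℝ) 1, f x = g x) →
      x ∈ Icc (0:ℝ) 1 → HasDerivWithinAt g d (Icc 0 1) x → deriv f x = d := by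
    intro f g d x hf hfg hx hg
    exact (uniqueDiffOn_Icc_zero_one x hx).eq_deriv _ (hf x).hasDerivAt.hasDerivWithinAt
      (hg.congr hfg (hfg x hx))
  have syt : ∀ t, ContDiff ℝ ∞ fun x => ye (t, x) := fun t => sy.comp (contDiff_prodMk_right t)
  have svt : ∀ t, ContDiff ℝ ∞ fun x => ve (t, x) := fun t => sv.comp (contDiff_prodMk_right t)
  have hy1 : ∀ t, |t| ≤ T + 1 → ∀ x ∈ Icc (0:ℝ) 1, deriv (fun x => ye (t, x)) x = Y 1 t x := fun t ht x hx =>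
    hxderiv ((syt t).differentiable (by simp)) (hy t ht) hx (h.xY 0 t x hx)
  have hy2 : ∀ t, |t| ≤ T + 1 → ∀ x ∈ Icc (0:ℝ) 1, deriv (deriv fun x => ye (t, x)) x = Y 2 t x :=
    fun t ht x hx => hxderiv (((contDiff_infty_iff_deriv.1 (syt t)).2).differentiable (by simp)) (hy1 t ht) hx
      (h.xY 1 t x hx)
  refine ⟨fun t x => ye (t, x), fun t x => ve (t, x), sy, sv, fun x hx => ?_, fun t ht x hx => ?_⟩
  · have h0 : |(0:ℝ)| ≤ T + 1 := by rw [abs_zero]; linarith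
    refine ⟨(hy 0 h0 x hx).trans (h.initY x hx), ?_⟩
    have hp := (jet_props h hrad' 0 hx).2.2.1
    have e1 : Y 1 0 x = deriv ψ₀ x := (hxderiv (s₀.differentiable (by simp)) (fun x hx => (h.initY x hx).symm) hx
      (h.xY 0 0 x hx)).symm
    show ve (0, x) = ψ₁ x
    rw [hv 0 h0 x hx]
    show U 0 0 x / S.J (x, Y 0 0 x, x * Y 1 0 x) = ψ₁ x
    rw [div_eq_iff hp, h.initU x hx, h.initY x hx, e1]
    have hz : ‖fun c => I c x‖ ≤ rV := (pi_norm_le_iff_of_nonneg hrV.le).2 fun c => by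
      simpa using (hIs x hx c 0 (by omega)).trans hδr
    rw [mul_comm (ψ₁ x)]
    exact hV x hx _ hz
  · have ht1 : |t| < T + 1 := by rw [abs_of_nonneg ht.1]; linarith [ht.2]
    have hev : ∀ᶠ s in nhds t, |s| ≤ T + 1 :=
      (continuous_abs.continuousAt.eventually_lt continuousAt_const ht1).mono fun s hs => hs.le
    have hκt := hκT t ht1.le
    have hvt := hv t ht1.le x hx
    obtain ⟨d, hd, hdw⟩ := hasDerivWithinAt_v h hrad' t hx
    have hvx : deriv (fun x => ve (t, x)) x = d :=
      hxderiv ((svt t).differentiable (by simp)) (hv t ht1.le) hx hd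
    simp only [hy t ht1.le x hx, hy1 t ht1.le x hx, hy2 t ht1.le x hx, hvx, hdw, hvt]
    constructor
    · have hd := (h.tY 0 t x hx).congr_of_eventuallyEq (hev.mono fun s hs => hy s hs x hx)
      rw [hd.deriv, hκt, one_mul]
      exact (mul_div_cancel₀ _ (jet_props h hrad' t hx).2.2.1).symm
    · have hd := (hasDerivAt_v h hrad' hκt hx).congr_of_eventuallyEq (hev.mono fun s hs => hv s hs x hx)
      rw [hd.deriv]
      rfl

end Coeffs

end JacobiWave

/-- (Corollary 2: the Cauchy problem.)  For every `T > 0` there are `δ₀ > 0` and `𝔎 ∈ ℕ` such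
that for all smooth data `ψ₀, ψ₁` on `[0,1]`, taking values (together with `xψ₀'`, `xψ₁'`) in
`U` and with derivatives of order `≤ 𝔎` bounded by `δ₀`, the Cauchy problem has a smooth
solution `(y, v)` on `[0,T]×[0,1]` with `y(0,·) = ψ₀`, `v(0,·) = ψ₁`. -/
theorem corollary2
    -- (B0)
    (N : ℝ) (hN : 4 < N)
    (ℓ₁ L₀ : ℝ → ℝ)
    (hℓ₁ : AnalyticOnNhd ℝ ℓ₁ (Icc 0 1))
    (hL₀ : AnalyticOnNhd ℝ L₀ (Icc 0 1))
    (U : Set ℝ) (hUopen : IsOpen U) (hU0 : (0:ℝ) ∈ U)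
    (J : ℝ → ℝ → ℝ → ℝ) (H₁ : ℝ → ℝ → ℝ → ℝ → ℝ) (H₂ : ℝ → ℝ → ℝ → ℝ → ℝ → ℝ)
    -- (B1)
    (hJ : AnalyticOnNhd ℝ (fun p : ℝ × ℝ × ℝ => J p.1 p.2.1 p.2.2)
      (Icc 0 1 ×ˢ closure U ×ˢ closure U))
    (hH₁ : AnalyticOnNhd ℝ (fun p : ℝ × ℝ × ℝ × ℝ => H₁ p.1 p.2.1 p.2.2.1 p.2.2.2)
      (Icc 0 1 ×ˢ closure U ×ˢ closure U ×ˢ closure U))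
    (hH₂ : AnalyticOnNhd ℝ
      (fun p : ℝ × ℝ × ℝ × ℝ × ℝ => H₂ p.1 p.2.1 p.2.2.1 p.2.2.2.1 p.2.2.2.2)
      (Icc 0 1 ×ˢ closure U ×ˢ closure U ×ˢ closure U ×ˢ closure U))
    (hH₂0 : ∀ x ∈ Icc (0:ℝ) 1, H₂ x 0 0 0 0 = 0)
    (hH₂y : ∀ x ∈ Icc (0:ℝ) 1, deriv (fun y => H₂ x y 0 0 0) 0 = 0)
    (hH₂z : ∀ x ∈ Icc (0:ℝ) 1, deriv (fun z => H₂ x 0 z 0 0) 0 = 0)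
    (hH₂v : ∀ x ∈ Icc (0:ℝ) 1, deriv (fun v => H₂ x 0 0 v 0) 0 = 0)
    (hH₂w : ∀ x ∈ Icc (0:ℝ) 1, deriv (fun w => H₂ x 0 0 0 w) 0 = 0)
    -- (B2)
    (hB2 : ∀ x ∈ Icc (0:ℝ) 1, H₁ x 0 0 0 = (J x 0 0)⁻¹)
    (C₀ : ℝ) (hC₀ : 1 < C₀)
    (hJlow : ∀ x ∈ Icc (0:ℝ) 1, 1 / C₀ < J x 0 0)
    (hJhigh : ∀ x ∈ Icc (0:ℝ) 1, J x 0 0 < C₀)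
    -- (B3)
    (hB3J : ∃ Ω : ℝ × ℝ × ℝ → ℝ, AnalyticAt ℝ Ω ((1,0,0) : ℝ × ℝ × ℝ) ∧
      ∀ᶠ p : ℝ × ℝ × ℝ in nhds ((1,0,0) : ℝ × ℝ × ℝ),
        deriv (fun z => J p.1 p.2.1 z) p.2.2 = (1 - p.1) * Ω p)
    (hB3H : ∃ Ω : ℝ × ℝ × ℝ × ℝ × ℝ × ℝ → ℝ,
      AnalyticAt ℝ Ω ((1,0,0,0,0,0) : ℝ × ℝ × ℝ × ℝ × ℝ × ℝ) ∧
      ∀ᶠ p : ℝ × ℝ × ℝ × ℝ × ℝ × ℝ in nhds ((1,0,0,0,0,0) : ℝ × ℝ × ℝ × ℝ × ℝ × ℝ),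
        deriv (fun z => H₁ p.1 p.2.1 z p.2.2.2.2.1) (p.1 * p.2.2.1)
            * Lfun N ℓ₁ L₀ p.1 p.2.1 p.2.2.1 p.2.2.2.1
          + deriv (fun z => H₂ p.1 p.2.1 z p.2.2.2.2.1 (p.1 * p.2.2.2.2.2)) (p.1 * p.2.2.1)
          = (1 - p.1) * Ω p)
    (hB3W : ∃ Ω : ℝ × ℝ × ℝ × ℝ × ℝ → ℝ,
      AnalyticAt ℝ Ω ((1,0,0,0,0) : ℝ × ℝ × ℝ × ℝ × ℝ) ∧
      ∀ᶠ p : ℝ × ℝ × ℝ × ℝ × ℝ in nhds ((1,0,0,0,0) : ℝ × ℝ × ℝ × ℝ × ℝ),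
        deriv (fun w => H₂ p.1 p.2.1 p.2.2.1 p.2.2.2.1 w) p.2.2.2.2 = (1 - p.1) * Ω p)
    (T : ℝ) (hT : 0 < T) :
    ∃ δ₀ : ℝ, 0 < δ₀ ∧ ∃ 𝔎 : ℕ,
      ∀ ψ₀ ψ₁ : ℝ → ℝ,
        ContDiff ℝ (⊤ : ℕ∞) ψ₀ → ContDiff ℝ (⊤ : ℕ∞) ψ₁ →
        (∀ x ∈ Icc (0:ℝ) 1,
          ψ₀ x ∈ U ∧ x * deriv ψ₀ x ∈ U ∧ ψ₁ x ∈ U ∧ x * deriv ψ₁ x ∈ U) →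
        (∀ k : ℕ, k ≤ 𝔎 → ∀ x ∈ Icc (0:ℝ) 1,
          |iteratedDeriv k ψ₀ x| ≤ δ₀ ∧ |iteratedDeriv k ψ₁ x| ≤ δ₀) →
        ∃ y v : ℝ → ℝ → ℝ,
          ContDiff ℝ (⊤ : ℕ∞) (Function.uncurry y) ∧
          ContDiff ℝ (⊤ : ℕ∞) (Function.uncurry v) ∧
          (∀ x ∈ Icc (0:ℝ) 1, y 0 x = ψ₀ x ∧ v 0 x = ψ₁ x) ∧
          (∀ t ∈ Icc (0:ℝ) T, ∀ x ∈ Icc (0:ℝ) 1,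
            deriv (fun s => y s x) t
              - J x (y t x) (x * deriv (y t) x) * v t x = 0 ∧
            deriv (fun s => v s x) t
              + H₁ x (y t x) (x * deriv (y t) x) (v t x) * opL N ℓ₁ L₀ (y t) x
              + H₂ x (y t x) (x * deriv (y t) x) (v t x) (x * deriv (v t) x) = 0) := by
  obtain ⟨Ω, hΩ, hΩe⟩ := hB3J
  obtain ⟨Ω₁, -, hΩ₁e⟩ := hB3H
  obtain ⟨Ω₂, -, hΩ₂e⟩ := hB3W
  have h0 : (0:ℝ) ∈ closure U := subset_closure hU0
  have m1 : (1:ℝ) ∈ Icc (0:ℝ) 1 := right_mem_Icc.2 zero_le_one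
  have anJ : ∀ x ∈ Icc (0:ℝ) 1, AnalyticAt ℝ (fun p : ℝ × ℝ × ℝ => J p.1 p.2.1 p.2.2) (x, 0, 0) :=
    fun x hx => hJ (x, 0, 0) ⟨hx, h0, h0⟩
  have hJz : ∀ x ∈ Icc (0:ℝ) 1, ∀ᶠ p in nhds (x, (0:ℝ), (0:ℝ)),
      fderiv ℝ (fun p : ℝ × ℝ × ℝ => J p.1 p.2.1 p.2.2) p (0, 0, 1) = deriv (fun z => J p.1 p.2.1 z) p.2.2 := by
    intro x hx
    filter_upwards [(anJ x hx).eventually_analyticAt] with p hp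
    have h := hp.differentiableAt.hasFDerivAt.comp_hasDerivAt (f := fun z : ℝ => (p.1, p.2.1, z)) p.2.2
      ((hasDerivAt_const _ p.1).prodMk ((hasDerivAt_const _ p.2.1).prodMk (hasDerivAt_id' p.2.2)))
    exact h.deriv.symm
  have hJpos : ∀ x ∈ Icc (0:ℝ) 1, 0 < J x 0 0 := fun x hx =>
    (div_pos one_pos (one_pos.trans hC₀)).trans (hJlow x hx)
  let S : JacobiWave.Coeffs :=
    { N := N, ℓ := ℓ₁, L := L₀
      J := fun p => J p.1 p.2.1 p.2.2
      Ω := fun p => if p.1 = 1 then Ω p else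
        fderiv ℝ (fun p : ℝ × ℝ × ℝ => J p.1 p.2.1 p.2.2) p (0, 0, 1) / (1 - p.1)
      H₁ := fun p => H₁ p.1 p.2.1 p.2.2.1 p.2.2.2
      H₂ := fun p => H₂ p.1 p.2.1 p.2.2.1 p.2.2.2.1 p.2.2.2.2 }
  have hS1 : ∀ᶠ p in nhds ((1, 0, 0) : ℝ × ℝ × ℝ), Ω p = S.Ω p := by
    filter_upwards [hΩe, hJz 1 m1] with p h1 h2
    show Ω p = if p.1 = 1 then Ω p else
        fderiv ℝ (fun p : ℝ × ℝ × ℝ => J p.1 p.2.1 p.2.2) p (0, 0, 1) / (1 - p.1)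
    split_ifs with h
    · rfl
    · rw [h2, h1, mul_div_cancel_left₀ _ (sub_ne_zero.2 (Ne.symm h))]
  have hSx : ∀ x : ℝ, x ≠ 1 → ∀ᶠ p in nhds ((x, 0, 0) : ℝ × ℝ × ℝ),
      p.1 ≠ 1 ∧ fderiv ℝ (fun p : ℝ × ℝ × ℝ => J p.1 p.2.1 p.2.2) p (0, 0, 1) / (1 - p.1) = S.Ω p := by
    intro x hx
    filter_upwards [continuousAt_fst.eventually_ne (x := ((x, 0, 0) : ℝ × ℝ × ℝ)) hx] with p hp
    exact ⟨hp, (if_neg hp).symm⟩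
  have hS : S.Good :=
    { hN := hN
      anl := hℓ₁
      anL := hL₀
      anJ := anJ
      anΩ := by
        intro x hx
        rcases eq_or_ne x 1 with rfl | h1
        · exact hΩ.congr hS1
        · have hd : AnalyticAt ℝ (fun p : ℝ × ℝ × ℝ =>
              fderiv ℝ (fun p : ℝ × ℝ × ℝ => J p.1 p.2.1 p.2.2) p (0, 0, 1)) (x, 0, 0) :=
            ((ContinuousLinearMap.apply ℝ ℝ ((0, 0, 1) : ℝ × ℝ × ℝ)).analyticAt _).comp (anJ x hx).fderiv
          exact (hd.div (analyticAt_const.sub analyticAt_fst) (sub_ne_zero.2 h1.symm)).congr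
            ((hSx x h1).mono fun p hp => hp.2)
      anH₁ := fun x hx => hH₁ (x, 0, 0, 0) ⟨hx, h0, h0, h0⟩
      anH₂ := fun x hx => hH₂ (x, 0, 0, 0, 0) ⟨hx, h0, h0, h0, h0⟩
      Jpos := hJpos
      JH₁ := fun x hx => by
        show J x 0 0 * H₁ x 0 0 0 = 1
        rw [hB2 x hx, mul_inv_cancel₀ (hJpos x hx).ne']
      H₂0 := hH₂0
      jz := by
        intro x hx
        rcases eq_or_ne x 1 with rfl | h1
        · filter_upwards [hΩe, hJz 1 m1, hS1] with p e1 e2 e3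
          rw [← e3, ← e1]
          exact e2
        · filter_upwards [hSx x h1] with p hp
          rw [← hp.2, mul_div_cancel₀ _ (sub_ne_zero.2 hp.1.symm)]
      h1 := by
        have hc : Continuous fun q : ℝ × ℝ × ℝ => ((1, q.1, q.2.1, 0, q.2.2, 0) : ℝ × ℝ × ℝ × ℝ × ℝ × ℝ) := by
          fun_prop
        filter_upwards [(hc.tendsto 0).eventually hΩ₁e] with q hq
        have eL : Lfun N ℓ₁ L₀ 1 q.1 q.2.1 0 = L₀ 1 * q.1 - JacobiWave.bf N 1 * q.2.1 := by
          simp only [Lfun, JacobiWave.bf]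
          ring
        simp only [eL, one_mul, sub_self, zero_mul, mul_zero] at hq
        exact hq
      h2 := by
        have hc : Continuous fun q : ℝ × ℝ × ℝ × ℝ => ((1, q) : ℝ × ℝ × ℝ × ℝ × ℝ) := by fun_prop
        filter_upwards [(hc.tendsto 0).eventually hΩ₂e] with q hq
        simpa using hq }
  obtain ⟨δ₀, hδ₀, K, h⟩ := hS.exists_solution hT
  refine ⟨δ₀, hδ₀, K, fun ψ₀ ψ₁ s₀ s₁ _ hsm => ?_⟩
  obtain ⟨y, v, sy, sv, hi, he⟩ := h ψ₀ ψ₁ s₀ s₁ hsm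
  refine ⟨y, v, sy, sv, hi, fun t ht x hx => ?_⟩
  obtain ⟨e1, e2⟩ := he t ht x hx
  refine ⟨sub_eq_zero.2 e1, ?_⟩
  have eL : opL N ℓ₁ L₀ (y t) x = -(JacobiWave.qf x * deriv (deriv (y t)) x) - JacobiWave.bf N x * deriv (y t) x +
      ℓ₁ x * JacobiWave.qf x * deriv (y t) x + L₀ x * y t x := by
    simp only [opL, JacobiWave.qf, JacobiWave.bf]
    ring
  rw [e2, eL]
  simp only [S]
  ring
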